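/- Let n ≥ 1 and let U be a connected open neighborhood of 0 in ℝⁿ. Let X₁, …, X_{n−1} : U → ℝⁿ be real analytic vector fields with X_i(0) = 0 for all i, which commute pairwise ([X_i, X_j] = 0 on U), which are isochore (trace(DX_i(x)) = 0 for all x ∈ U and all i), and such that there exists a point x ∈ U at which the vectors X₁(x), …, X_{n−1}(x) are linearly independent over ℝ. Then X₁, …, X_{n−1} admit a simultaneous volume-preserving convergent Poincaré–Dulac normalization: there exist a real analytic map φ defined near 0 with φ(0) = 0 and det(Dφ(x)) = 1 for all x near 0, and real analytic vector fields Y₁, …, Y_{n−1} defined near 0, each in Poincaré–Dulac normal form, such that Dφ(x)(Y_i(x)) = X_i(φ(x)) for all x near 0 and all i. -/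

import Mathlib

/-- `Y` is in Poincaré–Dulac normal form on the neighborhood `U` of `0`:
writing the Jordan–Chevalley decomposition `DY(0) = S + N` with `S` semisimple,
`N` nilpotent and `S ∘ N = N ∘ S`, the Lie bracket `[Y, Yˢ]` (where `Yˢ x = S x`)
vanishes on `U`. -/
def InPDNormalForm (𝕂 : Type*) [NontriviallyNormedField 𝕂] {n : ℕ}
    (Y : (Fin n → 𝕂) → (Fin n → 𝕂)) (U : Set (Fin n → 𝕂)) : Prop :=
  ∃ S N : (Fin n → 𝕂) →L[𝕂] (Fin n → 𝕂),
    fderiv 𝕂 Y 0 = S + N ∧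
    Module.End.IsSemisimple (S : Module.End 𝕂 (Fin n → 𝕂)) ∧
    IsNilpotent (N : Module.End 𝕂 (Fin n → 𝕂)) ∧
    S ∘L N = N ∘L S ∧
    ∀ x ∈ U, VectorField.lieBracket 𝕂 Y (fun y => S y) x = 0

/-- `X` admits a convergent Poincaré–Dulac normalization: there are an analytic
vector field `Y` near `0`, in Poincaré–Dulac normal form with `Y 0 = 0`, and an
analytic map `φ` near `0` with `φ 0 = 0` and `Dφ(0)` invertible, such that
`Dφ(x) (Y x) = X (φ x)` for all `x` near `0`. -/
def AdmitsPDNormalization (𝕂 : Type*) [NontriviallyNormedField 𝕂] {n : ℕ}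
    (X : (Fin n → 𝕂) → (Fin n → 𝕂)) : Prop :=
  ∃ (V : Set (Fin n → 𝕂)) (Y φ : (Fin n → 𝕂) → (Fin n → 𝕂)),
    IsOpen V ∧ (0 : Fin n → 𝕂) ∈ V ∧
    AnalyticOnNhd 𝕂 Y V ∧ AnalyticOnNhd 𝕂 φ V ∧
    Y 0 = 0 ∧ φ 0 = 0 ∧ Function.Bijective (fderiv 𝕂 φ 0) ∧
    InPDNormalForm 𝕂 Y V ∧
    ∀ x ∈ V, fderiv 𝕂 φ x (Y x) = X (φ x)

section NormalFormTheory

open Filter Topology Asymptotics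
open scoped ContDiff

section VanishingOrder

/-- `g` vanishes to order at least `k` at the origin. -/
def VO {E F : Type*} [NormedAddCommGroup E] [NormedAddCommGroup F] (k : ℕ) (g : E → F) : Prop :=
  g =O[𝓝 0] fun x => ‖x‖ ^ k

variable {E F G : Type*} [NormedAddCommGroup E] [NormedAddCommGroup F] [NormedAddCommGroup G]

theorem VO.mono {k l : ℕ} {g : E → F} (h : VO l g) (hkl : k ≤ l) : VO k g := by
  refine h.trans (IsBigO.of_bound 1 ?_)
  filter_upwards [Metric.ball_mem_nhds (0 : E) one_pos] with x hx
  have hx : ‖x‖ < 1 := by simpa using hx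
  simpa using pow_le_pow_of_le_one (norm_nonneg x) hx.le hkl

theorem VO.add {k : ℕ} {g h : E → F} (hg : VO k g) (hh : VO k h) : VO k (fun x => g x + h x) :=
  IsBigO.add hg hh

theorem VO.sub {k : ℕ} {g h : E → F} (hg : VO k g) (hh : VO k h) : VO k (fun x => g x - h x) :=
  IsBigO.sub hg hh

theorem VO.neg {k : ℕ} {g : E → F} (hg : VO k g) : VO k (fun x => - g x) :=
  IsBigO.neg_left hg

theorem VO.zero {k : ℕ} : VO k (fun _ : E => (0 : F)) := isBigO_zero _ _

theorem VO.sum {ι : Type*} {s : Finset ι} {k : ℕ} {g : ι → E → F} (hg : ∀ i ∈ s, VO k (g i)) :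
    VO k (fun x => ∑ i ∈ s, g i x) :=
  IsBigO.fun_sum hg

theorem VO.congr {k : ℕ} {g h : E → F} (hg : VO k g) (he : g =ᶠ[𝓝 0] h) : VO k h :=
  IsBigO.congr' hg he EventuallyEq.rfl

theorem vo_zero_of_continuousAt {g : E → F} (hg : ContinuousAt g 0) : VO 0 g := by
  have := hg.isBigO_one ℝ
  simpa [VO] using this

theorem VO.tendsto {k : ℕ} {g : E → F} (hg : VO (k + 1) g) : Tendsto g (𝓝 0) (𝓝 0) := by
  refine (VO.mono hg (Nat.succ_le_succ (Nat.zero_le k))).trans_tendsto ?_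
  have : Tendsto (fun x : E => ‖x‖ ^ 1) (𝓝 0) (𝓝 (‖(0:E)‖ ^ 1)) :=
    Continuous.tendsto (by fun_prop) 0
  simpa using this

theorem VO.apply_zero {k : ℕ} {g : E → F} (hg : VO (k + 1) g) : g 0 = 0 := by
  have := IsBigO.eq_zero_imp hg
  simpa using this.self_of_nhds

theorem VO.comp {k : ℕ} {g : F → G} {u : E → F} (hg : VO k g) (hu : VO 1 u) :
    VO k (fun x => g (u x)) := by
  refine (hg.comp_tendsto (VO.tendsto hu)).trans ?_
  have := (IsBigO.norm_left hu).pow k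
  simp only [pow_one] at this
  exact this

theorem VO.continuousLinearMap {𝕜 : Type*} [NontriviallyNormedField 𝕜] [NormedSpace 𝕜 F]
    [NormedSpace 𝕜 G] {k : ℕ} {g : E → F} (hg : VO k g) (L : F →L[𝕜] G) :
    VO k (fun x => L (g x)) :=
  (L.isBigO_comp g _).trans hg

theorem VO.smul {𝕜 : Type*} [NontriviallyNormedField 𝕜] [NormedSpace 𝕜 F] {k l : ℕ} {c : E → 𝕜}
    {g : E → F} (hc : VO k c) (hg : VO l g) : VO (k + l) (fun x => c x • g x) := by
  have := IsBigO.smul hc hg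
  simpa [VO, pow_add] using this

theorem VO.mul {R : Type*} [NormedRing R] {k l : ℕ} {c g : E → R}
    (hc : VO k c) (hg : VO l g) : VO (k + l) (fun x => c x * g x) := by
  have := IsBigO.mul hc hg
  simpa [VO, pow_add] using this

theorem VO.clm_apply {𝕜 : Type*} [NontriviallyNormedField 𝕜] [NormedSpace 𝕜 F] [NormedSpace 𝕜 G]
    {k l : ℕ} {A : E → F →L[𝕜] G} {g : E → F} (hA : VO k A) (hg : VO l g) :
    VO (k + l) (fun x => A x (g x)) := by
  refine IsBigO.trans (IsBigO.of_bound 1 ?_) ((IsBigO.norm_left hA).mul (IsBigO.norm_left hg)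
    |>.trans (by simpa [pow_add] using isBigO_refl _ _))
  filter_upwards with x
  simpa using (A x).le_opNorm (g x)

theorem vo_pi {ι : Type*} [Fintype ι] {k : ℕ} {g : E → ι → F} :
    VO k g ↔ ∀ i, VO k (fun x => g x i) := isBigO_pi

theorem vo_id : VO 1 (fun x : E => x) := by
  simpa [VO] using (isBigO_refl (fun x : E => x) (𝓝 0)).norm_right

theorem vo_one_of_differentiableAt {𝕜 : Type*} [NontriviallyNormedField 𝕜] [NormedSpace 𝕜 E]
    [NormedSpace 𝕜 F] {g : E → F} (hg : DifferentiableAt 𝕜 g 0) (h0 : g 0 = 0) : VO 1 g := by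
  have := hg.isBigO_sub
  simpa [VO, h0] using this.norm_right

/-- An analytic function vanishing to all orders vanishes near the origin. -/
theorem AnalyticAt.eventually_eq_zero_of_vo {𝕜 : Type*} [NontriviallyNormedField 𝕜]
    [NormedSpace 𝕜 E] [NormedSpace 𝕜 F] {g : E → F} (hg : AnalyticAt 𝕜 g 0)
    (h : ∀ k, VO k g) : ∀ᶠ x in 𝓝 0, g x = 0 := by
  obtain ⟨p, hp⟩ := hg
  have key : ∀ N y, p N (fun _ => y) = 0 := by
    intro N
    induction N using Nat.strong_induction_on with
    | _ N ih =>
      have h1 := hp.isBigO_sub_partialSum_pow (N + 1)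
      simp only [zero_add] at h1
      have h2 := (h (N + 1)).sub h1
      have h3 : (fun y : E => p N fun _ => y) =O[𝓝 0] fun y => ‖y‖ ^ (N + 1) := by
        refine IsBigO.congr_left h2 fun y => ?_
        simp [FormalMultilinearSeries.partialSum, Finset.sum_range_succ,
          Finset.sum_eq_zero fun i hi => ih i (Finset.mem_range.1 hi) y]
      exact fun y => h3.continuousMultilinearMap_apply_eq_zero y
  filter_upwards [hp.eventually_hasSum_sub] with y hy
  simp only [key] at hy
  exact hy.unique hasSum_zero

end VanishingOrder

section ComplexVO

variable {E F : Type*} [NormedAddCommGroup E] [NormedSpace ℂ E] [NormedAddCommGroup F]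
  [NormedSpace ℂ F] [CompleteSpace F]

/-- Cauchy estimate for the Fréchet derivative. -/
theorem norm_fderiv_le_of_forall_closedBall_norm_le {g : E → F} {x : E} {R C : ℝ} (hR : 0 < R)
    (hd : ∀ y ∈ Metric.closedBall x R, DifferentiableAt ℂ g y)
    (hC : ∀ y ∈ Metric.closedBall x R, ‖g y‖ ≤ C) : ‖fderiv ℂ g x‖ ≤ C / R := by
  have hC0 : 0 ≤ C := (norm_nonneg _).trans (hC x (Metric.mem_closedBall_self hR.le))
  refine ContinuousLinearMap.opNorm_le_of_ball (ε := 1) one_pos (by positivity) fun v hv => ?_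
  rcases eq_or_ne v 0 with rfl | hv0
  · simp
  have hvp : 0 < ‖v‖ := norm_pos_iff.2 hv0
  have hmem : ∀ t ∈ Metric.closedBall (0 : ℂ) (R / ‖v‖), x + t • v ∈ Metric.closedBall x R := by
    intro t ht
    rw [mem_closedBall_zero_iff, le_div_iff₀ hvp] at ht
    simpa [norm_smul] using ht
  have hl : ∀ t : ℂ, HasDerivAt (fun t : ℂ => x + t • v) v t := fun t => by
    simpa using ((hasDerivAt_id t).smul_const v).const_add x
  have hderiv : deriv (fun t : ℂ => g (x + t • v)) 0 = fderiv ℂ g x v := by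
    have h1 : HasFDerivAt g (fderiv ℂ g x) (x + (0 : ℂ) • v) := by
      simpa using (hd x (Metric.mem_closedBall_self hR.le)).hasFDerivAt
    exact (h1.comp_hasDerivAt (0 : ℂ) (hl 0)).deriv
  rw [← hderiv]
  refine (Complex.norm_deriv_le_of_forall_mem_sphere_norm_le (C := C) (R := R / ‖v‖)
    (by positivity) ?_ ?_).trans (le_of_eq (by field_simp))
  · refine DifferentiableOn.diffContOnCl (s := Metric.ball 0 (R / ‖v‖)) fun t ht => ?_
    have := hmem t (Metric.closure_ball_subset_closedBall ht)
    exact ((hd _ this).comp t (hl t).differentiableAt).differentiableWithinAt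
  · exact fun t ht => hC _ (hmem t (Metric.sphere_subset_closedBall ht))

theorem VO.fderiv_of_analyticAt {k : ℕ} {g : E → F} (hg : VO (k + 1) g)
    (hd : AnalyticAt ℂ g 0) : VO k (fderiv ℂ g) := by
  have hcont : VO 0 (fderiv ℂ g) := vo_zero_of_continuousAt hd.fderiv.continuousAt
  rcases Nat.eq_zero_or_pos k with rfl | hk
  · exact hcont
  obtain ⟨C, hC⟩ := IsBigO.bound hg
  obtain ⟨ε, hε, hb⟩ := Metric.eventually_nhds_iff_ball.1
    (hC.and (hd.eventually_analyticAt))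
  have h0 : fderiv ℂ g 0 = 0 := by
    refine HasFDerivAt.fderiv (hasFDerivAt_iff_isLittleO_nhds_zero.2 ?_)
    have h2 : VO 2 g := hg.mono (by omega)
    have : (fun x : E => ‖x‖ ^ 2) =o[𝓝 0] fun x => x :=
      (isLittleO_norm_pow_id one_lt_two)
    simpa [hg.apply_zero] using h2.trans_isLittleO this
  refine IsBigO.of_bound (|C| * 2 ^ (k + 1)) ?_
  filter_upwards [Metric.ball_mem_nhds (0 : E) (half_pos hε)] with x hx
  rcases eq_or_ne x 0 with rfl | hx0
  · simp only [h0, norm_zero]; positivity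
  have hxp : 0 < ‖x‖ := norm_pos_iff.2 hx0
  have hx : ‖x‖ < ε / 2 := by simpa using hx
  have hle : ∀ y ∈ Metric.closedBall x ‖x‖, ‖y‖ ≤ 2 * ‖x‖ := fun y hy => by
    have h1 := norm_sub_norm_le y x
    have h2 : ‖y - x‖ ≤ ‖x‖ := by simpa [dist_eq_norm] using hy
    linarith
  have hmem : ∀ y ∈ Metric.closedBall x ‖x‖, y ∈ Metric.ball (0 : E) ε := fun y hy => by
    have := hle y hy
    simp only [mem_ball_zero_iff]; linarith
  refine (norm_fderiv_le_of_forall_closedBall_norm_le (C := |C| * (2 * ‖x‖) ^ (k + 1)) hxp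
    (fun y hy => (hb y (hmem y hy)).2.differentiableAt) fun y hy => ?_).trans (le_of_eq ?_)
  · refine (hb y (hmem y hy)).1.trans ?_
    rw [norm_pow, norm_norm]
    exact mul_le_mul (le_abs_self C) (pow_le_pow_left₀ (norm_nonneg y) (hle y hy) _)
      (by positivity) (abs_nonneg C)
  · rw [norm_pow, norm_norm]; field_simp; ring

end ComplexVO

section Superposition

variable {𝕜 E F K : Type*} [NontriviallyNormedField 𝕜] [NormedAddCommGroup E] [NormedSpace 𝕜 E]
  [NormedAddCommGroup F] [NormedSpace 𝕜 F] [CompleteSpace F] [TopologicalSpace K] [CompactSpace K]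

theorem ContinuousMap.update_apply_eq {E K : Type*} [TopologicalSpace E] [TopologicalSpace K] {n : ℕ} [DecidableEq (Fin n)] (u : Fin n → C(K, E)) (i : Fin n)
    (z : C(K, E)) (k : K) : (fun j => (Function.update u i z) j k) =
      Function.update (fun j => u j k) i (z k) := by
  ext j
  by_cases hj : j = i
  · subst hj; simp
  · simp [hj]

/-- A continuous multilinear map acts pointwise on continuous functions. -/
noncomputable def pointwiseMultilinear {n : ℕ} (p : E [×n]→L[𝕜] F) :
    C(K, E) [×n]→L[𝕜] C(K, F) :=
  MultilinearMap.mkContinuous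
    { toFun := fun u => ⟨fun k => p (fun i => u i k), by fun_prop⟩
      map_update_add' := fun u i x y => by
        ext k
        simp [ContinuousMap.update_apply_eq]
      map_update_smul' := fun u i c x => by
        ext k
        simp [ContinuousMap.update_apply_eq] }
    ‖p‖ (fun u => by
      rw [ContinuousMap.norm_le _ (by positivity)]
      intro k
      refine (p.le_opNorm _).trans ?_
      gcongr with i
      exact (u i).norm_coe_le_norm k)

/-- Superposition (Nemytskii) operators of analytic functions are analytic. -/
theorem HasFPowerSeriesOnBall.exists_superposition {g : E → F} {p : FormalMultilinearSeries 𝕜 E F}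
    {c : E} {R : ENNReal} (hg : HasFPowerSeriesOnBall g p c R) :
    ∃ G : C(K, E) → C(K, F), AnalyticOnNhd 𝕜 G (Metric.eball (ContinuousMap.const K c) R) ∧
      ∀ u ∈ Metric.eball (ContinuousMap.const K c) R, ∀ k, G u k = g (u k) := by
  set P : FormalMultilinearSeries 𝕜 C(K, E) C(K, F) := fun n => pointwiseMultilinear (p n)
  have hrad : R ≤ P.radius := hg.r_le.trans <| FormalMultilinearSeries.radius_le_of_le fun n =>
    MultilinearMap.mkContinuous_norm_le _ (norm_nonneg _) _
  have hP := (P.hasFPowerSeriesOnBall (hg.r_pos.trans_le hrad)).mono hg.r_pos hrad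
  have hP' := hP.comp_sub (ContinuousMap.const K c)
  rw [zero_add] at hP'
  refine ⟨_, hP'.analyticOnNhd, fun u hu k => ?_⟩
  have hu' : u - ContinuousMap.const K c ∈ Metric.eball (0 : C(K, E)) R := by
    rw [Metric.mem_eball] at hu ⊢
    rwa [edist_eq_enorm_sub, sub_zero, ← edist_eq_enorm_sub]
  have h1 := hP.hasSum hu'
  have h2 := (ContinuousMap.evalCLM 𝕜 k : C(K, F) →L[𝕜] F).hasSum h1
  have hk : u k - c ∈ Metric.eball (0 : E) R := by
    rw [Metric.mem_eball, edist_eq_enorm_sub, sub_zero, ← edist_eq_enorm_sub]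
    refine lt_of_le_of_lt ?_ hu
    rw [edist_dist, edist_dist]
    exact ENNReal.ofReal_le_ofReal (ContinuousMap.dist_apply_le_dist (g := ContinuousMap.const K c) k)
  have h3 := hg.hasSum hk
  rw [add_sub_cancel] at h3
  rw [zero_add] at h2
  exact h2.unique h3

theorem AnalyticAt.exists_superposition {g : E → F} {c : E} (hg : AnalyticAt 𝕜 g c) :
    ∃ R > 0, ∃ G : C(K, E) → C(K, F), AnalyticOnNhd 𝕜 G (Metric.ball (ContinuousMap.const K c) R) ∧
      ∀ u ∈ Metric.ball (ContinuousMap.const K c) R, ∀ k, G u k = g (u k) := by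
  obtain ⟨p, R, hp⟩ := hg
  obtain ⟨R', hR', hle⟩ : ∃ R' : ℝ, 0 < R' ∧ ENNReal.ofReal R' ≤ R := by
    rcases eq_or_ne R ⊤ with rfl | h
    · exact ⟨1, one_pos, le_top⟩
    · exact ⟨R.toReal, ENNReal.toReal_pos hp.r_pos.ne' h, (ENNReal.ofReal_toReal h).le⟩
  obtain ⟨G, hG, hG'⟩ := (hp.mono (by simpa using hR') hle).exists_superposition (K := K)
  rw [Metric.eball_ofReal] at hG hG'
  exact ⟨R', hR', G, hG, hG'⟩

end Superposition

section LinearTools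

variable {𝕜 E F K : Type*} [NontriviallyNormedField 𝕜] [NormedAddCommGroup E] [NormedSpace 𝕜 E]
  [NormedAddCommGroup F] [NormedSpace 𝕜 F] [TopologicalSpace K] [CompactSpace K]

/-- Pointwise application of a continuous family of continuous linear maps. -/
noncomputable def applyFamily (l : C(K, E →L[𝕜] F)) : C(K, E) →L[𝕜] C(K, F) :=
  LinearMap.mkContinuous
    { toFun := fun u => ⟨fun k => l k (u k), by fun_prop⟩
      map_add' := fun u v => by ext k; simp
      map_smul' := fun c u => by ext k; simp } ‖l‖ (fun u => by
      rw [ContinuousMap.norm_le _ (by positivity)]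
      intro k
      refine ((l k).le_opNorm _).trans ?_
      gcongr
      exacts [l.norm_coe_le_norm k, u.norm_coe_le_norm k])

@[simp] theorem applyFamily_apply (l : C(K, E →L[𝕜] F)) (u : C(K, E)) (k : K) :
    applyFamily l u k = l k (u k) := rfl

variable (𝕜 K) in
/-- Constant functions, as a continuous linear map. -/
noncomputable def constFamily : E →L[𝕜] C(K, E) :=
  LinearMap.mkContinuous
    { toFun := fun x => ContinuousMap.const K x
      map_add' := fun u v => by ext k; simp
      map_smul' := fun c u => by ext k; simp } 1 (fun x => by
      rw [ContinuousMap.norm_le _ (by positivity)]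
      intro k; simp)

@[simp] theorem constFamily_apply (x : E) (k : K) : constFamily 𝕜 K x k = x := rfl

end LinearTools

section IntegralTools

variable {𝕜 F : Type*} [RCLike 𝕜] [NormedAddCommGroup F] [NormedSpace ℝ F] [NormedSpace 𝕜 F]
  [SMulCommClass ℝ 𝕜 F]

variable (𝕜 F) in
/-- Integration over `[a, b]` as a continuous linear map on continuous functions. -/
noncomputable def integralIcc {a b : ℝ} (hb : a ≤ b) : C(Set.Icc a b, F) →L[𝕜] F :=
  LinearMap.mkContinuous
    { toFun := fun u => ∫ t in a..b, u.IccExtend hb t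
      map_add' := fun u v => by
        rw [← intervalIntegral.integral_add]
        · rfl
        · exact (u.IccExtend hb).continuous.intervalIntegrable _ _
        · exact (v.IccExtend hb).continuous.intervalIntegrable _ _
      map_smul' := fun c u => by
        rw [RingHom.id_apply, ← intervalIntegral.integral_smul]
        rfl } (b - a) (fun u => by
      have := intervalIntegral.norm_integral_le_of_norm_le_const (a := a) (b := b) (C := ‖u‖)
        (f := u.IccExtend hb) (fun t _ => u.norm_coe_le_norm _)
      rw [abs_of_nonneg (sub_nonneg.2 hb), mul_comm] at this
      exact this)

theorem integralIcc_eq {a b : ℝ} (hb : a ≤ b) (u : C(Set.Icc a b, F)) {g : ℝ → F}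
    (hg : ∀ t : Set.Icc a b, u t = g t) : integralIcc 𝕜 F hb u = ∫ t in a..b, g t := by
  refine intervalIntegral.integral_congr fun t ht => ?_
  rw [Set.uIcc_of_le hb] at ht
  simp [ContinuousMap.IccExtend, Set.IccExtend_of_mem hb _ ht, hg]

end IntegralTools

theorem AnalyticAt.clm_apply_of {𝕜 E F G : Type*} [NontriviallyNormedField 𝕜]
    [NormedAddCommGroup E] [NormedSpace 𝕜 E] [NormedAddCommGroup F] [NormedSpace 𝕜 F]
    [NormedAddCommGroup G] [NormedSpace 𝕜 G] {A : E → F →L[𝕜] G} {u : E → F} {x : E}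
    (hA : AnalyticAt 𝕜 A x) (hu : AnalyticAt 𝕜 u x) : AnalyticAt 𝕜 (fun y => A y (u y)) x :=
  ((ContinuousLinearMap.id 𝕜 (F →L[𝕜] G)).analyticAt_bilinear (A x, u x)).comp₂ hA hu

section Primitive

theorem AnalyticAt.radial_integral {𝕜 E F : Type*} [RCLike 𝕜] [NormedAddCommGroup E]
    [NormedSpace 𝕜 E] [NormedAddCommGroup F] [NormedSpace ℝ F] [NormedSpace 𝕜 F]
    [SMulCommClass ℝ 𝕜 F] [CompleteSpace F] {α : E → F} (hα : AnalyticAt 𝕜 α 0) (c : C(ℝ, 𝕜)) :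
    AnalyticAt 𝕜 (fun x => ∫ t in (0 : ℝ)..1, c t • α ((t : 𝕜) • x)) 0 := by
  obtain ⟨R, hR, G, hG, hGe⟩ := hα.exists_superposition (K := Set.Icc (0 : ℝ) 1)
  set ℓ : E →L[𝕜] C(Set.Icc (0 : ℝ) 1, E) :=
    (applyFamily (⟨fun t : Set.Icc (0 : ℝ) 1 => ((t : ℝ) : 𝕜) • ContinuousLinearMap.id 𝕜 E,
      by fun_prop⟩ : C(Set.Icc (0 : ℝ) 1, E →L[𝕜] E))).comp (constFamily 𝕜 _)
  set m : C(Set.Icc (0 : ℝ) 1, F) →L[𝕜] C(Set.Icc (0 : ℝ) 1, F) :=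
    applyFamily (⟨fun t : Set.Icc (0 : ℝ) 1 => c t • ContinuousLinearMap.id 𝕜 F,
      by fun_prop⟩ : C(Set.Icc (0 : ℝ) 1, F →L[𝕜] F))
  have hℓ0 : ℓ 0 = ContinuousMap.const _ 0 := by rw [map_zero]; rfl
  have h1 : AnalyticAt 𝕜 (fun x => integralIcc 𝕜 F zero_le_one (m (G (ℓ x)))) 0 := by
    have hGa : AnalyticAt 𝕜 (fun x => G (ℓ x)) 0 :=
      AnalyticAt.fun_comp (g := G) (by rw [hℓ0]; exact hG _ (Metric.mem_ball_self hR))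
        (ℓ.analyticAt 0)
    exact AnalyticAt.fun_comp (g := ((integralIcc 𝕜 F zero_le_one).comp m))
      (ContinuousLinearMap.analyticAt _ _) hGa
  refine h1.congr ?_
  have hn : ∀ᶠ x in 𝓝 (0 : E), ℓ x ∈ Metric.ball (ContinuousMap.const _ 0) R := by
    have := ℓ.continuous.tendsto 0
    rw [hℓ0] at this
    exact this (Metric.ball_mem_nhds _ hR)
  filter_upwards [hn] with x hx
  refine integralIcc_eq _ _ fun t => ?_
  change c t • (G (ℓ x)) t = _
  rw [hGe _ hx]
  rfl

/-- A function whose derivative is analytic is analytic. -/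
theorem analyticAt_of_hasFDerivAt_analyticAt {E F : Type*} [NormedAddCommGroup E]
    [NormedSpace ℂ E] [NormedAddCommGroup F] [NormedSpace ℂ F] [CompleteSpace F]
    {g : E → F} {α : E → E →L[ℂ] F}
    (hα : AnalyticAt ℂ α 0) (hg : ∀ᶠ x in 𝓝 0, HasFDerivAt g (α x) x) : AnalyticAt ℂ g 0 := by
  obtain ⟨ε, hε, hb⟩ := Metric.eventually_nhds_iff_ball.1
    (hg.and hα.eventually_continuousAt)
  have h1 : AnalyticAt ℂ
      (fun x => (∫ t in (0 : ℝ)..1, (1 : C(ℝ, ℂ)) t • α ((t : ℂ) • x)) x + g 0) 0 :=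
    ((hα.radial_integral 1).clm_apply_of analyticAt_id).add analyticAt_const
  refine h1.congr ?_
  filter_upwards [Metric.ball_mem_nhds (0 : E) hε] with x hx
  have hmem : ∀ t ∈ Set.uIcc (0 : ℝ) 1, ((t : ℂ) • x) ∈ Metric.ball (0 : E) ε := by
    intro t ht
    rw [Set.uIcc_of_le zero_le_one] at ht
    rw [mem_ball_zero_iff] at hx ⊢
    rw [norm_smul, Complex.norm_real, Real.norm_of_nonneg ht.1]
    exact (mul_le_of_le_one_left (norm_nonneg _) ht.2).trans_lt hx
  have hl : ∀ t : ℝ, HasDerivAt (fun t : ℝ => (t : ℂ) • x) x t := fun t => by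
    simpa using (Complex.ofRealCLM.hasDerivAt (x := t)).smul_const x
  have hcont : ContinuousOn (fun t : ℝ => α ((t : ℂ) • x)) (Set.uIcc 0 1) := fun t ht =>
    ((hb _ (hmem t ht)).2.comp (f := fun t : ℝ => (t : ℂ) • x)
      (hl t).continuousAt).continuousWithinAt
  have h_int := intervalIntegral.integral_eq_sub_of_hasDerivAt (a := 0) (b := 1)
    (f := fun t : ℝ => g ((t : ℂ) • x)) (f' := fun t => α ((t : ℂ) • x) x)
    (fun t ht => by
      have h : HasFDerivAt g ((α ((t : ℂ) • x)).restrictScalars ℝ) ((t : ℂ) • x) :=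
        (hb _ (hmem t ht)).1.restrictScalars ℝ
      exact h.comp_hasDerivAt t (hl t))
    (hcont.clm_apply continuousOn_const).intervalIntegrable
  simp only [Complex.ofReal_one, one_smul, Complex.ofReal_zero, zero_smul] at h_int
  rw [eq_sub_iff_add_eq] at h_int
  rw [← h_int]
  congr 1
  simp only [ContinuousMap.one_apply, one_smul]
  exact ContinuousLinearMap.intervalIntegral_apply hcont.intervalIntegrable x

end Primitive

section Division

variable {E : Type*} [NormedAddCommGroup E] [NormedSpace ℂ E]

theorem exists_differentiableOn_eq_pow_mul {g : ℂ → ℂ} {R : ℝ} (hR : 0 < R) {r : ℕ}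
    (hg : DifferentiableOn ℂ g (Metric.ball 0 R)) (hO : VO r g) :
    ∃ g₁ : ℂ → ℂ, DifferentiableOn ℂ g₁ (Metric.ball 0 R) ∧
      ∀ u ∈ Metric.ball (0 : ℂ) R, g u = u ^ r * g₁ u := by
  have han : AnalyticAt ℂ g 0 := hg.analyticAt (Metric.ball_mem_nhds _ hR)
  obtain ⟨k, hk, hk'⟩ := (natCast_le_analyticOrderAt han).1
    (show (r : ℕ∞) ≤ analyticOrderAt g 0 by
      by_contra hlt
      rw [not_le] at hlt
      obtain ⟨m, hm⟩ := ENat.ne_top_iff_exists.1 hlt.ne_top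
      rw [← hm] at hlt
      have hlt' : m < r := by exact_mod_cast hlt
      obtain ⟨k, hk, hk0, hk'⟩ := (han.analyticOrderAt_eq_natCast).1 hm.symm
      have h1 : (fun z : ℂ => z ^ m • k z) =O[𝓝 0] fun z : ℂ => ‖z‖ ^ (m + 1) :=
        (VO.mono hO hlt').congr (by filter_upwards [hk'] with z hz; simpa using hz)
      have h2 : (fun z : ℂ => z ^ m) =O[𝓝 0] fun z : ℂ => z ^ m * k z := by
        have h3 : (fun z : ℂ => (1 : ℂ)) =O[𝓝 0] k := by
          refine IsBigO.of_bound (‖k 0‖ / 2)⁻¹ ?_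
          have : ∀ᶠ z in 𝓝 (0 : ℂ), ‖k 0‖ / 2 < ‖k z‖ :=
            hk.continuousAt.norm.eventually (lt_mem_nhds (by simpa using hk0))
          filter_upwards [this] with z hz
          have : 0 < ‖k 0‖ := norm_pos_iff.2 hk0
          rw [norm_one, inv_mul_eq_div, one_le_div (by positivity)]
          exact hz.le
        simpa using (isBigO_refl (fun z : ℂ => z ^ m) (𝓝 0)).mul h3
      have h4 := h2.trans h1
      have h5 : (fun z : ℂ => (ContinuousMultilinearMap.mkPiAlgebraFin ℂ m ℂ) (fun _ => z))
          =O[𝓝 0] fun z : ℂ => ‖z‖ ^ (m + 1) := by simpa using h4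
      simpa using h5.continuousMultilinearMap_apply_eq_zero 1)
  simp only [sub_zero, smul_eq_mul] at hk'
  refine ⟨fun u => if u = 0 then k 0 else g u / u ^ r, fun u hu => ?_, fun u hu => ?_⟩
  · rcases eq_or_ne u 0 with rfl | hu0
    · refine (hk.differentiableAt.congr_of_eventuallyEq ?_).differentiableWithinAt
      filter_upwards [hk'] with z hz
      split_ifs with h
      · rw [h]
      · rw [hz, mul_div_cancel_left₀ _ (pow_ne_zero _ h)]
    · have h1 : DifferentiableAt ℂ (fun u => g u / u ^ r) u :=
        (hg.differentiableAt (Metric.isOpen_ball.mem_nhds hu)).div (by fun_prop)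
          (pow_ne_zero _ hu0)
      refine (h1.congr_of_eventuallyEq ?_).differentiableWithinAt
      filter_upwards [isOpen_ne.mem_nhds hu0] with z hz
      exact if_neg hz
  · beta_reduce
    split_ifs with h
    · rw [h]; exact hk'.self_of_nhds
    · rw [mul_div_cancel₀ _ (pow_ne_zero _ h)]

/-- Division of `f (s w)` by the power `s ^ r`, analytically in `(s, w)`. -/
theorem AnalyticAt.exists_scaling_quotient {f : E → ℂ} (hf : AnalyticAt ℂ f 0) {r : ℕ}
    (hO : VO r f) {B : ℝ} (hB : 0 < B) : ∃ ρ > 0, ∃ q : ℂ × E → ℂ,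
      AnalyticOnNhd ℂ q (Metric.ball 0 ρ ×ˢ Metric.ball 0 B) ∧
      ∀ s ∈ Metric.ball (0 : ℂ) ρ, ∀ w ∈ Metric.ball (0 : E) B,
        f (s • w) = s ^ r * q (s, w) := by
  have hpi : (0 : ℝ) ≤ 2 * Real.pi := by positivity
  obtain ⟨R₁, hR₁, G, hG, hGe⟩ := hf.exists_superposition (K := Set.Icc (0 : ℝ) (2 * Real.pi))
  obtain ⟨R₂, hR₂, hf₂⟩ := Metric.eventually_nhds_iff_ball.1 hf.eventually_analyticAt
  obtain ⟨H, hH, hHe⟩ := (hasFPowerSeriesOnBall_inv_one_sub ℂ ℂ).exists_superposition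
    (K := Set.Icc (0 : ℝ) (2 * Real.pi))
  set ρ : ℝ := min R₁ R₂ / (2 * B) with hρ
  have hρ0 : 0 < ρ := by positivity
  have hρB : ρ * B < R₁ ∧ ρ * B < R₂ := by
    have : ρ * B = min R₁ R₂ / 2 := by rw [hρ]; field_simp
    have h3 : 0 < min R₁ R₂ := lt_min hR₁ hR₂
    rw [this]
    exact ⟨by linarith [min_le_left R₁ R₂], by linarith [min_le_right R₁ R₂]⟩
  have hc0 : ∀ θ, circleMap 0 ρ θ ≠ 0 := fun θ => circleMap_ne_center hρ0.ne'
  set ℓ : E →L[ℂ] C(Set.Icc (0 : ℝ) (2 * Real.pi), E) :=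
    (applyFamily (⟨fun t => circleMap 0 ρ t • ContinuousLinearMap.id ℂ E,
      by fun_prop⟩ : C(Set.Icc (0 : ℝ) (2 * Real.pi), E →L[ℂ] E))).comp (constFamily ℂ _) with hℓ
  set m : ℂ →L[ℂ] C(Set.Icc (0 : ℝ) (2 * Real.pi), ℂ) :=
    (applyFamily (⟨fun t => (circleMap 0 ρ t)⁻¹ • ContinuousLinearMap.id ℂ ℂ,
      (((continuous_circleMap 0 ρ).comp continuous_subtype_val).inv₀ fun t => hc0 _).smul
        continuous_const⟩ : C(Set.Icc (0 : ℝ) (2 * Real.pi), ℂ →L[ℂ] ℂ))).comp (constFamily ℂ _)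
    with hm
  set e : C(Set.Icc (0 : ℝ) (2 * Real.pi), ℂ) := ⟨fun t => (circleMap 0 ρ t ^ r)⁻¹,
    (((continuous_circleMap 0 ρ).comp continuous_subtype_val).pow r).inv₀
      fun t => pow_ne_zero _ (hc0 _)⟩ with he
  have hℓb : ∀ w ∈ Metric.ball (0 : E) B, ℓ w ∈ Metric.ball (ContinuousMap.const _ 0) R₁ := by
    intro w hw
    rw [show (ContinuousMap.const (Set.Icc (0 : ℝ) (2 * Real.pi)) (0 : E)) = 0 from rfl,
      mem_ball_zero_iff]
    rw [mem_ball_zero_iff] at hw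
    refine lt_of_le_of_lt ?_ hρB.1
    rw [ContinuousMap.norm_le _ (by positivity)]
    intro t
    change ‖circleMap 0 ρ t • w‖ ≤ _
    rw [norm_smul, norm_circleMap_zero, abs_of_pos hρ0]
    gcongr
  have hmb : ∀ s ∈ Metric.ball (0 : ℂ) ρ, m s ∈ Metric.eball (ContinuousMap.const _ 0) 1 := by
    intro s hs
    rw [show (ContinuousMap.const (Set.Icc (0 : ℝ) (2 * Real.pi)) (0 : ℂ)) = 0 from rfl,
      ← ENNReal.ofReal_one, Metric.eball_ofReal, mem_ball_zero_iff]
    rw [mem_ball_zero_iff] at hs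
    refine lt_of_le_of_lt (b := ρ⁻¹ * ‖s‖) ?_ (by rwa [inv_mul_eq_div, div_lt_one hρ0])
    rw [ContinuousMap.norm_le _ (by positivity)]
    intro t
    change ‖(circleMap 0 ρ t)⁻¹ • s‖ ≤ _
    rw [norm_smul, norm_inv, norm_circleMap_zero, abs_of_pos hρ0]
  refine ⟨ρ, hρ0, fun z => (2 * Real.pi : ℂ)⁻¹ * integralIcc ℂ ℂ hpi (e * (H (m z.1) * G (ℓ z.2))),
    ?_, fun s hs w hw => ?_⟩
  · have h1 : AnalyticOnNhd ℂ (fun z : ℂ × E => H (m z.1)) (Metric.ball 0 ρ ×ˢ Metric.ball 0 B) :=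
      hH.comp ((m.comp (ContinuousLinearMap.fst ℂ ℂ E)).analyticOnNhd _) fun z hz => hmb _ hz.1
    have h2 : AnalyticOnNhd ℂ (fun z : ℂ × E => G (ℓ z.2)) (Metric.ball 0 ρ ×ˢ Metric.ball 0 B) :=
      hG.comp ((ℓ.comp (ContinuousLinearMap.snd ℂ ℂ E)).analyticOnNhd _) fun z hz => hℓb _ hz.2
    exact analyticOnNhd_const.mul (((integralIcc ℂ ℂ hpi).comp_analyticOnNhd
      (analyticOnNhd_const.mul (h1.mul h2))))
  · have hwB : ‖w‖ < B := by simpa using hw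
    obtain ⟨g₁, hg₁, hg₁e⟩ := exists_differentiableOn_eq_pow_mul (g := fun u => f (u • w))
      (R := R₂ / B) (r := r) (by positivity) (fun u hu => by
        have : u • w ∈ Metric.ball (0 : E) R₂ := by
          rw [mem_ball_zero_iff] at hu ⊢
          rw [lt_div_iff₀ hB] at hu
          rw [norm_smul]
          exact lt_of_le_of_lt (by gcongr) hu
        exact ((hf₂ _ this).differentiableAt.comp u
          (by fun_prop : DifferentiableAt ℂ (fun u : ℂ => u • w) u)).differentiableWithinAt)
      (hO.comp (vo_one_of_differentiableAt (𝕜 := ℂ) (by fun_prop) (by simp)))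
    have hρR : ρ < R₂ / B := by rw [lt_div_iff₀ hB]; exact hρB.2
    have hcauchy := (hg₁.mono (Metric.closedBall_subset_ball hρR)).circleIntegral_sub_inv_smul hs
    have hval : integralIcc ℂ ℂ hpi (e * (H (m s) * G (ℓ w))) = 2 * Real.pi * g₁ s := by
      rw [integralIcc_eq hpi _ (g := fun t => (circleMap 0 ρ t ^ r)⁻¹ *
        ((1 - (circleMap 0 ρ t)⁻¹ * s)⁻¹ * f (circleMap 0 ρ t • w)))]
      · have : (2 * Real.pi * Complex.I : ℂ) • g₁ s = Complex.I * (2 * Real.pi * g₁ s) := by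
          rw [smul_eq_mul]; ring
        rw [this, circleIntegral] at hcauchy
        refine mul_left_cancel₀ Complex.I_ne_zero ?_
        rw [← hcauchy, ← intervalIntegral.integral_const_mul]
        refine intervalIntegral.integral_congr fun t _ => ?_
        have hct : circleMap 0 ρ t ∈ Metric.ball (0 : ℂ) (R₂ / B) := by
          rw [mem_ball_zero_iff, norm_circleMap_zero, abs_of_pos hρ0]; exact hρR
        have hcs : circleMap 0 ρ t - s ≠ 0 := by
          intro h
          rw [sub_eq_zero] at h
          rw [← h, mem_ball_zero_iff, norm_circleMap_zero, abs_of_pos hρ0] at hs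
          exact lt_irrefl _ hs
        have hg' : f (circleMap 0 ρ t • w) = _ := hg₁e _ hct
        rw [hg', deriv_circleMap, smul_eq_mul, smul_eq_mul]
        have h1 : (1 - (circleMap 0 ρ t)⁻¹ * s)⁻¹ = circleMap 0 ρ t * (circleMap 0 ρ t - s)⁻¹ := by
          rw [show 1 - (circleMap 0 ρ t)⁻¹ * s = (circleMap 0 ρ t)⁻¹ * (circleMap 0 ρ t - s) by
            rw [mul_sub, inv_mul_cancel₀ (hc0 t)], mul_inv, inv_inv]
        rw [h1]
        have h2 := pow_ne_zero r (hc0 t)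
        field_simp
      · intro t
        simp only [ContinuousMap.mul_apply]
        rw [hHe _ (hmb s hs), hGe _ (hℓb w hw)]
        rfl
    beta_reduce
    rw [hval, inv_mul_cancel_left₀]
    · exact hg₁e s (Metric.ball_subset_ball hρR.le hs)
    · exact_mod_cast (by positivity : (2 * Real.pi : ℝ) ≠ 0)

end Division

section ParametricIntegral

variable {W P G : Type*} [NormedAddCommGroup W] [NormedSpace ℂ W] [NormedAddCommGroup P]
  [NormedSpace ℂ P] [NormedAddCommGroup G] [NormedSpace ℂ G] [CompleteSpace G]

/-- An integral over a curve depends analytically on the parameter, as soon as the integrand is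
jointly analytic along the curve. -/
theorem analyticAt_intervalIntegral_of_analyticAt {F : W × P → G} {γ : ℝ → W} {a b : ℝ}
    (hab : a ≤ b) (hγ : Continuous γ) {v₀ : P} (hF : ∀ t ∈ Set.Icc a b, AnalyticAt ℂ F (γ t, v₀)) :
    AnalyticAt ℂ (fun v => ∫ t in a..b, F (γ t, v)) v₀ := by
  have hloc : ∀ t₀ : Set.Icc a b, ∃ U : Set (Set.Icc a b), IsOpen U ∧ t₀ ∈ U ∧
      ∀ c d : Set.Icc a b, c ≤ d → Set.Icc c d ⊆ U →
        AnalyticAt ℂ (fun v => ∫ t in (c : ℝ)..d, F (γ t, v)) v₀ ∧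
        ∀ᶠ v in 𝓝 v₀, IntervalIntegrable (fun t => F (γ t, v)) MeasureTheory.volume c d := by
    intro t₀
    obtain ⟨p, R, hp⟩ := hF t₀ t₀.2
    obtain ⟨ε, hε, hεR⟩ : ∃ ε : ℝ, 0 < ε ∧ ENNReal.ofReal ε ≤ R := by
      rcases eq_or_ne R ⊤ with rfl | h
      · exact ⟨1, one_pos, le_top⟩
      · exact ⟨R.toReal, ENNReal.toReal_pos hp.r_pos.ne' h, (ENNReal.ofReal_toReal h).le⟩
    have hp' := hp.mono (by simpa using hε) hεR
    refine ⟨{t | dist (γ t) (γ t₀) < ε / 2}, isOpen_lt (by fun_prop) continuous_const, by simpa,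
      fun c d hcd hU => ?_⟩
    obtain ⟨S, hS, hSe⟩ := hp'.exists_superposition (K := Set.Icc (c : ℝ) d)
    rw [Metric.eball_ofReal] at hS hSe
    set u : P → C(Set.Icc (c : ℝ) d, W × P) := fun v =>
      (⟨fun t => (γ t, 0), by fun_prop⟩ : C(Set.Icc (c : ℝ) d, W × P)) +
        constFamily ℂ _ ((0 : W), v) with hu
    have hua : AnalyticAt ℂ u v₀ := by
      refine analyticAt_const.add ?_
      exact ((constFamily ℂ (Set.Icc (c : ℝ) d)).comp
        (ContinuousLinearMap.inr ℂ W P)).analyticAt v₀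
    have hue : ∀ v t, u v t = (γ t, v) := fun v t => by simp [hu]
    have hub : ∀ v ∈ Metric.ball v₀ (ε / 2),
        u v ∈ Metric.ball (ContinuousMap.const (Set.Icc (c : ℝ) d) (γ t₀, v₀)) ε := by
      intro v hv
      rw [Metric.mem_ball] at hv ⊢
      refine lt_of_le_of_lt ?_ (half_lt_self hε)
      rw [ContinuousMap.dist_le (by positivity)]
      intro t
      rw [hue, ContinuousMap.const_apply, Prod.dist_eq]
      refine max_le ?_ hv.le
      have : (⟨t, c.2.1.trans t.2.1, t.2.2.trans d.2.2⟩ : Set.Icc a b) ∈ Set.Icc c d :=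
        ⟨t.2.1, t.2.2⟩
      exact (hU this).le
    have hev : ∀ᶠ v in 𝓝 v₀, v ∈ Metric.ball v₀ (ε / 2) := Metric.ball_mem_nhds _ (by positivity)
    constructor
    · have h1 : AnalyticAt ℂ (fun v => integralIcc ℂ G (show (c : ℝ) ≤ d from hcd) (S (u v))) v₀ :=
        (ContinuousLinearMap.analyticAt _ _).comp
          ((hS _ (hub v₀ (Metric.mem_ball_self (by positivity)))).comp hua)
      refine h1.congr ?_
      filter_upwards [hev] with v hv
      refine integralIcc_eq _ _ fun t => ?_
      rw [hSe _ (hub v hv), hue]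
    · filter_upwards [hev] with v hv
      refine ContinuousOn.intervalIntegrable ?_
      rw [Set.uIcc_of_le (show (c : ℝ) ≤ d from hcd), continuousOn_iff_continuous_domRestrict]
      convert (S (u v)).continuous using 1
      ext t
      rw [hSe _ (hub v hv), hue]
      rfl
  choose U hUo hUm hU using hloc
  obtain ⟨t, ht0, htm, ⟨m, hm⟩, htU⟩ := exists_monotone_Icc_subset_open_cover_Icc hab hUo
    (fun t _ => Set.mem_iUnion.2 ⟨t, hUm t⟩)
  have key : ∀ n, AnalyticAt ℂ (fun v => ∫ s in a..(t n : ℝ), F (γ s, v)) v₀ ∧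
      ∀ᶠ v in 𝓝 v₀, IntervalIntegrable (fun s => F (γ s, v)) MeasureTheory.volume a (t n) := by
    intro n
    induction n with
    | zero => simp [ht0, analyticAt_const]
    | succ n ih =>
      obtain ⟨i, hi⟩ := htU n
      obtain ⟨h1, h2⟩ := hU i _ _ (htm n.le_succ) hi
      refine ⟨(ih.1.add h1).congr ?_, ?_⟩
      · filter_upwards [ih.2, h2] with v hv hv'
        exact intervalIntegral.integral_add_adjacent_intervals hv hv'
      · filter_upwards [ih.2, h2] with v hv hv'
        exact hv.trans hv'
  simpa [hm m le_rfl] using (key m).1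

end ParametricIntegral

section LoopIntegral

variable {E G : Type*} [NormedAddCommGroup E] [NormedSpace ℂ E] [NormedAddCommGroup G]
  [NormedSpace ℂ G]

/-- Two loops joined by a straight homotopy give the same integral of a closed one-form. -/
theorem loop_integral_eq_of_closed {η : E → E →L[ℂ] G} {γ γ' γ'' β β' β'' : ℝ → E} {a b : ℝ}
    (hγ : ∀ θ, HasDerivAt γ (γ' θ) θ) (hγ' : ∀ θ, HasDerivAt γ' (γ'' θ) θ)
    (hβ : ∀ θ, HasDerivAt β (β' θ) θ) (hβ' : ∀ θ, HasDerivAt β' (β'' θ) θ)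
    (hγab : γ a = γ b) (hβab : β a = β b)
    (hη : ∀ t ∈ Set.Icc (0 : ℝ) 1, ∀ θ, DifferentiableAt ℂ η (γ θ + t • (β θ - γ θ)))
    (hsymm : ∀ t ∈ Set.Icc (0 : ℝ) 1, ∀ θ, ∀ u v, fderiv ℂ η (γ θ + t • (β θ - γ θ)) u v =
      fderiv ℂ η (γ θ + t • (β θ - γ θ)) v u) :
    ∫ θ in a..b, η (γ θ) (γ' θ) = ∫ θ in a..b, η (β θ) (β' θ) := by
  set H : ℝ × ℝ → E := fun z => γ z.2 + z.1 • (β z.2 - γ z.2) with hH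
  set H₂ : ℝ × ℝ → E := fun z => γ' z.2 + z.1 • (β' z.2 - γ' z.2) with hH₂
  set Δ : ℝ × ℝ → E := fun z => β z.2 - γ z.2 with hΔ
  set s1 := ContinuousLinearMap.fst ℝ ℝ ℝ
  set s2 := ContinuousLinearMap.snd ℝ ℝ ℝ
  have hd : ∀ {g g' : ℝ → E}, (∀ θ, HasDerivAt g (g' θ) θ) → ∀ z : ℝ × ℝ,
      HasFDerivAt (fun z : ℝ × ℝ => g z.2) (s2.smulRight (g' z.2)) z := by
    intro g g' hg z
    have := (hg z.2).hasFDerivAt.comp z (hasFDerivAt_snd (𝕜 := ℝ) (p := z))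
    refine this.congr_fderiv ?_
    ext <;> simp [s2]
  have hfst : ∀ z : ℝ × ℝ, HasFDerivAt (fun z : ℝ × ℝ => z.1) s1 z := fun z => hasFDerivAt_fst
  have hHd : ∀ z, HasFDerivAt H (s2.smulRight (γ' z.2) +
      (z.1 • (s2.smulRight (β' z.2) - s2.smulRight (γ' z.2)) + s1.smulRight (Δ z))) z := fun z =>
    (hd hγ z).add ((hfst z).smul ((hd hβ z).sub (hd hγ z)))
  have hH₂d : ∀ z, HasFDerivAt H₂ (s2.smulRight (γ'' z.2) +
      (z.1 • (s2.smulRight (β'' z.2) - s2.smulRight (γ'' z.2)) +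
        s1.smulRight (β' z.2 - γ' z.2))) z := fun z =>
    (hd hγ' z).add ((hfst z).smul ((hd hβ' z).sub (hd hγ' z)))
  have hΔd : ∀ z, HasFDerivAt Δ (s2.smulRight (β' z.2) - s2.smulRight (γ' z.2)) z := fun z =>
    (hd hβ z).sub (hd hγ z)
  set ηr : E → E →L[ℝ] G := fun x => (η x).restrictScalars ℝ with hηr
  have hηd : ∀ z ∈ Set.Icc (0 : ℝ) 1 ×ˢ Set.univ, HasFDerivAt (fun z => ηr (H z))
      ((((ContinuousLinearMap.restrictScalarsL ℂ E G ℝ ℝ).comp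
        ((fderiv ℂ η (H z)).restrictScalars ℝ))).comp (s2.smulRight (γ' z.2) +
      (z.1 • (s2.smulRight (β' z.2) - s2.smulRight (γ' z.2)) + s1.smulRight (Δ z)))) z := by
    intro z hz
    have h1 : HasFDerivAt η ((fderiv ℂ η (H z)).restrictScalars ℝ) (H z) :=
      (hη z.1 hz.1 z.2).hasFDerivAt.restrictScalars ℝ
    exact ((ContinuousLinearMap.restrictScalarsL ℂ E G ℝ ℝ).hasFDerivAt.comp _ h1).comp z (hHd z)
  have hfd := fun z hz => (hηd z hz).clm_apply (hH₂d z)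
  have hgd := fun z hz => ((hηd z hz).clm_apply (hΔd z)).neg
  have hzero : ∀ z ∈ Set.Icc (0 : ℝ) 1 ×ˢ (Set.univ : Set ℝ), ∀ f' g' : ℝ × ℝ →L[ℝ] G,
      HasFDerivAt (fun z => ηr (H z) (H₂ z)) f' z →
      HasFDerivAt (fun z => -ηr (H z) (Δ z)) g' z → f' (1, 0) + g' (0, 1) = 0 := by
    intro z hz f' g' hf hg
    have h1 : f' (1, 0) = η (H z) (β' z.2 - γ' z.2) + fderiv ℂ η (H z) (Δ z) (H₂ z) := by
      rw [hf.unique (hfd z hz)]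
      simp [s1, s2, hηr]
    have h2 : g' (0, 1) = -(η (H z) (β' z.2 - γ' z.2) + fderiv ℂ η (H z) (H₂ z) (Δ z)) := by
      rw [hg.unique (hgd z hz)]
      simp only [neg_apply, add_apply,
        ContinuousLinearMap.comp_apply, ContinuousLinearMap.flip_apply]
      congr 2
      · simp [s2, hηr]
      · have : (s2.smulRight (γ' z.2) + (z.1 • (s2.smulRight (β' z.2) - s2.smulRight (γ' z.2)) +
            s1.smulRight (Δ z))) (0, 1) = H₂ z := by simp [s1, s2, hH₂]
        rw [← this]
        rfl
    have h3 : fderiv ℂ η (H z) (Δ z) (H₂ z) = fderiv ℂ η (H z) (H₂ z) (Δ z) :=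
      hsymm z.1 hz.1 z.2 (Δ z) (H₂ z)
    rw [h1, h2, h3, add_neg_cancel]
  have hmain := MeasureTheory.integral2_divergence_prod_of_hasFDerivAt_off_countable
    (fun z => ηr (H z) (H₂ z)) (fun z => -ηr (H z) (Δ z)) (fun z => fderiv ℝ (fun z => ηr (H z) (H₂ z)) z)
    (fun z => fderiv ℝ (fun z => -ηr (H z) (Δ z)) z)
    0 a 1 b ∅ Set.countable_empty
    (fun z hz => (hfd z ⟨by simpa using hz.1, trivial⟩).continuousAt.continuousWithinAt)
    (fun z hz => (hgd z ⟨by simpa using hz.1, trivial⟩).continuousAt.continuousWithinAt)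
    (fun z hz => (hfd z ⟨Set.Ioo_subset_Icc_self (by simpa using hz.1.1), trivial⟩).differentiableAt.hasFDerivAt)
    (fun z hz => (hgd z ⟨Set.Ioo_subset_Icc_self (by simpa using hz.1.1), trivial⟩).differentiableAt.hasFDerivAt)
    ?_
  · have hz : ∀ x ∈ Set.Icc (0 : ℝ) 1, ∀ y : ℝ, fderiv ℝ (fun z => ηr (H z) (H₂ z)) (x, y) (1, 0) +
        fderiv ℝ (fun z => -ηr (H z) (Δ z)) (x, y) (0, 1) = 0 := fun x hx y =>
      hzero (x, y) ⟨hx, trivial⟩ _ _ (hfd _ ⟨hx, trivial⟩).differentiableAt.hasFDerivAt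
        (hgd _ ⟨hx, trivial⟩).differentiableAt.hasFDerivAt
    rw [intervalIntegral.integral_congr (g := fun _ => (0 : G))] at hmain
    · simp only [hηr, hH, hΔ, hH₂, intervalIntegral.integral_zero, hγab, hβab, sub_self,
        zero_add, ContinuousLinearMap.coe_restrictScalars', one_smul, zero_smul, add_zero,
        add_sub_cancel] at hmain
      exact (sub_eq_zero.1 hmain.symm).symm
    · intro x hx
      rw [Set.uIcc_of_le zero_le_one] at hx
      simp only [hz x hx, intervalIntegral.integral_zero]
  · refine MeasureTheory.integrableOn_zero.congr_fun (fun z hz => ?_)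
      (measurableSet_uIcc.prod measurableSet_uIcc)
    have hz1 : z.1 ∈ Set.Icc (0 : ℝ) 1 := by simpa using hz.1
    exact (hzero z ⟨hz1, trivial⟩ _ _ (hfd _ ⟨hz1, trivial⟩).differentiableAt.hasFDerivAt
        (hgd _ ⟨hz1, trivial⟩).differentiableAt.hasFDerivAt).symm

end LoopIntegral

section LeadingForm

variable {𝕜 E F : Type*} [NontriviallyNormedField 𝕜] [NormedAddCommGroup E] [NormedSpace 𝕜 E]
  [NormedAddCommGroup F] [NormedSpace 𝕜 F]

/-- The leading homogeneous form of a nonzero analytic germ. -/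
theorem AnalyticAt.exists_leadingForm {f : E → F} (hf : AnalyticAt 𝕜 f 0)
    (hne : ¬ ∀ᶠ x in 𝓝 0, f x = 0) :
    ∃ (r : ℕ) (p : E [×r]→L[𝕜] F), (∃ w, p (fun _ => w) ≠ 0) ∧
      VO (r + 1) (fun x => f x - p (fun _ => x)) := by
  classical
  obtain ⟨p, hp⟩ := hf
  have hex : ∃ r, ∃ w, p r (fun _ => w) ≠ 0 := by
    by_contra! h
    refine hne ?_
    obtain ⟨R, hR⟩ := hp
    filter_upwards [Metric.eball_mem_nhds (0 : E) hR.r_pos] with x hx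
    have := hR.hasSum hx
    simp only [h, zero_add] at this
    exact this.unique hasSum_zero
  refine ⟨Nat.find hex, p _, Nat.find_spec hex, ?_⟩
  have h := hp.isBigO_sub_partialSum_pow (Nat.find hex + 1)
  refine h.congr' ?_ EventuallyEq.rfl
  refine Eventually.of_forall fun y => ?_
  simp only [FormalMultilinearSeries.partialSum, zero_add]
  rw [Finset.sum_range_succ, Finset.sum_eq_zero, zero_add]
  intro k hk
  have := Nat.find_min hex (Finset.mem_range.1 hk)
  push Not at this
  exact this y

theorem vo_diagonal {r : ℕ} (p : E [×r]→L[𝕜] F) : VO r (fun x => p (fun _ => x)) := by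
  refine IsBigO.of_bound ‖p‖ (Eventually.of_forall fun x => ?_)
  simpa using p.le_opNorm fun _ => x

end LeadingForm

section InverseNearCompact

variable {A B : Type*} [NormedAddCommGroup A] [NormedSpace ℂ A] [CompleteSpace A]
  [NormedAddCommGroup B] [NormedSpace ℂ B] [CompleteSpace B]

/-- Analytic inverse of a map near a compact set on which it is injective and étale. -/
theorem exists_analytic_inverse_nhdsSet {Ψ : A → B} {K : Set A} (hK : IsCompact K)
    (hinj : Set.InjOn Ψ K) (han : ∀ k ∈ K, AnalyticAt ℂ Ψ k)
    (hd : ∀ k ∈ K, ∃ e : A ≃L[ℂ] B, HasFDerivAt Ψ (e : A →L[ℂ] B) k) :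
    ∃ Θ : B → A, (∀ k ∈ K, AnalyticAt ℂ Θ (Ψ k)) ∧ (∀ᶠ a in 𝓝ˢ K, Θ (Ψ a) = a) ∧
      ∀ k ∈ K, ∀ᶠ b in 𝓝 (Ψ k), Ψ (Θ b) = b := by
  classical
  have hloc : ∀ k ∈ K, ∃ Θ : B → A, AnalyticAt ℂ Θ (Ψ k) ∧ (∀ᶠ b in 𝓝 (Ψ k), Ψ (Θ b) = b) ∧
      Θ (Ψ k) = k ∧ ∃ u ∈ 𝓝 k, Set.InjOn Ψ u := by
    intro k hk
    obtain ⟨e, he⟩ := hd k hk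
    have hc : ContDiffAt ℂ ω Ψ k := (han k hk).contDiffAt
    have hs : HasStrictFDerivAt Ψ (e : A →L[ℂ] B) k := hc.hasStrictFDerivAt' he (by simp)
    refine ⟨hc.localInverse he (by simp), ?_, hs.eventually_right_inverse,
      hs.localInverse_apply_image, ?_⟩
    · exact (hc.to_localInverse he (by simp)).analyticAt
    · exact ⟨(hs.toOpenPartialHomeomorph Ψ).source, (hs.toOpenPartialHomeomorph Ψ).open_source.mem_nhds
        hs.mem_toOpenPartialHomeomorph_source, (hs.toOpenPartialHomeomorph Ψ).injOn⟩
  obtain ⟨U, hU, hUinj⟩ := hinj.exists_mem_nhdsSet hK (fun k hk => (han k hk).continuousAt)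
    (fun k hk => by obtain ⟨Θ, _, _, _, h⟩ := hloc k hk; exact h)
  have hinv : ∀ k ∈ K, ∃ Θ : B → A, AnalyticAt ℂ Θ (Ψ k) ∧ (∀ᶠ b in 𝓝 (Ψ k), Ψ (Θ b) = b) ∧
      Function.invFunOn Ψ U =ᶠ[𝓝 (Ψ k)] Θ := by
    intro k hk
    obtain ⟨Θ, h1, h2, h3, -⟩ := hloc k hk
    refine ⟨Θ, h1, h2, ?_⟩
    have h4 : ∀ᶠ b in 𝓝 (Ψ k), Θ b ∈ U := h1.continuousAt.eventually_mem (by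
      rw [h3]; exact mem_nhdsSet_iff_forall.1 hU k hk)
    filter_upwards [h2, h4] with b hb hbU
    conv_lhs => rw [← hb]
    exact hUinj.leftInvOn_invFunOn hbU
  refine ⟨Function.invFunOn Ψ U, fun k hk => ?_, ?_, fun k hk => ?_⟩
  · obtain ⟨Θ, h1, h2, h3⟩ := hinv k hk
    exact h1.congr h3.symm
  · filter_upwards [hU] with a ha using hUinj.leftInvOn_invFunOn ha
  · obtain ⟨Θ, h1, h2, h3⟩ := hinv k hk
    filter_upwards [h2, h3] with b hb hb'
    rw [hb', hb]

end InverseNearCompact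

section TubeFilter

variable {E : Type*} [NormedAddCommGroup E]

/-- Eventual properties near `{0} ×ˢ K` hold on a product of a ball with a thickening of `K`. -/
theorem Filter.Eventually.exists_tube {K : Set E} (hK : IsCompact K) {P : ℂ × E → Prop}
    (h : ∀ᶠ p in 𝓝ˢ (({0} : Set ℂ) ×ˢ K), P p) :
    ∃ ε > 0, ∀ s : ℂ, ‖s‖ < ε → ∀ k ∈ K, ∀ W, ‖W - k‖ < ε → P (s, W) := by
  have hc : IsCompact (({0} : Set ℂ) ×ˢ K) := isCompact_singleton.prod hK
  obtain ⟨u, huo, hu, hP⟩ := eventually_nhdsSet_iff_exists.1 h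
  obtain ⟨ε, hε, h2⟩ := hc.exists_thickening_subset_open huo hu
  refine ⟨ε, hε, fun s hs k hk W hW => hP _ (h2 ?_)⟩
  rw [Metric.mem_thickening_iff]
  refine ⟨(0, k), ⟨rfl, hk⟩, ?_⟩
  rw [Prod.dist_eq]
  simp only [dist_eq_norm, sub_zero]
  exact max_lt hs hW

theorem eventually_nhdsSet_singleton_prod {K : Set E} {P : ℂ × E → Prop}
    (h : ∀ k ∈ K, ∀ᶠ p in 𝓝 ((0 : ℂ), k), P p) : ∀ᶠ p in 𝓝ˢ (({0} : Set ℂ) ×ˢ K), P p := by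
  refine eventually_nhdsSet_iff_forall.2 ?_
  rintro ⟨s, k⟩ ⟨hs, hk⟩
  obtain rfl : s = 0 := hs
  exact h k hk

theorem Filter.Eventually.at_point {K : Set E} {P : ℂ × E → Prop}
    (h : ∀ᶠ p in 𝓝ˢ (({0} : Set ℂ) ×ˢ K), P p) {k : E} (hk : k ∈ K) :
    ∀ᶠ p in 𝓝 ((0 : ℂ), k), P p :=
  eventually_nhdsSet_iff_forall.1 h _ ⟨rfl, hk⟩

theorem eventually_norm_le_of_compact {A B : Type*} [TopologicalSpace A] [NormedAddCommGroup B]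
    {K : Set A} (hK : IsCompact K) {F : A → B} (hF : ∀ k ∈ K, ContinuousAt F k) :
    ∃ C, 0 < C ∧ ∀ᶠ p in 𝓝ˢ K, ‖F p‖ ≤ C := by
  obtain ⟨C, hC⟩ := hK.exists_bound_of_continuousOn
    (fun k hk => (hF k hk).continuousWithinAt : ContinuousOn F K)
  refine ⟨max C 0 + 1, by positivity, eventually_nhdsSet_iff_forall.2 fun k hk => ?_⟩
  have : ‖F k‖ < max C 0 + 1 := ((hC k hk).trans (le_max_left _ _)).trans_lt (lt_add_one _)
  filter_upwards [(hF k hk).norm.eventually_lt continuousAt_const this] with p hp using hp.le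

end TubeFilter

/-- A `2π`-periodic one-parameter group of linear maps with generator `I • L`. -/
structure Rotation (E : Type*) [NormedAddCommGroup E] [NormedSpace ℂ E] where
  /-- the group -/
  U : ℝ → E →L[ℂ] E
  /-- the generator divided by `I` -/
  L : E →L[ℂ] E
  hasDerivAt : ∀ θ, HasDerivAt U (Complex.I • (L ∘L U θ)) θ
  U_zero : U 0 = ContinuousLinearMap.id ℂ E
  periodic : Function.Periodic U (2 * Real.pi)

section

variable {E : Type*} [NormedAddCommGroup E] [NormedSpace ℂ E] {ι : Type*}

namespace Rotation

variable (R : Rotation E)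

theorem continuous : Continuous R.U :=
  continuous_iff_continuousAt.2 fun θ => (R.hasDerivAt θ).continuousAt

theorem hasDerivAt_apply (w : E) (θ : ℝ) :
    HasDerivAt (fun t => R.U t w) (Complex.I • R.L (R.U θ w)) θ := by
  have := ((ContinuousLinearMap.apply ℂ E w).hasFDerivAt.restrictScalars ℝ).comp_hasDerivAt θ
    (R.hasDerivAt θ)
  simpa [Function.comp_def] using this

theorem exists_bound : ∃ M, 1 ≤ M ∧ ∀ θ, ‖R.U θ‖ ≤ M := by
  have hc : IsCompact (Set.range R.U) :=
    R.periodic.compact_of_continuous (by positivity) R.continuous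
  obtain ⟨M, hM⟩ := hc.isBounded.exists_norm_le
  exact ⟨max M 1, le_max_right _ _, fun θ => (hM _ ⟨θ, rfl⟩).trans (le_max_left _ _)⟩

/-- The orbit of a vector. -/
def orbit (w : E) : Set E := Set.range fun θ => R.U θ w

theorem isCompact_orbit (w : E) : IsCompact (R.orbit w) := by
  refine Function.Periodic.compact_of_continuous (c := 2 * Real.pi) (fun θ => ?_)
    (by positivity) (R.continuous.clm_apply continuous_const)
  simp only [R.periodic θ]

theorem mem_orbit (w : E) (θ : ℝ) : R.U θ w ∈ R.orbit w := ⟨θ, rfl⟩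

theorem self_mem_orbit (w : E) : w ∈ R.orbit w := ⟨0, by simp [R.U_zero]⟩

end Rotation

/-- A frame adapted to commuting vector fields `X` with first integral `f`. -/
structure IsFrame [Fintype ι] [DecidableEq ι] (f : E → ℂ) (X : ι → E → E) (K : ι → E → E →L[ℂ] ℂ) : Prop where
  f_an : AnalyticAt ℂ f 0
  X_an : ∀ j, AnalyticAt ℂ (X j) 0
  K_an : ∀ j, AnalyticAt ℂ (K j) 0
  f_zero : f 0 = 0
  f_ne : ¬ ∀ᶠ x in 𝓝 0, f x = 0
  expand : ∀ᶠ x in 𝓝 0, ∀ V, fderiv ℂ f x x • V = fderiv ℂ f x V • x + ∑ j, K j x V • X j x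
  K_self : ∀ j, ∀ᶠ x in 𝓝 0, K j x x = 0
  K_X : ∀ j a, ∀ᶠ x in 𝓝 0, K j x (X a x) = if j = a then fderiv ℂ f x x else 0
  f_X : ∀ a, ∀ᶠ x in 𝓝 0, fderiv ℂ f x (X a x) = 0
  comm : ∀ a b, ∀ᶠ x in 𝓝 0, fderiv ℂ (X b) x (X a x) = fderiv ℂ (X a) x (X b x)

/-- `Z` generates a `2π`-periodic flow tangent to `R` and is a symmetry of `f`, `X` to order `N`. -/
structure IsApprox (R : Rotation E) (f : E → ℂ) (X : ι → E → E) (N : ℕ) (Z : E → E)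
    (Ψ : ℝ → E → E) : Prop where
  Z_an : AnalyticAt ℂ Z 0
  flow : ∃ ρ > 0, ∃ C, ∀ x, ‖x‖ < ρ → ∀ θ, HasDerivAt (fun t => Ψ t x) (Complex.I • Z (Ψ θ x)) θ ∧
    ‖Ψ θ x - R.U θ x‖ ≤ C * ‖x‖ ^ 2
  start : ∀ᶠ x in 𝓝 0, Ψ 0 x = x
  period : ∀ᶠ x in 𝓝 0, Ψ (2 * Real.pi) x = x
  bracket : ∀ j, VO N fun x => fderiv ℂ (X j) x (Z x) - fderiv ℂ Z x (X j x)
  integral : VO N fun x => fderiv ℂ f x (Z x)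

namespace IsApprox

variable {R : Rotation E} {f : E → ℂ} {X : ι → E → E} {N : ℕ} {Z : E → E} {Ψ : ℝ → E → E}

theorem exists_flow (h : IsApprox R f X N Z Ψ) : ∃ ρ > 0, ∃ C > 0, ∃ M ≥ 1, ∀ x, ‖x‖ < ρ →
    Ψ 0 x = x ∧ Ψ (2 * Real.pi) x = x ∧ ∀ θ,
      HasDerivAt (fun t => Ψ t x) (Complex.I • Z (Ψ θ x)) θ ∧
      ‖Ψ θ x - R.U θ x‖ ≤ C * ‖x‖ ^ 2 ∧ ‖Ψ θ x‖ ≤ M * ‖x‖ := by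
  obtain ⟨ρ, hρ, C, hC⟩ := h.flow
  obtain ⟨M, hM1, hM⟩ := R.exists_bound
  obtain ⟨ρ', hρ', h'⟩ := Metric.eventually_nhds_iff_ball.1 (h.start.and h.period)
  refine ⟨min (min ρ ρ') 1, by positivity, max C 1, by positivity, max C 1 + M,
    by linarith [le_max_right C 1], fun x hx => ?_⟩
  have hx1 : ‖x‖ < ρ := hx.trans_le ((min_le_left _ _).trans (min_le_left _ _))
  have hx2 : ‖x‖ < ρ' := hx.trans_le ((min_le_left _ _).trans (min_le_right _ _))
  have hx3 : ‖x‖ < 1 := hx.trans_le (min_le_right _ _)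
  obtain ⟨h0, h1⟩ := h' x (by simpa using hx2)
  refine ⟨h0, h1, fun θ => ⟨(hC x hx1 θ).1, ?_, ?_⟩⟩
  · refine (hC x hx1 θ).2.trans ?_
    gcongr
    exact le_max_left _ _
  · have e1 : ‖Ψ θ x - R.U θ x‖ ≤ max C 1 * ‖x‖ := by
      refine (hC x hx1 θ).2.trans ?_
      have : C * ‖x‖ ^ 2 ≤ max C 1 * ‖x‖ ^ 2 := by gcongr; exact le_max_left _ _
      refine this.trans ?_
      have hp : 0 < max C 1 := by positivity
      have : ‖x‖ ^ 2 ≤ ‖x‖ := by nlinarith [norm_nonneg x]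
      gcongr
    have e2 : ‖R.U θ x‖ ≤ M * ‖x‖ := (R.U θ).le_of_opNorm_le (hM θ) x
    calc ‖Ψ θ x‖ = ‖(Ψ θ x - R.U θ x) + R.U θ x‖ := by rw [sub_add_cancel]
      _ ≤ _ := norm_add_le _ _
      _ ≤ _ := by linarith

theorem Z_zero (h : IsApprox R f X N Z Ψ) : Z 0 = 0 := by
  obtain ⟨ρ, hρ, C, hC, M, hM, hf⟩ := h.exists_flow
  have h0 := hf 0 (by simpa using hρ)
  have : (fun t => Ψ t 0) = fun _ => 0 := by
    funext t
    have := (h0.2.2 t).2.2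
    simpa using this
  have hd := (h0.2.2 0).1
  rw [this, h0.1] at hd
  have := hd.unique (hasDerivAt_const _ _)
  simpa using this

/-- Almost invariant functions are almost constant along orbits. -/
theorem sub_le_of_vo (h : IsApprox R f X N Z Ψ) {g : E → ℂ} (hg : AnalyticAt ℂ g 0) {k : ℕ}
    (hgZ : VO k fun x => fderiv ℂ g x (Z x)) :
    ∃ ρ > 0, ∃ C > 0, ∀ x, ‖x‖ < ρ → ∀ θ ∈ Set.Icc 0 (2 * Real.pi),
      ‖g (Ψ θ x) - g x‖ ≤ C * ‖x‖ ^ k := by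
  obtain ⟨ρ, hρ, C, hC, M, hM, hf⟩ := h.exists_flow
  obtain ⟨c, hc, hb⟩ := hgZ.exists_pos
  obtain ⟨ρ', hρ', h'⟩ := Metric.eventually_nhds_iff_ball.1
    (hb.bound.and hg.eventually_analyticAt)
  refine ⟨min ρ (ρ' / M), by positivity, c * M ^ k * (2 * Real.pi), by positivity,
    fun x hx θ hθ => ?_⟩
  obtain ⟨h0, -, hx1⟩ := hf x (hx.trans_le (min_le_left _ _))
  have hx2 : M * ‖x‖ < ρ' := by
    have := hx.trans_le (min_le_right _ _)
    rw [lt_div_iff₀ (by positivity)] at this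
    linarith
  have hd : ∀ t, HasDerivAt (fun t => g (Ψ t x)) (fderiv ℂ g (Ψ t x) (Complex.I • Z (Ψ t x))) t := by
    intro t
    have ha := (h' (Ψ t x) (by simpa using ((hx1 t).2.2.trans_lt hx2))).2
    exact (ha.differentiableAt.hasFDerivAt.restrictScalars ℝ).comp_hasDerivAt t (hx1 t).1
  have := (convex_Icc (0 : ℝ) (2 * Real.pi)).norm_image_sub_le_of_norm_hasDerivWithin_le
    (f := fun t => g (Ψ t x)) (C := c * (M * ‖x‖) ^ k) (x := 0) (y := θ)
    (fun t _ => (hd t).hasDerivWithinAt) (fun t _ => ?_) ⟨le_rfl, by positivity⟩ hθ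
  · rw [h0] at this
    refine this.trans ?_
    rw [sub_zero, Real.norm_of_nonneg hθ.1, mul_pow, ← mul_assoc]
    have := mul_le_mul_of_nonneg_left hθ.2 (show 0 ≤ c * M ^ k * ‖x‖ ^ k by positivity)
    linarith
  · have ha := (h' (Ψ t x) (by simpa using ((hx1 t).2.2.trans_lt hx2))).1
    rw [map_smul, norm_smul, Complex.norm_I, one_mul]
    refine ha.trans ?_
    rw [norm_pow, norm_norm]
    gcongr
    exact (hx1 t).2.2

end IsApprox

end

section

variable {E : Type*} [NormedAddCommGroup E] [NormedSpace ℂ E] {ι : Type*}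

/-- Scaling quotient `f (s • w) = s ^ r * q (s, w)` with `q = 1` along an orbit of the rotation. -/
theorem exists_normalized_quotient {R : Rotation E} {f : E → ℂ} {X : ι → E → E}
    (hf : AnalyticAt ℂ f 0) (hf0 : f 0 = 0) (hfne : ¬ ∀ᶠ x in 𝓝 0, f x = 0)
    (happ : ∀ N, ∃ Z Ψ, IsApprox R f X N Z Ψ) :
    ∃ (r : ℕ) (ζ : E) (q : ℂ × E → ℂ), 1 ≤ r ∧ (∀ k ∈ R.orbit ζ, AnalyticAt ℂ q (0, k)) ∧
      (∀ k ∈ R.orbit ζ, q (0, k) = 1) ∧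
      ∀ᶠ p in 𝓝ˢ (({0} : Set ℂ) ×ˢ R.orbit ζ), f (p.1 • p.2) = p.1 ^ r * q p := by
  obtain ⟨r, p, ⟨w, hw⟩, hp⟩ := hf.exists_leadingForm hfne
  have hr : 1 ≤ r := by
    rcases Nat.eq_zero_or_pos r with rfl | h
    · exfalso
      have h1 := hp.apply_zero
      rw [hf0, zero_sub, neg_eq_zero] at h1
      apply hw
      rw [← h1]
      congr 1
      exact Subsingleton.elim _ _
    · exact h
  obtain ⟨a, ha⟩ := IsAlgClosed.exists_pow_nat_eq (p fun _ => w)⁻¹ (n := r) hr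
  set ζ : E := a • w with hζdef
  have hpζ : p (fun _ => ζ) = 1 := by
    have := p.map_smul_univ (fun _ => a) (fun _ => w)
    simp only [Finset.prod_const, Finset.card_univ, Fintype.card_fin] at this
    rw [hζdef, this, ha, smul_eq_mul, inv_mul_cancel₀ hw]
  obtain ⟨B, hB⟩ := (R.isCompact_orbit ζ).isBounded.exists_norm_le
  have hfr : VO r f := by
    have := (hp.mono (Nat.le_succ r)).add (vo_diagonal p)
    simpa using this
  obtain ⟨ρ, hρ, q, hq, hfq⟩ := hf.exists_scaling_quotient hfr (B := max B 0 + 1) (by positivity)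
  have hK : ∀ k ∈ R.orbit ζ, k ∈ Metric.ball (0 : E) (max B 0 + 1) := fun k hk => by
    simpa using ((hB k hk).trans (le_max_left B 0)).trans_lt (lt_add_one _)
  have hqan : ∀ k ∈ R.orbit ζ, AnalyticAt ℂ q (0, k) := fun k hk =>
    hq _ ⟨by simpa using hρ, hK k hk⟩
  have hev : ∀ᶠ z in 𝓝ˢ (({0} : Set ℂ) ×ˢ R.orbit ζ), f (z.1 • z.2) = z.1 ^ r * q z := by
    refine eventually_nhdsSet_singleton_prod fun k hk => ?_
    filter_upwards [prod_mem_nhds (Metric.ball_mem_nhds (0 : ℂ) hρ)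
      (Metric.isOpen_ball.mem_nhds (hK k hk))] with z hz
    exact hfq z.1 hz.1 z.2 hz.2
  refine ⟨r, ζ, q, hr, hqan, ?_, hev⟩
  have hζ := R.self_mem_orbit ζ
  -- limits along punctured neighbourhoods of `0`
  have hlim0 : Tendsto (fun s : ℂ => q (s, ζ)) (𝓝[≠] 0) (𝓝 (q (0, ζ))) := by
    have : ContinuousAt (fun s : ℂ => q (s, ζ)) 0 :=
      ContinuousAt.comp (f := fun s : ℂ => (s, ζ)) (hqan ζ hζ).continuousAt (by fun_prop)
    exact this.tendsto.mono_left nhdsWithin_le_nhds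
  have hsm : Tendsto (fun s : ℂ => s • ζ) (𝓝[≠] 0) (𝓝 0) := by
    have : Continuous fun s : ℂ => s • ζ := by fun_prop
    have := this.tendsto 0
    rw [zero_smul] at this
    exact this.mono_left nhdsWithin_le_nhds
  have hne : ∀ᶠ s : ℂ in 𝓝[≠] 0, s ≠ 0 := eventually_mem_nhdsWithin
  have hq0 : q (0, ζ) = 1 := by
    refine tendsto_nhds_unique hlim0 ?_
    obtain ⟨C, hC, hb⟩ := hp.exists_pos
    have e1 := hsm.eventually hb.bound
    have e2 : ∀ᶠ s : ℂ in 𝓝[≠] 0, f (s • ζ) = s ^ r * q (s, ζ) := by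
      have h1 := hev.at_point hζ
      have h2 : Tendsto (fun s : ℂ => (s, ζ)) (𝓝[≠] 0) (𝓝 (0, ζ)) :=
        (Continuous.tendsto (by fun_prop : Continuous fun s : ℂ => (s, ζ)) 0).mono_left
          nhdsWithin_le_nhds
      exact h2.eventually h1
    rw [tendsto_iff_norm_sub_tendsto_zero]
    have e3 : Tendsto (fun s : ℂ => C * ‖ζ‖ ^ (r + 1) * ‖s‖) (𝓝[≠] 0) (𝓝 0) := by
      have : Continuous fun s : ℂ => C * ‖ζ‖ ^ (r + 1) * ‖s‖ := by fun_prop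
      have := this.tendsto 0
      simp only [norm_zero, mul_zero] at this
      exact this.mono_left nhdsWithin_le_nhds
    refine squeeze_zero' (Eventually.of_forall fun _ => norm_nonneg _) ?_ e3
    filter_upwards [e1, e2, hne] with s h1 h2 hs
    have h3 := p.map_smul_univ (fun _ => s) (fun _ => ζ)
    simp only [Finset.prod_const, Finset.card_univ, Fintype.card_fin, hpζ] at h3
    rw [h2, h3, smul_eq_mul, ← mul_sub, norm_mul, norm_pow, norm_pow, norm_norm, norm_smul] at h1
    have hs' : 0 < ‖s‖ ^ r := by positivity
    refine le_of_mul_le_mul_left (h1.trans (le_of_eq ?_)) hs'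
    ring
  rintro _ ⟨θ₀, rfl⟩
  -- the orbit is periodic, so we may assume the angle lies in `[0, 2π]`
  obtain ⟨θ, hθ, hθe⟩ : ∃ θ ∈ Set.Icc 0 (2 * Real.pi), R.U θ₀ = R.U θ := by
    obtain ⟨y, hy, h⟩ := R.periodic.exists_mem_Ico₀ (by positivity) θ₀
    exact ⟨y, ⟨hy.1, hy.2.le⟩, h⟩
  simp only [hθe]
  obtain ⟨Z, Ψ, hΨ⟩ := happ (r + 1)
  obtain ⟨ρ₁, hρ₁, C₁, hC₁, hb₁⟩ := hΨ.sub_le_of_vo hf hΨ.integral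
  obtain ⟨ρ₂, hρ₂, C₂, hC₂, M, hM, hfl⟩ := hΨ.exists_flow
  have hball : ∀ ε > 0, ∀ᶠ s : ℂ in 𝓝[≠] 0, ‖s • ζ‖ < ε := fun ε hε => by
    filter_upwards [hsm.eventually (Metric.ball_mem_nhds 0 hε)] with s hs
    simpa using hs
  have hW : Tendsto (fun s : ℂ => (s, s⁻¹ • Ψ θ (s • ζ))) (𝓝[≠] 0) (𝓝 (0, R.U θ ζ)) := by
    refine Tendsto.prodMk_nhds (tendsto_id.mono_left nhdsWithin_le_nhds) ?_
    rw [tendsto_iff_norm_sub_tendsto_zero]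
    have e3 : Tendsto (fun s : ℂ => C₂ * ‖ζ‖ ^ 2 * ‖s‖) (𝓝[≠] 0) (𝓝 0) := by
      have : Continuous fun s : ℂ => C₂ * ‖ζ‖ ^ 2 * ‖s‖ := by fun_prop
      have := this.tendsto 0
      simp only [norm_zero, mul_zero] at this
      exact this.mono_left nhdsWithin_le_nhds
    refine squeeze_zero' (Eventually.of_forall fun _ => norm_nonneg _) ?_ e3
    filter_upwards [hball ρ₂ hρ₂, hne] with s h1 hs
    have h2 := ((hfl _ h1).2.2 θ).2.1
    have : s⁻¹ • Ψ θ (s • ζ) - R.U θ ζ = s⁻¹ • (Ψ θ (s • ζ) - R.U θ (s • ζ)) := by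
      rw [smul_sub, map_smul (R.U θ) s ζ, inv_smul_smul₀ hs]
    rw [this, norm_smul, norm_inv]
    rw [norm_smul] at h2
    have hs' : 0 < ‖s‖ := by positivity
    rw [inv_mul_le_iff₀ hs']
    refine h2.trans (le_of_eq ?_)
    ring
  have hlimθ : Tendsto (fun s : ℂ => q (s, s⁻¹ • Ψ θ (s • ζ))) (𝓝[≠] 0) (𝓝 (q (0, R.U θ ζ))) :=
    (hqan _ (R.mem_orbit ζ θ)).continuousAt.tendsto.comp hW
  rw [← hq0]
  refine tendsto_nhds_unique hlimθ ?_
  have : Tendsto (fun s : ℂ => q (s, s⁻¹ • Ψ θ (s • ζ)) - q (s, ζ)) (𝓝[≠] 0) (𝓝 0) := by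
    rw [tendsto_zero_iff_norm_tendsto_zero]
    have e3 : Tendsto (fun s : ℂ => C₁ * ‖ζ‖ ^ (r + 1) * ‖s‖) (𝓝[≠] 0) (𝓝 0) := by
      have : Continuous fun s : ℂ => C₁ * ‖ζ‖ ^ (r + 1) * ‖s‖ := by fun_prop
      have := this.tendsto 0
      simp only [norm_zero, mul_zero] at this
      exact this.mono_left nhdsWithin_le_nhds
    refine squeeze_zero' (Eventually.of_forall fun _ => norm_nonneg _) ?_ e3
    have h2 : Tendsto (fun s : ℂ => (s, ζ)) (𝓝[≠] 0) (𝓝 (0, ζ)) :=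
        (Continuous.tendsto (by fun_prop : Continuous fun s : ℂ => (s, ζ)) 0).mono_left
          nhdsWithin_le_nhds
    filter_upwards [hball ρ₁ hρ₁, hne, h2.eventually (hev.at_point hζ),
      hW.eventually (hev.at_point (R.mem_orbit ζ θ))] with s h1 hs h3 h4
    have h5 := hb₁ _ h1 θ hθ
    rw [smul_inv_smul₀ hs] at h4
    rw [h3, h4, ← mul_sub, norm_mul, norm_pow, norm_smul] at h5
    have hs' : 0 < ‖s‖ ^ r := by positivity
    refine le_of_mul_le_mul_left (h5.trans (le_of_eq ?_)) hs'
    ring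
  simpa using this.add hlim0

/-- The coordinate `σ = s q^{1/r}` and its partial inverse `S` near `{0} ×ˢ K`. -/
theorem exists_radial_chart [CompleteSpace E] {K : Set E} (hK : IsCompact K) {r : ℕ} (hr : 1 ≤ r) {q : ℂ × E → ℂ}
    (hq : ∀ k ∈ K, AnalyticAt ℂ q (0, k)) (hq1 : ∀ k ∈ K, q (0, k) = 1) :
    ∃ S : ℂ × E → ℂ, (∀ k ∈ K, AnalyticAt ℂ S (0, k)) ∧ (∀ k ∈ K, S (0, k) = 0) ∧
      (∀ᶠ p in 𝓝ˢ (({0} : Set ℂ) ×ˢ K), S (p.1 * q p ^ (1 / r : ℂ), p.2) = p.1) ∧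
      ∀ᶠ p in 𝓝ˢ (({0} : Set ℂ) ×ˢ K), S p * q (S p, p.2) ^ (1 / r : ℂ) = p.1 := by
  have hr' : (r : ℂ) ≠ 0 := by exact_mod_cast (by omega : r ≠ 0)
  set Ψ : ℂ × E → ℂ × E := fun p => (p.1 * q p ^ (1 / r : ℂ), p.2) with hΨ
  have hroot : ∀ k ∈ K, AnalyticAt ℂ (fun p : ℂ × E => q p ^ (1 / r : ℂ)) (0, k) := fun k hk =>
    (hq k hk).cpow analyticAt_const (by rw [hq1 k hk]; simp)
  have hΨan : ∀ k ∈ K, AnalyticAt ℂ Ψ (0, k) := fun k hk =>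
    (analyticAt_fst.mul (hroot k hk)).prod analyticAt_snd
  have hΨ0 : ∀ k, Ψ (0, k) = (0, k) := fun k => by simp [hΨ]
  have hinj : Set.InjOn Ψ (({0} : Set ℂ) ×ˢ K) := by
    rintro ⟨s, k⟩ ⟨hs, hk⟩ ⟨s', k'⟩ ⟨hs', hk'⟩ h
    obtain rfl : s = 0 := hs
    obtain rfl : s' = 0 := hs'
    rwa [hΨ0, hΨ0] at h
  have han : ∀ k ∈ ({0} : Set ℂ) ×ˢ K, AnalyticAt ℂ Ψ k := by
    rintro ⟨s, k⟩ ⟨hs, hk⟩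
    obtain rfl : s = 0 := hs
    exact hΨan k hk
  have hd : ∀ k ∈ ({0} : Set ℂ) ×ˢ K,
      ∃ e : (ℂ × E) ≃L[ℂ] ℂ × E, HasFDerivAt Ψ (e : ℂ × E →L[ℂ] ℂ × E) k := by
    rintro ⟨s, k⟩ ⟨hs, hk⟩
    obtain rfl : s = 0 := hs
    refine ⟨ContinuousLinearEquiv.refl ℂ _, ?_⟩
    have hd := ((hasFDerivAt_fst (𝕜 := ℂ) (E := ℂ) (F := E) (p := (0, k))).mul
      (hroot k hk).differentiableAt.hasFDerivAt).prodMk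
        (hasFDerivAt_snd (𝕜 := ℂ) (E := ℂ) (F := E) (p := (0, k)))
    refine hd.congr_fderiv ?_
    refine ContinuousLinearMap.ext fun v => ?_
    simp [hq1 k hk]
  obtain ⟨Θ, h1, h2, h3⟩ := exists_analytic_inverse_nhdsSet (Ψ := Ψ)
    (K := ({0} : Set ℂ) ×ˢ K) (isCompact_singleton.prod hK) hinj han hd
  refine ⟨fun p => (Θ p).1, fun k hk => ?_, fun k hk => ?_, ?_, ?_⟩
  · have := h1 (0, k) ⟨rfl, hk⟩
    rw [hΨ0] at this
    exact analyticAt_fst.comp this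
  · have := (h2.at_point hk).self_of_nhds
    rw [hΨ0] at this
    simp [this]
  · filter_upwards [h2] with p hp
    have : (p.1 * q p ^ (1 / r : ℂ), p.2) = Ψ p := rfl
    rw [this, hp]
  · refine eventually_nhdsSet_singleton_prod fun k hk => ?_
    have := h3 (0, k) ⟨rfl, hk⟩
    rw [hΨ0] at this
    filter_upwards [this] with p hp
    have e2 : (Ψ (Θ p)).2 = p.2 := congrArg Prod.snd hp
    have e1 : (Ψ (Θ p)).1 = p.1 := congrArg Prod.fst hp
    rw [← e2]
    exact e1

end

section Closedness

variable {E : Type*} [NormedAddCommGroup E] [NormedSpace ℂ E] {ι : Type*}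

/-- The pullback of a one-form with symmetric derivative on the image of `Dg` has symmetric
derivative. -/
theorem fderiv_pullback_symm [CompleteSpace E] {η : E → E →L[ℂ] ℂ} {g : E → E} {W : E}
    (hη : DifferentiableAt ℂ η (g W)) (hg : AnalyticAt ℂ g W) (u v : E)
    (hs : fderiv ℂ η (g W) (fderiv ℂ g W u) (fderiv ℂ g W v) =
      fderiv ℂ η (g W) (fderiv ℂ g W v) (fderiv ℂ g W u)) :
    fderiv ℂ (fun y => (η (g y)).comp (fderiv ℂ g y)) W u v =
      fderiv ℂ (fun y => (η (g y)).comp (fderiv ℂ g y)) W v u := by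
  have h1 : HasFDerivAt (fun y => η (g y)) ((fderiv ℂ η (g W)).comp (fderiv ℂ g W)) W :=
    hη.hasFDerivAt.comp W hg.differentiableAt.hasFDerivAt
  have h2 : HasFDerivAt (fderiv ℂ g) (fderiv ℂ (fderiv ℂ g) W) W :=
    hg.fderiv.differentiableAt.hasFDerivAt
  have h3 := h1.clm_comp h2
  have h4 : fderiv ℂ (fderiv ℂ g) W u v = fderiv ℂ (fderiv ℂ g) W v u :=
    (hg.contDiffAt (n := ω)).isSymmSndFDerivAt (by simp) u v
  rw [h3.fderiv]
  simp [h4, hs]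

/-- The one-forms dual to the frame are closed on the level sets of `f`. -/
theorem IsFrame.fderiv_dual_symm [Fintype ι] [DecidableEq ι] {f : E → ℂ} {X : ι → E → E}
    {K : ι → E → E →L[ℂ] ℂ} {x : E} (j : ι) (hX : ∀ a, DifferentiableAt ℂ (X a) x)
    (hK : DifferentiableAt ℂ (K j) x) (hf : AnalyticAt ℂ f x) (hne : fderiv ℂ f x x ≠ 0)
    (hexp : ∀ V, fderiv ℂ f x x • V = fderiv ℂ f x V • x + ∑ j, K j x V • X j x)
    (hKX : ∀ a, ∀ᶠ y in 𝓝 x, K j y (X a y) = if j = a then fderiv ℂ f y y else 0)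
    (hcomm : ∀ a b, fderiv ℂ (X b) x (X a x) = fderiv ℂ (X a) x (X b x))
    {u v : E} (hu : fderiv ℂ f x u = 0) (hv : fderiv ℂ f x v = 0) :
    DifferentiableAt ℂ (fun y => (fderiv ℂ f y y)⁻¹ • K j y) x ∧
    fderiv ℂ (fun y => (fderiv ℂ f y y)⁻¹ • K j y) x u v =
      fderiv ℂ (fun y => (fderiv ℂ f y y)⁻¹ • K j y) x v u := by
  have hh : DifferentiableAt ℂ (fun y => fderiv ℂ f y y) x :=
    hf.fderiv.differentiableAt.clm_apply differentiableAt_id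
  have hη : DifferentiableAt ℂ (fun y => (fderiv ℂ f y y)⁻¹ • K j y) x := (hh.inv hne).smul hK
  refine ⟨hη, ?_⟩
  set η := fun y => (fderiv ℂ f y y)⁻¹ • K j y with hηdef
  have hXX : ∀ a b, fderiv ℂ η x (X a x) (X b x) = - η x (fderiv ℂ (X b) x (X a x)) := by
    intro a b
    have h1 : (fun y => η y (X b y)) =ᶠ[𝓝 x] fun _ => if j = b then 1 else 0 := by
      filter_upwards [hKX b, hh.continuousAt.eventually_ne hne] with y hy hy'
      simp only [hηdef, smul_apply, hy, smul_eq_mul]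
      split_ifs
      · exact inv_mul_cancel₀ hy'
      · simp
    have h2 := hη.hasFDerivAt.clm_apply (hX b).hasFDerivAt
    have h3 := h2.fderiv
    rw [h1.fderiv_eq, fderiv_fun_const] at h3
    have := congrArg (fun T : E →L[ℂ] ℂ => T (X a x)) h3
    simp at this
    rw [eq_neg_iff_add_eq_zero, add_comm]
    exact this.symm
  have hsym : ∀ a b, fderiv ℂ η x (X a x) (X b x) = fderiv ℂ η x (X b x) (X a x) := fun a b => by
    rw [hXX, hXX, hcomm]
  have hexp' : ∀ w, fderiv ℂ f x w = 0 → ∃ c : ι → ℂ, w = ∑ a, c a • X a x := by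
    intro w hw
    refine ⟨fun a => (fderiv ℂ f x x)⁻¹ * K a x w, ?_⟩
    have := hexp w
    rw [hw, zero_smul, zero_add] at this
    calc w = (fderiv ℂ f x x)⁻¹ • (fderiv ℂ f x x • w) := (inv_smul_smul₀ hne w).symm
      _ = _ := by rw [this, Finset.smul_sum]; simp only [smul_smul]
  obtain ⟨c, hc⟩ := hexp' u hu
  obtain ⟨d, hd⟩ := hexp' v hv
  rw [hc, hd]
  simp only [map_sum, map_smul, sum_apply, smul_apply,
    Finset.smul_sum]
  rw [Finset.sum_comm]
  refine Finset.sum_congr rfl fun a _ => Finset.sum_congr rfl fun b _ => ?_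
  rw [hsym b a, smul_comm]

end Closedness

section Chart

variable {E : Type*} [NormedAddCommGroup E] [NormedSpace ℂ E] {ι : Type*}

/-- Blow-up coordinates near `{0} ×ˢ K` adapted to the function `f`. -/
structure IsChart (f : E → ℂ) (K₀ : Set E) (r : ℕ) (q S : ℂ × E → ℂ) : Prop where
  isCompact : IsCompact K₀
  one_le : 1 ≤ r
  q_an : ∀ k ∈ K₀, AnalyticAt ℂ q (0, k)
  q_one : ∀ k ∈ K₀, q (0, k) = 1
  f_eq : ∀ᶠ p in 𝓝ˢ (({0} : Set ℂ) ×ˢ K₀), f (p.1 • p.2) = p.1 ^ r * q p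
  S_an : ∀ k ∈ K₀, AnalyticAt ℂ S (0, k)
  S_zero : ∀ k ∈ K₀, S (0, k) = 0
  S_left : ∀ᶠ p in 𝓝ˢ (({0} : Set ℂ) ×ˢ K₀), S (p.1 * q p ^ (1 / r : ℂ), p.2) = p.1
  S_right : ∀ᶠ p in 𝓝ˢ (({0} : Set ℂ) ×ˢ K₀), S p * q (S p, p.2) ^ (1 / r : ℂ) = p.1

/-- The radial derivative of `s ^ r * q`, divided by `s ^ (r - 1)`. -/
noncomputable def radialFactor (r : ℕ) (q : ℂ × E → ℂ) (p : ℂ × E) : ℂ :=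
  r * q p + p.1 * fderiv ℂ q p (1, 0)

/-- The rescaled one-forms on the level sets in blow-up coordinates. -/
noncomputable def levelForm (K : E → E →L[ℂ] ℂ) (r : ℕ) (q S : ℂ × E → ℂ) (p : ℂ × E) :
    E →L[ℂ] ℂ :=
  (q (S p, p.2) * (radialFactor r q (S p, p.2))⁻¹ * S p) • K (S p • p.2)

namespace IsChart

variable {f : E → ℂ} {K₀ : Set E} {r : ℕ} {q S : ℂ × E → ℂ}

theorem radialFactor_an (h : IsChart f K₀ r q S) {k : E} (hk : k ∈ K₀) :
    AnalyticAt ℂ (radialFactor r q) (0, k) := by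
  refine (analyticAt_const.mul (h.q_an k hk)).add (analyticAt_fst.mul ?_)
  exact (h.q_an k hk).fderiv.clm_apply_of analyticAt_const

theorem radialFactor_ne (h : IsChart f K₀ r q S) {k : E} (hk : k ∈ K₀) :
    radialFactor r q (0, k) ≠ 0 := by
  have := h.one_le
  simp [radialFactor, h.q_one k hk]
  omega

theorem radial_eq (h : IsChart f K₀ r q S) (hf : AnalyticAt ℂ f 0) :
    ∀ᶠ p in 𝓝ˢ (({0} : Set ℂ) ×ˢ K₀),
      fderiv ℂ f (p.1 • p.2) (p.1 • p.2) = p.1 ^ r * radialFactor r q p := by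
  refine eventually_nhdsSet_singleton_prod fun k hk => ?_
  have hsm : ContinuousAt (fun p : ℂ × E => p.1 • p.2) (0, k) := by fun_prop
  have hfe : ∀ᶠ p : ℂ × E in 𝓝 (0, k), AnalyticAt ℂ f (p.1 • p.2) :=
    hsm.eventually (by simpa using hf.eventually_analyticAt)
  filter_upwards [hfe, (h.f_eq.at_point hk).eventually_nhds,
    (h.q_an k hk).eventually_analyticAt] with p h1 h2 h3
  have d1 : HasFDerivAt (fun p : ℂ × E => f (p.1 • p.2)) _ p :=
    HasFDerivAt.comp p h1.differentiableAt.hasFDerivAt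
      ((hasFDerivAt_fst (𝕜 := ℂ)).smul (hasFDerivAt_snd (𝕜 := ℂ)))
  have d2 := ((hasFDerivAt_fst (𝕜 := ℂ) (p := p)).pow r).mul h3.differentiableAt.hasFDerivAt
  have d3 := (d1.congr_of_eventuallyEq (f₁ := fun p : ℂ × E => p.1 ^ r * q p)
    (by filter_upwards [h2] with y hy using hy.symm)).unique d2
  have d4 := congrArg (fun T : (ℂ × E) →L[ℂ] ℂ => p.1 * T (1, 0)) d3
  simp only [ContinuousLinearMap.comp_apply, add_apply, smul_apply, ContinuousLinearMap.smulRight_apply,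
    ContinuousLinearMap.coe_fst', ContinuousLinearMap.coe_snd', smul_zero, zero_add, one_smul,
    smul_eq_mul, mul_one] at d4
  rw [map_smul, smul_eq_mul, d4, radialFactor]
  have := h.one_le
  obtain ⟨m, rfl⟩ : ∃ m, r = m + 1 := ⟨r - 1, by omega⟩
  simp only [Nat.add_sub_cancel, pow_succ]
  simp
  ring

/-- Composition with the inverse chart keeps eventual properties. -/
theorem eventually_S (h : IsChart f K₀ r q S) {P : ℂ × E → Prop}
    (hP : ∀ᶠ p in 𝓝ˢ (({0} : Set ℂ) ×ˢ K₀), P p) :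
    ∀ᶠ p in 𝓝ˢ (({0} : Set ℂ) ×ˢ K₀), P (S p, p.2) := by
  refine eventually_nhdsSet_singleton_prod fun k hk => ?_
  have hc : ContinuousAt (fun p : ℂ × E => (S p, p.2)) (0, k) :=
    (h.S_an k hk).continuousAt.prodMk continuousAt_snd
  have := hP.at_point hk
  rw [← h.S_zero k hk] at this
  exact hc.eventually this

theorem levelForm_an (h : IsChart f K₀ r q S) {K : E → E →L[ℂ] ℂ} (hK : AnalyticAt ℂ K 0)
    {k : E} (hk : k ∈ K₀) : AnalyticAt ℂ (levelForm K r q S) (0, k) := by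
  have h0 := h.S_zero k hk
  have hp : AnalyticAt ℂ (fun p : ℂ × E => (S p, p.2)) (0, k) := (h.S_an k hk).prod analyticAt_snd
  have hq : AnalyticAt ℂ (fun p : ℂ × E => q (S p, p.2)) (0, k) :=
    AnalyticAt.fun_comp (by simpa [h0] using h.q_an k hk) hp
  have hr : AnalyticAt ℂ (fun p : ℂ × E => radialFactor r q (S p, p.2)) (0, k) :=
    AnalyticAt.fun_comp (by simpa [h0] using h.radialFactor_an hk) hp
  have hKc : AnalyticAt ℂ (fun p : ℂ × E => K (S p • p.2)) (0, k) :=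
    AnalyticAt.fun_comp (by simpa [h0] using hK) ((h.S_an k hk).smul analyticAt_snd)
  exact ((hq.mul (hr.inv (by simpa [h0] using h.radialFactor_ne hk))).mul (h.S_an k hk)).smul hKc

theorem S_pow (h : IsChart f K₀ r q S) : ∀ᶠ p in 𝓝ˢ (({0} : Set ℂ) ×ˢ K₀),
    S p ^ r * q (S p, p.2) = p.1 ^ r := by
  filter_upwards [h.S_right] with p hp
  have hr : r ≠ 0 := by have := h.one_le; omega
  rw [← hp, mul_pow, one_div, Complex.cpow_nat_inv_pow _ hr]

/-- The rescaled one-forms restrict to closed forms on the slices `τ = const ≠ 0`. -/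
theorem levelForm_symm [CompleteSpace E] [Fintype ι] [DecidableEq ι] (h : IsChart f K₀ r q S)
    {X : ι → E → E} {K : ι → E → E →L[ℂ] ℂ} (hF : IsFrame f X K) (j : ι) :
    ∀ᶠ p in 𝓝ˢ (({0} : Set ℂ) ×ˢ K₀), p.1 ≠ 0 → ∀ u v,
      fderiv ℂ (fun W => levelForm (K j) r q S (p.1, W)) p.2 u v =
        fderiv ℂ (fun W => levelForm (K j) r q S (p.1, W)) p.2 v u := by
  have hS0 : ∀ {P : E → Prop}, (∀ᶠ x in 𝓝 0, P x) →
      ∀ᶠ p in 𝓝ˢ (({0} : Set ℂ) ×ˢ K₀), P (S p • p.2) := by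
    intro P hP
    refine eventually_nhdsSet_singleton_prod fun k hk => ?_
    have hc : ContinuousAt (fun p : ℂ × E => S p • p.2) (0, k) :=
      (h.S_an k hk).continuousAt.smul continuousAt_snd
    exact hc.eventually (by simpa [h.S_zero k hk] using hP)
  have hrf : ∀ᶠ p in 𝓝ˢ (({0} : Set ℂ) ×ˢ K₀), radialFactor r q p ≠ 0 :=
    eventually_nhdsSet_singleton_prod fun k hk =>
      (h.radialFactor_an hk).continuousAt.eventually_ne (h.radialFactor_ne hk)
  have hSan : ∀ᶠ p in 𝓝ˢ (({0} : Set ℂ) ×ˢ K₀), AnalyticAt ℂ S p :=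
    eventually_nhdsSet_singleton_prod fun k hk => (h.S_an k hk).eventually_analyticAt
  -- pointwise facts
  have hpt : ∀ᶠ p in 𝓝ˢ (({0} : Set ℂ) ×ˢ K₀), AnalyticAt ℂ S p ∧ S p * q (S p, p.2) ^ (1 / r : ℂ) = p.1 ∧
      S p ^ r * q (S p, p.2) = p.1 ^ r ∧ f (S p • p.2) = p.1 ^ r ∧
      fderiv ℂ f (S p • p.2) (S p • p.2) = S p ^ r * radialFactor r q (S p, p.2) ∧
      radialFactor r q (S p, p.2) ≠ 0 ∧ K j (S p • p.2) (S p • p.2) = 0 := by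
    filter_upwards [hSan, h.S_right, h.S_pow, h.eventually_S h.f_eq,
      h.eventually_S (h.radial_eq hF.f_an), h.eventually_S hrf, hS0 (hF.K_self j)]
      with p h1 h2 h3 h4 h5 h6 h7
    exact ⟨h1, h2, h3, h4.trans h3, h5, h6, h7⟩
  have hXan : ∀ᶠ x in 𝓝 (0 : E), ∀ a, AnalyticAt ℂ (X a) x :=
    eventually_all.2 fun a => (hF.X_an a).eventually_analyticAt
  have hcomm := eventually_all.2 fun a => eventually_all.2 fun b => hF.comm a b
  have hKX := eventually_all.2 fun a => (hF.K_X j a).eventually_nhds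
  filter_upwards [hpt.eventually_nhdsSet, hS0 hXan, hS0 (hF.K_an j).eventually_analyticAt,
    hS0 hF.f_an.eventually_analyticAt, hS0 hF.expand, hS0 hKX, hS0 hcomm]
    with ⟨τ, W₀⟩ hp hXp hKp hfp hep hKXp hcp hτ u v
  replace hτ : τ ≠ 0 := hτ
  set g : E → E := fun W => S (τ, W) • W with hg
  have hslice : Tendsto (fun W : E => (τ, W)) (𝓝 W₀) (𝓝 (τ, W₀)) :=
    Continuous.tendsto (by fun_prop) W₀
  have hev := hslice.eventually hp
  have hSne : ∀ {p : ℂ × E}, S p * q (S p, p.2) ^ (1 / r : ℂ) = τ → S p ≠ 0 := by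
    intro p hp h0
    rw [h0, zero_mul] at hp
    exact hτ hp.symm
  have hgd : ∀ᶠ W in 𝓝 W₀, AnalyticAt ℂ (fun W => S (τ, W)) W := by
    filter_upwards [hev] with W hW
    exact AnalyticAt.fun_comp (f := fun W => (τ, W)) hW.1 (analyticAt_const.prod analyticAt_id)
  have hgan : AnalyticAt ℂ g W₀ := hgd.self_of_nhds.smul analyticAt_id
  have hgder : ∀ W, AnalyticAt ℂ (fun W => S (τ, W)) W → ∀ V,
      fderiv ℂ g W V = S (τ, W) • V + fderiv ℂ (fun W => S (τ, W)) W V • W := by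
    intro W hW V
    have := hW.differentiableAt.hasFDerivAt.smul (hasFDerivAt_id W)
    have := this.fderiv
    simp only [hg]
    rw [show fderiv ℂ (fun W => S (τ, W) • W) W = _ from this]
    simp
  have hform : (fun W => levelForm (K j) r q S (τ, W)) =ᶠ[𝓝 W₀]
      fun W => τ ^ r • (((fderiv ℂ f (g W) (g W))⁻¹ • K j (g W)).comp (fderiv ℂ g W)) := by
    filter_upwards [hev, hgd] with W hW hWd
    obtain ⟨-, h2, h3, h4, h5, h6, h7⟩ := hW
    have hs := hSne h2
    refine ContinuousLinearMap.ext fun V => ?_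
    have hKW : K j (g W) W = 0 := by
      have h8 : S (τ, W) * K j (g W) W = 0 := by
        rw [← smul_eq_mul, ← map_smul]; exact h7
      exact (mul_eq_zero.1 h8).resolve_left hs
    have h5' : fderiv ℂ f (g W) (g W) = S (τ, W) ^ r * radialFactor r q (S (τ, W), W) := h5
    simp only [levelForm, smul_apply, ContinuousLinearMap.comp_apply, smul_eq_mul]
    rw [h5', hgder W hWd, map_add, map_smul, map_smul, hKW, ← h3]
    simp only [smul_eq_mul, mul_zero, add_zero]
    have : S (τ, W) ^ r ≠ 0 := pow_ne_zero _ hs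
    field_simp
    simp [hg]
  have h0 := hp.self_of_nhds
  have hS := hSne h0.2.1
  have hne : fderiv ℂ f (g W₀) (g W₀) ≠ 0 := by
    have := h0.2.2.2.2.1
    simp only [hg]
    rw [this]
    exact mul_ne_zero (pow_ne_zero _ hS) h0.2.2.2.2.2.1
  have hker : ∀ w, fderiv ℂ f (g W₀) (fderiv ℂ g W₀ w) = 0 := by
    intro w
    have h1 : (fun W => f (g W)) =ᶠ[𝓝 W₀] fun _ => τ ^ r := by
      filter_upwards [hev] with W hW using hW.2.2.2.1
    have hfp' : DifferentiableAt ℂ f (g W₀) := hfp.differentiableAt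
    have h2 := (hfp'.hasFDerivAt.comp W₀ hgan.differentiableAt.hasFDerivAt).fderiv
    have h3 : fderiv ℂ (f ∘ g) W₀ = 0 := by
      rw [show f ∘ g = fun W => f (g W) from rfl, h1.fderiv_eq, fderiv_fun_const]; rfl
    rw [h3] at h2
    simpa using (congrArg (fun T : E →L[ℂ] ℂ => T w) h2).symm
  have hcl := fun u v => IsFrame.fderiv_dual_symm (f := f) (X := X) (K := K) (x := g W₀) j
    (fun a => (hXp a).differentiableAt) hKp.differentiableAt hfp hne hep hKXp hcp
    (hker u) (hker v)
  have hsymm := fderiv_pullback_symm (hcl u v).1 hgan u v (hcl u v).2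
  have hdiff : DifferentiableAt ℂ (fun W => ((fderiv ℂ f (g W) (g W))⁻¹ • K j (g W)).comp
      (fderiv ℂ g W)) W₀ :=
    ((hcl u v).1.comp W₀ hgan.differentiableAt).clm_comp hgan.fderiv.differentiableAt
  show fderiv ℂ (fun W => levelForm (K j) r q S (τ, W)) W₀ u v =
    fderiv ℂ (fun W => levelForm (K j) r q S (τ, W)) W₀ v u
  rw [hform.fderiv_eq, fderiv_fun_const_smul hdiff]
  simp only [smul_apply, hsymm]

end IsChart

end Chart

section Bracket

variable {E : Type*} [NormedAddCommGroup E] [NormedSpace ℂ E] {ι : Type*} [Fintype ι]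
  [DecidableEq ι] {R : Rotation E} {f : E → ℂ} {X : ι → E → E} {K : ι → E → E →L[ℂ] ℂ} {N : ℕ}
  {Z : E → E} {Ψ : ℝ → E → E}

theorem AnalyticAt.radial_derivative {f : E → ℂ} {x : E} [CompleteSpace E] (hf : AnalyticAt ℂ f x) :
    AnalyticAt ℂ (fun y => fderiv ℂ f y y) x := hf.fderiv.clm_apply_of analyticAt_id

/-- The coefficients of an approximate symmetry are approximate first integrals up to the
common factor `h`. -/
theorem IsApprox.vo_coefficient [CompleteSpace E] (hA : IsApprox R f X N Z Ψ) (hF : IsFrame f X K)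
    (i : ι) :
    VO N fun x => fderiv ℂ f x x * fderiv ℂ (fun y => K i y (Z y)) x (Z x) -
      K i x (Z x) * fderiv ℂ (fun y => fderiv ℂ f y y) x (Z x) := by
  have hk : ∀ j, AnalyticAt ℂ (fun y => K j y (Z y)) 0 := fun j => (hF.K_an j).clm_apply_of hA.Z_an
  have ha : AnalyticAt ℂ (fun y => fderiv ℂ f y (Z y)) 0 := hF.f_an.fderiv.clm_apply_of hA.Z_an
  have key : ∀ᶠ x in 𝓝 0, fderiv ℂ f x x * fderiv ℂ (fun y => K i y (Z y)) x (Z x) -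
      K i x (Z x) * fderiv ℂ (fun y => fderiv ℂ f y y) x (Z x) =
      fderiv ℂ f x (Z x) • (K i x (fderiv ℂ Z x x) - K i x (Z x)) -
        ∑ j, K j x (Z x) • K i x (fderiv ℂ (X j) x (Z x) - fderiv ℂ Z x (X j x)) := by
    have hk' := eventually_all.2 fun j => (hk j).eventually_analyticAt
    have hX' := eventually_all.2 fun j => (hF.X_an j).eventually_analyticAt
    have hKX := eventually_all.2 fun j => hF.K_X i j
    filter_upwards [hF.expand.eventually_nhds, hk', hX', hKX, ha.eventually_analyticAt,
      hA.Z_an.eventually_analyticAt, hF.f_an.eventually_analyticAt, hF.K_self i]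
      with x hexp hkx hXx hKXx hax hZx hfx hKs
    have e1 : (fun y => fderiv ℂ f y y • Z y) =ᶠ[𝓝 x]
        fun y => fderiv ℂ f y (Z y) • y + ∑ j, K j y (Z y) • X j y := by
      filter_upwards [hexp] with y hy using hy (Z y)
    have d1 := (hfx.radial_derivative.differentiableAt.hasFDerivAt.smul
      hZx.differentiableAt.hasFDerivAt)
    have d2 := (hax.differentiableAt.hasFDerivAt.smul (hasFDerivAt_id (𝕜 := ℂ) x)).add
      (HasFDerivAt.fun_sum fun j (_ : j ∈ Finset.univ) =>
        (hkx j).differentiableAt.hasFDerivAt.smul (hXx j).differentiableAt.hasFDerivAt)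
    have d3 := (d2.congr_of_eventuallyEq e1).unique d1
    have d4 := congrArg (fun T : E →L[ℂ] E => K i x (T (Z x))) d3
    have d5 := congrArg (fun v => K i x (fderiv ℂ Z x v)) (hexp.self_of_nhds (Z x))
    simp only [map_add, map_sum, map_smul, add_apply, sum_apply, smul_apply,
      ContinuousLinearMap.smulRight_apply, smul_eq_mul, hKXx, hKs, mul_zero, add_zero,
      ContinuousLinearMap.id_apply, id, mul_ite, Finset.sum_add_distrib, Finset.sum_ite_eq,
      Finset.mem_univ, if_true] at d4 d5
    simp only [map_sub, smul_eq_mul, mul_sub, Finset.sum_sub_distrib]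
    linear_combination d4 + d5
  refine VO.congr ?_ (EventuallyEq.symm key)
  have hK0 : ∀ j, VO 0 (K j) := fun j => vo_zero_of_continuousAt (hF.K_an j).continuousAt
  refine VO.sub ?_ (VO.sum fun j _ => ?_)
  · have h0 : VO 0 fun x => K i x (fderiv ℂ Z x x) - K i x (Z x) :=
      vo_zero_of_continuousAt
        (((hF.K_an i).clm_apply_of (hA.Z_an.fderiv.clm_apply_of analyticAt_id)).sub
          (hk i)).continuousAt
    simpa using hA.integral.smul h0
  · have h0 : VO 0 fun x => K j x (Z x) := vo_zero_of_continuousAt (hk j).continuousAt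
    simpa using h0.smul ((hK0 i).clm_apply (hA.bracket j))

end Bracket

section Orbits

variable {E : Type*} [NormedAddCommGroup E] [NormedSpace ℂ E] {ι : Type*}
  {R : Rotation E} {f : E → ℂ} {X : ι → E → E} {N : ℕ} {Z : E → E} {Ψ : ℝ → E → E}

/-- Rescaled orbits stay close to the orbits of the rotation. -/
theorem IsApprox.exists_rescaled_orbit (hA : IsApprox R f X N Z Ψ) {M : ℝ} (hM1 : 1 ≤ M)
    (hM : ∀ θ, ‖R.U θ‖ ≤ M) (ζ : E) {ε : ℝ} (hε : 0 < ε) :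
    ∃ ρ > 0, ∀ s : ℂ, s ≠ 0 → ‖s‖ < ρ → ∀ W, ‖W - ζ‖ < ε / (2 * M) → ∀ θ,
      ‖s⁻¹ • Ψ θ (s • W) - R.U θ ζ‖ < ε := by
  obtain ⟨ρ, hρ, C, hC, M', hM', hf⟩ := hA.exists_flow
  set B : ℝ := ‖ζ‖ + ε / (2 * M) with hB
  have hBpos : 0 < B := by positivity
  refine ⟨min (ρ / B) (ε / (2 * (C * B ^ 2))), by positivity, fun s hs hsρ W hW θ => ?_⟩
  have hWB : ‖W‖ ≤ B := by
    have := norm_add_le (W - ζ) ζ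
    rw [sub_add_cancel] at this
    linarith
  have hs' : 0 < ‖s‖ := by positivity
  have h1 : ‖s • W‖ < ρ := by
    rw [norm_smul]
    have := hsρ.trans_le (min_le_left _ _)
    rw [lt_div_iff₀ hBpos] at this
    exact (mul_le_mul_of_nonneg_left hWB hs'.le).trans_lt this
  have h2 := ((hf _ h1).2.2 θ).2.1
  have e1 : s⁻¹ • Ψ θ (s • W) - R.U θ ζ =
      s⁻¹ • (Ψ θ (s • W) - R.U θ (s • W)) + R.U θ (W - ζ) := by
    rw [smul_sub, map_smul (R.U θ) s W, inv_smul_smul₀ hs, map_sub]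
    abel
  have e2 : ‖s⁻¹ • (Ψ θ (s • W) - R.U θ (s • W))‖ ≤ ε / 2 := by
    rw [norm_smul, norm_inv, inv_mul_le_iff₀ hs']
    refine h2.trans ?_
    rw [norm_smul, mul_pow]
    have h3 := (hsρ.trans_le (min_le_right _ _)).le
    rw [le_div_iff₀ (by positivity)] at h3
    have h4 : ‖W‖ ^ 2 ≤ B ^ 2 := by gcongr
    calc C * (‖s‖ ^ 2 * ‖W‖ ^ 2) ≤ C * (‖s‖ ^ 2 * B ^ 2) := by gcongr
      _ = ‖s‖ * (‖s‖ * (2 * (C * B ^ 2))) / 2 := by ring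
      _ ≤ ‖s‖ * ε / 2 := by gcongr
      _ = ‖s‖ * (ε / 2) := by ring
  have e3 : ‖R.U θ (W - ζ)‖ < ε / 2 := by
    refine ((R.U θ).le_of_opNorm_le (hM θ) _).trans_lt ?_
    rw [lt_div_iff₀ (by positivity)] at hW
    linarith
  rw [e1]
  exact (norm_add_le _ _).trans_lt (by linarith)

/-- The period of the one-form `η (τ, ·)` along the orbit of `ζ`. -/
noncomputable def periodFun (R : Rotation E) (ζ : E) (η : ℂ × E → E →L[ℂ] ℂ) (τ : ℂ) : ℂ :=
  (2 * Real.pi : ℂ)⁻¹ * ∫ θ in (0 : ℝ)..2 * Real.pi, η (τ, R.U θ ζ) (R.L (R.U θ ζ))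

theorem periodFun_an {ζ : E} {η : ℂ × E → E →L[ℂ] ℂ}
    (h : ∀ k ∈ R.orbit ζ, AnalyticAt ℂ η (0, k)) : AnalyticAt ℂ (periodFun R ζ η) 0 := by
  refine analyticAt_const.mul ?_
  refine analyticAt_intervalIntegral_of_analyticAt (W := E) (P := ℂ)
    (F := fun p : E × ℂ => η (p.2, p.1) (R.L p.1)) (γ := fun θ => R.U θ ζ) (by positivity)
    (R.continuous.clm_apply continuous_const) fun t _ => ?_
  refine AnalyticAt.clm_apply_of ?_ ?_
  · exact AnalyticAt.fun_comp (f := fun p : E × ℂ => (p.2, p.1)) (h _ (R.mem_orbit ζ t))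
      (analyticAt_snd.prod analyticAt_fst)
  · exact AnalyticAt.fun_comp (f := fun p : E × ℂ => p.1) (R.L.analyticAt _) analyticAt_fst

end Orbits

section

variable {E : Type*} [NormedAddCommGroup E] [NormedSpace ℂ E] [CompleteSpace E] {ι : Type*}
  [Fintype ι] [DecidableEq ι]
  {R : Rotation E} {f : E → ℂ} {X : ι → E → E} {K : ι → E → E →L[ℂ] ℂ} {N : ℕ}
  {Z : E → E} {Ψ : ℝ → E → E}

/-- The normalized coefficient `f h⁻¹ K(Z)` of a vector field in a frame. -/
noncomputable def frameCoeff (f : E → ℂ) (K : E → E →L[ℂ] ℂ) (Z : E → E) (y : E) : ℂ :=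
  f y * (fderiv ℂ f y y)⁻¹ * K y (Z y)

theorem IsApprox.frameCoeff_sub_le (hA : IsApprox R f X N Z Ψ) (hF : IsFrame f X K) (j : ι) :
    ∃ ρ > 0, ∃ C > 0, ∀ x, ‖x‖ < ρ → ∀ a b : ℝ, 0 < a →
      (∀ t, a ≤ ‖fderiv ℂ f (Ψ t x) (Ψ t x)‖) → (∀ t, ‖f (Ψ t x)‖ ≤ b) →
      ∀ θ ∈ Set.Icc 0 (2 * Real.pi),
        ‖frameCoeff f (K j) Z (Ψ θ x) - frameCoeff f (K j) Z x‖ ≤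
          C * (a⁻¹ + b * (a ^ 2)⁻¹) * ‖x‖ ^ N := by
  obtain ⟨ρ, hρ, C, hC, M, hM, hf⟩ := hA.exists_flow
  have hk : AnalyticAt ℂ (fun y => K j y (Z y)) 0 := (hF.K_an j).clm_apply_of hA.Z_an
  obtain ⟨c₁, hc₁, hb₁⟩ := (hA.vo_coefficient hF j).exists_pos
  obtain ⟨c₂, hc₂, hb₂⟩ := hA.integral.exists_pos
  obtain ⟨c₃, hc₃, hb₃⟩ := (vo_zero_of_continuousAt hk.continuousAt).exists_pos
  obtain ⟨ρ', hρ', h'⟩ := Metric.eventually_nhds_iff_ball.1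
    ((hb₁.bound.and hb₂.bound).and (hb₃.bound.and
      (hk.eventually_analyticAt.and hF.f_an.eventually_analyticAt)))
  refine ⟨min ρ (ρ' / M), by positivity, (c₂ * c₃ + c₁) * M ^ N * (2 * Real.pi), by positivity,
    fun x hx a b ha hha hfb θ hθ => ?_⟩
  have hb : 0 ≤ b := (norm_nonneg _).trans (hfb 0)
  obtain ⟨h0, -, hx1⟩ := hf x (hx.trans_le (min_le_left _ _))
  have hx2 : M * ‖x‖ < ρ' := by
    have := hx.trans_le (min_le_right _ _)
    rw [lt_div_iff₀ (by positivity)] at this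
    linarith
  have hin : ∀ t, Ψ t x ∈ Metric.ball (0 : E) ρ' := fun t => by
    simpa using ((hx1 t).2.2.trans_lt hx2)
  have hne : ∀ t, fderiv ℂ f (Ψ t x) (Ψ t x) ≠ 0 := fun t h => by
    have := hha t
    rw [h, norm_zero] at this
    linarith
  have hd : ∀ t, HasDerivAt (fun t => frameCoeff f (K j) Z (Ψ t x))
      (Complex.I * (fderiv ℂ f (Ψ t x) (Z (Ψ t x)) * K j (Ψ t x) (Z (Ψ t x)) *
          (fderiv ℂ f (Ψ t x) (Ψ t x))⁻¹ +
        f (Ψ t x) * (fderiv ℂ f (Ψ t x) (Ψ t x) *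
            fderiv ℂ (fun y => K j y (Z y)) (Ψ t x) (Z (Ψ t x)) -
          K j (Ψ t x) (Z (Ψ t x)) * fderiv ℂ (fun y => fderiv ℂ f y y) (Ψ t x) (Z (Ψ t x))) *
          (fderiv ℂ f (Ψ t x) (Ψ t x) ^ 2)⁻¹)) t := by
    intro t
    obtain ⟨-, -, hka, hfa⟩ := h' _ (hin t)
    have e1 : HasDerivAt (fun t => f (Ψ t x)) _ t :=
      (hfa.differentiableAt.hasFDerivAt.restrictScalars ℝ).comp_hasDerivAt t (hx1 t).1
    have e2 : HasDerivAt (fun t => fderiv ℂ f (Ψ t x) (Ψ t x)) _ t :=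
      ((hfa.radial_derivative.differentiableAt.hasFDerivAt.restrictScalars ℝ).comp_hasDerivAt t
        (hx1 t).1 :)
    have e3 : HasDerivAt (fun t => K j (Ψ t x) (Z (Ψ t x))) _ t :=
      ((hka.differentiableAt.hasFDerivAt.restrictScalars ℝ).comp_hasDerivAt t (hx1 t).1 :)
    have e4 := (e1.mul (e2.inv (hne t))).mul e3
    refine e4.congr_deriv ?_
    have := hne t
    simp only [ContinuousLinearMap.coe_restrictScalars', map_smul, smul_eq_mul, Pi.mul_apply,
      Pi.inv_apply]
    field_simp
    ring
  have := (convex_Icc (0 : ℝ) (2 * Real.pi)).norm_image_sub_le_of_norm_hasDerivWithin_le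
    (f := fun t => frameCoeff f (K j) Z (Ψ t x))
    (C := (c₂ * c₃ + c₁) * (a⁻¹ + b * (a ^ 2)⁻¹) * (M * ‖x‖) ^ N) (x := 0) (y := θ)
    (fun t _ => (hd t).hasDerivWithinAt) (fun t _ => ?_) ⟨le_rfl, by positivity⟩ hθ
  · rw [h0] at this
    refine this.trans ?_
    rw [sub_zero, Real.norm_of_nonneg hθ.1, mul_pow]
    have := mul_le_mul_of_nonneg_left hθ.2
      (show 0 ≤ (c₂ * c₃ + c₁) * (a⁻¹ + b * (a ^ 2)⁻¹) * (M ^ N * ‖x‖ ^ N) by positivity)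
    linarith
  · obtain ⟨⟨h1, h2⟩, h3, -⟩ := h' _ (hin t)
    rw [norm_mul, Complex.norm_I, one_mul]
    simp only [norm_pow, norm_norm, pow_zero, mul_one, norm_one] at h1 h2 h3
    have hz : ‖Ψ t x‖ ^ N ≤ (M * ‖x‖) ^ N := by gcongr; exact (hx1 t).2.2
    have hi : ‖(fderiv ℂ f (Ψ t x) (Ψ t x))⁻¹‖ ≤ a⁻¹ := by
      rw [norm_inv]; exact inv_anti₀ ha (hha t)
    have hi2 : ‖(fderiv ℂ f (Ψ t x) (Ψ t x) ^ 2)⁻¹‖ ≤ (a ^ 2)⁻¹ := by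
      rw [norm_inv, norm_pow]; exact inv_anti₀ (by positivity) (by gcongr; exact hha t)
    refine (norm_add_le _ _).trans ?_
    simp only [norm_mul _ _]
    calc _ ≤ (c₂ * (M * ‖x‖) ^ N) * c₃ * a⁻¹ + b * (c₁ * (M * ‖x‖) ^ N) * (a ^ 2)⁻¹ := by
          gcongr
          · exact h2.trans (by gcongr)
          · exact hfb t
          · exact h1.trans (by gcongr)
      _ ≤ _ := by
          have p1 : 0 ≤ c₁ * a⁻¹ * (M * ‖x‖) ^ N := by positivity
          have p2 : 0 ≤ c₂ * c₃ * (b * (a ^ 2)⁻¹) * (M * ‖x‖) ^ N := by positivity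
          nlinarith [p1, p2]

end

section

variable {E : Type*} [NormedAddCommGroup E] [NormedSpace ℂ E] [CompleteSpace E] {ι : Type*}
  [Fintype ι] [DecidableEq ι]
  {R : Rotation E} {f : E → ℂ} {X : ι → E → E} {K : ι → E → E →L[ℂ] ℂ}

theorem exists_lipschitz_root (r : ℕ) : ∃ C > 0, ∃ δ > 0, ∀ z ∈ Metric.ball (1 : ℂ) δ,
    ∀ w ∈ Metric.ball (1 : ℂ) δ, ‖z ^ (1 / r : ℂ) - w ^ (1 / r : ℂ)‖ ≤ C * ‖z - w‖ := by
  have h : AnalyticAt ℂ (fun z : ℂ => z ^ (1 / r : ℂ)) 1 :=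
    analyticAt_id.cpow analyticAt_const (by simp)
  obtain ⟨C, s, hs, hL⟩ := h.hasStrictFDerivAt.exists_lipschitzOnWith
  obtain ⟨δ, hδ, hsub⟩ := Metric.mem_nhds_iff.1 hs
  refine ⟨C + 1, by positivity, δ, hδ, fun z hz w hw => ?_⟩
  have := hL.dist_le_mul z (hsub hz) w (hsub hw)
  rw [dist_eq_norm, dist_eq_norm] at this
  refine this.trans ?_
  gcongr
  simp

/-- Uniform data in a tube around the orbit. -/
theorem IsChart.exists_tube {ζ : E} {r : ℕ} {q S : ℂ × E → ℂ} (hF : IsFrame f X K)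
    (hC : IsChart f (R.orbit ζ) r q S) (j : ι) :
    ∃ ε₁ > 0, ∃ ε₂ > 0, ε₂ ≤ ε₁ ∧ ∃ C > 0,
      (∀ τ : ℂ, ‖τ‖ < ε₁ → ∀ θ W, ‖W - R.U θ ζ‖ < ε₁ →
        AnalyticAt ℂ (levelForm (K j) r q S) (τ, W) ∧
        (τ ≠ 0 → ∀ u v, fderiv ℂ (fun W => levelForm (K j) r q S (τ, W)) W u v =
          fderiv ℂ (fun W => levelForm (K j) r q S (τ, W)) W v u) ∧
        ‖fderiv ℂ (levelForm (K j) r q S) (τ, W)‖ ≤ C) ∧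
      (∀ s : ℂ, ‖s‖ < ε₂ → ∀ θ W, ‖W - R.U θ ζ‖ < ε₂ →
        f (s • W) = s ^ r * q (s, W) ∧
        fderiv ℂ f (s • W) (s • W) = s ^ r * radialFactor r q (s, W) ∧
        S (s * q (s, W) ^ (1 / r : ℂ), W) = s ∧ q (s, W) ≠ 0 ∧ ‖q (s, W)‖ ≤ 2 ∧
        1 / 2 ≤ ‖radialFactor r q (s, W)‖ ∧ ‖s * q (s, W) ^ (1 / r : ℂ)‖ < ε₁) ∧
      (∀ s : ℂ, ‖s‖ < ε₂ → ∀ θ W, ‖W - R.U θ ζ‖ < ε₂ → ∀ θ' W', ‖W' - R.U θ' ζ‖ < ε₂ →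
        ‖q (s, W) ^ (1 / r : ℂ) - q (s, W') ^ (1 / r : ℂ)‖ ≤ C * ‖q (s, W) - q (s, W')‖) := by
  have hK₀ := hC.isCompact
  have hη := fun k hk => hC.levelForm_an (hF.K_an j) (k := k) hk
  have hcomp : IsCompact (({0} : Set ℂ) ×ˢ R.orbit ζ) := isCompact_singleton.prod hK₀
  obtain ⟨C₁, hC₁, hb⟩ := eventually_norm_le_of_compact hcomp
    (F := fderiv ℂ (levelForm (K j) r q S)) (by
      rintro ⟨s, k⟩ ⟨hs, hk⟩
      obtain rfl : s = 0 := hs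
      exact (hη k hk).fderiv.continuousAt)
  have han : ∀ᶠ p in 𝓝ˢ (({0} : Set ℂ) ×ˢ R.orbit ζ), AnalyticAt ℂ (levelForm (K j) r q S) p :=
    eventually_nhdsSet_singleton_prod fun k hk => (hη k hk).eventually_analyticAt
  obtain ⟨ε₁, hε₁, h1⟩ := ((han.and ((hC.levelForm_symm hF j).and hb))).exists_tube hK₀
  obtain ⟨C₂, hC₂, δ, hδ, hL⟩ := exists_lipschitz_root r
  have hroot : ∀ᶠ p in 𝓝ˢ (({0} : Set ℂ) ×ˢ R.orbit ζ), q p ∈ Metric.ball (1 : ℂ) (min δ 1) ∧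
      1 / 2 ≤ ‖radialFactor r q p‖ ∧ ‖p.1 * q p ^ (1 / r : ℂ)‖ < ε₁ := by
    refine eventually_nhdsSet_singleton_prod fun k hk => ?_
    have hq := (hC.q_an k hk).continuousAt
    have hq1 := hC.q_one k hk
    have e1 : ∀ᶠ p in 𝓝 ((0 : ℂ), k), q p ∈ Metric.ball (1 : ℂ) (min δ 1) :=
      hq.eventually (by rw [hq1]; exact Metric.ball_mem_nhds _ (by positivity))
    have e2 : ∀ᶠ p in 𝓝 ((0 : ℂ), k), 1 / 2 < ‖radialFactor r q p‖ := by
      refine continuousAt_const.eventually_lt (hC.radialFactor_an hk).continuousAt.norm ?_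
      have : (1 : ℝ) ≤ r := by exact_mod_cast hC.one_le
      simp [radialFactor, hq1]
      linarith
    have e3 : ∀ᶠ p in 𝓝 ((0 : ℂ), k), ‖p.1 * q p ^ (1 / r : ℂ)‖ < ε₁ := by
      have : ContinuousAt (fun p : ℂ × E => p.1 * q p ^ (1 / r : ℂ)) (0, k) :=
        continuousAt_fst.mul (((hC.q_an k hk).cpow analyticAt_const
          (by rw [hq1]; simp)).continuousAt)
      exact this.norm.eventually_lt continuousAt_const (by simpa using hε₁)
    filter_upwards [e1, e2, e3] with p a b c using ⟨a, b.le, c⟩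
  obtain ⟨ε₂, hε₂, h2⟩ := ((hC.f_eq.and (hC.radial_eq hF.f_an)).and
    (hC.S_left.and hroot)).exists_tube hK₀
  refine ⟨ε₁, hε₁, min ε₁ ε₂, by positivity, min_le_left _ _, max C₁ C₂, by positivity, ?_, ?_, ?_⟩
  · intro τ hτ θ W hW
    obtain ⟨a, b, c⟩ := h1 τ hτ _ (R.mem_orbit ζ θ) W hW
    exact ⟨a, b, c.trans (le_max_left _ _)⟩
  · intro s hs θ W hW
    obtain ⟨⟨a, b⟩, c, d, e, g⟩ := h2 s (hs.trans_le (min_le_right _ _)) _ (R.mem_orbit ζ θ) W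
      (hW.trans_le (min_le_right _ _))
    have d1 : ‖q (s, W) - 1‖ < 1 := by
      have := Metric.ball_subset_ball (min_le_right _ _) d
      rwa [Metric.mem_ball, dist_eq_norm] at this
    refine ⟨a, b, c, ?_, ?_, e, g⟩
    · intro h0
      rw [h0] at d1
      simp at d1
    · have := norm_add_le (q (s, W) - 1) 1
      rw [sub_add_cancel, norm_one] at this
      linarith
  · intro s hs θ W hW θ' W' hW'
    have a := (h2 s (hs.trans_le (min_le_right _ _)) _ (R.mem_orbit ζ θ) W
      (hW.trans_le (min_le_right _ _))).2.2.1
    have b := (h2 s (hs.trans_le (min_le_right _ _)) _ (R.mem_orbit ζ θ') W'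
      (hW'.trans_le (min_le_right _ _))).2.2.1
    refine (hL _ (Metric.ball_subset_ball (min_le_left _ _) a) _
      (Metric.ball_subset_ball (min_le_left _ _) b)).trans ?_
    gcongr
    exact le_max_right _ _

end

section

variable {E : Type*} [NormedAddCommGroup E] [NormedSpace ℂ E] [CompleteSpace E] {ι : Type*}
  [Fintype ι] [DecidableEq ι]
  {R : Rotation E} {f : E → ℂ} {X : ι → E → E} {K : ι → E → E →L[ℂ] ℂ}

/-- The coefficients of an approximate symmetry are given by periods, up to a small error. -/
theorem IsChart.exists_period_estimate {ζ : E} {r : ℕ} {q S : ℂ × E → ℂ} (hF : IsFrame f X K)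
    (hC : IsChart f (R.orbit ζ) r q S) (j : ι) :
    ∃ ε > 0, ∀ N Z Ψ, IsApprox R f X N Z Ψ → ∃ ρ > 0, ∃ C > 0, ∀ s : ℂ, s ≠ 0 → ‖s‖ < ρ →
      ∀ W, ‖W - ζ‖ < ε → ‖s‖ ^ r * ‖periodFun R ζ (levelForm (K j) r q S)
        (s * q (s, W) ^ (1 / r : ℂ)) - frameCoeff f (K j) Z (s • W)‖ ≤ C * ‖s‖ ^ N := by
  obtain ⟨ε₁, hε₁, ε₂, hε₂, hε₂₁, C₁, hC₁, hT1, hT2, hT3⟩ := hC.exists_tube hF j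
  obtain ⟨M, hM1, hM⟩ := R.exists_bound
  refine ⟨ε₂ / (2 * M), by positivity, fun N Z Ψ hA => ?_⟩
  obtain ⟨ρ₁, hρ₁, horb⟩ := hA.exists_rescaled_orbit hM1 hM ζ hε₂
  obtain ⟨ρ₂, hρ₂, C₂, hC₂, hcoef⟩ := hA.frameCoeff_sub_le hF j
  obtain ⟨ρ₃, hρ₃, C₃, hC₃, h_int⟩ := hA.sub_le_of_vo hF.f_an hA.integral
  obtain ⟨ρ₄, hρ₄, C₄, hC₄, M₄, hM₄, hflow⟩ := hA.exists_flow
  have hZ1 : VO 1 Z := by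
    have := vo_one_of_differentiableAt (𝕜 := ℂ) hA.Z_an.differentiableAt
    simpa [hA.Z_zero] using this
  obtain ⟨C₅, hC₅, hZb⟩ := hZ1.exists_pos
  obtain ⟨ρ₅, hρ₅, hZ5⟩ := Metric.eventually_nhds_iff_ball.1
    (hZb.bound.and hA.Z_an.eventually_analyticAt)
  set B : ℝ := ‖ζ‖ + ε₂ / (2 * M) with hB
  have hBpos : 0 < B := by positivity
  refine ⟨min (min (min ρ₁ (ρ₂ / B)) (min (ρ₃ / B) (ρ₄ / B))) (min (min (ρ₅ / (M₄ * B)) ε₂) 1),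
    by positivity, C₁ * (C₁ * C₃ * B ^ N) * (C₅ * M₄ * B) + 10 * C₂ * B ^ N, by positivity,
    fun s hs hsρ W hW => ?_⟩
  simp only [lt_min_iff] at hsρ
  obtain ⟨⟨⟨s1, s2⟩, s3, s4⟩, ⟨s5, s6⟩, s7⟩ := hsρ
  have hs' : 0 < ‖s‖ := by positivity
  have hWB : ‖W‖ ≤ B := by
    have := norm_add_le (W - ζ) ζ
    rw [sub_add_cancel] at this
    linarith
  set x : E := s • W with hx
  have hxB : ‖x‖ ≤ ‖s‖ * B := by rw [hx, norm_smul]; gcongr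
  have hxlt : ∀ {ρ : ℝ}, ‖s‖ < ρ / B → ‖x‖ < ρ := fun h => by
    rw [lt_div_iff₀ hBpos] at h
    exact hxB.trans_lt h
  replace s2 := hxlt s2
  replace s3 := hxlt s3
  replace s4 := hxlt s4
  obtain ⟨h0, hper, hfl⟩ := hflow x s4
  have hΨB : ∀ t, ‖Ψ t x‖ ≤ M₄ * (‖s‖ * B) := fun t => (hfl t).2.2.trans (by gcongr)
  have hΨ5 : ∀ t, Ψ t x ∈ Metric.ball (0 : E) ρ₅ := fun t => by
    rw [lt_div_iff₀ (by positivity)] at s5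
    rw [mem_ball_zero_iff]
    exact (hΨB t).trans_lt (by linarith)
  -- the rescaled orbit
  set β : ℝ → E := fun t => s⁻¹ • Ψ t x with hβ
  have hβx : ∀ t, s • β t = Ψ t x := fun t => smul_inv_smul₀ hs _
  have hβ0 : β 0 = W := by
    show s⁻¹ • Ψ 0 x = W
    rw [h0, hx, inv_smul_smul₀ hs]
  have hβU : ∀ t, ‖β t - R.U t ζ‖ < ε₂ := fun t => horb s hs s1 W hW t
  have hT := fun t => hT2 s s6 t (β t) (hβU t)
  simp only [hβx] at hT
  set τ : ℝ → ℂ := fun t => s * q (s, β t) ^ (1 / r : ℂ) with hτ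
  have hτ0 : τ 0 = s * q (s, W) ^ (1 / r : ℂ) := by simp only [hτ, hβ0]
  have hτne : τ 0 ≠ 0 := by
    refine mul_ne_zero hs fun h => ?_
    rw [Complex.cpow_eq_zero_iff] at h
    exact (hT 0).2.2.2.1 h.1
  have hτlt : ∀ t, ‖τ t‖ < ε₁ := fun t => (hT t).2.2.2.2.2.2
  set η := levelForm (K j) r q S with hη
  set e := frameCoeff f (K j) Z with he
  have hsr : 0 < ‖s‖ ^ r := by positivity
  have hxN : ‖x‖ ^ N ≤ B ^ N * ‖s‖ ^ N := by
    rw [← mul_pow, mul_comm]; gcongr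
  -- velocities
  have hβd : ∀ t, HasDerivAt β (s⁻¹ • Complex.I • Z (Ψ t x)) t := fun t =>
    (hfl t).1.fun_const_smul s⁻¹
  have hβd' : ∀ t, HasDerivAt (fun t => s⁻¹ • Complex.I • Z (Ψ t x))
      (s⁻¹ • Complex.I • fderiv ℂ Z (Ψ t x) (Complex.I • Z (Ψ t x))) t := fun t => by
    have := ((hZ5 _ (hΨ5 t)).2.differentiableAt.hasFDerivAt.restrictScalars ℝ).comp_hasDerivAt t
      (hfl t).1
    exact (this.fun_const_smul Complex.I).fun_const_smul s⁻¹
  have hβv : ∀ t, ‖s⁻¹ • Complex.I • Z (Ψ t x)‖ ≤ C₅ * M₄ * B := fun t => by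
    rw [norm_smul, norm_smul, Complex.norm_I, one_mul, norm_inv, inv_mul_le_iff₀ hs']
    have := (hZ5 _ (hΨ5 t)).1
    rw [norm_pow, norm_norm, pow_one] at this
    refine this.trans ?_
    have := mul_le_mul_of_nonneg_left (hΨB t) hC₅.le
    linarith
  -- the form along the orbit
  have hform : ∀ t, η (τ t, β t) (s⁻¹ • Complex.I • Z (Ψ t x)) = Complex.I * e (Ψ t x) := by
    intro t
    obtain ⟨a1, a2, a3, a4, -, a6, -⟩ := hT t
    have a6' : radialFactor r q (s, β t) ≠ 0 := fun h => by
      rw [h, norm_zero] at a6; linarith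
    simp only [hη, levelForm, he, frameCoeff]
    rw [show S (τ t, β t) = s from a3, a1, a2, hβx]
    simp only [smul_apply, map_smul, smul_eq_mul]
    have : s ^ r ≠ 0 := pow_ne_zero _ hs
    field_simp
  -- `τ` is almost constant
  have hτd : ∀ t ∈ Set.Icc 0 (2 * Real.pi), ‖s‖ ^ r * ‖τ 0 - τ t‖ ≤ C₁ * C₃ * B ^ N * ‖s‖ ^ N := by
    intro t ht
    have b1 := hT3 s s6 0 (β 0) (hβU 0) t (β t) (hβU t)
    have b2 := h_int x s3 t ht
    have b3 : f (Ψ t x) - f x = s ^ r * (q (s, β t) - q (s, β 0)) := by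
      have := (hT 0).1
      rw [h0] at this
      rw [(hT t).1, this, mul_sub]
    rw [b3, norm_mul, norm_pow, norm_sub_rev] at b2
    calc ‖s‖ ^ r * ‖τ 0 - τ t‖
        = ‖s‖ * (‖s‖ ^ r * ‖q (s, β 0) ^ (1 / r : ℂ) - q (s, β t) ^ (1 / r : ℂ)‖) := by
          simp only [hτ]; rw [← mul_sub, norm_mul]; ring
      _ ≤ 1 * (‖s‖ ^ r * (C₁ * ‖q (s, β 0) - q (s, β t)‖)) := by gcongr
      _ = C₁ * (‖s‖ ^ r * ‖q (s, β 0) - q (s, β t)‖) := by ring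
      _ ≤ C₁ * (C₃ * (B ^ N * ‖s‖ ^ N)) :=
          mul_le_mul_of_nonneg_left (b2.trans (by gcongr)) hC₁.le
      _ = _ := by ring
  have hηL : ∀ t, ‖η (τ 0, β t) - η (τ t, β t)‖ ≤ C₁ * ‖τ 0 - τ t‖ := by
    intro t
    refine (convex_ball (0 : ℂ) ε₁).norm_image_sub_le_of_norm_hasDerivWithin_le
      (f := fun z => η (z, β t)) (f' := fun z => fderiv ℂ η (z, β t) (1, 0))
      (fun z hz => ?_) (fun z hz => ?_) (by simpa using hτlt t) (by simpa using hτlt 0)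
    · have h1 := (hT1 z (by simpa using hz) t (β t) ((hβU t).trans_le hε₂₁)).1
      have h2 : HasDerivAt (fun z : ℂ => (z, β t)) (1, 0) z :=
        (hasDerivAt_id z).prodMk (hasDerivAt_const z (β t))
      exact (h1.differentiableAt.hasFDerivAt.comp_hasDerivAt z h2).hasDerivWithinAt
    · have h1 := (hT1 z (by simpa using hz) t (β t) ((hβU t).trans_le hε₂₁)).2.2
      refine ((fderiv ℂ η (z, β t)).le_of_opNorm_le h1 _).trans (le_of_eq ?_)
      simp [Prod.norm_def]
  have hcoef' : ∀ t ∈ Set.Icc 0 (2 * Real.pi), ‖s‖ ^ r * ‖e (Ψ t x) - e x‖ ≤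
      10 * C₂ * B ^ N * ‖s‖ ^ N := by
    intro t ht
    have h1 := hcoef x s2 (‖s‖ ^ r / 2) (2 * ‖s‖ ^ r) (by positivity) (fun t => ?_) (fun t => ?_) t ht
    · have h2 : C₂ * ((‖s‖ ^ r / 2)⁻¹ + 2 * ‖s‖ ^ r * ((‖s‖ ^ r / 2) ^ 2)⁻¹) * ‖x‖ ^ N =
          (‖s‖ ^ r)⁻¹ * (10 * C₂ * ‖x‖ ^ N) := by
        field_simp
        ring
      rw [h2] at h1
      calc ‖s‖ ^ r * ‖e (Ψ t x) - e x‖ ≤ ‖s‖ ^ r * ((‖s‖ ^ r)⁻¹ * (10 * C₂ * ‖x‖ ^ N)) := by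
            gcongr
        _ = 10 * C₂ * ‖x‖ ^ N := mul_inv_cancel_left₀ hsr.ne' _
        _ ≤ 10 * C₂ * (B ^ N * ‖s‖ ^ N) := by gcongr
        _ = _ := by ring
    · rw [(hT t).2.1, norm_mul, norm_pow]
      have := mul_le_mul_of_nonneg_left (hT t).2.2.2.2.2.1 hsr.le
      linarith
    · rw [(hT t).1, norm_mul, norm_pow]
      have := mul_le_mul_of_nonneg_left (hT t).2.2.2.2.1 hsr.le
      linarith
  -- the loop integral is independent of the loop
  have hloop := loop_integral_eq_of_closed (η := fun W => η (τ 0, W)) (a := 0) (b := 2 * Real.pi)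
    (γ := fun t => R.U t ζ) (γ' := fun t => Complex.I • R.L (R.U t ζ))
    (γ'' := fun t => Complex.I • R.L (Complex.I • R.L (R.U t ζ))) (β := β)
    (β' := fun t => s⁻¹ • Complex.I • Z (Ψ t x))
    (β'' := fun t => s⁻¹ • Complex.I • fderiv ℂ Z (Ψ t x) (Complex.I • Z (Ψ t x)))
    (fun t => R.hasDerivAt_apply ζ t)
    (fun t => (((R.L.hasFDerivAt.restrictScalars ℝ).comp_hasDerivAt t
      (R.hasDerivAt_apply ζ t)).fun_const_smul Complex.I :))
    hβd hβd' (by have := R.periodic 0; rw [zero_add] at this; simp only [this])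
    (by simp only [hβ, h0, hper])
  have hseg : ∀ t ∈ Set.Icc (0 : ℝ) 1, ∀ θ,
      ‖R.U θ ζ + t • (β θ - R.U θ ζ) - R.U θ ζ‖ < ε₁ := by
    intro t ht θ
    rw [add_sub_cancel_left, norm_smul, Real.norm_of_nonneg ht.1]
    calc t * ‖β θ - R.U θ ζ‖ ≤ 1 * ‖β θ - R.U θ ζ‖ := by gcongr; exact ht.2
      _ < ε₁ := by rw [one_mul]; exact (hβU θ).trans_le hε₂₁
  have hslice : ∀ W, AnalyticAt ℂ η (τ 0, W) → AnalyticAt ℂ (fun W => η (τ 0, W)) W := fun W h =>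
    AnalyticAt.fun_comp (f := fun W => (τ 0, W)) h (analyticAt_const.prod analyticAt_id)
  replace hloop := hloop
    (fun t ht θ => (hslice _ (hT1 (τ 0) (hτlt 0) θ _ (hseg t ht θ)).1).differentiableAt)
    (fun t ht θ => (hT1 (τ 0) (hτlt 0) θ _ (hseg t ht θ)).2.1 hτne)
  have hper' : periodFun R ζ η (τ 0) - e x = (2 * Real.pi * Complex.I : ℂ)⁻¹ *
      ∫ t in (0 : ℝ)..2 * Real.pi,
        (η (τ 0, β t) (s⁻¹ • Complex.I • Z (Ψ t x)) - Complex.I * e x) := by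
    have hcont : Continuous fun t => η (τ 0, β t) (s⁻¹ • Complex.I • Z (Ψ t x)) := by
      refine continuous_iff_continuousAt.2 fun t => ContinuousAt.clm_apply ?_
        (hβd' t).continuousAt
      have h1 := (hslice _ (hT1 (τ 0) (hτlt 0) t (β t) ((hβU t).trans_le hε₂₁)).1).continuousAt
      exact ContinuousAt.comp (f := β) (g := fun W => η (τ 0, W)) h1 (hβd t).continuousAt
    rw [intervalIntegral.integral_sub (hcont.intervalIntegrable _ _) (by simp),
      ← hloop, intervalIntegral.integral_const]
    simp only [map_smul, smul_eq_mul, intervalIntegral.integral_const_mul, periodFun]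
    have hpi : (Real.pi : ℂ) ≠ 0 := by exact_mod_cast Real.pi_ne_zero
    have hI := Complex.I_ne_zero
    simp only [sub_zero, Complex.real_smul]
    push_cast
    field_simp
  rw [← hτ0, hper', norm_mul, norm_inv]
  have hn : ‖(2 * Real.pi * Complex.I : ℂ)‖ = 2 * Real.pi := by
    simp [abs_of_pos Real.pi_pos]
  rw [hn]
  have hfin := intervalIntegral.norm_integral_le_of_norm_le_const (a := 0) (b := 2 * Real.pi)
    (C := (‖s‖ ^ r)⁻¹ * ((C₁ * (C₁ * C₃ * B ^ N) * (C₅ * M₄ * B) + 10 * C₂ * B ^ N) * ‖s‖ ^ N))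
    (f := fun t => η (τ 0, β t) (s⁻¹ • Complex.I • Z (Ψ t x)) - Complex.I * e x) (fun t ht => ?_)
  · rw [sub_zero, abs_of_pos (by positivity)] at hfin
    refine (mul_le_mul_of_nonneg_left (mul_le_mul_of_nonneg_left hfin
      (by positivity : (0 : ℝ) ≤ (2 * Real.pi)⁻¹)) hsr.le).trans (le_of_eq ?_)
    field_simp
  · rw [Set.uIoc_of_le (by positivity)] at ht
    have ht' : t ∈ Set.Icc 0 (2 * Real.pi) := ⟨ht.1.le, ht.2⟩
    rw [← div_eq_inv_mul, le_div_iff₀ hsr, mul_comm]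
    have split : η (τ 0, β t) (s⁻¹ • Complex.I • Z (Ψ t x)) - Complex.I * e x =
        (η (τ 0, β t) - η (τ t, β t)) (s⁻¹ • Complex.I • Z (Ψ t x)) +
          Complex.I * (e (Ψ t x) - e x) := by
      rw [sub_apply, hform t]; ring
    rw [split]
    calc ‖s‖ ^ r * _ ≤ ‖s‖ ^ r * (‖η (τ 0, β t) - η (τ t, β t)‖ * (C₅ * M₄ * B) +
          ‖e (Ψ t x) - e x‖) := by
          gcongr
          refine (norm_add_le _ _).trans (add_le_add ?_ ?_)
          · refine (ContinuousLinearMap.le_opNorm _ _).trans ?_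
            gcongr
            exact hβv t
          · rw [norm_mul, Complex.norm_I, one_mul]
      _ ≤ ‖s‖ ^ r * ((C₁ * ‖τ 0 - τ t‖) * (C₅ * M₄ * B) + ‖e (Ψ t x) - e x‖) := by
          gcongr
          exact hηL t
      _ = C₁ * (‖s‖ ^ r * ‖τ 0 - τ t‖) * (C₅ * M₄ * B) + ‖s‖ ^ r * ‖e (Ψ t x) - e x‖ := by ring
      _ ≤ C₁ * (C₁ * C₃ * B ^ N * ‖s‖ ^ N) * (C₅ * M₄ * B) + 10 * C₂ * B ^ N * ‖s‖ ^ N := by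
          exact add_le_add (mul_le_mul_of_nonneg_right (mul_le_mul_of_nonneg_left (hτd t ht')
            hC₁.le) (by positivity)) (hcoef' t ht')
      _ = _ := by ring

end

section

variable {E : Type*} [NormedAddCommGroup E] [NormedSpace ℂ E] [CompleteSpace E] {ι : Type*}
  [Fintype ι] [DecidableEq ι]
  {R : Rotation E} {f : E → ℂ} {X : ι → E → E} {K : ι → E → E →L[ℂ] ℂ}

/-- Periods provide a common analytic approximation, in blow-up coordinates, of all approximate
symmetries. -/
theorem IsChart.exists_symmetry_estimate {ζ : E} {r : ℕ} {q S : ℂ × E → ℂ} (hF : IsFrame f X K)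
    (hC : IsChart f (R.orbit ζ) r q S) :
    ∃ F : ℂ × E → E, ∃ ε > 0, (∀ s : ℂ, s ≠ 0 → ‖s‖ < ε → ∀ W, ‖W - ζ‖ < ε →
      AnalyticAt ℂ F (s, W)) ∧
      ∀ N Z Ψ, IsApprox R f X N Z Ψ → ∃ ρ > 0, ∃ C > 0, ∀ s : ℂ, s ≠ 0 → ‖s‖ < ρ →
        ∀ W, ‖W - ζ‖ < ε → ‖s‖ ^ (2 * r) * ‖F (s, W) - Z (s • W)‖ ≤ C * ‖s‖ ^ N := by
  choose ε₁ hε₁ hest using fun j => hC.exists_period_estimate hF j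
  have hζ := R.self_mem_orbit ζ
  have hsm : ContinuousAt (fun p : ℂ × E => p.1 • p.2) (0, ζ) := by fun_prop
  have hsm0 : ∀ {P : E → Prop}, (∀ᶠ x in 𝓝 0, P x) → ∀ᶠ p : ℂ × E in 𝓝 (0, ζ), P (p.1 • p.2) :=
    fun h => hsm.eventually (by simpa using h)
  have hXb : ∃ M > 0, ∀ᶠ x in 𝓝 0, ∀ j, ‖X j x‖ ≤ M := by
    choose M hM hMb using fun j =>
      (vo_zero_of_continuousAt (hF.X_an j).continuousAt).exists_pos
    refine ⟨1 + ∑ j, M j, by have := Finset.sum_nonneg fun j (_ : j ∈ Finset.univ) => (hM j).le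
                             linarith, ?_⟩
    filter_upwards [eventually_all.2 fun j => (hMb j).bound] with x hx j
    have h1 := hx j
    rw [pow_zero, norm_one, mul_one] at h1
    have := Finset.single_le_sum (fun j _ => (hM j).le) (Finset.mem_univ j)
    linarith
  obtain ⟨M, hM, hXM⟩ := hXb
  set c : ℝ := ‖radialFactor r q (0, ζ)‖ / 2 with hc
  have hcpos : 0 < c := by
    have := norm_pos_iff.2 (hC.radialFactor_ne hζ)
    positivity
  have hq2 : ∀ᶠ p in 𝓝 ((0 : ℂ), ζ), 1 / 2 < ‖q p‖ :=
    (hC.q_an _ hζ).continuousAt.norm.eventually (lt_mem_nhds (by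
      show 1 / 2 < ‖q (0, ζ)‖
      rw [hC.q_one _ hζ]; norm_num))
  have hr2 : ∀ᶠ p in 𝓝 ((0 : ℂ), ζ), c < ‖radialFactor r q p‖ :=
    (hC.radialFactor_an hζ).continuousAt.norm.eventually (lt_mem_nhds (by linarith))
  have hP : ∀ j, AnalyticAt ℂ (periodFun R ζ (levelForm (K j) r q S)) 0 := fun j =>
    periodFun_an fun k hk => hC.levelForm_an (hF.K_an j) hk
  have hσ : AnalyticAt ℂ (fun p : ℂ × E => p.1 * q p ^ (1 / r : ℂ)) (0, ζ) :=
    analyticAt_fst.mul ((hC.q_an _ hζ).cpow analyticAt_const (by rw [hC.q_one _ hζ]; simp))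
  have hPσ : ∀ j, AnalyticAt ℂ (fun p : ℂ × E =>
      periodFun R ζ (levelForm (K j) r q S) (p.1 * q p ^ (1 / r : ℂ))) (0, ζ) := fun j =>
    AnalyticAt.fun_comp (by simpa using hP j) hσ
  obtain ⟨ε₀, hε₀, hε⟩ := Metric.eventually_nhds_iff_ball.1
    ((hq2.and hr2).and (((hC.f_eq.at_point hζ).and ((hC.radial_eq hF.f_an).at_point hζ)).and
      ((eventually_all.2 fun j => (hPσ j).eventually_analyticAt).and
      (((hsm0 hF.f_an.eventually_analyticAt).and (hsm0 (eventually_all.2 fun j =>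
        (hF.X_an j).eventually_analyticAt))).and ((hsm0 hF.expand).and (hsm0 hXM))))))
  obtain ⟨ε₂, hε₂, hε₂j⟩ : ∃ ε₂ > 0, ∀ j, ε₂ ≤ ε₁ j := by
    have : ∀ᶠ e in 𝓝[>] (0 : ℝ), ∀ j, e ≤ ε₁ j := eventually_all.2 fun j =>
      eventually_nhdsWithin_of_eventually_nhds (eventually_le_nhds (hε₁ j))
    obtain ⟨e, he, hp⟩ := (this.and self_mem_nhdsWithin).exists
    exact ⟨e, hp, he⟩
  set ε := min (min ε₀ ε₂) 1 with hεd
  have hmem : ∀ s : ℂ, ‖s‖ < ε → ∀ W, ‖W - ζ‖ < ε → (s, W) ∈ Metric.ball ((0 : ℂ), ζ) ε₀ := by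
    intro s hs W hW
    have : ε ≤ ε₀ := (min_le_left _ _).trans (min_le_left _ _)
    rw [mem_ball_iff_norm, Prod.norm_def]
    simp only [Prod.fst_sub, Prod.snd_sub, sub_zero]
    exact max_lt (hs.trans_le this) (hW.trans_le this)
  refine ⟨fun p => ∑ j, (periodFun R ζ (levelForm (K j) r q S) (p.1 * q p ^ (1 / r : ℂ)) *
    (f (p.1 • p.2))⁻¹) • X j (p.1 • p.2), ε, by positivity, fun s hs hsε W hW => ?_,
    fun N Z Ψ hA => ?_⟩
  · obtain ⟨⟨h1, h2⟩, ⟨h3, h4⟩, h5, ⟨h6, h7⟩, -⟩ := hε _ (hmem s hsε W hW)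
    have hsm' : AnalyticAt ℂ (fun p : ℂ × E => p.1 • p.2) (s, W) :=
      analyticAt_fst.smul analyticAt_snd
    refine Finset.analyticAt_fun_sum _ fun j _ => ?_
    refine ((h5 j).mul (AnalyticAt.inv (AnalyticAt.fun_comp h6 hsm') ?_)).smul
      (AnalyticAt.fun_comp (h7 j) hsm')
    rw [h3]
    exact mul_ne_zero (pow_ne_zero _ hs) (norm_pos_iff.1 (by linarith))
  · choose ρ hρ C hCp hj using fun j => hest j N Z Ψ hA
    obtain ⟨ρ₁, hρ₁, hρ₁j⟩ : ∃ ρ₁ > 0, ∀ j, ρ₁ ≤ ρ j := by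
      have : ∀ᶠ e in 𝓝[>] (0 : ℝ), ∀ j, e ≤ ρ j := eventually_all.2 fun j =>
        eventually_nhdsWithin_of_eventually_nhds (eventually_le_nhds (hρ j))
      obtain ⟨e, he, hp⟩ := (this.and self_mem_nhdsWithin).exists
      exact ⟨e, hp, he⟩
    obtain ⟨c₂, hc₂, hb₂⟩ := hA.integral.exists_pos
    obtain ⟨ρ₂, hρ₂, hZ⟩ := Metric.eventually_nhds_iff_ball.1 hb₂.bound
    set B : ℝ := ‖ζ‖ + 1 with hB
    have hBpos : 0 < B := by positivity
    have hsum : 0 ≤ ∑ j, C j * 2 * M := Finset.sum_nonneg fun j _ => by have := hCp j; positivity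
    refine ⟨min (min ρ₁ (ρ₂ / B)) ε, by positivity, ∑ j, C j * 2 * M + c₂ * B ^ N * c⁻¹ * B,
      by positivity, fun s hs hsρ W hW => ?_⟩
    simp only [lt_min_iff] at hsρ
    obtain ⟨⟨s1, s2⟩, s3⟩ := hsρ
    obtain ⟨⟨h1, h2⟩, ⟨h3, h4⟩, h5, ⟨h6, h7⟩, h8, h9⟩ :=
      hε _ (hmem s s3 W hW)
    have hs' : 0 < ‖s‖ := by positivity
    have hsr : 0 < ‖s‖ ^ r := by positivity
    have s4 : ‖s‖ ≤ 1 := (s3.trans_le (min_le_right _ _)).le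
    have hW1 : ‖W‖ ≤ B := by
      have := norm_add_le (W - ζ) ζ
      rw [sub_add_cancel] at this
      have : ε ≤ 1 := min_le_right _ _
      linarith
    set x : E := s • W with hx
    have hxB : ‖x‖ ≤ ‖s‖ * B := by rw [hx, norm_smul]; gcongr
    have hx2 : ‖x‖ < ρ₂ := by
      rw [lt_div_iff₀ hBpos] at s2
      exact hxB.trans_lt s2
    have hZx := hZ x (by simpa using hx2)
    simp only [] at h3 h4 h8 h9
    have hf0 : f x ≠ 0 := by
      rw [h3]; exact mul_ne_zero (pow_ne_zero _ hs) (norm_pos_iff.1 (by linarith))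
    have hr0 : radialFactor r q (s, W) ≠ 0 := norm_pos_iff.1 (by linarith)
    have hh0 : fderiv ℂ f x x ≠ 0 := by rw [h4]; exact mul_ne_zero (pow_ne_zero _ hs) hr0
    have hfinv : ‖s‖ ^ r * ‖(f x)⁻¹‖ ≤ 2 := by
      rw [h3, mul_inv, norm_mul, norm_inv, norm_pow, mul_inv_cancel_left₀ hsr.ne', norm_inv]
      exact inv_le_of_inv_le₀ (by norm_num) (by linarith)
    have hhinv : ‖s‖ ^ r * ‖(fderiv ℂ f x x)⁻¹‖ ≤ c⁻¹ := by
      rw [h4, mul_inv, norm_mul, norm_inv, norm_pow, mul_inv_cancel_left₀ hsr.ne', norm_inv]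
      exact inv_anti₀ hcpos h2.le
    have key : ∑ j, (periodFun R ζ (levelForm (K j) r q S) (s * q (s, W) ^ (1 / r : ℂ)) *
        (f x)⁻¹) • X j x - Z x = ∑ j, ((periodFun R ζ (levelForm (K j) r q S)
          (s * q (s, W) ^ (1 / r : ℂ)) - frameCoeff f (K j) Z x) * (f x)⁻¹) • X j x -
        ((fderiv ℂ f x x)⁻¹ * fderiv ℂ f x (Z x)) • x := by
      have h10 : Z x = ((fderiv ℂ f x x)⁻¹ * fderiv ℂ f x (Z x)) • x +
          ∑ j, (frameCoeff f (K j) Z x * (f x)⁻¹) • X j x := by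
        have := congrArg (fun v => (fderiv ℂ f x x)⁻¹ • v) (h8 (Z x))
        simp only [inv_smul_smul₀ hh0, smul_add, Finset.smul_sum, smul_smul] at this
        refine this.trans ?_
        congr 1
        refine Finset.sum_congr rfl fun j _ => ?_
        congr 1
        simp only [frameCoeff]
        field_simp
      simp only [sub_mul, sub_smul, Finset.sum_sub_distrib]
      conv_lhs => rw [h10]
      abel
    rw [key]
    have e1 : ∀ j, ‖s‖ ^ (2 * r) * ‖((periodFun R ζ (levelForm (K j) r q S)
          (s * q (s, W) ^ (1 / r : ℂ)) - frameCoeff f (K j) Z x) * (f x)⁻¹) • X j x‖ ≤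
          C j * 2 * M * ‖s‖ ^ N := by
      intro j
      have b1 := hj j s hs (s1.trans_le (hρ₁j j)) W (hW.trans_le
        (((min_le_left _ _).trans (min_le_right _ _)).trans (hε₂j j)))
      rw [norm_smul, norm_mul]
      have hCj := hCp j
      calc _ = (‖s‖ ^ r * ‖periodFun R ζ (levelForm (K j) r q S)
          (s * q (s, W) ^ (1 / r : ℂ)) - frameCoeff f (K j) Z x‖) * (‖s‖ ^ r * ‖(f x)⁻¹‖) *
            ‖X j x‖ := by rw [two_mul, pow_add]; ring
        _ ≤ (C j * ‖s‖ ^ N) * 2 * M :=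
          mul_le_mul (mul_le_mul b1 hfinv (by positivity) (by positivity)) (h9 j)
            (by positivity) (by positivity)
        _ = _ := by ring
    have e2 : ‖s‖ ^ (2 * r) * ‖((fderiv ℂ f x x)⁻¹ * fderiv ℂ f x (Z x)) • x‖ ≤
        c₂ * B ^ N * c⁻¹ * B * ‖s‖ ^ N := by
      rw [norm_smul, norm_mul]
      rw [norm_pow, norm_norm] at hZx
      have hsr1 : ‖s‖ ^ r ≤ 1 := pow_le_one₀ hs'.le s4
      calc _ = (‖s‖ ^ r * ‖(fderiv ℂ f x x)⁻¹‖) * ‖fderiv ℂ f x (Z x)‖ * (‖s‖ ^ r * ‖x‖) := by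
            rw [two_mul, pow_add]; ring
        _ ≤ c⁻¹ * (c₂ * (‖s‖ * B) ^ N) * (1 * (1 * B)) := by
          have : ‖fderiv ℂ f x (Z x)‖ ≤ c₂ * (‖s‖ * B) ^ N := hZx.trans (by gcongr)
          have h4 : ‖s‖ ^ r * ‖x‖ ≤ 1 * (1 * B) := by
            refine mul_le_mul hsr1 (hxB.trans (by gcongr)) (by positivity) (by positivity)
          exact mul_le_mul (mul_le_mul hhinv this (by positivity) (by positivity)) h4
            (by positivity) (by positivity)
        _ = _ := by rw [mul_pow]; ring
    calc ‖s‖ ^ (2 * r) * _ ≤ ‖s‖ ^ (2 * r) * (∑ j, ‖((periodFun R ζ (levelForm (K j) r q S)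
          (s * q (s, W) ^ (1 / r : ℂ)) - frameCoeff f (K j) Z x) * (f x)⁻¹) • X j x‖ +
          ‖((fderiv ℂ f x x)⁻¹ * fderiv ℂ f x (Z x)) • x‖) :=
          mul_le_mul_of_nonneg_left ((norm_sub_le _ _).trans
            (add_le_add_left (norm_sum_le _ _) _)) (by positivity)
      _ ≤ ∑ j, C j * 2 * M * ‖s‖ ^ N + c₂ * B ^ N * c⁻¹ * B * ‖s‖ ^ N := by
          rw [mul_add, Finset.mul_sum]
          exact add_le_add (Finset.sum_le_sum fun j _ => e1 j) e2
      _ = _ := by rw [add_mul, Finset.sum_mul]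

end

/-- A function which is analytic in the blow-up coordinates `x = s • W`, `s ≠ 0`, determines an
analytic function near `0` which has the same asymptotic expansions. -/
theorem exists_analyticAt_of_blowup {E G : Type*} [NormedAddCommGroup E] [NormedSpace ℂ E]
    [NormedAddCommGroup G] [NormedSpace ℂ G] [CompleteSpace G] {F : ℂ × E → G} {ζ : E} {ε : ℝ}
    (hε : 0 < ε)
    (hF : ∀ s : ℂ, s ≠ 0 → ‖s‖ < ε → ∀ W, ‖W - ζ‖ < ε → AnalyticAt ℂ F (s, W)) :
    ∃ Z₀ : E → G, AnalyticAt ℂ Z₀ 0 ∧ ∀ N Z, AnalyticAt ℂ Z 0 →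
      (∃ ρ > 0, ∃ C > 0, ∀ s : ℂ, s ≠ 0 → ‖s‖ < ρ → ∀ W, ‖W - ζ‖ < ε →
        ‖F (s, W) - Z (s • W)‖ ≤ C * ‖s‖ ^ N) → VO N fun x => Z x - Z₀ x := by
  set δ := ε / 2 with hδ
  have hδ0 : 0 < δ := by positivity
  set H : ℂ × E → G := fun p => F (p.1, ζ + p.1⁻¹ • p.2) with hH
  have hHan : ∀ s : ℂ, s ≠ 0 → ‖s‖ < ε → ∀ v, ‖s⁻¹ • v‖ < ε → AnalyticAt ℂ H (s, v) := by
    intro s hs hsε v hv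
    refine AnalyticAt.fun_comp (f := fun p : ℂ × E => (p.1, ζ + p.1⁻¹ • p.2))
      (hF s hs hsε _ (by simpa using hv)) ?_
    exact analyticAt_fst.prod (analyticAt_const.add ((analyticAt_fst.inv hs).smul analyticAt_snd))
  set Z₀ : E → G := fun v => Real.circleAverage (fun s => H (s, v)) 0 δ with hZ₀
  refine ⟨Z₀, ?_, fun N Z hZ ⟨ρ, hρ, C, hC, hest⟩ => ?_⟩
  · simp only [hZ₀, Real.circleAverage_def]
    have h1 : AnalyticAt ℂ (fun v => ∫ t in (0 : ℝ)..2 * Real.pi, H (circleMap 0 δ t, v)) 0 := by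
      refine analyticAt_intervalIntegral_of_analyticAt (F := H) (γ := circleMap 0 δ)
        (by positivity) (continuous_circleMap 0 δ) fun t _ => ?_
      refine hHan _ (circleMap_ne_center hδ0.ne') ?_ _ (by simpa using hε)
      rw [norm_circleMap_zero, abs_of_pos hδ0]; linarith
    refine ((analyticAt_const (v := ((2 * Real.pi)⁻¹ : ℂ))).smul h1).congr
      (Eventually.of_forall fun v => ?_)
    simp only [Pi.smul_apply']
    rw [← Complex.coe_smul]
    push_cast
    rfl
  · obtain ⟨ρ', hρ', hZan⟩ := Metric.eventually_nhds_iff_ball.1 hZ.eventually_analyticAt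
    set κ := ρ' / (2 * (‖ζ‖ + ε)) with hκ
    have hκ0 : 0 < κ := by positivity
    set δ₀ := min (min κ δ) (ρ / 2) with hδ₀
    have hδ₀0 : 0 < δ₀ := by positivity
    -- comparison on a small circle
    have main : ∀ v d, 0 < d → d < δ₀ → 2 * ‖v‖ / ε < d → ‖Z v - Z₀ v‖ ≤ C * d ^ N := by
      intro v d hd hdδ hv
      simp only [hδ₀, lt_min_iff] at hdδ
      obtain ⟨⟨d1, d2⟩, d3⟩ := hdδ
      have hv' : ‖v‖ < d * ε / 2 := by rw [div_lt_iff₀ hε] at hv; linarith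
      have hs : ∀ s : ℂ, d ≤ ‖s‖ → ‖s⁻¹ • v‖ < ε / 2 := by
        intro s hs
        rw [norm_smul, norm_inv, inv_mul_lt_iff₀ (hd.trans_le hs)]
        nlinarith
      have e1 : Z₀ v = Real.circleAverage (fun s => H (s, v)) 0 d := by
        simp only [hZ₀]
        rw [Real.circleAverage_eq_circleIntegral hδ0.ne', Real.circleAverage_eq_circleIntegral hd.ne']
        congr 1
        have hdiff : ∀ z ∈ Metric.closedBall (0 : ℂ) δ \ Metric.ball 0 d,
            DifferentiableAt ℂ (fun s => H (s, v)) z := by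
          intro z hz
          simp only [Set.mem_sdiff, mem_closedBall_zero_iff, mem_ball_zero_iff, not_lt] at hz
          have hz0 : z ≠ 0 := norm_pos_iff.1 (hd.trans_le hz.2)
          have := hHan z hz0 (by linarith [hz.1]) v ((hs z hz.2).trans (by linarith))
          exact (AnalyticAt.fun_comp (f := fun s => (s, v)) this
            (analyticAt_id.prod analyticAt_const)).differentiableAt
        refine Complex.circleIntegral_sub_center_inv_smul_eq_of_differentiable_on_annulus_off_countable
          hd d2.le Set.countable_empty
          (fun z hz => (hdiff z hz).continuousAt.continuousWithinAt) fun z hz => hdiff z ?_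
        simp only [Set.mem_sdiff, mem_closedBall_zero_iff, mem_ball_zero_iff, not_lt, not_le] at hz ⊢
        exact ⟨hz.1.1.le, hz.1.2.le⟩
      have hin : ∀ s : ℂ, ‖s‖ ≤ d → AnalyticAt ℂ (fun s => Z (s • ζ + v)) s := by
        intro s hs
        refine AnalyticAt.fun_comp (hZan _ ?_) ((analyticAt_id.smul analyticAt_const).add
          analyticAt_const)
        rw [mem_ball_zero_iff]
        have : ‖s • ζ + v‖ ≤ d * (‖ζ‖ + ε) := by
          refine (norm_add_le _ _).trans ?_
          rw [norm_smul]
          have := mul_le_mul_of_nonneg_right hs (norm_nonneg ζ)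
          nlinarith
        refine this.trans_lt ?_
        rw [hκ, lt_div_iff₀ (by positivity)] at d1
        nlinarith
      have e2 : Z v = Real.circleAverage (fun s => Z (s • ζ + v)) 0 d := by
        have := circleAverage_of_differentiable_on_off_countable (c := 0) (R := d)
          (f := fun s : ℂ => Z (s • ζ + v)) Set.countable_empty ?_ ?_
        · rw [this]; simp
        · intro z hz
          rw [abs_of_pos hd] at hz
          exact (hin z (by simpa using hz)).continuousAt.continuousWithinAt
        · intro z hz
          rw [abs_of_pos hd] at hz
          exact (hin z (by simpa using (Metric.ball_subset_closedBall hz.1))).differentiableAt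
      have c1 : ∀ t : ℝ, AnalyticAt ℂ (fun s => Z (s • ζ + v)) (circleMap 0 d t) := fun t =>
        hin _ (by rw [norm_circleMap_zero, abs_of_pos hd])
      have c2 : ∀ t : ℝ, AnalyticAt ℂ (fun s => H (s, v)) (circleMap 0 d t) := by
        intro t
        have hn : ‖circleMap 0 d t‖ = d := by rw [norm_circleMap_zero, abs_of_pos hd]
        have := hHan _ (circleMap_ne_center hd.ne') (by rw [hn]; linarith) v
          ((hs _ hn.ge).trans (by linarith))
        exact AnalyticAt.fun_comp (f := fun s => (s, v)) this (analyticAt_id.prod analyticAt_const)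
      have i1 : Continuous fun t => Z (circleMap 0 d t • ζ + v) := continuous_iff_continuousAt.2
        fun t => ContinuousAt.comp (f := circleMap 0 d) (g := fun s => Z (s • ζ + v))
          (c1 t).continuousAt (continuous_circleMap 0 d).continuousAt
      have i2 : Continuous fun t => H (circleMap 0 d t, v) := continuous_iff_continuousAt.2
        fun t => ContinuousAt.comp (f := circleMap 0 d) (g := fun s => H (s, v))
          (c2 t).continuousAt (continuous_circleMap 0 d).continuousAt
      rw [e1, e2, Real.circleAverage_def, Real.circleAverage_def, ← smul_sub,
        ← intervalIntegral.integral_sub (i1.intervalIntegrable _ _) (i2.intervalIntegrable _ _)]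
      have hb := intervalIntegral.norm_integral_le_of_norm_le_const (a := 0) (b := 2 * Real.pi)
        (C := C * d ^ N) (f := fun t => Z (circleMap 0 d t • ζ + v) - H (circleMap 0 d t, v))
        fun t _ => ?_
      · rw [norm_smul, Real.norm_of_nonneg (by positivity)]
        rw [sub_zero, abs_of_pos (by positivity)] at hb
        rw [inv_mul_le_iff₀ (by positivity)]
        linarith
      · have hn : ‖circleMap 0 d t‖ = d := by rw [norm_circleMap_zero, abs_of_pos hd]
        have hne : circleMap 0 d t ≠ 0 := circleMap_ne_center hd.ne'
        have := hest _ hne (by rw [hn]; linarith) (ζ + (circleMap 0 d t)⁻¹ • v)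
          (by rw [add_sub_cancel_left]; exact (hs _ hn.ge).trans (by linarith))
        rw [smul_add, smul_inv_smul₀ hne, hn, norm_sub_rev] at this
        exact this
    have hlim : ∀ v, 2 * ‖v‖ / ε < δ₀ → ‖Z v - Z₀ v‖ ≤ C * (2 * ‖v‖ / ε) ^ N := by
      intro v hv
      have h1 : Tendsto (fun d : ℝ => C * d ^ N) (𝓝[>] (2 * ‖v‖ / ε))
          (𝓝 (C * (2 * ‖v‖ / ε) ^ N)) :=
        ((continuous_const.mul (continuous_id.pow N)).tendsto _).mono_left nhdsWithin_le_nhds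
      refine ge_of_tendsto h1 ?_
      filter_upwards [self_mem_nhdsWithin, nhdsWithin_le_nhds (eventually_lt_nhds hv)] with d hd1 hd2
      exact main v d (lt_of_le_of_lt (by positivity) hd1) hd2 hd1
    refine IsBigO.of_bound (C * (2 / ε) ^ N) ?_
    have h2 : ∀ᶠ v : E in 𝓝 0, 2 * ‖v‖ / ε < δ₀ := by
      have : ContinuousAt (fun v : E => 2 * ‖v‖ / ε) 0 := by fun_prop
      exact this.eventually (gt_mem_nhds (by simpa using hδ₀0))
    filter_upwards [h2] with v hv
    refine (hlim v hv).trans (le_of_eq ?_)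
    rw [norm_pow, norm_norm, mul_div_right_comm, mul_pow]
    ring

/-- If a frame has approximate symmetries of all orders, then these are the Taylor polynomials
of an analytic vector field. -/
theorem IsFrame.exists_symmetry {E : Type*} [NormedAddCommGroup E] [NormedSpace ℂ E]
    [CompleteSpace E] {ι : Type*} [Fintype ι] [DecidableEq ι] {R : Rotation E} {f : E → ℂ}
    {X : ι → E → E} {K : ι → E → E →L[ℂ] ℂ} (hF : IsFrame f X K)
    (happ : ∀ N, ∃ Z Ψ, IsApprox R f X N Z Ψ) :
    ∃ Z₀ : E → E, AnalyticAt ℂ Z₀ 0 ∧ ∃ c, ∀ N Z Ψ, IsApprox R f X (N + c) Z Ψ →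
      VO N fun x => Z x - Z₀ x := by
  obtain ⟨r, ζ, q, hr, hq, hq1, hfq⟩ := exists_normalized_quotient hF.f_an hF.f_zero hF.f_ne happ
  obtain ⟨S, hS, hS0, hSl, hSr⟩ := exists_radial_chart (R.isCompact_orbit ζ) hr hq hq1
  obtain ⟨F, ε, hε, hFan, hest⟩ := IsChart.exists_symmetry_estimate hF
    ⟨R.isCompact_orbit ζ, hr, hq, hq1, hfq, hS, hS0, hSl, hSr⟩
  obtain ⟨Z₀, hZ₀, hvo⟩ := exists_analyticAt_of_blowup hε hFan
  refine ⟨Z₀, hZ₀, 2 * r, fun N Z Ψ hA => hvo N Z hA.Z_an ?_⟩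
  obtain ⟨ρ, hρ, C, hC, h⟩ := hest _ Z Ψ hA
  refine ⟨ρ, hρ, C, hC, fun s hs hsρ W hW => ?_⟩
  have := h s hs hsρ W hW
  rw [pow_add, ← mul_assoc, mul_comm] at this
  exact le_of_mul_le_mul_right this (by positivity)

section Jets

variable {E : Type*} [NormedAddCommGroup E] [NormedSpace ℂ E]

/-- The derivative of a function along a vector field. -/
noncomputable def lieD {F : Type*} [NormedAddCommGroup F] [NormedSpace ℂ F] (V : E → E) (u : E → F)
    (x : E) : F := fderiv ℂ u x (V x)

theorem AnalyticAt.lieD [CompleteSpace E] {F : Type*} [NormedAddCommGroup F] [NormedSpace ℂ F]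
    [CompleteSpace F] {V : E → E} {u : E → F} {x : E}
    (hV : AnalyticAt ℂ V x) (hu : AnalyticAt ℂ u x) : AnalyticAt ℂ (lieD V u) x :=
  hu.fderiv.clm_apply_of hV

theorem Filter.EventuallyEq.lieD {F : Type*} [NormedAddCommGroup F] [NormedSpace ℂ F] {V : E → E}
    {u v : E → F} {x : E} (h : u =ᶠ[𝓝 x] v) : lieD V u =ᶠ[𝓝 x] lieD V v :=
  (h.fderiv (𝕜 := ℂ)).mono fun y hy => by simp only [_root_.lieD, hy]

theorem lieD_add {F : Type*} [NormedAddCommGroup F] [NormedSpace ℂ F] [CompleteSpace F] {V : E → E}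
    {u v : E → F} {x : E} (hu : AnalyticAt ℂ u x) (hv : AnalyticAt ℂ v x) :
    lieD V (u + v) =ᶠ[𝓝 x] lieD V u + lieD V v := by
  filter_upwards [hu.eventually_analyticAt, hv.eventually_analyticAt] with y h1 h2
  simp only [lieD, Pi.add_apply, fderiv_add h1.differentiableAt h2.differentiableAt, add_apply]

theorem lieD_smul {F : Type*} [NormedAddCommGroup F] [NormedSpace ℂ F] [CompleteSpace F] {V : E → E}
    {u : E → F} {x : E} (hu : AnalyticAt ℂ u x) (c : ℂ) :
    lieD V (c • u) =ᶠ[𝓝 x] c • lieD V u := by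
  filter_upwards [hu.eventually_analyticAt] with y h1
  simp only [lieD, Pi.smul_apply, fderiv_const_smul h1.differentiableAt, smul_apply]

theorem lieD_mul {V : E → E} {u v : E → ℂ} {x : E} (hu : AnalyticAt ℂ u x)
    (hv : AnalyticAt ℂ v x) : lieD V (u * v) =ᶠ[𝓝 x] lieD V u * v + u * lieD V v := by
  filter_upwards [hu.eventually_analyticAt, hv.eventually_analyticAt] with y h1 h2
  simp only [lieD, Pi.add_apply, Pi.mul_apply, fderiv_mul h1.differentiableAt h2.differentiableAt,
    add_apply, smul_apply, smul_eq_mul]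
  ring

theorem lieD_comm [CompleteSpace E] {F : Type*} [NormedAddCommGroup F] [NormedSpace ℂ F]
    [CompleteSpace F] {V W : E → E} {u : E → F} {x : E} (hV : AnalyticAt ℂ V x)
    (hW : AnalyticAt ℂ W x) (hu : AnalyticAt ℂ u x) :
    ∀ᶠ y in 𝓝 x, lieD V (lieD W u) y - lieD W (lieD V u) y =
      fderiv ℂ u y (fderiv ℂ W y (V y) - fderiv ℂ V y (W y)) := by
  filter_upwards [hV.eventually_analyticAt, hW.eventually_analyticAt,
    hu.eventually_analyticAt] with y h1 h2 h3
  have e1 := (h3.fderiv.differentiableAt.hasFDerivAt.clm_apply h2.differentiableAt.hasFDerivAt).fderiv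
  have e2 := (h3.fderiv.differentiableAt.hasFDerivAt.clm_apply h1.differentiableAt.hasFDerivAt).fderiv
  have hs := (h3.contDiffAt (n := ω)).isSymmSndFDerivAt (by simp)
  simp only [lieD] at e1 e2 ⊢
  change (fderiv ℂ (fun y => fderiv ℂ u y (W y)) y) (V y) -
    (fderiv ℂ (fun y => fderiv ℂ u y (V y)) y) (W y) = _
  rw [e1, e2]
  simp only [add_apply, ContinuousLinearMap.comp_apply, ContinuousLinearMap.flip_apply, map_sub]
  rw [hs.eq (V y) (W y)]
  abel

variable (E) in
/-- The algebra of functions which are analytic at `0`. -/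
def analyticFunctions : Subalgebra ℂ (E → ℂ) where
  carrier := {u | AnalyticAt ℂ u 0}
  mul_mem' h1 h2 := h1.mul h2
  add_mem' h1 h2 := h1.add h2
  algebraMap_mem' _ := analyticAt_const

variable (E) in
/-- The ideal of functions vanishing to order `N + 1` at the origin. -/
def vanishingIdeal (N : ℕ) : Ideal (analyticFunctions E) where
  carrier := {u | VO (N + 1) (u : E → ℂ)}
  add_mem' h1 h2 := VO.add h1 h2
  zero_mem' := VO.zero
  smul_mem' c u h := by
    have := (vo_zero_of_continuousAt (AnalyticAt.continuousAt c.2)).mul h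
    rwa [zero_add] at this

variable (E) in
/-- The algebra of `N`-jets of functions at the origin. -/
def Jet (N : ℕ) : Type _ := analyticFunctions E ⧸ vanishingIdeal E N

noncomputable instance (N : ℕ) : CommRing (Jet E N) :=
  inferInstanceAs (CommRing (analyticFunctions E ⧸ vanishingIdeal E N))

noncomputable instance (N : ℕ) : Algebra ℂ (Jet E N) :=
  inferInstanceAs (Algebra ℂ (analyticFunctions E ⧸ vanishingIdeal E N))

variable (E) in
/-- The projection of an analytic function to its jet. -/
noncomputable def toJet (N : ℕ) : analyticFunctions E →ₐ[ℂ] Jet E N :=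
  Ideal.Quotient.mkₐ ℂ (vanishingIdeal E N)

theorem toJet_surjective (N : ℕ) : Function.Surjective (toJet E N) :=
  Ideal.Quotient.mk_surjective

theorem toJet_eq_zero_iff {N : ℕ} {u : analyticFunctions E} :
    toJet E N u = 0 ↔ VO (N + 1) (u : E → ℂ) :=
  Ideal.Quotient.eq_zero_iff_mem

open Classical in
/-- The `N`-jet of an analytic function. -/
noncomputable def jet (N : ℕ) (u : E → ℂ) : Jet E N :=
  if h : AnalyticAt ℂ u 0 then toJet E N ⟨u, h⟩ else 0

theorem jet_of_analyticAt {N : ℕ} {u : E → ℂ} (h : AnalyticAt ℂ u 0) :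
    jet N u = toJet E N ⟨u, h⟩ := dif_pos h

theorem jet_surjective {N : ℕ} (q : Jet E N) : ∃ u, AnalyticAt ℂ u 0 ∧ jet N u = q := by
  obtain ⟨⟨u, hu⟩, rfl⟩ := toJet_surjective N q
  exact ⟨u, hu, jet_of_analyticAt hu⟩

theorem jet_eq_iff {N : ℕ} {u v : E → ℂ} (hu : AnalyticAt ℂ u 0) (hv : AnalyticAt ℂ v 0) :
    jet N u = jet N v ↔ VO (N + 1) fun x => u x - v x := by
  rw [jet_of_analyticAt hu, jet_of_analyticAt hv, ← sub_eq_zero, ← map_sub, toJet_eq_zero_iff]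
  rfl

theorem jet_eq_zero_iff {N : ℕ} {u : E → ℂ} (hu : AnalyticAt ℂ u 0) :
    jet N u = 0 ↔ VO (N + 1) u := by
  rw [jet_of_analyticAt hu, toJet_eq_zero_iff]

theorem jet_congr {N : ℕ} {u v : E → ℂ} (h : u =ᶠ[𝓝 0] v) : jet N u = jet N v := by
  by_cases hu : AnalyticAt ℂ u 0
  · rw [jet_eq_iff hu (hu.congr h)]
    exact VO.zero.congr (h.mono fun x hx => by simp [hx])
  · have hv : ¬ AnalyticAt ℂ v 0 := fun hv => hu (hv.congr h.symm)
    rw [jet, jet, dif_neg hu, dif_neg hv]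

theorem jet_add {N : ℕ} {u v : E → ℂ} (hu : AnalyticAt ℂ u 0) (hv : AnalyticAt ℂ v 0) :
    jet N (u + v) = jet N u + jet N v := by
  rw [jet_of_analyticAt hu, jet_of_analyticAt hv, jet_of_analyticAt (hu.add hv), ← map_add]
  rfl

theorem jet_mul {N : ℕ} {u v : E → ℂ} (hu : AnalyticAt ℂ u 0) (hv : AnalyticAt ℂ v 0) :
    jet N (u * v) = jet N u * jet N v := by
  rw [jet_of_analyticAt hu, jet_of_analyticAt hv, jet_of_analyticAt (hu.mul hv), ← map_mul]
  rfl

theorem jet_smul {N : ℕ} {u : E → ℂ} (hu : AnalyticAt ℂ u 0) (c : ℂ) :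
    jet N (c • u) = c • jet N u := by
  rw [jet_of_analyticAt hu, jet_of_analyticAt (u := c • u) (analyticAt_const.smul hu), ← map_smul]
  rfl

theorem jet_sum {N : ℕ} {α : Type*} {s : Finset α} {u : α → E → ℂ}
    (hu : ∀ a ∈ s, AnalyticAt ℂ (u a) 0) : jet N (∑ a ∈ s, u a) = ∑ a ∈ s, jet N (u a) := by
  classical
  induction s using Finset.induction_on with
  | empty => 
    rw [Finset.sum_empty, Finset.sum_empty,
      jet_eq_zero_iff (u := 0) (analyticAt_const (v := (0 : ℂ)))]
    exact VO.zero
  | insert a s ha ih =>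
    rw [Finset.sum_insert ha, Finset.sum_insert ha, jet_add (hu a (by simp)), ih]
    · exact fun b hb => hu b (by simp [hb])
    · exact Finset.analyticAt_sum _ fun b hb => hu b (by simp [hb])

theorem jet_one {N : ℕ} : jet N (1 : E → ℂ) = 1 := by
  rw [jet_of_analyticAt (u := 1) (analyticAt_const (v := (1 : ℂ))), ← map_one (toJet E N)]
  rfl

theorem jet_prod {N : ℕ} {α : Type*} {s : Finset α} {u : α → E → ℂ}
    (hu : ∀ a ∈ s, AnalyticAt ℂ (u a) 0) : jet N (∏ a ∈ s, u a) = ∏ a ∈ s, jet N (u a) := by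
  classical
  induction s using Finset.induction_on with
  | empty => simpa using jet_one
  | insert a s ha ih =>
    rw [Finset.prod_insert ha, Finset.prod_insert ha, jet_mul (hu a (by simp)), ih]
    · exact fun b hb => hu b (by simp [hb])
    · exact Finset.analyticAt_prod _ fun b hb => hu b (by simp [hb])

theorem VO.lieD [CompleteSpace E] {N : ℕ} {V : E → E} {u : E → ℂ} (hV : AnalyticAt ℂ V 0)
    (h0 : V 0 = 0) (hu : AnalyticAt ℂ u 0) (h : VO (N + 1) u) : VO (N + 1) (lieD V u) := by
  have h1 : VO 1 V := by
    simpa [h0] using vo_one_of_differentiableAt (𝕜 := ℂ) hV.differentiableAt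
  exact VO.clm_apply (h.fderiv_of_analyticAt hu) h1

variable [CompleteSpace E]

/-- The derivative along a vector field as an endomorphism of the analytic functions. -/
noncomputable def lieEnd (V : E → E) (hV : AnalyticAt ℂ V 0) (N : ℕ) :
    analyticFunctions E →ₗ[ℂ] Jet E N where
  toFun u := jet N (lieD V (u : E → ℂ))
  map_add' u v := by
    rw [← jet_add (hV.lieD u.2) (hV.lieD v.2)]
    exact jet_congr (lieD_add u.2 v.2)
  map_smul' c u := by
    rw [RingHom.id_apply, ← jet_smul (hV.lieD u.2)]
    exact jet_congr (lieD_smul u.2 c)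

theorem exists_linearMap_jet {M : Type*} [AddCommGroup M] [Module ℂ M] {N : ℕ}
    (φ : analyticFunctions E →ₗ[ℂ] M) (h : ∀ u : analyticFunctions E, VO (N + 1) (u : E → ℂ) → φ u = 0) :
    ∃ g : Jet E N →ₗ[ℂ] M, ∀ u (hu : AnalyticAt ℂ u 0), g (jet N u) = φ ⟨u, hu⟩ := by
  obtain ⟨g, hg⟩ := (toJet E N).toLinearMap.exists_rightInverse_of_surjective
    (LinearMap.range_eq_top.2 (toJet_surjective (E := E) N))
  refine ⟨φ ∘ₗ g, fun u hu => ?_⟩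
  have h1 : toJet E N (g (jet N u) - ⟨u, hu⟩) = 0 := by
    rw [map_sub, sub_eq_zero]
    exact (LinearMap.congr_fun hg (jet N u)).trans (jet_of_analyticAt hu)
  have h2 := h _ (toJet_eq_zero_iff.1 h1)
  rwa [map_sub, sub_eq_zero] at h2

theorem exists_jetDer (N : ℕ) {V : E → E} (hV : AnalyticAt ℂ V 0) (h0 : V 0 = 0) :
    ∃ d : Module.End ℂ (Jet E N), ∀ u, AnalyticAt ℂ u 0 → d (jet N u) = jet N (lieD V u) :=
  exists_linearMap_jet (lieEnd V hV N) fun u hu =>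
    (jet_eq_zero_iff (hV.lieD u.2)).2 (VO.lieD hV h0 u.2 hu)

/-- Truncation of jets. -/
theorem exists_jet_truncation {M N : ℕ} (h : M ≤ N) :
    ∃ π : Jet E N →ₗ[ℂ] Jet E M, ∀ u, AnalyticAt ℂ u 0 → π (jet N u) = jet M u := by
  obtain ⟨π, hπ⟩ := exists_linearMap_jet (N := N) (toJet E M).toLinearMap fun u hu =>
    toJet_eq_zero_iff.2 (hu.mono (Nat.succ_le_succ h))
  exact ⟨π, fun u hu => (hπ u hu).trans (jet_of_analyticAt hu).symm⟩

open Classical in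
/-- The action of a vector field vanishing at the origin on jets. -/
noncomputable def jetDer (N : ℕ) (V : E → E) : Module.End ℂ (Jet E N) :=
  if h : AnalyticAt ℂ V 0 ∧ V 0 = 0 then (exists_jetDer N h.1 h.2).choose else 0

theorem jetDer_jet {N : ℕ} {V : E → E} {u : E → ℂ} (hV : AnalyticAt ℂ V 0) (h0 : V 0 = 0)
    (hu : AnalyticAt ℂ u 0) : jetDer N V (jet N u) = jet N (lieD V u) := by
  rw [jetDer, dif_pos ⟨hV, h0⟩]
  exact (exists_jetDer N hV h0).choose_spec u hu

theorem jetDer_mul {N : ℕ} {V : E → E} (hV : AnalyticAt ℂ V 0) (h0 : V 0 = 0) (a b : Jet E N) :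
    jetDer N V (a * b) = jetDer N V a * b + a * jetDer N V b := by
  obtain ⟨u, hu, rfl⟩ := jet_surjective a
  obtain ⟨v, hv, rfl⟩ := jet_surjective b
  rw [← jet_mul hu hv, jetDer_jet hV h0 (hu.mul hv), jetDer_jet hV h0 hu, jetDer_jet hV h0 hv,
    ← jet_mul (hV.lieD hu) hv, ← jet_mul hu (hV.lieD hv),
    ← jet_add ((hV.lieD hu).mul hv) (hu.mul (hV.lieD hv))]
  exact jet_congr (lieD_mul hu hv)

theorem jetDer_commute {N : ℕ} {V W : E → E} (hV : AnalyticAt ℂ V 0) (h0 : V 0 = 0)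
    (hW : AnalyticAt ℂ W 0) (h0' : W 0 = 0)
    (h : ∀ᶠ x in 𝓝 0, fderiv ℂ W x (V x) = fderiv ℂ V x (W x)) :
    Commute (jetDer N V) (jetDer N W) := by
  ext a
  obtain ⟨u, hu, rfl⟩ := jet_surjective a
  simp only [Module.End.mul_apply]
  rw [jetDer_jet hV h0 hu, jetDer_jet hW h0' hu, jetDer_jet hV h0 (hW.lieD hu),
    jetDer_jet hW h0' (hV.lieD hu)]
  refine jet_congr ?_
  filter_upwards [lieD_comm hV hW hu, h] with x h1 h2
  rwa [h2, sub_self, map_zero, sub_eq_zero] at h1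

/-- The Lie bracket of two vector fields is determined by the commutator of their actions. -/
theorem vo_bracket_of_commute {N : ℕ} {V W : E → E} (hV : AnalyticAt ℂ V 0) (h0 : V 0 = 0)
    (hW : AnalyticAt ℂ W 0) (h0' : W 0 = 0) (h : Commute (jetDer N V) (jetDer N W))
    (l : E →L[ℂ] ℂ) :
    VO (N + 1) fun x => l (fderiv ℂ W x (V x) - fderiv ℂ V x (W x)) := by
  have hl : AnalyticAt ℂ (fun x => l x) 0 := l.analyticAt 0
  have h1 := congrArg (fun T : Module.End ℂ (Jet E N) => T (jet N fun x => l x)) h.eq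
  simp only [Module.End.mul_apply] at h1
  rw [jetDer_jet hV h0 hl, jetDer_jet hW h0' hl, jetDer_jet hV h0 (hW.lieD hl),
    jetDer_jet hW h0' (hV.lieD hl), jet_eq_iff (hV.lieD (hW.lieD hl)) (hW.lieD (hV.lieD hl))] at h1
  refine h1.congr ?_
  filter_upwards [lieD_comm hV hW hl] with x hx
  rw [hx, ContinuousLinearMap.fderiv]

end Jets

section WeightSpaces

variable {τ R : Type*} [CommRing R] [Algebra ℂ R]

/-- The joint generalized eigenspaces of a family of endomorphisms. -/
def weightSpace (d : τ → Module.End ℂ R) (μ : τ → ℂ) : Submodule ℂ R :=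
  ⨅ i, (d i).maxGenEigenspace (μ i)

theorem mem_weightSpace {d : τ → Module.End ℂ R} {μ : τ → ℂ} {a : R} :
    a ∈ weightSpace d μ ↔ ∀ i, ∃ k : ℕ, ((d i - μ i • 1) ^ k) a = 0 :=
  Module.End.mem_iInf_maxGenEigenspace_iff _ _ _

theorem iSupIndep_weightSpace {d : τ → Module.End ℂ R} (hc : ∀ i j, Commute (d i) (d j)) :
    iSupIndep (weightSpace d) :=
  Module.End.independent_iInf_maxGenEigenspace_of_forall_mapsTo d fun i j φ =>
    Module.End.mapsTo_maxGenEigenspace_of_comm (hc j i) φ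

theorem iSup_weightSpace_eq_top [FiniteDimensional ℂ R] {d : τ → Module.End ℂ R}
    (hc : ∀ i j, Commute (d i) (d j)) : ⨆ μ, weightSpace d μ = ⊤ :=
  Module.End.iSup_iInf_maxGenEigenspace_eq_top_of_forall_mapsTo d (fun i j φ =>
    Module.End.mapsTo_maxGenEigenspace_of_comm (hc j i) φ)
    fun i => Module.End.iSup_maxGenEigenspace_eq_top (d i)

theorem mapsTo_weightSpace {d : τ → Module.End ℂ R} (hc : ∀ i j, Commute (d i) (d j)) (i : τ)
    (μ : τ → ℂ) {a : R} (ha : a ∈ weightSpace d μ) : d i a ∈ weightSpace d μ := by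
  simp only [weightSpace, Submodule.mem_iInf] at ha ⊢
  exact fun j => Module.End.mapsTo_maxGenEigenspace_of_comm (hc j i) _ (ha j)

theorem pow_apply_mul_eq_zero {d : Module.End ℂ R} (hd : ∀ a b, d (a * b) = d a * b + a * d b)
    (μ ν : ℂ) (n : ℕ) : ∀ (k l : ℕ) (a b : R), k + l = n → ((d - μ • 1) ^ k) a = 0 →
      ((d - ν • 1) ^ l) b = 0 → ((d - (μ + ν) • 1) ^ n) (a * b) = 0 := by
  induction n with
  | zero =>
    intro k l a b h ha hb
    obtain ⟨rfl, rfl⟩ : k = 0 ∧ l = 0 := by omega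
    simp only [pow_zero, Module.End.one_apply] at ha
    simp [ha]
  | succ n ih =>
    intro k l a b h ha hb
    have e : (d - (μ + ν) • 1) (a * b) = (d - μ • 1) a * b + a * (d - ν • 1) b := by
      simp only [LinearMap.sub_apply, LinearMap.smul_apply, LinearMap.add_apply,
        Module.End.one_apply, hd, add_smul,
        sub_mul, mul_sub, smul_mul_assoc, mul_smul_comm]
      abel
    rw [pow_succ, Module.End.mul_apply, e, map_add]
    rcases k with _ | k
    · simp only [pow_zero, Module.End.one_apply] at ha
      simp [ha]
    rcases l with _ | l
    · simp only [pow_zero, Module.End.one_apply] at hb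
      simp [hb]
    rw [ih k (l + 1) _ b (by omega) (by rwa [pow_succ, Module.End.mul_apply] at ha) hb,
      ih (k + 1) l a _ (by omega) ha (by rwa [pow_succ, Module.End.mul_apply] at hb), add_zero]

theorem mul_mem_weightSpace {d : τ → Module.End ℂ R}
    (hd : ∀ i a b, d i (a * b) = d i a * b + a * d i b) {μ ν : τ → ℂ} {a b : R}
    (ha : a ∈ weightSpace d μ) (hb : b ∈ weightSpace d ν) : a * b ∈ weightSpace d (μ + ν) := by
  rw [mem_weightSpace] at ha hb ⊢
  intro i
  obtain ⟨k, hk⟩ := ha i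
  obtain ⟨l, hl⟩ := hb i
  exact ⟨k + l, pow_apply_mul_eq_zero (hd i) _ _ _ k l a b rfl hk hl⟩

theorem apply_one_of_leibniz {d : Module.End ℂ R} (hd : ∀ a b, d (a * b) = d a * b + a * d b) :
    d 1 = 0 := by
  simpa using hd 1 1

theorem one_mem_weightSpace {d : τ → Module.End ℂ R}
    (hd : ∀ i a b, d i (a * b) = d i a * b + a * d i b) : (1 : R) ∈ weightSpace d 0 := by
  rw [mem_weightSpace]
  exact fun i => ⟨1, by simp [apply_one_of_leibniz (hd i)]⟩

theorem prod_mem_weightSpace {d : τ → Module.End ℂ R}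
    (hd : ∀ i a b, d i (a * b) = d i a * b + a * d i b) {α : Type*} (s : Finset α)
    {μ : α → τ → ℂ} {a : α → R} (ha : ∀ j ∈ s, a j ∈ weightSpace d (μ j)) :
    ∏ j ∈ s, a j ∈ weightSpace d (∑ j ∈ s, μ j) := by
  classical
  induction s using Finset.induction_on with
  | empty => simpa using one_mem_weightSpace hd
  | insert j s hj ih =>
    rw [Finset.prod_insert hj, Finset.sum_insert hj]
    exact mul_mem_weightSpace hd (ha j (by simp)) (ih fun b hb => ha b (by simp [hb]))

theorem apply_prod_of_leibniz {d : Module.End ℂ R} (hd : ∀ a b, d (a * b) = d a * b + a * d b)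
    {α : Type*} (s : Finset α) {μ : α → ℂ} {a : α → R} (ha : ∀ j ∈ s, d (a j) = μ j • a j) :
    d (∏ j ∈ s, a j) = (∑ j ∈ s, μ j) • ∏ j ∈ s, a j := by
  classical
  induction s using Finset.induction_on with
  | empty => simp [apply_one_of_leibniz hd]
  | insert j s hj ih =>
    rw [Finset.prod_insert hj, Finset.sum_insert hj, hd, ha j (by simp),
      ih fun b hb => ha b (by simp [hb]), add_smul, smul_mul_assoc, mul_smul_comm]

theorem eq_of_iSupIndep_of_le {ι M : Type*} [AddCommGroup M] [Module ℂ M]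
    {W W' : ι → Submodule ℂ M} (hW : iSupIndep W) (hle : W' ≤ W) (htop : ⨆ i, W' i = ⊤) :
    W' = W := by
  refine le_antisymm hle fun i w hw => ?_
  have h1 : w ∈ W' i ⊔ ⨆ (j) (_ : j ≠ i), W' j := by
    rw [← iSup_split_single W' i, htop]
    trivial
  obtain ⟨a, ha, b, hb, rfl⟩ := Submodule.mem_sup.1 h1
  have hb' : b ∈ ⨆ (j) (_ : j ≠ i), W j := iSup₂_mono (fun j _ => hle j) hb
  have hb'' : b ∈ W i := by simpa using (W i).sub_mem hw (hle i ha)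
  have := Submodule.disjoint_def.1 (hW i) b hb'' hb'
  simpa [this] using ha

/-- If the monomials in weight vectors `ξ j` span, a derivation that is diagonal on the `ξ j` with
eigenvalues depending additively on the weight acts as a scalar on each weight space. -/
theorem apply_eq_smul_of_mem_weightSpace {κ α : Type*} {d : τ → Module.End ℂ R}
    (hc : ∀ i j, Commute (d i) (d j)) (hd : ∀ i a b, d i (a * b) = d i a * b + a * d i b)
    {ξ : κ → R} {w : κ → τ → ℂ} (hξ : ∀ j, ξ j ∈ weightSpace d (w j))
    {l : α → ℕ} {i : ∀ a, Fin (l a) → κ}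
    (hspan : Submodule.span ℂ (Set.range fun a => ∏ s, ξ (i a s)) = ⊤)
    {z : Module.End ℂ R} (hz : ∀ a b, z (a * b) = z a * b + a * z b) {P : (τ → ℂ) →+ ℂ}
    (hzξ : ∀ j, z (ξ j) = P (w j) • ξ j) {μ : τ → ℂ} {a : R} (ha : a ∈ weightSpace d μ) :
    z a = P μ • a := by
  set W' : (τ → ℂ) → Submodule ℂ R := fun μ =>
    weightSpace d μ ⊓ LinearMap.ker (z - P μ • 1)
  have htop : ⨆ μ, W' μ = ⊤ := by
    rw [eq_top_iff, ← hspan, Submodule.span_le]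
    rintro _ ⟨b, rfl⟩
    refine Submodule.mem_iSup_of_mem (∑ s, w (i b s)) ⟨prod_mem_weightSpace hd _ fun s _ =>
      hξ _, ?_⟩
    simp only [SetLike.mem_coe, LinearMap.mem_ker, LinearMap.sub_apply, LinearMap.smul_apply,
      Module.End.one_apply, sub_eq_zero, map_sum]
    exact apply_prod_of_leibniz hz _ fun s _ => hzξ _
  have := eq_of_iSupIndep_of_le (iSupIndep_weightSpace hc) (fun μ => inf_le_left) htop
  rw [← this] at ha
  simpa [sub_eq_zero] using ha.2

theorem commute_of_apply_eq_smul {d : τ → Module.End ℂ R} (hc : ∀ i j, Commute (d i) (d j))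
    (htop : ⨆ μ, weightSpace d μ = ⊤) {z : Module.End ℂ R} {P : (τ → ℂ) → ℂ}
    (hz : ∀ μ, ∀ a ∈ weightSpace d μ, z a = P μ • a) (i : τ) : Commute (d i) z := by
  have : ⨆ μ, weightSpace d μ ≤ LinearMap.ker (d i * z - z * d i) := by
    refine iSup_le fun μ a ha => ?_
    simp [hz μ a ha, hz μ _ (mapsTo_weightSpace hc i μ ha)]
  rw [htop, top_le_iff, LinearMap.ker_eq_top, sub_eq_zero] at this
  exact this

end WeightSpaces

section Monomials

variable {E κ : Type*} [NormedAddCommGroup E] [NormedSpace ℂ E] [Fintype κ]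

theorem vo_prod_sub_prod {E : Type*} [NormedAddCommGroup E] {k : ℕ} {a b : Fin k → E → ℂ} (ha : ∀ s, VO 1 (a s))
    (hb : ∀ s, VO 1 (b s)) (hab : ∀ s, VO 2 fun x => a s x - b s x) :
    VO k (fun x => ∏ s, b s x) ∧ VO (k + 1) fun x => ∏ s, a s x - ∏ s, b s x := by
  induction k with
  | zero =>
    refine ⟨?_, by simpa using VO.zero⟩
    simpa using vo_zero_of_continuousAt (continuousAt_const (y := (1 : ℂ)))
  | succ k ih =>
    obtain ⟨h1, h2⟩ := ih (fun s => ha s.succ) (fun s => hb s.succ) fun s => hab s.succ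
    simp only [Fin.prod_univ_succ]
    refine ⟨by simpa [add_comm] using (hb 0).mul h1, ?_⟩
    have e1 := (hab 0).mul h1
    have e2 := (ha 0).mul h2
    rw [show 2 + k = k + 1 + 1 by ring] at e1
    rw [show 1 + (k + 1) = k + 1 + 1 by ring] at e2
    refine (e1.add e2).congr (Eventually.of_forall fun x => ?_)
    ring

theorem span_jet_monomials [DecidableEq κ] (ℓ : E ≃L[ℂ] (κ → ℂ)) {ξ : κ → E → ℂ}
    (hξ : ∀ j, AnalyticAt ℂ (ξ j) 0) (hξℓ : ∀ j, VO 2 fun x => ξ j x - ℓ x j) (N : ℕ) :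
    Submodule.span ℂ (Set.range fun a : Σ k : Fin (N + 1), (Fin k → κ) =>
      ∏ s, jet N (ξ (a.2 s))) = ⊤ := by
  set S := Submodule.span ℂ (Set.range fun a : Σ k : Fin (N + 1), (Fin k → κ) =>
      ∏ s, jet N (ξ (a.2 s)))
  have hℓ1 : ∀ j, VO 1 fun x => ℓ x j := fun j => by
    simpa using vo_id.continuousLinearMap ((ContinuousLinearMap.proj j).comp
      (ℓ : E →L[ℂ] (κ → ℂ)))
  have hξ1 : ∀ j, VO 1 (ξ j) := fun j => by
    simpa using (VO.mono (hξℓ j) one_le_two).add (hℓ1 j)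
  have key : ∀ m k, N + 1 - k = m → ∀ u : E → ℂ, AnalyticAt ℂ u 0 → VO k u → jet N u ∈ S := by
    intro m
    induction m using Nat.strong_induction_on with | _ m ih => ?_
    intro k hk u hu hku
    by_cases hne : ∀ᶠ x in 𝓝 0, u x = 0
    · rw [(jet_eq_zero_iff hu).2 (VO.zero.congr (hne.mono fun x hx => hx.symm))]
      exact S.zero_mem
    obtain ⟨r, p, ⟨w, hw⟩, hp⟩ := hu.exists_leadingForm hne
    rcases Nat.lt_or_ge N r with hNr | hNr
    · have : VO (N + 1) u := by
        have := (hp.mono (Nat.le_succ r)).add (vo_diagonal p)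
        simp only [sub_add_cancel] at this
        exact this.mono hNr
      rw [(jet_eq_zero_iff hu).2 this]
      exact S.zero_mem
    have hkr : k ≤ r := by
      by_contra! hlt
      refine hw (IsBigO.continuousMultilinearMap_apply_eq_zero ?_ w)
      have := (hku.mono hlt).sub hp
      simpa [VO] using this
    set e : κ → E := fun j => ℓ.symm (Pi.single j 1)
    have hx : ∀ x, x = ∑ j, ℓ x j • e j := fun x => by
      apply ℓ.injective
      ext i
      simp [e, Finset.sum_apply, Pi.single_apply]
    have hpe : ∀ x, p (fun _ => x) = ∑ i : Fin r → κ, (∏ s, ℓ x (i s)) * p fun s => e (i s) := by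
      intro x
      conv_lhs => rw [hx x]
      rw [p.map_sum]
      refine Finset.sum_congr rfl fun i _ => ?_
      rw [p.map_smul_univ, smul_eq_mul]
    set v : E → ℂ := ∑ i : Fin r → κ, (p fun s => e (i s)) • ∏ s, ξ (i s) with hv
    have hprod : ∀ i : Fin r → κ, AnalyticAt ℂ (∏ s, ξ (i s)) 0 := fun i =>
      Finset.analyticAt_prod _ fun s _ => hξ _
    have hva' : ∀ i : Fin r → κ, AnalyticAt ℂ ((p fun s => e (i s)) • ∏ s, ξ (i s)) 0 :=
      fun i => analyticAt_const.smul (hprod i)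
    have hva : AnalyticAt ℂ v 0 := Finset.analyticAt_sum _ fun i _ => hva' i
    have hjv : jet N v ∈ S := by
      rw [hv, jet_sum fun i _ => hva' i]
      refine S.sum_mem fun i _ => ?_
      rw [jet_smul (hprod i), jet_prod fun s _ => hξ _]
      exact S.smul_mem _ (Submodule.subset_span ⟨⟨⟨r, by omega⟩, i⟩, rfl⟩)
    have hsub : VO (r + 1) (u - v) := by
      have h1 : VO (r + 1) fun x => p (fun _ => x) - v x := by
        have h2 : VO (r + 1) fun x => ∑ i : Fin r → κ, (p fun s => e (i s)) *
            (∏ s, ℓ x (i s) - ∏ s, ξ (i s) x) := by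
          refine VO.sum fun i _ => ?_
          have h3 := (vo_prod_sub_prod (fun s => hℓ1 (i s)) (fun s => hξ1 (i s))
            fun s => by simpa using (hξℓ (i s)).neg).2
          simpa using (vo_zero_of_continuousAt (continuousAt_const
            (y := (p fun s => e (i s))))).mul h3
        refine h2.congr (Eventually.of_forall fun x => ?_)
        simp only [hpe, hv, Finset.sum_apply, Pi.smul_apply, Finset.prod_apply, smul_eq_mul,
          ← Finset.sum_sub_distrib]
        exact Finset.sum_congr rfl fun i _ => by ring
      refine (hp.add h1).congr (Eventually.of_forall fun x => ?_)
      simp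
    have := ih (N + 1 - (r + 1)) (by omega) (r + 1) rfl (u - v) (hu.sub hva) hsub
    have h4 := S.add_mem this hjv
    rwa [← jet_add (hu.sub hva) hva, sub_add_cancel] at h4
  refine eq_top_iff.2 fun q _ => ?_
  obtain ⟨u, hu, rfl⟩ := jet_surjective q
  exact key _ 0 rfl u hu (vo_zero_of_continuousAt hu.continuousAt)

theorem finiteDimensional_jet (ℓ : E ≃L[ℂ] (κ → ℂ)) (N : ℕ) : FiniteDimensional ℂ (Jet E N) := by
  classical
  have h := span_jet_monomials ℓ (ξ := fun j x => ℓ x j) (fun j =>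
    ((ContinuousLinearMap.proj (R := ℂ) (φ := fun _ : κ => ℂ) j).comp
      (ℓ : E →L[ℂ] (κ → ℂ))).analyticAt 0) (fun j => by simpa using VO.zero) N
  exact Module.finite_def.2 (h ▸ Submodule.fg_span (Set.finite_range _))
end Monomials

section NearIdentity

variable {𝕜 E F : Type*} [RCLike 𝕜] [NormedAddCommGroup E] [NormedSpace 𝕜 E] [NormedAddCommGroup F]
  [NormedSpace 𝕜 F]

theorem AnalyticAt.vo_two {g : E → F} (hg : AnalyticAt 𝕜 g 0) (h0 : g 0 = 0)
    (h1 : fderiv 𝕜 g 0 = 0) : VO 2 g := by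
  obtain ⟨p, hp⟩ := hg
  have h := hp.isBigO_sub_partialSum_pow 2
  refine VO.congr h (Eventually.of_forall fun y => ?_)
  have e0 : p 0 (fun _ => y) = 0 := by rw [hp.coeff_zero, h0]
  have e1 : p 1 (fun _ => y) = 0 := by
    have := hp.fderiv_eq
    rw [h1] at this
    have h2 := congrArg (fun T : E →L[𝕜] F => T y) this
    simp only [zero_apply, continuousMultilinearCurryFin1_apply] at h2
    rw [h2]
    congr 1
  simp [FormalMultilinearSeries.partialSum, Finset.sum_range_succ, e0, e1]

theorem fderiv_eq_of_vo_two_sub {g h : E → F} (hg : DifferentiableAt 𝕜 g 0)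
    (hh : DifferentiableAt 𝕜 h 0) (hgh : VO 2 fun x => g x - h x) :
    fderiv 𝕜 g 0 = fderiv 𝕜 h 0 := by
  have h0 : HasFDerivAt (fun x => g x - h x) (0 : E →L[𝕜] F) 0 := by
    rw [hasFDerivAt_iff_isLittleO_nhds_zero]
    have e : g 0 - h 0 = 0 := hgh.apply_zero
    simp only [zero_add, e, zero_apply, sub_zero]
    refine IsBigO.trans_isLittleO hgh ?_
    simpa using (isLittleO_norm_pow_id (E' := E) one_lt_two)
  have := h0.unique (hg.hasFDerivAt.sub hh.hasFDerivAt)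
  exact (sub_eq_zero.1 this.symm)

theorem AnalyticAt.exists_localInverse [CompleteSpace E] {g : E → E} (hg : AnalyticAt 𝕜 g 0)
    (h0 : g 0 = 0) (h1 : fderiv 𝕜 g 0 = ContinuousLinearMap.id 𝕜 E) :
    ∃ k : E → E, AnalyticAt 𝕜 k 0 ∧ k 0 = 0 ∧ fderiv 𝕜 k 0 = ContinuousLinearMap.id 𝕜 E ∧
      (∀ᶠ x in 𝓝 0, k (g x) = x) ∧ ∀ᶠ x in 𝓝 0, g (k x) = x := by
  have hc : ContDiffAt 𝕜 ω g 0 := hg.contDiffAt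
  have he : HasFDerivAt g ((ContinuousLinearEquiv.refl 𝕜 E : E ≃L[𝕜] E) : E →L[𝕜] E) 0 := by
    have := hg.differentiableAt.hasFDerivAt
    rw [h1] at this
    exact this
  have hs := hc.hasStrictFDerivAt' he (by simp)
  have e2 := (hc.to_localInverse he (by simp)).analyticAt
  have e3 := hs.localInverse_apply_image
  have e4 := hs.to_localInverse
  have e5 := hs.eventually_right_inverse
  rw [h0] at e2 e3 e4 e5
  refine ⟨hc.localInverse he (by simp), e2, e3, ?_, hs.eventually_left_inverse, e5⟩
  exact e4.hasFDerivAt.fderiv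

end NearIdentity

section NormalCoordinates

variable {τ : Type*}

theorem map_mem_weightSpace {R R' : Type*} [CommRing R] [Algebra ℂ R] [CommRing R'] [Algebra ℂ R']
    {d : τ → Module.End ℂ R} {d' : τ → Module.End ℂ R'} (π : R →ₗ[ℂ] R')
    (h : ∀ i a, π (d i a) = d' i (π a)) {μ : τ → ℂ} {a : R} (ha : a ∈ weightSpace d μ) :
    π a ∈ weightSpace d' μ := by
  rw [mem_weightSpace] at ha ⊢
  intro i
  obtain ⟨k, hk⟩ := ha i
  refine ⟨k, ?_⟩
  have : ∀ (k : ℕ) (b : R), ((d' i - μ i • 1) ^ k) (π b) = π (((d i - μ i • 1) ^ k) b) := by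
    intro k
    induction k with
    | zero => simp
    | succ k ih =>
      intro b
      rw [pow_succ, pow_succ, Module.End.mul_apply, Module.End.mul_apply, ← ih]
      simp [h]
  rw [this, hk, map_zero]

variable {E κ : Type*} [NormedAddCommGroup E] [NormedSpace ℂ E] [CompleteSpace E] [Fintype κ]

theorem jetDer_one_pow_apply {V : E → E} (hV : AnalyticAt ℂ V 0) (h0 : V 0 = 0) (c : ℂ) (k : ℕ)
    (l : E →L[ℂ] ℂ) : ((jetDer 1 V - c • 1) ^ k) (jet 1 fun x => l x) =
      jet 1 fun x => l (((fderiv ℂ V 0 - c • 1) ^ k) x) := by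
  induction k generalizing l with
  | zero => simp
  | succ k ih =>
    set A := fderiv ℂ V 0 - c • 1 with hA
    have e : (jetDer 1 V - c • 1) (jet 1 fun x => l x) = jet 1 fun x => (l.comp A) x := by
      have hl : AnalyticAt ℂ (fun x => l x) 0 := l.analyticAt 0
      have hla : AnalyticAt ℂ (fun x => (l.comp (fderiv ℂ V 0)) x) 0 :=
        (l.comp (fderiv ℂ V 0)).analyticAt 0
      have e1 : jetDer 1 V (jet 1 fun x => l x) = jet 1 fun x => (l.comp (fderiv ℂ V 0)) x := by
        rw [jetDer_jet hV h0 hl, jet_eq_iff (hV.lieD hl) hla]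
        have h2 : VO 2 fun x => V x - fderiv ℂ V 0 x := by
          refine AnalyticAt.vo_two (𝕜 := ℂ) (hV.sub ((fderiv ℂ V 0).analyticAt 0)) (by simp [h0]) ?_
          have h3 := hV.differentiableAt.hasFDerivAt.sub (fderiv ℂ V 0).hasFDerivAt
          rw [sub_self] at h3
          exact h3.fderiv
        refine (h2.continuousLinearMap l).congr (Eventually.of_forall fun x => ?_)
        simp only [lieD, map_sub, ContinuousLinearMap.comp_apply]
        rw [ContinuousLinearMap.fderiv]
      rw [LinearMap.sub_apply, LinearMap.smul_apply, Module.End.one_apply, e1, ← jet_smul hl,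
        sub_eq_iff_eq_add, ← jet_add (u := fun x => (l.comp A) x) (v := c • fun x => l x)
          ((l.comp A).analyticAt 0) (analyticAt_const.smul hl)]
      congr 1
      ext x
      simp [hA]
    rw [pow_succ, Module.End.mul_apply, e, ih]
    congr 1
    ext x
    rw [pow_succ', ContinuousLinearMap.comp_apply]
    rfl

theorem exists_lift_weightSpace {R R' : Type*} [CommRing R] [Algebra ℂ R] [CommRing R']
    [Algebra ℂ R'] {d : τ → Module.End ℂ R} {d' : τ → Module.End ℂ R'}
    (hc' : ∀ i j, Commute (d' i) (d' j)) (htop : ⨆ μ, weightSpace d μ = ⊤) (π : R →ₗ[ℂ] R')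
    (hπ : Function.Surjective π) (h : ∀ i a, π (d i a) = d' i (π a)) {μ : τ → ℂ} {a : R'}
    (ha : a ∈ weightSpace d' μ) : ∃ b ∈ weightSpace d μ, π b = a := by
  obtain ⟨c, rfl⟩ := hπ a
  have h1 : c ∈ weightSpace d μ ⊔ ⨆ (ν) (_ : ν ≠ μ), weightSpace d ν := by
    rw [← iSup_split_single, htop]
    trivial
  obtain ⟨b, hb, b', hb', rfl⟩ := Submodule.mem_sup.1 h1
  have h2 : π b' ∈ ⨆ (ν) (_ : ν ≠ μ), weightSpace d' ν := by
    have : (⨆ (ν) (_ : ν ≠ μ), weightSpace d ν) ≤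
        (⨆ (ν) (_ : ν ≠ μ), weightSpace d' ν).comap π :=
      iSup₂_le fun ν hν c hc => Submodule.mem_comap.2 <|
        Submodule.mem_iSup_of_mem ν <| Submodule.mem_iSup_of_mem hν (map_mem_weightSpace π h hc)
    exact this hb'
  have h3 : π b' ∈ weightSpace d' μ := by
    have := Submodule.sub_mem _ ha (map_mem_weightSpace π h hb)
    rwa [map_add, add_sub_cancel_left] at this
  have h4 := Submodule.disjoint_def.1 (iSupIndep_weightSpace hc' μ) _ h3 h2
  exact ⟨b, hb, by rw [map_add, h4, add_zero]⟩

/-- Every weight jet lifts to a weight jet of higher order. -/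
theorem exists_weight_lift {X : τ → E → E} (hX : ∀ i, AnalyticAt ℂ (X i) 0)
    (hX0 : ∀ i, X i 0 = 0)
    (hcomm : ∀ a b, ∀ᶠ x in 𝓝 0, fderiv ℂ (X b) x (X a x) = fderiv ℂ (X a) x (X b x))
    (ℓ : E ≃L[ℂ] (κ → ℂ)) {M N : ℕ} (hMN : M ≤ N) {μ : τ → ℂ} {u : E → ℂ}
    (hu : AnalyticAt ℂ u 0) (hw : jet M u ∈ weightSpace (fun i => jetDer M (X i)) μ) :
    ∃ v, AnalyticAt ℂ v 0 ∧ (VO (M + 1) fun x => v x - u x) ∧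
      jet N v ∈ weightSpace (fun i => jetDer N (X i)) μ := by
  have hfin : FiniteDimensional ℂ (Jet E N) := finiteDimensional_jet ℓ N
  have hc : ∀ N, ∀ i j, Commute (jetDer N (X i)) (jetDer N (X j)) := fun N i j =>
    jetDer_commute (hX i) (hX0 i) (hX j) (hX0 j) (hcomm i j)
  obtain ⟨π, hπ⟩ := exists_jet_truncation (E := E) hMN
  have hπd : ∀ i a, π (jetDer N (X i) a) = jetDer M (X i) (π a) := by
    intro i a
    obtain ⟨u, hu, rfl⟩ := jet_surjective a
    rw [jetDer_jet (hX i) (hX0 i) hu, hπ _ ((hX i).lieD hu), hπ _ hu,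
      jetDer_jet (hX i) (hX0 i) hu]
  have hsurj : Function.Surjective π := fun b => by
    obtain ⟨u, hu, rfl⟩ := jet_surjective b
    exact ⟨_, hπ u hu⟩
  obtain ⟨b, hb, hbu⟩ := exists_lift_weightSpace (hc M) (iSup_weightSpace_eq_top (hc N)) π hsurj hπd hw
  obtain ⟨v, hv, rfl⟩ := jet_surjective b
  rw [hπ v hv, jet_eq_iff hv hu] at hbu
  exact ⟨v, hv, hbu, hb⟩

theorem jet_one_mem_weightSpace {X : τ → E → E} (hX : ∀ i, AnalyticAt ℂ (X i) 0)
    (hX0 : ∀ i, X i 0 = 0) (l : E →L[ℂ] ℂ) {μ : τ → ℂ}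
    (hw : ∀ i, ∃ k : ℕ, ∀ x, l (((fderiv ℂ (X i) 0 - μ i • 1) ^ k) x) = 0) :
    jet 1 (fun x => l x) ∈ weightSpace (fun i => jetDer 1 (X i)) μ := by
  rw [mem_weightSpace]
  intro i
  obtain ⟨k, hk⟩ := hw i
  refine ⟨k, ?_⟩
  rw [jetDer_one_pow_apply (hX i) (hX0 i), jet_eq_zero_iff]
  · exact VO.zero.congr (Eventually.of_forall fun x => (hk x).symm)
  · exact (l.comp ((fderiv ℂ (X i) 0 - μ i • 1) ^ k)).analyticAt 0

theorem exists_weight_coordinates {X : τ → E → E} (hX : ∀ i, AnalyticAt ℂ (X i) 0)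
    (hX0 : ∀ i, X i 0 = 0)
    (hcomm : ∀ a b, ∀ᶠ x in 𝓝 0, fderiv ℂ (X b) x (X a x) = fderiv ℂ (X a) x (X b x))
    (ℓ : E ≃L[ℂ] (κ → ℂ)) {w : κ → τ → ℂ}
    (hw : ∀ i j, ∃ k : ℕ, ∀ x, ℓ (((fderiv ℂ (X i) 0 - w j i • 1) ^ k) x) j = 0)
    {N : ℕ} (hN : 1 ≤ N) :
    ∃ ξ : κ → E → ℂ, (∀ j, AnalyticAt ℂ (ξ j) 0) ∧ (∀ j, VO 2 fun x => ξ j x - ℓ x j) ∧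
      ∀ j, jet N (ξ j) ∈ weightSpace (fun i => jetDer N (X i)) (w j) := by
  have hmain : ∀ j, ∃ ξ : E → ℂ, AnalyticAt ℂ ξ 0 ∧ (VO 2 fun x => ξ x - ℓ x j) ∧
      jet N ξ ∈ weightSpace (fun i => jetDer N (X i)) (w j) := by
    intro j
    set l : E →L[ℂ] ℂ := (ContinuousLinearMap.proj (R := ℂ) (φ := fun _ : κ => ℂ) j).comp
      (ℓ : E →L[ℂ] (κ → ℂ))
    exact exists_weight_lift hX hX0 hcomm ℓ hN (l.analyticAt 0)
      (jet_one_mem_weightSpace hX hX0 l fun i => hw i j)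
  choose ξ h1 h2 h3 using hmain
  exact ⟨ξ, h1, h2, h3⟩

end NormalCoordinates

section DiagonalRotation

variable {E κ : Type*} [NormedAddCommGroup E] [NormedSpace ℂ E] [Fintype κ] [DecidableEq κ]

/-- The projection onto the `j`-th coordinate axis. -/
noncomputable def axisProj (ℓ : E ≃L[ℂ] (κ → ℂ)) (j : κ) : E →L[ℂ] E :=
  ((ContinuousLinearMap.proj (R := ℂ) (φ := fun _ : κ => ℂ) j).comp
    (ℓ : E →L[ℂ] (κ → ℂ))).smulRight (ℓ.symm (Pi.single j 1))

/-- The operator which is diagonal in the coordinates `ℓ`. -/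
noncomputable def diagOp (ℓ : E ≃L[ℂ] (κ → ℂ)) (c : κ → ℂ) : E →L[ℂ] E :=
  ∑ j, c j • axisProj ℓ j

theorem coord_diagOp (ℓ : E ≃L[ℂ] (κ → ℂ)) (c : κ → ℂ) (x : E) (j : κ) :
    ℓ (diagOp ℓ c x) j = c j * ℓ x j := by
  simp [diagOp, axisProj, map_sum, Finset.sum_apply, Pi.single_apply]

theorem diagOp_comp (ℓ : E ≃L[ℂ] (κ → ℂ)) (c c' : κ → ℂ) :
    diagOp ℓ c ∘L diagOp ℓ c' = diagOp ℓ fun j => c j * c' j := by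
  ext x
  apply ℓ.injective
  ext j
  simp only [ContinuousLinearMap.comp_apply, coord_diagOp, mul_assoc]

theorem diagOp_one (ℓ : E ≃L[ℂ] (κ → ℂ)) :
    diagOp ℓ (fun _ => 1) = ContinuousLinearMap.id ℂ E := by
  ext x
  apply ℓ.injective
  ext j
  simp [coord_diagOp]

/-- The circle action with weights `p` in the coordinates `ℓ`. -/
noncomputable def diagRotation (ℓ : E ≃L[ℂ] (κ → ℂ)) (p : κ → ℤ) : Rotation E where
  U θ := diagOp ℓ fun j => Complex.exp (Complex.I * p j * θ)
  L := diagOp ℓ fun j => (p j : ℂ)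
  hasDerivAt θ := by
    have e : Complex.I • (diagOp ℓ (fun j => (p j : ℂ)) ∘L
        diagOp ℓ fun j => Complex.exp (Complex.I * p j * θ)) =
        ∑ j, (Complex.exp (Complex.I * p j * θ) * (Complex.I * p j)) • axisProj ℓ j := by
      rw [diagOp_comp, diagOp, Finset.smul_sum]
      refine Finset.sum_congr rfl fun j _ => ?_
      rw [smul_smul]
      congr 1
      ring
    rw [e]
    simp only [diagOp]
    refine HasDerivAt.fun_sum fun j _ => ?_
    have h1 : HasDerivAt (fun θ : ℝ => Complex.I * p j * (θ : ℂ)) (Complex.I * p j) θ := by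
      simpa using (Complex.ofRealCLM.hasDerivAt (x := θ)).const_mul (Complex.I * (p j : ℂ))
    exact h1.cexp.smul_const (axisProj ℓ j)
  U_zero := by simp [diagOp_one]
  periodic θ := by
    simp only
    congr 1
    ext j
    rw [Complex.exp_eq_exp_iff_exists_int]
    exact ⟨p j, by push_cast; ring⟩

theorem coord_diagRotation_U (ℓ : E ≃L[ℂ] (κ → ℂ)) (p : κ → ℤ) (θ : ℝ) (x : E) (j : κ) :
    ℓ ((diagRotation ℓ p).U θ x) j = Complex.exp (Complex.I * p j * θ) * ℓ x j :=
  coord_diagOp ℓ _ x j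

theorem coord_diagRotation_L (ℓ : E ≃L[ℂ] (κ → ℂ)) (p : κ → ℤ) (x : E) (j : κ) :
    ℓ ((diagRotation ℓ p).L x) j = p j * ℓ x j :=
  coord_diagOp ℓ _ x j

end DiagonalRotation

section ApproximateSymmetry

variable {E κ τ : Type*} [NormedAddCommGroup E] [NormedSpace ℂ E] [CompleteSpace E]

theorem exists_conjugate_flow (R : Rotation E) {Ξ : E → E} (hΞ : AnalyticAt ℂ Ξ 0)
    (hΞ2 : VO 2 fun x => Ξ x - x) :
    ∃ (Z : E → E) (Ψ : ℝ → E → E), AnalyticAt ℂ Z 0 ∧ Z 0 = 0 ∧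
      (∀ᶠ x in 𝓝 0, fderiv ℂ Ξ x (Z x) = R.L (Ξ x)) ∧
      (∃ ρ > 0, ∃ C, ∀ x, ‖x‖ < ρ → ∀ θ, HasDerivAt (fun t => Ψ t x) (Complex.I • Z (Ψ θ x)) θ ∧
        ‖Ψ θ x - R.U θ x‖ ≤ C * ‖x‖ ^ 2) ∧
      (∀ᶠ x in 𝓝 0, Ψ 0 x = x) ∧ ∀ᶠ x in 𝓝 0, Ψ (2 * Real.pi) x = x := by
  have hΞ0 : Ξ 0 = 0 := by simpa using hΞ2.apply_zero
  have hΞ1 : fderiv ℂ Ξ 0 = ContinuousLinearMap.id ℂ E :=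
    (fderiv_eq_of_vo_two_sub hΞ.differentiableAt differentiableAt_id hΞ2).trans fderiv_id
  obtain ⟨Φ, hΦ, hΦ0, hΦ1, hΦΞ, hΞΦ⟩ := hΞ.exists_localInverse hΞ0 hΞ1
  have hΦ2 : VO 2 fun x => Φ x - x := by
    refine AnalyticAt.vo_two (𝕜 := ℂ) (hΦ.sub analyticAt_id) (by simp [hΦ0]) ?_
    rw [fderiv_fun_sub hΦ.differentiableAt differentiableAt_fun_id, hΦ1, fderiv_fun_id, sub_self]
  have hct : Tendsto Ξ (𝓝 0) (𝓝 0) := by simpa [hΞ0] using hΞ.continuousAt.tendsto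
  have hct' : Tendsto Φ (𝓝 0) (𝓝 0) := by simpa [hΦ0] using hΦ.continuousAt.tendsto
  have hinv : ∀ᶠ y in 𝓝 0, ∀ v, fderiv ℂ Ξ (Φ y) (fderiv ℂ Φ y v) = v := by
    filter_upwards [hΞΦ.eventually_nhds, hΦ.eventually_analyticAt,
      hct'.eventually hΞ.eventually_analyticAt] with y h1 h2 h3 v
    have h4 := (h3.differentiableAt.hasFDerivAt.comp y h2.differentiableAt.hasFDerivAt)
    have h5 : HasFDerivAt (fun x => x) (fderiv ℂ Ξ (Φ y) ∘L fderiv ℂ Φ y) y :=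
      h4.congr_of_eventuallyEq (h1.mono fun z hz => hz.symm)
    have h6 := h5.unique (hasFDerivAt_id y)
    exact congrArg (fun T : E →L[ℂ] E => T v) h6
  set Z : E → E := fun x => fderiv ℂ Φ (Ξ x) (R.L (Ξ x)) with hZ
  have hZan : AnalyticAt ℂ Z 0 := by
    have h1 : AnalyticAt ℂ (fderiv ℂ Φ) (Ξ 0) := by rw [hΞ0]; exact hΦ.fderiv
    exact (h1.fun_comp hΞ).clm_apply_of ((R.L.analyticAt _).fun_comp hΞ)
  refine ⟨Z, fun θ x => Φ (R.U θ (Ξ x)), hZan, by simp [hZ, hΞ0], ?_, ?_, ?_, ?_⟩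
  · filter_upwards [hct.eventually hinv, hΦΞ] with x h1 h2
    have := h1 (R.L (Ξ x))
    rwa [h2] at this
  · obtain ⟨M, hM1, hM⟩ := R.exists_bound
    obtain ⟨C₁, hC₁0, hC₁⟩ := hΦ2.exists_pos
    obtain ⟨C₂, hC₂0, hC₂⟩ := hΞ2.exists_pos
    have hy : ∀ᶠ y in 𝓝 (0 : E), DifferentiableAt ℂ Φ y ∧ Ξ (Φ y) = y ∧
        ‖Φ y - y‖ ≤ C₁ * ‖y‖ ^ 2 := by
      filter_upwards [hΦ.eventually_analyticAt, hΞΦ, hC₁.bound] with y h1 h2 h3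
      exact ⟨h1.differentiableAt, h2, by simpa using h3⟩
    obtain ⟨r, hr, hr'⟩ := Metric.eventually_nhds_iff.1 hy
    have hx : ∀ᶠ x in 𝓝 (0 : E), ‖Ξ x - x‖ ≤ C₂ * ‖x‖ ^ 2 ∧ C₂ * ‖x‖ < 1 ∧ M * (2 * ‖x‖) < r := by
      have t1 : ∀ᶠ x in 𝓝 (0 : E), C₂ * ‖x‖ < 1 := by
        have : Tendsto (fun x : E => C₂ * ‖x‖) (𝓝 0) (𝓝 (C₂ * ‖(0:E)‖)) :=
          Continuous.tendsto (by fun_prop) 0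
        exact this.eventually (gt_mem_nhds (by simp))
      have t2 : ∀ᶠ x in 𝓝 (0 : E), M * (2 * ‖x‖) < r := by
        have : Tendsto (fun x : E => M * (2 * ‖x‖)) (𝓝 0) (𝓝 (M * (2 * ‖(0:E)‖))) :=
          Continuous.tendsto (by fun_prop) 0
        exact this.eventually (gt_mem_nhds (by simpa using hr))
      filter_upwards [hC₂.bound, t1, t2] with x h1 h2 h3
      exact ⟨by simpa using h1, h2, h3⟩
    obtain ⟨ρ, hρ, hρ'⟩ := Metric.eventually_nhds_iff.1 hx
    refine ⟨ρ, hρ, C₁ * (M * 2) ^ 2 + M * C₂, fun x hxρ θ => ?_⟩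
    obtain ⟨h1, h2, h3⟩ := hρ' (by simpa using hxρ)
    have hΞx : ‖Ξ x‖ ≤ 2 * ‖x‖ := by
      have := norm_le_norm_add_norm_sub' (Ξ x) x
      have h4 : C₂ * ‖x‖ ^ 2 ≤ ‖x‖ := by
        rw [pow_two, ← mul_assoc]
        exact mul_le_of_le_one_left (norm_nonneg _) h2.le
      linarith
    have hUx : ‖R.U θ (Ξ x)‖ ≤ M * (2 * ‖x‖) :=
      ((R.U θ).le_opNorm _).trans (mul_le_mul (hM θ) hΞx (norm_nonneg _) (by linarith))
    obtain ⟨g1, g2, g3⟩ := hr' (y := R.U θ (Ξ x)) (by simpa using hUx.trans_lt h3)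
    constructor
    · have h5 := g1.hasFDerivAt.restrictScalars ℝ |>.comp_hasDerivAt θ (R.hasDerivAt_apply (Ξ x) θ)
      simp only [hZ, g2]
      rw [← map_smul]
      exact h5
    · have e : Φ (R.U θ (Ξ x)) - R.U θ x =
          (Φ (R.U θ (Ξ x)) - R.U θ (Ξ x)) + R.U θ (Ξ x - x) := by rw [map_sub]; abel
      rw [e]
      have b1 : C₁ * ‖R.U θ (Ξ x)‖ ^ 2 ≤ C₁ * (M * (2 * ‖x‖)) ^ 2 :=
        mul_le_mul_of_nonneg_left (pow_le_pow_left₀ (norm_nonneg _) hUx 2) hC₁0.le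
      have b2 : ‖R.U θ (Ξ x - x)‖ ≤ M * (C₂ * ‖x‖ ^ 2) :=
        ((R.U θ).le_opNorm _).trans (mul_le_mul (hM θ) h1 (norm_nonneg _) (by linarith))
      calc _ ≤ _ := norm_add_le _ _
        _ ≤ C₁ * (M * (2 * ‖x‖)) ^ 2 + M * (C₂ * ‖x‖ ^ 2) := by linarith
        _ = _ := by ring
  · filter_upwards [hΦΞ] with x hx
    simpa [R.U_zero] using hx
  · filter_upwards [hΦΞ] with x hx
    have := R.periodic 0
    rw [zero_add] at this
    simpa [this, R.U_zero] using hx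

variable [Fintype κ] [DecidableEq κ]

theorem exists_isApprox {X : τ → E → E} (hX : ∀ i, AnalyticAt ℂ (X i) 0)
    (hX0 : ∀ i, X i 0 = 0)
    (hcomm : ∀ a b, ∀ᶠ x in 𝓝 0, fderiv ℂ (X b) x (X a x) = fderiv ℂ (X a) x (X b x))
    (ℓ : E ≃L[ℂ] (κ → ℂ)) {w : κ → τ → ℂ}
    (hw : ∀ i j, ∃ k : ℕ, ∀ x, ℓ (((fderiv ℂ (X i) 0 - w j i • 1) ^ k) x) j = 0)
    {f : E → ℂ} (hf : AnalyticAt ℂ f 0) (hfX : ∀ a, ∀ᶠ x in 𝓝 0, fderiv ℂ f x (X a x) = 0)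
    {P : (τ → ℂ) →+ ℂ} {p : κ → ℤ} (hP : ∀ j, P (w j) = p j) (N : ℕ) :
    ∃ Z Ψ, IsApprox (diagRotation ℓ p) f X N Z Ψ ∧ ∀ μ u, AnalyticAt ℂ u 0 →
      jet (N + 1) u ∈ weightSpace (fun i => jetDer (N + 1) (X i)) μ →
      VO (N + 2) fun x => fderiv ℂ u x (Z x) - P μ * u x := by
  obtain ⟨ξ, hξ, hξℓ, hξw⟩ := exists_weight_coordinates hX hX0 hcomm ℓ hw (N := N + 1) (by omega)
  have hfin : FiniteDimensional ℂ (Jet E (N + 1)) := finiteDimensional_jet ℓ (N + 1)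
  have hc : ∀ i j, Commute (jetDer (N + 1) (X i)) (jetDer (N + 1) (X j)) := fun i j =>
    jetDer_commute (hX i) (hX0 i) (hX j) (hX0 j) (hcomm i j)
  set Ξ : E → E := fun x => ℓ.symm fun j => ξ j x with hΞdef
  have hΞ : AnalyticAt ℂ Ξ 0 :=
    (ℓ.symm : (κ → ℂ) →L[ℂ] E).analyticAt _ |>.fun_comp (AnalyticAt.pi hξ)
  have hΞ2 : VO 2 fun x => Ξ x - x := by
    have h1 : VO 2 fun x => fun j => ξ j x - ℓ x j := vo_pi.2 hξℓ
    refine (h1.continuousLinearMap (ℓ.symm : (κ → ℂ) →L[ℂ] E)).congr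
      (Eventually.of_forall fun x => ?_)
    apply ℓ.injective
    ext j
    simp [hΞdef]
  obtain ⟨Z, Ψ, hZ, hZ0, hΞZ, hflow, hstart, hper⟩ :=
    exists_conjugate_flow (diagRotation ℓ p) hΞ hΞ2
  have hZξ : ∀ j, jetDer (N + 1) Z (jet (N + 1) (ξ j)) = P (w j) • jet (N + 1) (ξ j) := by
    intro j
    rw [jetDer_jet hZ hZ0 (hξ j), ← jet_smul (hξ j)]
    refine jet_congr ?_
    filter_upwards [hΞZ, hΞ.eventually_analyticAt] with x h1 h2
    have e : ∀ x, ξ j x = ((ContinuousLinearMap.proj (R := ℂ) (φ := fun _ : κ => ℂ) j).comp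
      (ℓ : E →L[ℂ] (κ → ℂ))) (Ξ x) := fun x => by simp [hΞdef]
    have h3 := (((ContinuousLinearMap.proj (R := ℂ) (φ := fun _ : κ => ℂ) j).comp
      (ℓ : E →L[ℂ] (κ → ℂ))).hasFDerivAt (x := Ξ x)).comp x h2.differentiableAt.hasFDerivAt
    have h4 : HasFDerivAt (ξ j) _ x := h3.congr_of_eventuallyEq (Eventually.of_forall e)
    rw [lieD, h4.fderiv, ContinuousLinearMap.comp_apply, h1, ContinuousLinearMap.comp_apply]
    change ℓ ((diagRotation ℓ p).L (Ξ x)) j = _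
    rw [coord_diagRotation_L, hP]
    simp [hΞdef]
  have hz : ∀ μ, ∀ a ∈ weightSpace (fun i => jetDer (N + 1) (X i)) μ,
      jetDer (N + 1) Z a = P μ • a := fun μ a ha =>
    apply_eq_smul_of_mem_weightSpace hc (fun i => jetDer_mul (hX i) (hX0 i)) hξw
      (span_jet_monomials ℓ hξ hξℓ (N + 1)) (jetDer_mul hZ hZ0) hZξ ha
  have hz' : ∀ μ u, AnalyticAt ℂ u 0 →
      jet (N + 1) u ∈ weightSpace (fun i => jetDer (N + 1) (X i)) μ →
      VO (N + 2) fun x => fderiv ℂ u x (Z x) - P μ * u x := by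
    intro μ u hu hmem
    have h1 := hz μ _ hmem
    rw [jetDer_jet hZ hZ0 hu, ← jet_smul hu, jet_eq_iff (v := P μ • u) (hZ.lieD hu) (analyticAt_const.smul hu)] at h1
    exact h1
  refine ⟨Z, Ψ, ⟨hZ, hflow, hstart, hper, fun j => ?_, ?_⟩, hz'⟩
  · have h1 := (commute_of_apply_eq_smul hc (iSup_weightSpace_eq_top hc) hz j).symm
    have h2 : ∀ i, VO N fun x =>
        ℓ (fderiv ℂ (X j) x (Z x) - fderiv ℂ Z x (X j x)) i := fun i =>
      (vo_bracket_of_commute hZ hZ0 (hX j) (hX0 j) h1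
        ((ContinuousLinearMap.proj (R := ℂ) (φ := fun _ : κ => ℂ) i).comp
          (ℓ : E →L[ℂ] (κ → ℂ)))).mono (by omega)
    have h3 := (vo_pi.2 h2).continuousLinearMap (ℓ.symm : (κ → ℂ) →L[ℂ] E)
    refine h3.congr (Eventually.of_forall fun x => ?_)
    exact ℓ.symm_apply_apply _
  · have h1 : jet (N + 1) f ∈ weightSpace (fun i => jetDer (N + 1) (X i)) 0 := by
      rw [mem_weightSpace]
      refine fun i => ⟨1, ?_⟩
      simp only [Pi.zero_apply, zero_smul, sub_zero, pow_one]
      rw [jetDer_jet (hX i) (hX0 i) hf, jet_eq_zero_iff ((hX i).lieD hf)]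
      exact VO.zero.congr ((hfX i).mono fun x hx => hx.symm)
    refine ((hz' 0 f hf h1).mono (by omega : N ≤ N + 2)).congr (Eventually.of_forall fun x => ?_)
    simp

end ApproximateSymmetry

section WeightSymmetry

variable {E κ τ : Type*} [NormedAddCommGroup E] [NormedSpace ℂ E] [CompleteSpace E]
  [Fintype κ] [DecidableEq κ] [Fintype τ] [DecidableEq τ]

theorem IsFrame.exists_weight_symmetry {f : E → ℂ} {X : τ → E → E} {K : τ → E → E →L[ℂ] ℂ}
    (hF : IsFrame f X K) (hX0 : ∀ i, X i 0 = 0) (ℓ : E ≃L[ℂ] (κ → ℂ)) {w : κ → τ → ℂ}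
    (hw : ∀ i j, ∃ k : ℕ, ∀ x, ℓ (((fderiv ℂ (X i) 0 - w j i • 1) ^ k) x) j = 0)
    {P : (τ → ℂ) →+ ℂ} {p : κ → ℤ} (hP : ∀ j, P (w j) = p j) :
    ∃ Z : E → E, AnalyticAt ℂ Z 0 ∧ (VO 2 fun x => Z x - (diagRotation ℓ p).L x) ∧
      ∀ N μ u, AnalyticAt ℂ u 0 → jet N u ∈ weightSpace (fun i => jetDer N (X i)) μ →
      VO (N + 1) fun x => fderiv ℂ u x (Z x) - P μ * u x := by
  have happ := exists_isApprox hF.X_an hX0 hF.comm ℓ hw hF.f_an hF.f_X hP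
  obtain ⟨Z, hZ, c, hc⟩ := hF.exists_symmetry (fun N => by
    obtain ⟨Z, Ψ, h, -⟩ := happ N
    exact ⟨Z, Ψ, h⟩)
  have hZ1 : VO 1 Z := by
    obtain ⟨Z', Ψ, h, -⟩ := happ (1 + c)
    have h1 : VO 1 Z' := by
      simpa [h.Z_zero] using vo_one_of_differentiableAt (𝕜 := ℂ) h.Z_an.differentiableAt
    simpa using h1.sub (hc 1 Z' Ψ h)
  have key : ∀ N μ u, AnalyticAt ℂ u 0 → jet N u ∈ weightSpace (fun i => jetDer N (X i)) μ →
      VO (N + 1) fun x => fderiv ℂ u x (Z x) - P μ * u x := by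
    intro N μ u hu hmem
    obtain ⟨Z', Ψ, h, hZ'⟩ := happ (N + 1 + c)
    obtain ⟨v, hv, hvu, hvw⟩ := exists_weight_lift hF.X_an hX0 hF.comm ℓ
      (by omega : N ≤ N + 1 + c + 1) hu hmem
    have h1 := (hZ' μ v hv hvw).mono (by omega : N + 1 ≤ N + 1 + c + 2)
    have h2 : VO (N + 1) fun x => fderiv ℂ v x (Z' x - Z x) := by
      simpa using (vo_zero_of_continuousAt hv.fderiv.continuousAt).clm_apply (hc (N + 1) Z' Ψ h)
    have h3 : VO (N + 1) fun x => fderiv ℂ (fun x => v x - u x) x (Z x) :=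
      (hvu.fderiv_of_analyticAt (hv.sub hu)).clm_apply hZ1
    have h4 : VO (N + 1) fun x => P μ * (v x - u x) := by
      simpa using (vo_zero_of_continuousAt (continuousAt_const (y := P μ))).mul hvu
    refine (((h1.sub h2).sub h3).add h4).congr ?_
    filter_upwards [hu.eventually_analyticAt, hv.eventually_analyticAt] with x hx1 hx2
    rw [fderiv_fun_sub hx2.differentiableAt hx1.differentiableAt, sub_apply, map_sub]
    ring
  refine ⟨Z, hZ, ?_, key⟩
  have h1 : ∀ j, VO 2 fun x => ℓ (Z x - (diagRotation ℓ p).L x) j := by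
    intro j
    set l : E →L[ℂ] ℂ := (ContinuousLinearMap.proj (R := ℂ) (φ := fun _ : κ => ℂ) j).comp
      (ℓ : E →L[ℂ] (κ → ℂ))
    refine (key 1 (w j) (fun x => l x) (l.analyticAt 0)
      (jet_one_mem_weightSpace hF.X_an hX0 l fun i => hw i j)).congr
      (Eventually.of_forall fun x => ?_)
    change fderiv ℂ l x (Z x) - P (w j) * ℓ x j = _
    rw [ContinuousLinearMap.fderiv, hP]
    change ℓ (Z x) j - p j * ℓ x j = ℓ (Z x - _) j
    rw [map_sub, Pi.sub_apply, coord_diagRotation_L]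
  refine ((vo_pi.2 h1).continuousLinearMap (ℓ.symm : (κ → ℂ) →L[ℂ] E)).congr
    (Eventually.of_forall fun x => ?_)
  exact ℓ.symm_apply_apply _

end WeightSymmetry

section Volterra

variable {E : Type*} [NormedAddCommGroup E] [NormedSpace ℂ E]

/-- The primitive vanishing at `a`, as a continuous linear map on continuous functions. -/
noncomputable def primitiveIcc (E : Type*) [NormedAddCommGroup E] [NormedSpace ℂ E] {a b : ℝ}
    (hb : a ≤ b) : C(Set.Icc a b, E) →L[ℂ] C(Set.Icc a b, E) :=
  LinearMap.mkContinuous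
    { toFun := fun u => ⟨fun s => ∫ t in a..s, u.IccExtend hb t, by
        exact (intervalIntegral.continuous_primitive (fun c d =>
          (u.IccExtend hb).continuous.intervalIntegrable c d) a).comp continuous_subtype_val⟩
      map_add' := fun u v => by
        ext s
        change ∫ t in a..s, (u + v).IccExtend hb t =
          (∫ t in a..s, u.IccExtend hb t) + ∫ t in a..s, v.IccExtend hb t
        rw [← intervalIntegral.integral_add]
        · rfl
        · exact (u.IccExtend hb).continuous.intervalIntegrable _ _
        · exact (v.IccExtend hb).continuous.intervalIntegrable _ _
      map_smul' := fun c u => by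
        ext s
        change ∫ t in a..s, (c • u).IccExtend hb t = c • ∫ t in a..s, u.IccExtend hb t
        rw [← intervalIntegral.integral_smul]
        rfl } (b - a) (fun u => by
      rw [ContinuousMap.norm_le _ (mul_nonneg (sub_nonneg.2 hb) (norm_nonneg _))]
      intro s
      have := intervalIntegral.norm_integral_le_of_norm_le_const (a := a) (b := s) (C := ‖u‖)
        (f := u.IccExtend hb) (fun t _ => u.norm_coe_le_norm _)
      rw [abs_of_nonneg (sub_nonneg.2 s.2.1), mul_comm] at this
      refine this.trans ?_
      gcongr
      exact s.2.2)

theorem primitiveIcc_apply {a b : ℝ} (hb : a ≤ b) (u : C(Set.Icc a b, E)) (s : Set.Icc a b) :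
    primitiveIcc E hb u s = ∫ t in a..s, u.IccExtend hb t := rfl

end Volterra

section AnalyticFlow

variable {E κ : Type*} [NormedAddCommGroup E] [NormedSpace ℂ E]
  [Fintype κ] [DecidableEq κ]

theorem diagRotation_U_neg (ℓ : E ≃L[ℂ] (κ → ℂ)) (p : κ → ℤ) (θ : ℝ) (x : E) :
    (diagRotation ℓ p).U θ ((diagRotation ℓ p).U (-θ) x) = x := by
  apply ℓ.injective
  ext j
  rw [coord_diagRotation_U, coord_diagRotation_U, ← mul_assoc, ← Complex.exp_add]
  simp

/-- The flow of `I • Z` for times in `[0, 2π]`. -/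
theorem exists_analytic_flow [CompleteSpace E] (ℓ : E ≃L[ℂ] (κ → ℂ)) (p : κ → ℤ) {Z : E → E}
    (hZ : AnalyticAt ℂ Z 0) (hZ2 : VO 2 fun x => Z x - (diagRotation ℓ p).L x) :
    ∃ F : E → C(Set.Icc (0 : ℝ) (2 * Real.pi), E), AnalyticAt ℂ F 0 ∧ F 0 = 0 ∧
      ∀ᶠ x in 𝓝 0, ∃ y : ℝ → E, y 0 = x ∧
        ∀ θ : Set.Icc (0 : ℝ) (2 * Real.pi),
          F x θ = y θ ∧ HasDerivAt y (Complex.I • Z (y θ)) θ := by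
  set R := diagRotation ℓ p
  set K := Set.Icc (0 : ℝ) (2 * Real.pi)
  have hb : (0 : ℝ) ≤ 2 * Real.pi := by positivity
  obtain ⟨r, hr, G, hG, hGe⟩ :=
    (hZ.sub (R.L.analyticAt 0)).exists_superposition (K := K)
  set 𝒰 : C(K, E) →L[ℂ] C(K, E) := applyFamily ⟨fun θ : K => R.U θ,
    R.continuous.comp continuous_subtype_val⟩
  set 𝒰' : C(K, E) →L[ℂ] C(K, E) := applyFamily ⟨fun θ : K => R.U (-θ),
    R.continuous.comp continuous_subtype_val.neg⟩
  set B : C(K, E) → C(K, E) := fun u => Complex.I • 𝒰' (G (𝒰 u))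
  have hball : ∀ᶠ u in 𝓝 (0 : C(K, E)), 𝒰 u ∈ Metric.ball (ContinuousMap.const K (0 : E)) r := by
    refine 𝒰.continuous.continuousAt.preimage_mem_nhds ?_
    rw [map_zero]
    exact Metric.ball_mem_nhds _ hr
  have hB : AnalyticAt ℂ B 0 := by
    have h1 : AnalyticAt ℂ G (𝒰 0) := hG _ hball.self_of_nhds
    have h2 : AnalyticAt ℂ (fun u => G (𝒰 u)) 0 := h1.comp (𝒰.analyticAt 0)
    exact (analyticAt_const (v := Complex.I)).smul (f := fun _ => Complex.I) ((𝒰'.analyticAt _).comp h2)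
  have hB2 : VO 2 B := by
    have h1 : VO 2 fun u => G (𝒰 u) := by
      obtain ⟨c, hc, hcb⟩ := hZ2.exists_pos
      have h2 := Metric.eventually_nhds_iff_ball.1 hcb.bound
      obtain ⟨ρ, hρ, h2⟩ := h2
      refine IsBigO.of_bound (c * ‖𝒰‖ ^ 2) ?_
      have h3 : ∀ᶠ u in 𝓝 (0 : C(K, E)), ‖𝒰 u‖ < ρ := by
        have := (𝒰.continuous.norm.tendsto 0).eventually_lt_const (u := ρ) (by simpa using hρ)
        exact this
      filter_upwards [hball, h3] with u hu hu3
      rw [norm_pow, norm_norm, ContinuousMap.norm_le _ (by positivity)]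
      intro k
      have h4 : ‖𝒰 u k‖ ≤ ‖𝒰 u‖ := (𝒰 u).norm_coe_le_norm k
      rw [hGe _ hu k]
      refine (h2 _ (by simpa using h4.trans_lt hu3)).trans ?_
      rw [norm_pow, norm_norm, mul_assoc, ← mul_pow]
      gcongr
      exact h4.trans (𝒰.le_opNorm u)
    simpa [B] using (h1.continuousLinearMap 𝒰').continuousLinearMap
      (Complex.I • ContinuousLinearMap.id ℂ C(K, E))
  set V := primitiveIcc E hb
  set Θ : C(K, E) → C(K, E) := fun u => u - V (B u)
  have hΘ : AnalyticAt ℂ Θ 0 := analyticAt_id.sub ((V.analyticAt _).comp hB)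
  have hΘ2 : VO 2 fun u => Θ u - u := by
    refine (hB2.continuousLinearMap V).neg.congr (Eventually.of_forall fun u => ?_)
    simp [Θ]
  have hΘ0 : Θ 0 = 0 := by simpa using hΘ2.apply_zero
  have hΘ1 : fderiv ℂ Θ 0 = ContinuousLinearMap.id ℂ _ := by
    rw [fderiv_eq_of_vo_two_sub hΘ.differentiableAt differentiableAt_id hΘ2, fderiv_id]
  obtain ⟨k, hk, hk0, -, -, hkr⟩ := hΘ.exists_localInverse hΘ0 hΘ1
  set c : E →L[ℂ] C(K, E) := constFamily ℂ K
  have hkc : AnalyticAt ℂ (fun x => k (c x)) 0 := by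
    refine AnalyticAt.comp (g := k) ?_ (c.analyticAt 0)
    rwa [map_zero]
  have hkc0 : Tendsto (fun x => k (c x)) (𝓝 0) (𝓝 0) := by
    have := hkc.continuousAt.tendsto
    rwa [map_zero, hk0] at this
  have hc0 : Tendsto (fun x => c x) (𝓝 0) (𝓝 0) := by
    simpa using c.continuous.tendsto 0
  refine ⟨fun x => 𝒰 (k (c x)), (𝒰.analyticAt _).comp hkc, by simp [hk0], ?_⟩
  filter_upwards [hkc0.eventually hball, hc0.eventually hkr] with x hx1 hx2
  set u := k (c x)
  set g := (B u).IccExtend hb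
  have hu : ∀ θ : K, u θ = x + ∫ t in (0 : ℝ)..θ, g t := by
    intro θ
    have := congrArg (fun v : C(K, E) => v θ) hx2
    change u θ - V (B u) θ = x at this
    rw [sub_eq_iff_eq_add] at this
    exact this
  refine ⟨fun θ => R.U θ (x + ∫ t in (0 : ℝ)..θ, g t), by simp [R.U_zero], fun θ => ?_⟩
  have e1 : 𝒰 u θ = R.U θ (x + ∫ t in (0 : ℝ)..θ, g t) := by
    rw [← hu θ]; rfl
  refine ⟨e1, ?_⟩
  have d1 : HasDerivAt (fun s : ℝ => x + ∫ t in (0 : ℝ)..s, g t) (g θ) θ :=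
    (intervalIntegral.integral_hasDerivAt_right (g.continuous.intervalIntegrable _ _)
      (g.continuous.stronglyMeasurableAtFilter _ _) g.continuous.continuousAt).const_add x
  have d2 : HasDerivAt (fun s => (R.U s).restrictScalars ℝ)
      ((Complex.I • (R.L ∘L R.U θ)).restrictScalars ℝ) θ := by
    have := ((ContinuousLinearMap.restrictScalarsL ℂ E E ℝ ℝ).hasFDerivAt).comp_hasDerivAt
      (θ : ℝ) (R.hasDerivAt θ)
    exact this
  have d3 := d2.clm_apply d1
  have e2 : g θ = Complex.I • R.U (-θ) ((Z (𝒰 u θ)) - R.L (𝒰 u θ)) := by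
    have : g θ = B u θ := by
      simp [g, ContinuousMap.IccExtend]
    rw [this]
    change Complex.I • R.U (-θ) (G (𝒰 u) θ) = _
    rw [hGe _ hx1]
    rfl
  refine d3.congr_deriv ?_
  change Complex.I • R.L (R.U θ (x + ∫ t in (0 : ℝ)..θ, g t)) + R.U θ (g θ) =
    Complex.I • Z (R.U θ (x + ∫ t in (0 : ℝ)..θ, g t))
  rw [← e1, e2, map_smul, diagRotation_U_neg, ← smul_add, add_sub_cancel]

end AnalyticFlow

section FlowAverage

variable {E : Type*} [NormedAddCommGroup E]

theorem VO.exists_bound_comp_continuousMap {F G K : Type*} [NormedAddCommGroup F]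
    [NormedAddCommGroup G] [TopologicalSpace K] [CompactSpace K]
    {Φ : E → C(K, F)} (hΦ : VO 1 Φ) {N : ℕ} {g : F → G} (hg : VO N g) :
    ∃ C > 0, ∀ᶠ x in 𝓝 0, ∀ k, ‖g (Φ x k)‖ ≤ C * ‖x‖ ^ N := by
  obtain ⟨A, hA, hAb⟩ := hΦ.exists_pos
  obtain ⟨c, hc, hcb⟩ := hg.exists_pos
  obtain ⟨ρ, hρ, h2⟩ := Metric.eventually_nhds_iff_ball.1 hcb.bound
  refine ⟨c * A ^ N, by positivity, ?_⟩
  have h3 : ∀ᶠ x in 𝓝 (0 : E), A * ‖x‖ < ρ := by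
    have : Tendsto (fun x : E => A * ‖x‖) (𝓝 0) (𝓝 0) := by
      simpa using (tendsto_norm_zero (E := E)).const_mul A
    exact this.eventually_lt_const hρ
  filter_upwards [hAb.bound, h3] with x hx hx3 k
  have h4 : ‖Φ x k‖ ≤ A * ‖x‖ := ((Φ x).norm_coe_le_norm k).trans (by simpa using hx)
  refine (h2 _ (by simpa using h4.trans_lt hx3)).trans ?_
  rw [norm_pow, norm_norm, mul_assoc, ← mul_pow]
  gcongr

/-- The characters of the circle as continuous functions on `[0, 2π]`. -/
noncomputable def circleChar (m : ℤ) : C(Set.Icc (0 : ℝ) (2 * Real.pi), ℂ) :=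
  ⟨fun θ => Complex.exp (Complex.I * m * (θ : ℝ)), by fun_prop⟩

theorem circleChar_apply (m : ℤ) (θ : Set.Icc (0 : ℝ) (2 * Real.pi)) :
    circleChar m θ = Complex.exp (Complex.I * m * (θ : ℝ)) := rfl

theorem circleChar_mul (m k : ℤ) : circleChar m * circleChar k = circleChar (m + k) := by
  ext θ
  rw [ContinuousMap.mul_apply, circleChar_apply, circleChar_apply, circleChar_apply,
    ← Complex.exp_add]
  push_cast
  ring_nf

theorem norm_circleChar_apply (m : ℤ) (θ : Set.Icc (0 : ℝ) (2 * Real.pi)) :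
    ‖circleChar m θ‖ = 1 := by
  rw [circleChar_apply, show Complex.I * m * (θ : ℝ) = ((m * θ : ℝ) : ℂ) * Complex.I by
    push_cast; ring]
  exact Complex.norm_exp_ofReal_mul_I _

/-- The mean over the circle. -/
noncomputable def circleMean : C(Set.Icc (0 : ℝ) (2 * Real.pi), ℂ) →L[ℂ] ℂ :=
  ((2 * Real.pi : ℝ) : ℂ)⁻¹ • integralIcc ℂ ℂ (by positivity : (0 : ℝ) ≤ 2 * Real.pi)

theorem circleMean_circleChar (m : ℤ) : circleMean (circleChar m) = if m = 0 then 1 else 0 := by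
  have hpi : ((2 * Real.pi : ℝ) : ℂ) ≠ 0 := by exact_mod_cast (by positivity : 2 * Real.pi ≠ 0)
  rw [circleMean, smul_apply, integralIcc_eq (g := fun θ : ℝ =>
    Complex.exp (Complex.I * m * (θ : ℝ))) _ _ fun t => circleChar_apply m t]
  split_ifs with h
  · subst h
    have : ∀ θ : ℝ, Complex.exp (Complex.I * (0 : ℤ) * (θ : ℝ)) = 1 := by simp
    simp only [this, intervalIntegral.integral_const, sub_zero, smul_eq_mul, Complex.real_smul,
      mul_one]
    exact inv_mul_cancel₀ hpi
  · have hm : Complex.I * m ≠ 0 := mul_ne_zero Complex.I_ne_zero (by exact_mod_cast h)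
    rw [integral_exp_mul_complex hm]
    have : Complex.I * m * ((2 * Real.pi : ℝ) : ℂ) = m * (2 * Real.pi * Complex.I) := by
      push_cast; ring
    rw [this, Complex.exp_int_mul_two_pi_mul_I]
    simp

variable [NormedSpace ℂ E]

/-- An approximate eigenfunction is approximately transported by the flow. -/
theorem vo_flow_of_vo_eigen {Z : E → E} {Φ : E → C(Set.Icc (0 : ℝ) (2 * Real.pi), E)}
    (hΦ : VO 1 Φ) (hode : ∀ᶠ x in 𝓝 0, ∃ y : ℝ → E, y 0 = x ∧
        ∀ θ : Set.Icc (0 : ℝ) (2 * Real.pi),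
          Φ x θ = y θ ∧ HasDerivAt y (Complex.I • Z (y θ)) θ)
    {v : E → ℂ} (hv : AnalyticAt ℂ v 0) {c : ℤ} {N : ℕ}
    (hvc : VO N fun x => fderiv ℂ v x (Z x) - c * v x)
    {V : E → C(Set.Icc (0 : ℝ) (2 * Real.pi), ℂ)} (hV : ∀ᶠ x in 𝓝 0, ∀ θ, V x θ = v (Φ x θ)) :
    VO N fun x => V x - v x • circleChar c := by
  obtain ⟨C, hC, hCb⟩ := hΦ.exists_bound_comp_continuousMap hvc
  have hsmall : ∀ᶠ x in 𝓝 0, ∀ θ, AnalyticAt ℂ v (Φ x θ) := by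
    obtain ⟨ρ, hρ, h⟩ := Metric.eventually_nhds_iff_ball.1 hv.eventually_analyticAt
    obtain ⟨A, hA, hAb⟩ := hΦ.exists_bound_comp_continuousMap (g := fun x : E => x) vo_id
    have : Tendsto (fun x : E => A * ‖x‖ ^ 1) (𝓝 0) (𝓝 0) := by
      simpa using (tendsto_norm_zero (E := E)).const_mul A
    filter_upwards [hAb, this.eventually_lt_const hρ] with x hx hx' θ
    exact h _ (by simpa using (hx θ).trans_lt hx')
  refine IsBigO.of_bound (C * (2 * Real.pi)) ?_
  filter_upwards [hCb, hode, hV, hsmall] with x hx ⟨y, hy0, hy⟩ hVx hvx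
  rw [norm_pow, norm_norm, ContinuousMap.norm_le _ (by positivity)]
  intro θ
  set h : ℝ → ℂ := fun t => Complex.exp (Complex.I * (-c) * t) * v (y t)
  have hd : ∀ t ∈ Set.Icc (0 : ℝ) (2 * Real.pi), HasDerivWithinAt h
      (Complex.exp (Complex.I * (-c) * t) * (Complex.I * (fderiv ℂ v (y t) (Z (y t)) - c * v (y t))))
      (Set.Icc (0 : ℝ) (2 * Real.pi)) t := by
    intro t ht
    obtain ⟨e1, e2⟩ := hy ⟨t, ht⟩
    have hvt := hvx ⟨t, ht⟩
    rw [e1] at hvt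
    have d1 : HasDerivAt (fun t : ℝ => Complex.exp (Complex.I * (-c) * t))
        (Complex.exp (Complex.I * (-c) * t) * (Complex.I * (-c))) t := by
      have := ((hasDerivAt_id (t : ℂ)).const_mul (Complex.I * (-c))).cexp.comp_ofReal
      simpa using this
    have d2 : HasDerivAt (fun t => v (y t)) (fderiv ℂ v (y t) (Complex.I • Z (y t))) t := by
      have := (hvt.differentiableAt.hasFDerivAt.restrictScalars ℝ).comp_hasDerivAt t e2
      exact this
    refine ((d1.mul d2).congr_deriv ?_).hasDerivWithinAt
    rw [map_smul, smul_eq_mul]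
    ring
  have hn : ∀ t : ℝ, ‖Complex.exp (Complex.I * (-c) * t)‖ = 1 := by
    intro t
    rw [show Complex.I * (-c) * (t : ℂ) = ((-c * t : ℝ) : ℂ) * Complex.I by push_cast; ring]
    exact Complex.norm_exp_ofReal_mul_I _
  have hb := (convex_Icc (0 : ℝ) (2 * Real.pi)).norm_image_sub_le_of_norm_hasDerivWithin_le
    (C := C * ‖x‖ ^ N) hd (fun t ht => by
      rw [norm_mul, hn, one_mul, norm_mul, Complex.norm_I, one_mul, ← (hy ⟨t, ht⟩).1]
      exact hx ⟨t, ht⟩) (Set.left_mem_Icc.2 (by positivity)) θ.2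
  have e : V x θ - v x * circleChar c θ =
      Complex.exp (Complex.I * c * (θ : ℝ)) * (h θ - h 0) := by
    have : Complex.exp (Complex.I * c * (θ : ℝ)) * Complex.exp (Complex.I * (-c) * (θ : ℝ)) = 1 := by
      rw [← Complex.exp_add]; simp
    simp only [h, hy0, hVx, (hy θ).1, circleChar_apply]
    rw [mul_sub, ← mul_assoc, this]
    simp [mul_comm]
  change ‖V x θ - v x * circleChar c θ‖ ≤ _
  have hn' := norm_circleChar_apply c θ
  rw [circleChar_apply] at hn'
  rw [e, norm_mul, hn', one_mul]
  refine hb.trans ?_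
  rw [sub_zero, Real.norm_of_nonneg θ.2.1, mul_right_comm]
  gcongr
  exact θ.2.2

theorem exists_average [CompleteSpace E] {κ : Type*} [Fintype κ] [DecidableEq κ]
    (ℓ : E ≃L[ℂ] (κ → ℂ)) (p : κ → ℤ) {Z : E → E}
    (hZ : AnalyticAt ℂ Z 0) (hZ2 : VO 2 fun x => Z x - (diagRotation ℓ p).L x) (q : ℤ)
    {u : E → ℂ} (hu : AnalyticAt ℂ u 0) :
    ∃ u' : E → ℂ, AnalyticAt ℂ u' 0 ∧ ∀ (α : Type*) (N : ℕ) (s : Finset α) (v : α → E → ℂ) (c : α → ℤ),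
      (∀ a ∈ s, AnalyticAt ℂ (v a) 0) →
      (∀ a ∈ s, VO N fun x => fderiv ℂ (v a) x (Z x) - c a * v a x) →
      (VO N fun x => u x - ∑ a ∈ s, v a x) →
      VO N fun x => u' x - ∑ a ∈ s with c a = q, v a x := by
  obtain ⟨Φ, hΦ, hΦ0, hode⟩ := exists_analytic_flow ℓ p hZ hZ2
  have hΦ1 : VO 1 Φ := vo_one_of_differentiableAt (𝕜 := ℂ) hΦ.differentiableAt hΦ0
  have hsup : ∀ g : E → ℂ, AnalyticAt ℂ g 0 → ∃ G : E → C(Set.Icc (0 : ℝ) (2 * Real.pi), ℂ), AnalyticAt ℂ G 0 ∧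
      ∀ᶠ x in 𝓝 0, ∀ θ, G x θ = g (Φ x θ) := by
    intro g hg
    obtain ⟨r, hr, G, hG, hGe⟩ := hg.exists_superposition (K := Set.Icc (0 : ℝ) (2 * Real.pi))
    have hball : ∀ᶠ x in 𝓝 (0 : E), Φ x ∈ Metric.ball (ContinuousMap.const _ (0 : E)) r := by
      refine hΦ.continuousAt.preimage_mem_nhds ?_
      rw [hΦ0]
      exact Metric.ball_mem_nhds _ hr
    refine ⟨fun x => G (Φ x), ?_, ?_⟩
    · exact (hG _ hball.self_of_nhds).comp hΦ
    · filter_upwards [hball] with x hx using hGe _ hx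
  obtain ⟨G, hG, hGe⟩ := hsup u hu
  set T : C(Set.Icc (0 : ℝ) (2 * Real.pi), ℂ) →L[ℂ] ℂ :=
    circleMean ∘L (ContinuousLinearMap.mul ℂ C(Set.Icc (0 : ℝ) (2 * Real.pi), ℂ) (circleChar (-q)))
  have hT : ∀ w, T w = circleMean (circleChar (-q) * w) := fun w => rfl
  refine ⟨fun x => T (G x), (T.analyticAt _).comp hG, fun α N s v c hv hvc huv => ?_⟩
  choose! H hH hHe using hsup
  have h1 : ∀ a ∈ s, VO N fun x => H (v a) x - v a x • circleChar (c a) := fun a ha =>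
    vo_flow_of_vo_eigen hΦ1 hode (hv a ha) (hvc a ha) (hHe _ (hv a ha))
  have h2 : VO N fun x => G x - ∑ a ∈ s, H (v a) x := by
    obtain ⟨C, hC, hCb⟩ := hΦ1.exists_bound_comp_continuousMap huv
    refine IsBigO.of_bound C ?_
    have h3 : ∀ᶠ x in 𝓝 0, ∀ a ∈ s, ∀ θ, H (v a) x θ = v a (Φ x θ) :=
      (Finset.eventually_all s).2 fun a ha => hHe _ (hv a ha)
    filter_upwards [hCb, hGe, h3] with x hx hx1 hx2
    rw [norm_pow, norm_norm, ContinuousMap.norm_le _ (by positivity)]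
    intro θ
    have : (G x - ∑ a ∈ s, H (v a) x) θ = u (Φ x θ) - ∑ a ∈ s, v a (Φ x θ) := by
      rw [ContinuousMap.sub_apply, ContinuousMap.sum_apply, hx1]
      exact congrArg _ (Finset.sum_congr rfl fun a ha => hx2 a ha θ)
    rw [this]
    exact hx θ
  have h3 : VO N fun x => G x - ∑ a ∈ s, v a x • circleChar (c a) := by
    refine (h2.add (VO.sum (s := s) h1)).congr (Eventually.of_forall fun x => ?_)
    simp [Finset.sum_sub_distrib]
  refine (h3.continuousLinearMap T).congr (Eventually.of_forall fun x => ?_)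
  have hTc : ∀ a, T (circleChar (c a)) = if c a = q then 1 else 0 := by
    intro a
    rw [hT, circleChar_mul, circleMean_circleChar]
    simp only [neg_add_eq_zero, eq_comm]
  beta_reduce
  rw [map_sub, map_sum]
  simp only [map_smul, hTc, smul_eq_mul, mul_ite, mul_one, mul_zero, Finset.sum_filter]

end FlowAverage

section Eigenfunctions

variable {E κ τ : Type*} [NormedAddCommGroup E] [NormedSpace ℂ E] [CompleteSpace E]
  [Fintype κ] [DecidableEq κ] [Fintype τ] [DecidableEq τ]

theorem IsFrame.exists_iterated_average {ρ : Type*} {f : E → ℂ} {X : τ → E → E}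
    {K : τ → E → E →L[ℂ] ℂ}
    (hF : IsFrame f X K) (hX0 : ∀ i, X i 0 = 0) (ℓ : E ≃L[ℂ] (κ → ℂ)) {w : κ → τ → ℂ}
    (hw : ∀ i j, ∃ k : ℕ, ∀ x, ℓ (((fderiv ℂ (X i) 0 - w j i • 1) ^ k) x) j = 0)
    {P : ρ → (τ → ℂ) →+ ℂ} {p : ρ → κ → ℤ} (hP : ∀ a j, P a (w j) = p a j) (q : ρ → ℤ)
    {g : E → ℂ} (hg : AnalyticAt ℂ g 0) (t : Finset ρ) :
    ∃ u : E → ℂ, AnalyticAt ℂ u 0 ∧ ∀ (α : Type*) (N : ℕ) (s : Finset α) (v : α → E → ℂ)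
      (μ : α → τ → ℂ) (m : α → ρ → ℤ), (∀ a ∈ s, AnalyticAt ℂ (v a) 0) →
      (∀ a ∈ s, jet N (v a) ∈ weightSpace (fun i => jetDer N (X i)) (μ a)) →
      (∀ a b, P b (μ a) = m a b) → (VO (N + 1) fun x => g x - ∑ a ∈ s, v a x) →
      VO (N + 1) fun x => u x - ∑ a ∈ s with ∀ b ∈ t, m a b = q b, v a x := by
  classical
  induction t using Finset.induction_on with
  | empty => exact ⟨g, hg, fun α N s v μ m _ _ _ h => by simpa using h⟩
  | insert b t hb ih =>
    obtain ⟨u, hu, hus⟩ := ih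
    obtain ⟨Z, hZ, hZ2, hZw⟩ := hF.exists_weight_symmetry hX0 ℓ hw (hP b)
    obtain ⟨u', hu', h⟩ := exists_average ℓ (p b) hZ hZ2 (q b) hu
    refine ⟨u', hu', fun α N s v μ m hv hvw hm hvg => ?_⟩
    have := h α (N + 1) (s.filter fun a => ∀ b ∈ t, m a b = q b) v (fun a => m a b)
      (fun a ha => hv a (Finset.mem_filter.1 ha).1) (fun a ha => ?_)
      (hus α N s v μ m hv hvw hm hvg)
    · refine this.congr (Eventually.of_forall fun x => ?_)
      rw [Finset.filter_filter]
      simp only [Finset.forall_mem_insert, and_comm]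
    · have ha' := (Finset.mem_filter.1 ha).1
      simpa [hm] using hZw N (μ a) (v a) (hv a ha') (hvw a ha')

theorem IsFrame.exists_eigenfunctions {ρ : Type*} [Fintype ρ] {f : E → ℂ} {X : τ → E → E}
    {K : τ → E → E →L[ℂ] ℂ}
    (hF : IsFrame f X K) (hX0 : ∀ i, X i 0 = 0) (ℓ : E ≃L[ℂ] (κ → ℂ)) {w : κ → τ → ℂ}
    (hw : ∀ i j, ∃ k : ℕ, ∀ x, ℓ (((fderiv ℂ (X i) 0 - w j i • 1) ^ k) x) j = 0)
    {P : ρ → (τ → ℂ) →+ ℂ} {p : ρ → κ → ℤ} (hP : ∀ a j, P a (w j) = p a j)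
    (hsep : ∀ j, ∀ μ ∈ AddSubmonoid.closure (Set.range w), (∀ a, P a μ = p a j) → μ = w j) :
    ∃ ξ : κ → E → ℂ, (∀ j, AnalyticAt ℂ (ξ j) 0) ∧ (∀ j, VO 2 fun x => ξ j x - ℓ x j) ∧
      ∀ j N, jet N (ξ j) ∈ weightSpace (fun i => jetDer N (X i)) (w j) := by
  set l : κ → E →L[ℂ] ℂ := fun j => (ContinuousLinearMap.proj (R := ℂ) (φ := fun _ : κ => ℂ) j).comp
      (ℓ : E →L[ℂ] (κ → ℂ))
  have main : ∀ j, ∃ ξ : E → ℂ, AnalyticAt ℂ ξ 0 ∧ (VO 2 fun x => ξ x - ℓ x j) ∧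
      ∀ N, jet N ξ ∈ weightSpace (fun i => jetDer N (X i)) (w j) := by
    intro j
    obtain ⟨u, hu, h⟩ := hF.exists_iterated_average hX0 ℓ hw hP (fun a => p a j)
      ((l j).analyticAt 0) Finset.univ
    have hu2 : VO 2 fun x => u x - ℓ x j := by
      have := h κ 1 {j} (fun j x => l j x) w (fun j a => p a j) (fun j _ => (l j).analyticAt 0)
        (fun j _ => jet_one_mem_weightSpace hF.X_an hX0 (l j) fun i => hw i j)
        (fun j a => hP a j) (by simpa using VO.zero)
      simpa [l, Finset.filter_singleton] using this
    refine ⟨u, hu, hu2, fun N => ?_⟩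
    have key : ∀ N, 1 ≤ N → jet N u ∈ weightSpace (fun i => jetDer N (X i)) (w j) := by
      intro N hN
      obtain ⟨ξ, hξ, hξ2, hξw⟩ := exists_weight_coordinates hF.X_an hX0 hF.comm ℓ hw hN
      have hmem : jet N (fun x => l j x) ∈ (⊤ : Submodule ℂ (Jet E N)) := trivial
      rw [← span_jet_monomials ℓ hξ hξ2 N, Submodule.mem_span_range_iff_exists_fun] at hmem
      obtain ⟨c, hc⟩ := hmem
      set v : (Σ k : Fin (N + 1), (Fin k → κ)) → E → ℂ := fun a => c a • ∏ s, ξ (a.2 s)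
      have hprod : ∀ a : (Σ k : Fin (N + 1), (Fin k → κ)), AnalyticAt ℂ (∏ s, ξ (a.2 s)) 0 :=
        fun a => Finset.analyticAt_prod _ fun s _ => hξ _
      have hv : ∀ a, AnalyticAt ℂ (v a) 0 := fun a => analyticAt_const.smul (hprod a)
      have hjv : ∀ a, jet N (v a) = c a • ∏ s, jet N (ξ (a.2 s)) := fun a => by
        rw [jet_smul (hprod a), jet_prod fun s _ => hξ _]
      have hvw : ∀ a, jet N (v a) ∈ weightSpace (fun i => jetDer N (X i)) (∑ s, w (a.2 s)) :=
        fun a => by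
          rw [hjv]
          exact Submodule.smul_mem _ _ (prod_mem_weightSpace
            (fun i => jetDer_mul (hF.X_an i) (hX0 i)) _ fun s _ => hξw _)
      have h1 := h _ N Finset.univ v (fun a => ∑ s, w (a.2 s)) (fun a b => ∑ s, p b (a.2 s))
        (fun a _ => hv a) (fun a _ => hvw a) (fun a b => by simp [map_sum, hP]) (by
          have := (jet_eq_iff ((l j).analyticAt 0) (v := ∑ a, v a)
            (Finset.analyticAt_sum _ fun a _ => hv a)).1 (by
              rw [jet_sum fun a _ => hv a, ← hc]
              exact Finset.sum_congr rfl fun a _ => (hjv a).symm)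
          simpa using this)
      set T := Finset.univ.filter fun a : (Σ k : Fin (N + 1), (Fin k → κ)) =>
        ∀ b ∈ (Finset.univ : Finset ρ), (fun b => ∑ s, p b (a.2 s)) b = (fun a => p a j) b
      have h2 : jet N u = ∑ a ∈ T, jet N (v a) := by
        rw [← jet_sum fun a _ => hv a]
        refine (jet_eq_iff hu (Finset.analyticAt_sum _ fun a _ => hv a)).2 ?_
        simpa [T] using h1
      rw [h2]
      refine Submodule.sum_mem _ fun a ha => ?_
      have hμ : ∑ s, w (a.2 s) = w j := by
        refine hsep j _ (sum_mem fun s _ => AddSubmonoid.subset_closure ⟨_, rfl⟩) fun b => ?_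
        have : ∑ s, p b (a.2 s) = p b j := (Finset.mem_filter.1 ha).2 b (Finset.mem_univ _)
        rw [map_sum, ← this]
        simp [hP]
      rw [← hμ]
      exact hvw a
    rcases Nat.eq_zero_or_pos N with rfl | hN
    · have h0 : jet 0 u = 0 := by
        refine (jet_eq_zero_iff hu).2 ?_
        have hl : VO 1 (l j) := by simpa using vo_id.continuousLinearMap (l j)
        simpa [l] using (hu2.mono one_le_two).add hl
      rw [h0]
      exact Submodule.zero_mem _
    · exact key N hN
  choose ξ h1 h2 h3 using main
  exact ⟨ξ, h1, h2, h3⟩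

end Eigenfunctions

section Resonance

/-- Finitely many vectors can be given integral coordinates by additive functions that separate
the points of the lattice generated by them. -/
theorem exists_integral_coordinates {V κ : Type*} [AddCommGroup V] [Module ℚ V] [Finite κ]
    (w : κ → V) :
    ∃ (r : ℕ) (P : Fin r → V →+ ℂ) (p : Fin r → κ → ℤ), (∀ a j, P a (w j) = p a j) ∧
      ∀ μ ∈ AddSubmonoid.closure (Set.range w), ∀ ν ∈ AddSubmonoid.closure (Set.range w),
        (∀ a, P a μ = P a ν) → μ = ν := by
  classical
  have := Fintype.ofFinite κ
  set V₀ := Submodule.span ℚ (Set.range w)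
  have : FiniteDimensional ℚ V₀ := FiniteDimensional.span_of_finite ℚ (Set.finite_range w)
  set b := Module.finBasis ℚ V₀
  have hw : ∀ j, w j ∈ V₀ := fun j => Submodule.subset_span ⟨j, rfl⟩
  choose c hc using fun a => LinearMap.exists_extend (b.coord a)
  have hc' : ∀ a (x : V₀), c a x = b.repr x a := fun a x => by
    rw [← Module.Basis.coord_apply, ← hc a]; rfl
  set D : ℕ := ∏ a, ∏ j, (c a (w j)).den
  have hD : D ≠ 0 := Finset.prod_ne_zero_iff.2 fun a _ => Finset.prod_ne_zero_iff.2 fun j _ =>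
    (c a (w j)).den_ne_zero
  have h_int : ∀ a j, ∃ z : ℤ, (D : ℚ) * c a (w j) = z := by
    intro a j
    obtain ⟨e, he⟩ : (c a (w j)).den ∣ D :=
      (Finset.dvd_prod_of_mem _ (Finset.mem_univ j)).trans
        (Finset.dvd_prod_of_mem (fun a => ∏ j, (c a (w j)).den) (Finset.mem_univ a))
    refine ⟨e * (c a (w j)).num, ?_⟩
    rw [he]
    push_cast
    rw [mul_right_comm, mul_comm ((c a (w j)).den : ℚ), Rat.mul_den_eq_num, mul_comm]
  choose p hp using h_int
  refine ⟨_, fun a => ((algebraMap ℚ ℂ : ℚ →+ ℂ).comp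
    ((AddMonoidHom.mulLeft (D : ℚ)).comp (c a).toAddMonoidHom)), p, fun a j => ?_,
    fun μ hμ ν hν h => ?_⟩
  · change algebraMap ℚ ℂ ((D : ℚ) * c a (w j)) = _
    rw [hp]; simp
  · have hle : AddSubmonoid.closure (Set.range w) ≤ V₀.toAddSubmonoid :=
      AddSubmonoid.closure_le.2 (by rintro _ ⟨j, rfl⟩; exact hw j)
    have : (⟨μ, hle hμ⟩ : V₀) = ⟨ν, hle hν⟩ := by
      refine b.ext_elem fun a => ?_
      have h1 : algebraMap ℚ ℂ ((D : ℚ) * c a μ) = algebraMap ℚ ℂ ((D : ℚ) * c a ν) := h a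
      have h2 := mul_left_cancel₀ (by exact_mod_cast hD) ((algebraMap ℚ ℂ).injective h1)
      rw [← hc', ← hc']
      exact h2
    exact congrArg Subtype.val this

end Resonance

section Eigenfunctions

variable {E κ τ : Type*} [NormedAddCommGroup E] [NormedSpace ℂ E] [CompleteSpace E]
  [Fintype κ] [DecidableEq κ] [Fintype τ] [DecidableEq τ]

/-- Convergent simultaneous normal form: the common generalized eigenfunctions. -/
theorem IsFrame.exists_weight_functions {f : E → ℂ} {X : τ → E → E}
    {K : τ → E → E →L[ℂ] ℂ}
    (hF : IsFrame f X K) (hX0 : ∀ i, X i 0 = 0) (ℓ : E ≃L[ℂ] (κ → ℂ)) {w : κ → τ → ℂ}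
    (hw : ∀ i j, ∃ k : ℕ, ∀ x, ℓ (((fderiv ℂ (X i) 0 - w j i • 1) ^ k) x) j = 0) :
    ∃ ξ : κ → E → ℂ, (∀ j, AnalyticAt ℂ (ξ j) 0) ∧ (∀ j, VO 2 fun x => ξ j x - ℓ x j) ∧
      ∀ j N, jet N (ξ j) ∈ weightSpace (fun i => jetDer N (X i)) (w j) := by
  obtain ⟨r, P, p, hP, h⟩ := exists_integral_coordinates w
  exact hF.exists_eigenfunctions hX0 ℓ hw hP fun j μ hμ hPμ =>
    h μ hμ (w j) (AddSubmonoid.subset_closure ⟨j, rfl⟩) fun a => by rw [hPμ, hP]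

end Eigenfunctions

section PullBack

variable {E κ τ : Type*} [NormedAddCommGroup E] [NormedSpace ℂ E] [CompleteSpace E]
  [Fintype κ] [DecidableEq κ]

/-- In coordinates given by generalized eigenfunctions, the vector fields commute with the diagonal
linear vector fields, which annihilate the common first integrals. -/
theorem exists_normalForm_of_weight_functions {X : τ → E → E}
    (hX : ∀ i, AnalyticAt ℂ (X i) 0) (hX0 : ∀ i, X i 0 = 0)
    (hcomm : ∀ a b, ∀ᶠ x in 𝓝 0, fderiv ℂ (X b) x (X a x) = fderiv ℂ (X a) x (X b x))
    (ℓ : E ≃L[ℂ] (κ → ℂ)) {w : κ → τ → ℂ} {η : E → E} (hη : AnalyticAt ℂ η 0)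
    (hη2 : VO 2 fun x => η x - x)
    (hηw : ∀ j N, jet N (fun x => ℓ (η x) j) ∈ weightSpace (fun i => jetDer N (X i)) (w j))
    (k : τ) :
    ∃ z : E → E, AnalyticAt ℂ z 0 ∧ z 0 = 0 ∧
      (∀ᶠ x in 𝓝 0, fderiv ℂ η x (z x) = diagOp ℓ (fun j => w j k) (η x)) ∧
      (∀ i, ∀ᶠ x in 𝓝 0, fderiv ℂ (X i) x (z x) = fderiv ℂ z x (X i x)) ∧
      ∀ u : E → ℂ, AnalyticAt ℂ u 0 → (∀ i, ∀ᶠ x in 𝓝 0, fderiv ℂ u x (X i x) = 0) →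
        ∀ᶠ x in 𝓝 0, fderiv ℂ u x (z x) = 0 := by
  have hη0 : η 0 = 0 := by simpa using hη2.apply_zero
  have hη1 : fderiv ℂ η 0 = ContinuousLinearMap.id ℂ E :=
    (fderiv_eq_of_vo_two_sub hη.differentiableAt differentiableAt_id hη2).trans fderiv_id
  obtain ⟨Φ, hΦ, hΦ0, hΦ1, hΦη, hηΦ⟩ := hη.exists_localInverse hη0 hη1
  have hct : Tendsto η (𝓝 0) (𝓝 0) := by simpa [hη0] using hη.continuousAt.tendsto
  have hct' : Tendsto Φ (𝓝 0) (𝓝 0) := by simpa [hΦ0] using hΦ.continuousAt.tendsto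
  have hinv : ∀ᶠ y in 𝓝 0, ∀ v, fderiv ℂ η (Φ y) (fderiv ℂ Φ y v) = v := by
    filter_upwards [hηΦ.eventually_nhds, hΦ.eventually_analyticAt,
      hct'.eventually hη.eventually_analyticAt] with y h1 h2 h3 v
    have h4 := (h3.differentiableAt.hasFDerivAt.comp y h2.differentiableAt.hasFDerivAt)
    have h5 : HasFDerivAt (fun x => x) (fderiv ℂ η (Φ y) ∘L fderiv ℂ Φ y) y :=
      h4.congr_of_eventuallyEq (h1.mono fun z hz => hz.symm)
    have h6 := h5.unique (hasFDerivAt_id y)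
    exact congrArg (fun T : E →L[ℂ] E => T v) h6
  set L : E →L[ℂ] E := diagOp ℓ (fun j => w j k) with hL
  set Z : E → E := fun x => fderiv ℂ Φ (η x) (L (η x)) with hZdef
  have hZ : AnalyticAt ℂ Z 0 := by
    have h1 : AnalyticAt ℂ (fderiv ℂ Φ) (η 0) := by rw [hη0]; exact hΦ.fderiv
    exact (h1.fun_comp hη).clm_apply_of ((L.analyticAt _).fun_comp hη)
  have hZ0 : Z 0 = 0 := by simp [hZdef, hη0]
  have hηZ : ∀ᶠ x in 𝓝 0, fderiv ℂ η x (Z x) = L (η x) := by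
    filter_upwards [hct.eventually hinv, hΦη] with x h1 h2
    have := h1 (L (η x))
    rwa [h2] at this
  set c : κ → E →L[ℂ] ℂ := fun j =>
    (ContinuousLinearMap.proj (R := ℂ) (φ := fun _ : κ => ℂ) j).comp (ℓ : E →L[ℂ] (κ → ℂ)) with hc'
  set ξ : κ → E → ℂ := fun j x => ℓ (η x) j with hξdef
  have hξ : ∀ j, AnalyticAt ℂ (ξ j) 0 := fun j => ((c j).analyticAt _).fun_comp hη
  have hξℓ : ∀ j, VO 2 fun x => ξ j x - ℓ x j := fun j =>
    (hη2.continuousLinearMap (c j)).congr (Eventually.of_forall fun x => by simp [hc', hξdef])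
  have hZξ : ∀ N j, jetDer N Z (jet N (ξ j)) = w j k • jet N (ξ j) := by
    intro N j
    rw [jetDer_jet hZ hZ0 (hξ j), ← jet_smul (hξ j)]
    refine jet_congr ?_
    filter_upwards [hηZ, hη.eventually_analyticAt] with x h1 h2
    have h3 : HasFDerivAt (ξ j) _ x :=
      ((c j).hasFDerivAt (x := η x)).comp x h2.differentiableAt.hasFDerivAt
    rw [lieD, h3.fderiv, ContinuousLinearMap.comp_apply, h1]
    exact coord_diagOp ℓ _ _ j
  have hc : ∀ N i j, Commute (jetDer N (X i)) (jetDer N (X j)) := fun N i j =>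
    jetDer_commute (hX i) (hX0 i) (hX j) (hX0 j) (hcomm i j)
  have hz : ∀ N μ, ∀ a ∈ weightSpace (fun i => jetDer N (X i)) μ,
      jetDer N Z a = Pi.evalAddMonoidHom (fun _ : τ => ℂ) k μ • a := fun N μ a ha =>
    apply_eq_smul_of_mem_weightSpace (hc N) (fun i => jetDer_mul (hX i) (hX0 i))
      (fun j => hηw j N) (span_jet_monomials ℓ hξ hξℓ N) (jetDer_mul hZ hZ0) (hZξ N) ha
  refine ⟨Z, hZ, hZ0, hηZ, fun i => ?_, fun u hu hXu => ?_⟩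
  · set B : E → E := fun x => fderiv ℂ (X i) x (Z x) - fderiv ℂ Z x (X i x) with hB
    have hBan : AnalyticAt ℂ B 0 :=
      ((hX i).fderiv.clm_apply_of hZ).sub (hZ.fderiv.clm_apply_of (hX i))
    have hBv : ∀ N, VO N B := by
      intro N
      have hfin : FiniteDimensional ℂ (Jet E (N + 1)) := finiteDimensional_jet ℓ (N + 1)
      have h1 := (commute_of_apply_eq_smul (hc (N + 1)) (iSup_weightSpace_eq_top (hc (N + 1)))
        (hz (N + 1)) i).symm
      have h2 : ∀ j, VO N fun x => ℓ (B x) j := fun j =>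
        (vo_bracket_of_commute hZ hZ0 (hX i) (hX0 i) h1 (c j)).mono (by omega)
      refine ((vo_pi.2 h2).continuousLinearMap (ℓ.symm : (κ → ℂ) →L[ℂ] E)).congr
        (Eventually.of_forall fun x => ?_)
      exact ℓ.symm_apply_apply _
    filter_upwards [hBan.eventually_eq_zero_of_vo hBv] with x hx
    exact sub_eq_zero.1 hx
  · refine (hZ.lieD hu).eventually_eq_zero_of_vo fun N => ?_
    have h1 : jet (N + 1) u ∈ weightSpace (fun i => jetDer (N + 1) (X i)) 0 := by
      rw [mem_weightSpace]
      refine fun i => ⟨1, ?_⟩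
      simp only [Pi.zero_apply, zero_smul, sub_zero, pow_one]
      rw [jetDer_jet (hX i) (hX0 i) hu, jet_eq_zero_iff ((hX i).lieD hu)]
      exact VO.zero.congr ((hXu i).mono fun x hx => hx.symm)
    have h2 := hz (N + 1) 0 _ h1
    rw [jetDer_jet hZ hZ0 hu, map_zero, zero_smul, jet_eq_zero_iff (hZ.lieD hu)] at h2
    exact h2.mono (by omega)

end PullBack

section PowerSeries

theorem analyticAt_of_hasSum_of_norm_le {E F : Type*} [NormedAddCommGroup E] [NormedSpace ℂ E]
    [NormedAddCommGroup F] [NormedSpace ℂ F] (q : FormalMultilinearSeries ℂ E F) {g : E → F}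
    {C a : ℝ} (ha : 0 < a) (hq : ∀ k, ‖q k‖ ≤ C * a ^ k)
    (hg : ∀ᶠ y in 𝓝 0, HasSum (fun k => q k fun _ => y) (g y)) : AnalyticAt ℂ g 0 := by
  obtain ⟨r, hr, hr'⟩ := Metric.eventually_nhds_iff.1 hg
  have hrad : ENNReal.ofReal a⁻¹ ≤ q.radius := by
    refine q.le_radius_of_bound C fun k => ?_
    rw [Real.coe_toNNReal _ (inv_nonneg.2 ha.le)]
    calc ‖q k‖ * a⁻¹ ^ k ≤ C * a ^ k * a⁻¹ ^ k :=
          mul_le_mul_of_nonneg_right (hq k) (by positivity)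
      _ = C := by rw [mul_assoc, ← mul_pow, mul_inv_cancel₀ ha.ne', one_pow, mul_one]
  refine ⟨q, min (ENNReal.ofReal a⁻¹) (ENNReal.ofReal r), (min_le_left _ _).trans hrad, ?_,
    fun {y} hy => ?_⟩
  · simp [ha, hr]
  · rw [zero_add]
    refine hr' ?_
    have h1 := (mem_eball_zero_iff.1 hy).trans_le (min_le_right _ _)
    rw [dist_zero_right]
    rw [← ofReal_norm] at h1
    exact (ENNReal.ofReal_lt_ofReal_iff hr).1 h1

end PowerSeries

section Identity

/-- The germs of analytic functions have no zero divisors. -/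
theorem AnalyticAt.eventually_eq_zero_or_of_mul {𝕜 E : Type*} [RCLike 𝕜] [NormedAddCommGroup E]
    [NormedSpace 𝕜 E] {f g : E → 𝕜} (hf : AnalyticAt 𝕜 f 0) (hg : AnalyticAt 𝕜 g 0)
    (h : ∀ᶠ x in 𝓝 0, f x * g x = 0) : (∀ᶠ x in 𝓝 0, f x = 0) ∨ ∀ᶠ x in 𝓝 0, g x = 0 := by
  let _ : NormedSpace ℝ E := NormedSpace.restrictScalars ℝ 𝕜 E
  obtain ⟨r, hr, hr'⟩ := Metric.eventually_nhds_iff_ball.1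
    (h.and (hf.eventually_analyticAt.and hg.eventually_analyticAt))
  by_cases hzero : ∀ y ∈ Metric.ball (0 : E) r, f y = 0
  · exact Or.inl (by filter_upwards [Metric.ball_mem_nhds (0 : E) hr] with y hy using hzero y hy)
  · push Not at hzero
    obtain ⟨y, hy, hfy⟩ := hzero
    have h1 : g =ᶠ[𝓝 y] 0 := by
      filter_upwards [(hr' y hy).2.1.continuousAt.eventually_ne hfy,
        Metric.isOpen_ball.mem_nhds hy] with x hx hxr
      exact (mul_eq_zero.1 (hr' x hxr).1).resolve_left hx
    have h2 : AnalyticOnNhd 𝕜 g (Metric.ball 0 r) := fun x hx => (hr' x hx).2.2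
    have h3 := h2.eqOn_zero_of_preconnected_of_eventuallyEq_zero
      (convex_ball (0 : E) r).isPreconnected hy h1
    exact Or.inr (by filter_upwards [Metric.ball_mem_nhds (0 : E) hr] with y hy using h3 hy)

/-- The inclusion of `ℝⁿ` in `ℂⁿ`. -/
noncomputable def ofRealPi (ι : Type*) : (ι → ℝ) →L[ℝ] (ι → ℂ) :=
  ContinuousLinearMap.pi fun i => Complex.ofRealCLM.comp (ContinuousLinearMap.proj i)

@[simp]
theorem ofRealPi_apply {ι : Type*} (x : ι → ℝ) (i : ι) : ofRealPi ι x i = x i := rfl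

theorem norm_ofRealPi {ι : Type*} [Fintype ι] (x : ι → ℝ) : ‖ofRealPi ι x‖ = ‖x‖ := by
  simp [Pi.norm_def]

theorem ofRealPi_re_add_im {ι : Type*} (z : ι → ℂ) :
    ofRealPi ι (fun i => (z i).re) + Complex.I • ofRealPi ι (fun i => (z i).im) = z := by
  ext i
  simp [mul_comm Complex.I]

theorem tendsto_ofRealPi {ι : Type*} : Tendsto (ofRealPi ι) (𝓝 0) (𝓝 0) := by
  simpa using (ofRealPi ι).continuous.tendsto 0

/-- The identity principle on a totally real subspace. -/
theorem AnalyticAt.eventually_eq_zero_of_ofRealPi {ι : Type*} [Fintype ι] {g : (ι → ℂ) → ℂ} (hg : AnalyticAt ℂ g 0)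
    (h : ∀ᶠ x in 𝓝 0, g (ofRealPi ι x) = 0) : ∀ᶠ z in 𝓝 0, g z = 0 := by
  obtain ⟨r, hr, hr1⟩ := Metric.eventually_nhds_iff_ball.1 hg.eventually_analyticAt
  obtain ⟨s, hs, hs1⟩ := Metric.eventually_nhds_iff_ball.1 h
  have hρ : 0 < min r s / 3 := by positivity
  filter_upwards [Metric.ball_mem_nhds (0 : ι → ℂ) hρ] with z hz
  rw [mem_ball_zero_iff, lt_div_iff₀ three_pos, mul_comm, lt_min_iff] at hz
  set u : ι → ℝ := fun i => (z i).re
  set v : ι → ℝ := fun i => (z i).im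
  have hu : ‖u‖ ≤ ‖z‖ := pi_norm_le_iff_of_nonneg (norm_nonneg _) |>.2 fun i =>
    (Complex.abs_re_le_norm _).trans (norm_le_pi_norm z i)
  have hv : ‖v‖ ≤ ‖z‖ := pi_norm_le_iff_of_nonneg (norm_nonneg _) |>.2 fun i =>
    (Complex.abs_im_le_norm _).trans (norm_le_pi_norm z i)
  set φ : ℂ → ι → ℂ := fun t => ofRealPi ι u + t • ofRealPi ι v with hφ
  have hφan : ∀ t, AnalyticAt ℂ φ t := fun t =>
    analyticAt_const.add (analyticAt_id.smul analyticAt_const)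
  have hφr : ∀ t ∈ Metric.ball (0 : ℂ) 2, φ t ∈ Metric.ball (0 : ι → ℂ) r := by
    intro t ht
    rw [mem_ball_zero_iff] at ht ⊢
    calc _ ≤ ‖ofRealPi ι u‖ + ‖t • ofRealPi ι v‖ := norm_add_le _ _
      _ ≤ ‖z‖ + 2 * ‖z‖ := by
        rw [norm_smul, norm_ofRealPi, norm_ofRealPi]
        exact add_le_add hu (mul_le_mul ht.le hv (norm_nonneg _) two_pos.le)
      _ < r := by linarith [hz.1]
  have h1 : AnalyticOnNhd ℂ (fun t => g (φ t)) (Metric.ball 0 2) := fun t ht =>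
    (hr1 _ (hφr t ht)).comp (hφan t)
  have hreal : ∀ t : ℝ, |t| < 1 → g (φ t) = 0 := by
    intro t ht
    have e : φ t = ofRealPi ι (u + t • v) := by ext i; simp [hφ]
    rw [e]
    refine hs1 _ ?_
    rw [mem_ball_zero_iff]
    calc _ ≤ ‖u‖ + ‖t • v‖ := norm_add_le _ _
      _ ≤ ‖z‖ + 1 * ‖z‖ := by
        rw [norm_smul, Real.norm_eq_abs]
        exact add_le_add hu (mul_le_mul ht.le hv (norm_nonneg _) one_pos.le)
      _ < s := by linarith [hz.2, norm_nonneg z]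
  have hfreq : ∃ᶠ t in 𝓝[≠] (0 : ℂ), g (φ t) = 0 := by
    have ht : Tendsto (fun t : ℝ => (t : ℂ)) (𝓝[≠] 0) (𝓝[≠] 0) := by
      refine tendsto_nhdsWithin_of_tendsto_nhds_of_eventually_within _ ?_ ?_
      · simpa using (Complex.continuous_ofReal.tendsto 0).mono_left nhdsWithin_le_nhds
      · filter_upwards [self_mem_nhdsWithin] with t ht
        simpa using ht
    refine ht.frequently (Eventually.frequently ?_)
    filter_upwards [nhdsWithin_le_nhds (Metric.ball_mem_nhds (0 : ℝ) one_pos)] with t ht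
    exact hreal t (by simpa using ht)
  have h2 := h1.eqOn_zero_of_preconnected_of_frequently_eq_zero
    (convex_ball (0 : ℂ) 2).isPreconnected (Metric.mem_ball_self two_pos) hfreq
    (show Complex.I ∈ Metric.ball (0 : ℂ) 2 by simp)
  have h3 : φ Complex.I = z := ofRealPi_re_add_im z
  simpa [h3] using h2

end Identity

section Conjugation

theorem AnalyticAt.star_star {E F : Type*} [NormedAddCommGroup E] [NormedSpace ℂ E]
    [StarAddMonoid E] [NormedStarGroup E] [StarModule ℂ E] [NormedAddCommGroup F] [NormedSpace ℂ F]
    [StarAddMonoid F] [NormedStarGroup F] [StarModule ℂ F] {f : E → F} (hf : AnalyticAt ℂ f 0) :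
    AnalyticAt ℂ (fun z => star (f (star z))) 0 := by
  obtain ⟨p, hp⟩ := hf
  obtain ⟨C, a, hC, ha, hpa⟩ := p.le_mul_pow_of_radius_pos hp.radius_pos
  have e : ∀ {k : ℕ} [DecidableEq (Fin k)] (v : Fin k → E) i x,
      (fun j => star (Function.update v i x j)) = Function.update (fun j => star (v j)) i (star x) :=
    fun v i x => by
      ext j
      rcases eq_or_ne j i with rfl | h <;> simp_all
  have hb : ∀ k (v : Fin k → E), ‖star (p k fun i => star (v i))‖ ≤ ‖p k‖ * ∏ i, ‖v i‖ := by
    intro k v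
    rw [norm_star]
    simpa using (p k).le_opNorm fun i => star (v i)
  set q : FormalMultilinearSeries ℂ E F := fun k => MultilinearMap.mkContinuous
    { toFun := fun v => star (p k fun i => star (v i))
      map_update_add' := fun v i x y => by simp only [e, star_add, (p k).map_update_add]
      map_update_smul' := fun v i c x => by
        simp only [e, star_smul, (p k).map_update_smul, _root_.star_star] } ‖p k‖ (hb k)
  have hq : ∀ k, ‖q k‖ ≤ ‖p k‖ := fun k => MultilinearMap.mkContinuous_norm_le _ (norm_nonneg _) _
  refine analyticAt_of_hasSum_of_norm_le q ha (fun k => (hq k).trans (hpa k)) ?_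
  have h1 : Tendsto (fun y : E => star y) (𝓝 0) (𝓝 0) := by
    simpa using (continuous_star.tendsto (0 : E))
  filter_upwards [h1.eventually hp.eventually_hasSum] with y hy
  rw [zero_add] at hy
  exact hy.map (starAddEquiv : F ≃+ F) continuous_star

end Conjugation

section Complexification

variable {ι : Type*} [Fintype ι]

theorem AnalyticAt.exists_complexification {g : (ι → ℝ) → ℝ} (hg : AnalyticAt ℝ g 0) :
    ∃ G : (ι → ℂ) → ℂ, AnalyticAt ℂ G 0 ∧ ∀ᶠ x in 𝓝 0, G (ofRealPi ι x) = g x := by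
  classical
  obtain ⟨p, hp⟩ := hg
  obtain ⟨C, a, hC, ha, hpa⟩ := p.le_mul_pow_of_radius_pos hp.radius_pos
  set q : FormalMultilinearSeries ℂ (ι → ℂ) ℂ := fun k => ∑ e : Fin k → ι,
    ((p k fun i => Pi.single (e i) 1 : ℝ) : ℂ) •
      (ContinuousMultilinearMap.mkPiAlgebra ℂ (Fin k) ℂ).compContinuousLinearMap
        fun i => ContinuousLinearMap.proj (R := ℂ) (φ := fun _ : ι => ℂ) (e i) with hqdef
  have hproj : ∀ i, ‖ContinuousLinearMap.proj (R := ℂ) (φ := fun _ : ι => ℂ) i‖ ≤ 1 := fun i =>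
    ContinuousLinearMap.opNorm_le_bound _ zero_le_one fun z => by
      simpa using norm_le_pi_norm z i
  have hq : ∀ k, ‖q k‖ ≤ C * (Fintype.card ι * a) ^ k := by
    intro k
    have h1 : ∀ e ∈ (Finset.univ : Finset (Fin k → ι)),
        ‖((p k fun i => Pi.single (e i) 1 : ℝ) : ℂ) •
      (ContinuousMultilinearMap.mkPiAlgebra ℂ (Fin k) ℂ).compContinuousLinearMap
        fun i => ContinuousLinearMap.proj (R := ℂ) (φ := fun _ : ι => ℂ) (e i)‖ ≤ C * a ^ k := by
      intro e _
      rw [norm_smul, Complex.norm_real]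
      have h2 : ‖p k fun i => Pi.single (e i) (1 : ℝ)‖ ≤ C * a ^ k := by
        refine ((p k).le_opNorm _).trans ?_
        simpa [Pi.norm_single] using hpa k
      have h3 := (ContinuousMultilinearMap.norm_compContinuousLinearMap_le
        (ContinuousMultilinearMap.mkPiAlgebra ℂ (Fin k) ℂ)
        fun i => ContinuousLinearMap.proj (R := ℂ) (φ := fun _ : ι => ℂ) (e i))
      have h4 : ‖(ContinuousMultilinearMap.mkPiAlgebra ℂ (Fin k) ℂ).compContinuousLinearMap
          fun i => ContinuousLinearMap.proj (R := ℂ) (φ := fun _ : ι => ℂ) (e i)‖ ≤ 1 := by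
        refine h3.trans ?_
        rw [ContinuousMultilinearMap.norm_mkPiAlgebra, one_mul]
        exact Finset.prod_le_one (fun i _ => norm_nonneg _) fun i _ => hproj _
      calc _ ≤ C * a ^ k * 1 := mul_le_mul h2 h4 (norm_nonneg _) (by positivity)
        _ = _ := mul_one _
    refine (norm_sum_le_of_le _ h1).trans ?_
    rw [Finset.sum_const, Finset.card_univ, Fintype.card_fun, Fintype.card_fin, nsmul_eq_mul,
      mul_pow]
    push_cast
    exact (by ring : (_ : ℝ) = _).le
  have hqr : ∀ k (x : ι → ℝ), q k (fun _ => ofRealPi ι x) = (p k fun _ => x : ℝ) := by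
    intro k x
    have hx : x = ∑ i, x i • Pi.single (M := fun _ => ℝ) i 1 := by
      ext j; simp [Finset.sum_apply, Pi.single_apply]
    have h1 : (p k fun _ => x) = ∑ e : Fin k → ι, (∏ i, x (e i)) *
        p k fun i => Pi.single (e i) 1 := by
      conv_lhs => rw [hx]
      have := (p k).toMultilinearMap.map_sum (fun (_ : Fin k) (j : ι) =>
        x j • Pi.single (M := fun _ => ℝ) j 1)
      refine this.trans (Finset.sum_congr rfl fun e _ => ?_)
      exact (p k).toMultilinearMap.map_smul_univ _ _
    rw [h1]
    simp [hqdef, mul_comm]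
  have hrad : 0 < q.radius := by
    have hb : 0 < Fintype.card ι * a + 1 := by positivity
    refine lt_of_lt_of_le (b := ((Real.toNNReal (Fintype.card ι * a + 1)⁻¹ : NNReal) : ENNReal))
      (by simp [hb]) ?_
    refine q.le_radius_of_bound C fun k => ?_
    rw [Real.coe_toNNReal _ (inv_nonneg.2 hb.le)]
    calc ‖q k‖ * (Fintype.card ι * a + 1)⁻¹ ^ k
        ≤ C * (Fintype.card ι * a) ^ k * (Fintype.card ι * a + 1)⁻¹ ^ k :=
          mul_le_mul_of_nonneg_right (hq k) (by positivity)
      _ ≤ C * (Fintype.card ι * a + 1) ^ k * (Fintype.card ι * a + 1)⁻¹ ^ k := by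
          gcongr; linarith
      _ = C := by rw [mul_assoc, ← mul_pow, mul_inv_cancel₀ hb.ne', one_pow, mul_one]
  refine ⟨q.sum, (q.hasFPowerSeriesOnBall hrad).analyticAt, ?_⟩
  filter_upwards [hp.eventually_hasSum] with x hx
  rw [zero_add] at hx
  rw [FormalMultilinearSeries.sum]
  simp only [hqr]
  rw [← Complex.ofReal_tsum, hx.tsum_eq]

theorem AnalyticAt.exists_complexification_pi {κ : Type*} [Fintype κ] {g : (ι → ℝ) → κ → ℝ}
    (hg : AnalyticAt ℝ g 0) :
    ∃ G : (ι → ℂ) → κ → ℂ, AnalyticAt ℂ G 0 ∧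
      ∀ᶠ x in 𝓝 0, G (ofRealPi ι x) = ofRealPi κ (g x) := by
  have h1 : ∀ j, AnalyticAt ℝ (fun x => g x j) 0 := fun j =>
    ((ContinuousLinearMap.proj (R := ℝ) (φ := fun _ : κ => ℝ) j).analyticAt _).fun_comp hg
  choose G hG hGe using fun j => (h1 j).exists_complexification
  refine ⟨fun z j => G j z, AnalyticAt.pi hG, ?_⟩
  filter_upwards [eventually_all.2 hGe] with x hx
  ext j
  exact hx j

end Complexification

section Determinant

variable (𝕜 : Type*) [RCLike 𝕜] {n : ℕ}

/-- The determinant as a continuous multilinear function of the rows. -/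
noncomputable def volForm (n : ℕ) :
    ContinuousMultilinearMap 𝕜 (fun _ : Fin n => Fin n → 𝕜) 𝕜 :=
  { (Matrix.detRowAlternating (n := Fin n) (R := 𝕜)).toMultilinearMap with
    cont := (continuous_id (X := Matrix (Fin n) (Fin n) 𝕜)).matrix_det }

theorem volForm_apply (v : Fin n → Fin n → 𝕜) : volForm 𝕜 n v = (Matrix.of v).det := rfl

variable {𝕜}

theorem volForm_eq_zero_of_eq {v : Fin n → Fin n → 𝕜} {i j : Fin n} (h : i ≠ j)
    (hv : v i = v j) : volForm 𝕜 n v = 0 := Matrix.det_zero_of_row_eq h hv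

theorem volForm_swap (v : Fin n → Fin n → 𝕜) {i j : Fin n} (h : i ≠ j) :
    volForm 𝕜 n (v ∘ Equiv.swap i j) = -volForm 𝕜 n v :=
  (Matrix.detRowAlternating (n := Fin n) (R := 𝕜)).map_swap v h

theorem volForm_smul_eq_sum (v : Fin n → Fin n → 𝕜) (V : Fin n → 𝕜) :
    volForm 𝕜 n v • V = ∑ i, volForm 𝕜 n (Function.update v i V) • v i := by
  have h := Matrix.mulVec_cramer (Matrix.of v).transpose V
  rw [Matrix.det_transpose] at h
  rw [volForm_apply, ← h]
  ext j
  simp only [Matrix.mulVec, dotProduct, Finset.sum_apply, Pi.smul_apply, smul_eq_mul,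
    Matrix.cramer_transpose_apply, Matrix.transpose_apply, Matrix.of_apply]
  exact Finset.sum_congr rfl fun i _ => mul_comm _ _

theorem volForm_comp (T : (Fin n → 𝕜) →L[𝕜] (Fin n → 𝕜)) (v : Fin n → Fin n → 𝕜) :
    volForm 𝕜 n (fun i => T (v i)) =
      LinearMap.det (T : (Fin n → 𝕜) →ₗ[𝕜] (Fin n → 𝕜)) * volForm 𝕜 n v := by
  rw [volForm_apply, volForm_apply, ← LinearMap.det_toMatrix',
    ← Matrix.det_transpose (LinearMap.toMatrix' _), mul_comm, ← Matrix.det_mul]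
  congr 1
  ext i j
  have h := congrFun (LinearMap.toMatrix'_mulVec (T : (Fin n → 𝕜) →ₗ[𝕜] (Fin n → 𝕜)) (v i)) j
  simp only [Matrix.of_apply, Matrix.mul_apply, Matrix.transpose_apply]
  refine h.symm.trans ?_
  simp only [Matrix.mulVec, dotProduct]
  exact Finset.sum_congr rfl fun i _ => mul_comm _ _

theorem sum_volForm_update (T : (Fin n → 𝕜) →L[𝕜] (Fin n → 𝕜)) (v : Fin n → Fin n → 𝕜) :
    ∑ i, volForm 𝕜 n (Function.update v i (T (v i))) =
      LinearMap.trace 𝕜 _ (T : (Fin n → 𝕜) →ₗ[𝕜] (Fin n → 𝕜)) * volForm 𝕜 n v := by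
  set A := LinearMap.toMatrix' (T : (Fin n → 𝕜) →ₗ[𝕜] (Fin n → 𝕜))
  have hγ : ∀ t : 𝕜, HasDerivAt (fun t : 𝕜 => v + t • fun i => T (v i)) (fun i => T (v i)) t :=
    fun t => by simpa using ((hasDerivAt_id t).smul_const (fun i => T (v i))).const_add v
  have h1 := ((volForm 𝕜 n).hasFDerivAt (x := v + (0 : 𝕜) • fun i => T (v i))).comp_hasDerivAt 0
    (hγ 0)
  rw [ContinuousMultilinearMap.linearDeriv_apply, zero_smul, add_zero] at h1
  have h2 : ∀ t : 𝕜, volForm 𝕜 n (v + t • fun i => T (v i)) =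
      (1 + A.trace * t + (1 + (Polynomial.X : Polynomial 𝕜) • A.map Polynomial.C).det.divX.divX.eval
        t * t ^ 2) * volForm 𝕜 n v := by
    intro t
    rw [← Matrix.det_one_add_smul]
    have h3 := volForm_comp (ContinuousLinearMap.id 𝕜 (Fin n → 𝕜) + t • T) v
    rw [← LinearMap.det_toMatrix'] at h3
    have h4 : LinearMap.toMatrix' ((ContinuousLinearMap.id 𝕜 (Fin n → 𝕜) + t • T :
        (Fin n → 𝕜) →L[𝕜] (Fin n → 𝕜)) : (Fin n → 𝕜) →ₗ[𝕜] (Fin n → 𝕜)) = 1 + t • A := by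
      rw [← LinearMap.toMatrix'_id, ← map_smul, ← map_add]
      rfl
    rw [h4] at h3
    exact h3
  have h5 : HasDerivAt (fun t : 𝕜 => (1 + A.trace * t +
      (1 + (Polynomial.X : Polynomial 𝕜) • A.map Polynomial.C).det.divX.divX.eval t * t ^ 2) *
        volForm 𝕜 n v) (A.trace * volForm 𝕜 n v) 0 := by
    have h6 := ((((hasDerivAt_id (0 : 𝕜)).const_mul A.trace).const_add 1).add
      (((1 + (Polynomial.X : Polynomial 𝕜) • A.map Polynomial.C).det.divX.divX.hasDerivAt
        (0 : 𝕜)).mul ((hasDerivAt_id (0 : 𝕜)).pow 2))).mul_const (volForm 𝕜 n v)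
    simpa using h6
  have h7 : (⇑(volForm 𝕜 n) ∘ fun t : 𝕜 => v + t • fun i => T (v i)) = _ := funext h2
  rw [h7] at h1
  rw [h1.unique h5, ← Matrix.trace_toLin'_eq, Matrix.toLin'_toMatrix']

/-- The contraction of the volume form with `m` vector fields in dimension `m + 1`. -/
noncomputable def fluxForm {m : ℕ} (X : Fin m → (Fin (m + 1) → 𝕜) → Fin (m + 1) → 𝕜)
    (x : Fin (m + 1) → 𝕜) : (Fin (m + 1) → 𝕜) →L[𝕜] 𝕜 :=
  (volForm 𝕜 (m + 1)).toContinuousLinearMap (Fin.cons 0 fun i => X i x) 0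

variable {m : ℕ} {X : Fin m → (Fin (m + 1) → 𝕜) → Fin (m + 1) → 𝕜}

theorem fluxForm_apply (x V : Fin (m + 1) → 𝕜) :
    fluxForm X x V = volForm 𝕜 (m + 1) (Fin.cons V fun i => X i x) := by
  change volForm 𝕜 (m + 1) (Function.update (Fin.cons 0 fun i => X i x) 0 V) = _
  rw [Fin.update_cons_zero]

theorem fluxForm_self (x : Fin (m + 1) → 𝕜) (i : Fin m) : fluxForm X x (X i x) = 0 := by
  rw [fluxForm_apply]
  exact volForm_eq_zero_of_eq (Fin.succ_ne_zero i).symm rfl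

theorem analyticAt_clm_of_apply {ι F : Type*} [Fintype ι] [NormedAddCommGroup F]
    [NormedSpace 𝕜 F] {E : Type*} [NormedAddCommGroup E] [NormedSpace 𝕜 E]
    {α : E → (ι → 𝕜) →L[𝕜] F} {x₀ : E}
    (h : ∀ V, AnalyticAt 𝕜 (fun x => α x V) x₀) : AnalyticAt 𝕜 α x₀ := by
  classical
  have e : α = fun x => ∑ i, (ContinuousLinearMap.smulRightL 𝕜 (ι → 𝕜) F
      (ContinuousLinearMap.proj (R := 𝕜) (φ := fun _ : ι => 𝕜) i)) (α x (Pi.single i 1)) := by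
    ext x V
    conv_lhs => rw [pi_eq_sum_univ' V, map_sum]
    simp [sum_apply]
  rw [e]
  exact Finset.analyticAt_fun_sum _ fun i _ =>
    (ContinuousLinearMap.analyticAt _ _).fun_comp (h _)

theorem volForm_analyticAt {E : Type*} [NormedAddCommGroup E] [NormedSpace 𝕜 E]
    {v : E → Fin n → Fin n → 𝕜} {x₀ : E} (hv : ∀ i, AnalyticAt 𝕜 (fun x => v x i) x₀) :
    AnalyticAt 𝕜 (fun x => volForm 𝕜 n (v x)) x₀ :=
  (volForm 𝕜 n).analyticAt.fun_comp (AnalyticAt.pi hv)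

theorem analyticAt_cons {E : Type*} [NormedAddCommGroup E] [NormedSpace 𝕜 E]
    {W : E → Fin (m + 1) → 𝕜} {v : E → Fin m → Fin (m + 1) → 𝕜} {x₀ : E}
    (hW : AnalyticAt 𝕜 W x₀) (hv : ∀ i, AnalyticAt 𝕜 (fun x => v x i) x₀) (i : Fin (m + 1)) :
    AnalyticAt 𝕜 (fun x => (Fin.cons (W x) (v x) : Fin (m + 1) → Fin (m + 1) → 𝕜) i) x₀ := by
  cases i using Fin.cases with
  | zero => exact hW
  | succ i => exact hv i

theorem fluxForm_analyticAt {x₀ : Fin (m + 1) → 𝕜} (hX : ∀ i, AnalyticAt 𝕜 (X i) x₀) :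
    AnalyticAt 𝕜 (fluxForm X) x₀ :=
  analyticAt_clm_of_apply fun V => by
    simp only [fluxForm_apply]
    exact volForm_analyticAt (analyticAt_cons analyticAt_const hX)

theorem fderiv_fluxForm_apply {x : Fin (m + 1) → 𝕜} (hX : ∀ i, AnalyticAt 𝕜 (X i) x)
    (V W : Fin (m + 1) → 𝕜) :
    fderiv 𝕜 (fluxForm X) x V W = ∑ i, volForm 𝕜 (m + 1)
      (Fin.cons W (Function.update (fun i => X i x) i (fderiv 𝕜 (X i) x V))) := by
  have h1 : HasFDerivAt (fun y => (Fin.cons W fun i => X i y : Fin (m + 1) → Fin (m + 1) → 𝕜))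
      (ContinuousLinearMap.pi (Fin.cons 0 fun i => fderiv 𝕜 (X i) x)) x := by
    rw [hasFDerivAt_pi]
    intro i
    cases i using Fin.cases with
    | zero => exact hasFDerivAt_const _ _
    | succ i => exact (hX i).differentiableAt.hasFDerivAt
  have h2 := ((volForm 𝕜 (m + 1)).hasFDerivAt
    (x := (Fin.cons W fun i => X i x : Fin (m + 1) → Fin (m + 1) → 𝕜))).comp x h1
  have h3 : HasFDerivAt (fun y => fluxForm X y W) ((fderiv 𝕜 (fluxForm X) x).flip W) x := by
    simpa using! ((fluxForm_analyticAt hX).differentiableAt.hasFDerivAt.clm_apply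
      (hasFDerivAt_const W x))
  have h4 := congrArg (fun T : (Fin (m + 1) → 𝕜) →L[𝕜] 𝕜 => T V) (h3.unique (by
    simpa only [Function.comp_def, ← fluxForm_apply] using h2))
  refine h4.trans ?_
  rw [ContinuousLinearMap.comp_apply, ContinuousMultilinearMap.linearDeriv_apply,
    Fin.sum_univ_succ]
  have h5 : ∀ v : Fin (m + 1) → Fin (m + 1) → 𝕜,
      volForm 𝕜 (m + 1) (Function.update v 0 0) = 0 := fun v =>
    (volForm 𝕜 (m + 1)).map_coord_zero 0 (Function.update_self ..)
  refine (congrArg₂ (· + ·) (h5 _) rfl).trans ((zero_add _).trans ?_)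
  refine Finset.sum_congr rfl fun i _ => ?_
  rw [Fin.cons_update]
  rfl

/-- Transport of the flux form by a linear map `T` acting on the vector fields. -/
theorem sum_volForm_cons_update (T : (Fin (m + 1) → 𝕜) →L[𝕜] (Fin (m + 1) → 𝕜))
    (W : Fin (m + 1) → 𝕜) (v : Fin m → Fin (m + 1) → 𝕜) :
    ∑ i, volForm 𝕜 (m + 1) (Fin.cons W (Function.update v i (T (v i)))) =
      LinearMap.trace 𝕜 _ (T : (Fin (m + 1) → 𝕜) →ₗ[𝕜] (Fin (m + 1) → 𝕜)) *
        volForm 𝕜 (m + 1) (Fin.cons W v) - volForm 𝕜 (m + 1) (Fin.cons (T W) v) := by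
  rw [← sum_volForm_update T, Fin.sum_univ_succ]
  simp only [Fin.cons_zero, Fin.update_cons_zero, Fin.cons_succ, Fin.cons_update]
  ring

end Determinant

section FluxFormClosed

variable {𝕜 : Type*} [RCLike 𝕜] {m : ℕ} {X : Fin m → (Fin (m + 1) → 𝕜) → Fin (m + 1) → 𝕜}
  {x : Fin (m + 1) → 𝕜}

theorem fderiv_fluxForm_self_left (hX : ∀ i, AnalyticAt 𝕜 (X i) x)
    (hcomm : ∀ a b, fderiv 𝕜 (X b) x (X a x) = fderiv 𝕜 (X a) x (X b x))
    (hdiv : ∀ i, LinearMap.trace 𝕜 _ (fderiv 𝕜 (X i) x : (Fin (m + 1) → 𝕜) →ₗ[𝕜] _) = 0)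
    (a : Fin m) (V : Fin (m + 1) → 𝕜) :
    fderiv 𝕜 (fluxForm X) x (X a x) V = -fluxForm X x (fderiv 𝕜 (X a) x V) := by
  rw [fderiv_fluxForm_apply hX]
  simp only [fun i => hcomm a i]
  rw [sum_volForm_cons_update (fderiv 𝕜 (X a) x) V fun i => X i x, hdiv a, zero_mul, zero_sub,
    fluxForm_apply]

theorem fderiv_fluxForm_self_right (hX : ∀ i, AnalyticAt 𝕜 (X i) x) (a : Fin m)
    (V : Fin (m + 1) → 𝕜) :
    fderiv 𝕜 (fluxForm X) x V (X a x) = -fluxForm X x (fderiv 𝕜 (X a) x V) := by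
  rw [fderiv_fluxForm_apply hX, Finset.sum_eq_single a]
  · rw [fluxForm_apply, ← volForm_swap _ (Fin.succ_ne_zero a).symm]
    congr 1
    ext1 j
    cases j using Fin.cases with
    | zero => simp
    | succ j =>
      by_cases h : j = a
      · subst h; simp
      · have h' : j.succ ≠ a.succ := fun e => h (Fin.succ_injective _ e)
        simp [Function.update_of_ne h, Equiv.swap_apply_of_ne_of_ne (Fin.succ_ne_zero j) h']
  · intro i _ hi
    refine volForm_eq_zero_of_eq (Fin.succ_ne_zero a).symm ?_
    simp [Function.update_of_ne hi.symm]
  · simp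

theorem volForm_smul_eq_fluxForm_smul_add_sum (V U : Fin (m + 1) → 𝕜) :
    fluxForm X x U • V = fluxForm X x V • U + ∑ j, volForm 𝕜 (m + 1)
      (Function.update (Fin.cons U fun i => X i x) j.succ V) • X j x := by
  rw [fluxForm_apply, volForm_smul_eq_sum, Fin.sum_univ_succ, Fin.update_cons_zero, fluxForm_apply]
  rfl

theorem fluxForm_mul_fderiv_symm (hX : ∀ i, AnalyticAt 𝕜 (X i) x)
    (hcomm : ∀ a b, fderiv 𝕜 (X b) x (X a x) = fderiv 𝕜 (X a) x (X b x))
    (hdiv : ∀ i, LinearMap.trace 𝕜 _ (fderiv 𝕜 (X i) x : (Fin (m + 1) → 𝕜) →ₗ[𝕜] _) = 0)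
    (U V W : Fin (m + 1) → 𝕜) :
    fluxForm X x U * (fderiv 𝕜 (fluxForm X) x V W - fderiv 𝕜 (fluxForm X) x W V) = 0 := by
  set D := fderiv 𝕜 (fluxForm X) x
  have h1 : ∀ a V, D (X a x) V = D V (X a x) := fun a V => by
    rw [fderiv_fluxForm_self_left hX hcomm hdiv, fderiv_fluxForm_self_right hX]
  have h2 : ∀ V W, fluxForm X x U * (D V W - D W V) =
      fluxForm X x V * (D U W - D W U) := by
    intro V W
    have e1 := congrArg (fun Z => D Z W - D W Z)
      (volForm_smul_eq_fluxForm_smul_add_sum (X := X) (x := x) V U)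
    simp only [map_add, map_smul, map_sum, add_apply, smul_apply, sum_apply, smul_eq_mul, h1] at e1
    linear_combination e1
  by_cases hU : fluxForm X x U = 0
  · rw [hU, zero_mul]
  · have h3 : D U W - D W U = 0 := by
      have h4 := h2 W U
      rw [sub_self, mul_zero] at h4
      have := (mul_eq_zero.mp h4).resolve_left hU
      linear_combination -this
    rw [h2, h3, mul_zero]

theorem eventually_fderiv_fluxForm_symm (hX : ∀ i, AnalyticAt 𝕜 (X i) 0)
    (hcomm : ∀ a b, ∀ᶠ x in 𝓝 0, fderiv 𝕜 (X b) x (X a x) = fderiv 𝕜 (X a) x (X b x))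
    (hdiv : ∀ i, ∀ᶠ x in 𝓝 0,
      LinearMap.trace 𝕜 _ (fderiv 𝕜 (X i) x : (Fin (m + 1) → 𝕜) →ₗ[𝕜] _) = 0)
    (hind : ¬ ∀ᶠ x in 𝓝 0, fluxForm X x = 0) :
    ∀ᶠ x in 𝓝 0, ∀ V W, fderiv 𝕜 (fluxForm X) x V W = fderiv 𝕜 (fluxForm X) x W V := by
  have hα : AnalyticAt 𝕜 (fluxForm X) 0 := fluxForm_analyticAt hX
  have hU : ∃ U, ¬ ∀ᶠ x in 𝓝 0, fluxForm X x U = 0 := by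
    by_contra! h
    refine hind ?_
    have h1 : ∀ i : Fin (m + 1), ∀ᶠ x in 𝓝 0, fluxForm X x (Pi.single i 1) = 0 := fun i => h _
    filter_upwards [eventually_all.mpr h1] with x hx
    ext V
    rw [pi_eq_sum_univ' V, map_sum]
    simp [hx]
  obtain ⟨U, hU⟩ := hU
  have h1 : ∀ V W, ∀ᶠ x in 𝓝 0,
      fderiv 𝕜 (fluxForm X) x V W - fderiv 𝕜 (fluxForm X) x W V = 0 := by
    intro V W
    refine (AnalyticAt.eventually_eq_zero_or_of_mul (f := fun x => fluxForm X x U)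
      (hα.clm_apply_of analyticAt_const)
      (((hα.fderiv.clm_apply_of analyticAt_const).clm_apply_of analyticAt_const).sub
        ((hα.fderiv.clm_apply_of analyticAt_const).clm_apply_of analyticAt_const))
      ?_).resolve_left hU
    have h2 : ∀ᶠ x in 𝓝 0, ∀ i, AnalyticAt 𝕜 (X i) x :=
      eventually_all.mpr fun i => (hX i).eventually_analyticAt
    filter_upwards [h2, eventually_all.mpr fun a => eventually_all.mpr (hcomm a),
      eventually_all.mpr hdiv] with x h3 h4 h5
    exact fluxForm_mul_fderiv_symm h3 h4 h5 U V W
  have h2 := eventually_all.mpr fun i : Fin (m + 1) => eventually_all.mpr fun j : Fin (m + 1) =>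
    h1 (Pi.single i 1) (Pi.single j 1)
  filter_upwards [h2] with x hx V W
  rw [pi_eq_sum_univ' V, pi_eq_sum_univ' W]
  simp only [map_sum, sum_apply, map_smul, smul_apply, Finset.smul_sum]
  rw [Finset.sum_comm]
  refine Finset.sum_congr rfl fun i _ => Finset.sum_congr rfl fun j _ => ?_
  rw [sub_eq_zero.mp (hx i j), smul_comm]

theorem eventually_forall_mem_ball {E : Type*} [NormedAddCommGroup E] {p : E → Prop}
    (h : ∀ᶠ x in 𝓝 (0 : E), p x) : ∃ r > 0, ∀ x ∈ Metric.ball (0 : E) r, p x :=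
  Metric.eventually_nhds_iff_ball.mp h

/-- A primitive of the flux form of commuting divergence-free vector fields. -/
theorem exists_primitive_fluxForm {X : Fin m → (Fin (m + 1) → ℂ) → Fin (m + 1) → ℂ}
    (hX : ∀ i, AnalyticAt ℂ (X i) 0)
    (hcomm : ∀ a b, ∀ᶠ x in 𝓝 0, fderiv ℂ (X b) x (X a x) = fderiv ℂ (X a) x (X b x))
    (hdiv : ∀ i, ∀ᶠ x in 𝓝 0,
      LinearMap.trace ℂ _ (fderiv ℂ (X i) x : (Fin (m + 1) → ℂ) →ₗ[ℂ] _) = 0)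
    (hind : ¬ ∀ᶠ x in 𝓝 0, fluxForm X x = 0) :
    ∃ f : (Fin (m + 1) → ℂ) → ℂ, AnalyticAt ℂ f 0 ∧ f 0 = 0 ∧
      ∀ᶠ x in 𝓝 0, HasFDerivAt f (fluxForm X x) x := by
  have hα : AnalyticAt ℂ (fluxForm X) 0 := fluxForm_analyticAt hX
  obtain ⟨r, hr, h⟩ := eventually_forall_mem_ball (hα.eventually_analyticAt.and
    (eventually_fderiv_fluxForm_symm hX hcomm hdiv hind))
  have hd : ∀ x ∈ Metric.ball 0 r, HasFDerivAt (𝕜 := ℝ) (fluxForm X)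
      ((fderiv ℂ (fluxForm X) x).restrictScalars ℝ) x := fun x hx =>
    (h x hx).1.differentiableAt.hasFDerivAt.restrictScalars ℝ
  obtain ⟨f, hf⟩ := Convex.exists_forall_hasFDerivAt_of_fderiv_symmetric
    (convex_ball (0 : Fin (m + 1) → ℂ) r) Metric.isOpen_ball
    (fun x hx => (hd x hx).differentiableAt.differentiableWithinAt)
    (show ∀ x ∈ Metric.ball 0 r, ∀ V W, fderiv ℝ (fluxForm X) x V W = fderiv ℝ (fluxForm X) x W V
      from fun x hx V W => by
      rw [(hd x hx).fderiv]
      exact (h x hx).2 V W)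
  have hf' : ∀ᶠ x in 𝓝 0, HasFDerivAt f (fluxForm X x) x :=
    Metric.eventually_nhds_iff_ball.mpr ⟨r, hr, hf⟩
  exact ⟨fun x => f x - f 0, (analyticAt_of_hasFDerivAt_analyticAt hα hf').sub analyticAt_const,
    sub_self _, hf'.mono fun x hx => hx.sub_const _⟩

theorem exists_isFrame {X : Fin m → (Fin (m + 1) → ℂ) → Fin (m + 1) → ℂ}
    (hX : ∀ i, AnalyticAt ℂ (X i) 0)
    (hcomm : ∀ a b, ∀ᶠ x in 𝓝 0, fderiv ℂ (X b) x (X a x) = fderiv ℂ (X a) x (X b x))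
    (hdiv : ∀ i, ∀ᶠ x in 𝓝 0,
      LinearMap.trace ℂ _ (fderiv ℂ (X i) x : (Fin (m + 1) → ℂ) →ₗ[ℂ] _) = 0)
    (hind : ¬ ∀ᶠ x in 𝓝 0, fluxForm X x = 0) :
    ∃ f K, IsFrame f X K ∧ ∀ᶠ x in 𝓝 0, fderiv ℂ f x = fluxForm X x := by
  obtain ⟨f, hfan, hf0, hf⟩ := exists_primitive_fluxForm hX hcomm hdiv hind
  have hf' : ∀ᶠ x in 𝓝 0, fderiv ℂ f x = fluxForm X x := hf.mono fun x hx => hx.fderiv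
  set c : (Fin (m + 1) → ℂ) → Fin (m + 1) → Fin (m + 1) → ℂ := fun x => Fin.cons x fun i => X i x
    with hc
  refine ⟨f, fun j x => (volForm ℂ (m + 1)).toContinuousLinearMap (c x) j.succ,
    ⟨hfan, hX, fun j => ?_, hf0, fun h => hind ?_, ?_, fun j => ?_, fun j a => ?_, fun a => ?_,
      hcomm⟩, hf'⟩
  · refine analyticAt_clm_of_apply fun V => ?_
    change AnalyticAt ℂ (fun x => volForm ℂ (m + 1) (Function.update (c x) j.succ V)) 0
    refine volForm_analyticAt fun i => ?_
    by_cases hi : i = j.succ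
    · subst hi
      simpa using! analyticAt_const
    · simp only [Function.update_of_ne hi, hc]
      exact analyticAt_cons analyticAt_id hX i
  · filter_upwards [hf', Filter.EventuallyEq.fderiv (𝕜 := ℂ) h] with x h1 h2
    rw [← h1, h2, fderiv_fun_const]
    rfl
  · filter_upwards [hf'] with x hx V
    rw [hx]
    exact volForm_smul_eq_fluxForm_smul_add_sum V x
  · refine Eventually.of_forall fun x => volForm_eq_zero_of_eq (Fin.succ_ne_zero j) ?_
    simp [hc, Function.update_of_ne (Fin.succ_ne_zero j).symm]
  · filter_upwards [hf'] with x hx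
    rw [hx, fluxForm_apply]
    change volForm ℂ (m + 1) (Function.update (c x) j.succ (X a x)) = _
    split_ifs with h
    · subst h
      rw [Function.update_eq_self_iff.mpr (by simp [hc])]
    · refine volForm_eq_zero_of_eq (fun e => h (Fin.succ_injective _ e)) (i := j.succ)
        (j := a.succ) ?_
      rw [Function.update_self, Function.update_of_ne (fun e => h (Fin.succ_injective _ e).symm)]
      simp [hc]
  · filter_upwards [hf'] with x hx
    rw [hx, fluxForm_self]

end FluxFormClosed

section SimultaneousJordan

variable {ι : Type*} [Fintype ι]

/-- Extension of scalars from `ℝ` to `ℂ` for endomorphisms of `ι → ℝ`. -/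
noncomputable def complexifyEnd (ι : Type*) [Fintype ι] [DecidableEq ι] :
    Module.End ℝ (ι → ℝ) →+* Module.End ℂ (ι → ℂ) :=
  ((Matrix.toLinAlgEquiv' : Matrix ι ι ℂ ≃ₐ[ℂ] _).toRingEquiv.toRingHom.comp
    (algebraMap ℝ ℂ).mapMatrix).comp
      (Matrix.toLinAlgEquiv' : Matrix ι ι ℝ ≃ₐ[ℝ] _).symm.toRingEquiv.toRingHom

theorem complexifyEnd_ofRealPi [DecidableEq ι] (T : Module.End ℝ (ι → ℝ)) (v : ι → ℝ) :
    complexifyEnd ι T (ofRealPi ι v) = ofRealPi ι (T v) := by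
  obtain ⟨M, rfl⟩ := (Matrix.toLinAlgEquiv' : Matrix ι ι ℝ ≃ₐ[ℝ] _).surjective T
  ext i
  simp [complexifyEnd, Matrix.mulVec, dotProduct]

theorem LinearMap.ext_ofRealPi {ι F : Type*} [AddCommGroup F] [Module ℂ F]
    {T T' : (ι → ℂ) →ₗ[ℂ] F} (h : ∀ v, T (ofRealPi ι v) = T' (ofRealPi ι v)) : T = T' := by
  ext1 z
  rw [← ofRealPi_re_add_im z]
  simp only [map_add, map_smul, h]

theorem isSemisimple_complexifyEnd [DecidableEq ι] {S : Module.End ℝ (ι → ℝ)} (hS : S.IsSemisimple) :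
    (complexifyEnd ι S).IsSemisimple := by
  refine Module.End.isSemisimple_of_squarefree_aeval_eq_zero
    (p := (minpoly ℝ S).map (algebraMap ℝ ℂ)) ?_ ?_
  · exact ((PerfectField.separable_iff_squarefree.mpr hS.minpoly_squarefree).map).squarefree
  · have h1 : (complexifyEnd ι).comp (algebraMap ℝ (Module.End ℝ (ι → ℝ))) =
        (algebraMap ℂ (Module.End ℂ (ι → ℂ))).comp (algebraMap ℝ ℂ) := by
      refine RingHom.ext fun r => LinearMap.ext_ofRealPi fun v => ?_
      simp only [RingHom.comp_apply, complexifyEnd_ofRealPi, Module.algebraMap_end_apply, map_smul]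
      ext i
      simp
    rw [Polynomial.aeval_def, Polynomial.eval₂_map, ← h1, ← Polynomial.hom_eval₂,
      ← Polynomial.aeval_def, minpoly.aeval, map_zero]

/-- Commuting semisimple endomorphisms of `ι → ℂ` are diagonal in common linear coordinates. -/
theorem exists_diagonal_coordinates {τ : Type*} {S : τ → Module.End ℂ (ι → ℂ)}
    (hS : ∀ i, (S i).IsSemisimple) (hc : ∀ i j, Commute (S i) (S j)) :
    ∃ (κ : Type) (_ : Fintype κ) (_ : DecidableEq κ) (ℓ : (ι → ℂ) ≃L[ℂ] (κ → ℂ)) (w : κ → τ → ℂ),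
      ∀ i j x, ℓ (S i x) j = w j i * ℓ x j := by
  classical
  have hW : ∀ μ a, a ∈ weightSpace S μ → ∀ i, S i a = μ i • a := by
    intro μ a ha i
    have h1 := (Submodule.mem_iInf _).mp ha i
    rw [(hS i).isFinitelySemisimple.maxGenEigenspace_eq_eigenspace] at h1
    exact Module.End.mem_eigenspace_iff.mp h1
  set s : Set (ι → ℂ) := {a | ∃ μ : τ → ℂ, ∀ i, S i a = μ i • a}
  have hs : ⊤ ≤ Submodule.span ℂ s := by
    rw [← iSup_weightSpace_eq_top hc]
    exact iSup_le fun μ a ha => Submodule.subset_span ⟨μ, hW μ a ha⟩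
  let b := Module.Basis.ofSpan hs
  let e := b.reindex (Fintype.equivFin _)
  have he : ∀ j, ∃ μ : τ → ℂ, ∀ i, S i (e j) = μ i • e j := fun j =>
    Module.Basis.ofSpan_subset hs ⟨_, (b.reindex_apply _ j).symm⟩
  choose w hw using he
  refine ⟨Fin _, inferInstance, inferInstance, e.equivFunL, w, fun i j x => ?_⟩
  have h1 : e.equivFun (S i x) = e.equivFun (S i (∑ k, e.equivFun x k • e k)) := by
    rw [e.sum_equivFun]
  change e.equivFun (S i x) j = w j i * e.equivFun x j
  have h2 : ∀ k, e.equivFun (e k) j = if k = j then 1 else 0 := fun k => by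
    simp
  rw [h1]
  simp only [map_sum, map_smul, hw, Finset.sum_apply, Pi.smul_apply, h2, smul_eq_mul]
  simp [mul_comm]

theorem pow_sub_smul_one_coord {E κ : Type*} [NormedAddCommGroup E] [NormedSpace ℂ E]
    (ℓ : E ≃L[ℂ] (κ → ℂ)) {A S N : E →L[ℂ] E} (hA : A = S + N) (hSN : Commute S N) {w : ℂ} {j : κ}
    (hw : ∀ x, ℓ (S x) j = w * ℓ x j) (k : ℕ) (x : E) :
    ℓ (((A - w • 1) ^ k) x) j = ℓ ((N ^ k) x) j := by
  induction k generalizing x with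
  | zero => rfl
  | succ k ih =>
    have h1 : Commute (A - w • 1) N := by
      rw [hA]
      refine ContinuousLinearMap.ext fun y => ?_
      have h := DFunLike.congr_fun hSN.eq y
      change S (N y) = N (S y) at h
      change S (N y) + N (N y) - w • N y = N (S y + N y - w • y)
      rw [h, map_sub, map_add, map_smul]
    have h2 := DFunLike.congr_fun (h1.pow_right k).eq x
    change (A - w • 1) ((N ^ k) x) = (N ^ k) ((A - w • 1) x) at h2
    rw [pow_succ, pow_succ']
    change ℓ (((A - w • 1) ^ k) ((A - w • 1) x)) j = ℓ (N ((N ^ k) x)) j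
    rw [ih, ← h2, hA]
    change ℓ (S ((N ^ k) x) + N ((N ^ k) x) - w • (N ^ k) x) j = _
    rw [map_sub, map_add, map_smul]
    simp [hw]

/-- Simultaneous Jordan–Chevalley decomposition of commuting real endomorphisms, together with
complex linear coordinates which diagonalize the semisimple parts. -/
theorem exists_simultaneous_jordan [DecidableEq ι] {τ : Type*} {A : τ → (ι → ℝ) →L[ℝ] (ι → ℝ)}
    (hA : ∀ i j v, A i (A j v) = A j (A i v)) {A' : τ → (ι → ℂ) →L[ℂ] (ι → ℂ)}
    (hA' : ∀ i v, A' i (ofRealPi ι v) = ofRealPi ι (A i v)) :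
    ∃ S N : τ → (ι → ℝ) →L[ℝ] (ι → ℝ), (∀ i, A i = S i + N i) ∧
      (∀ i, Module.End.IsSemisimple (S i : Module.End ℝ (ι → ℝ))) ∧
      (∀ i, IsNilpotent (N i : Module.End ℝ (ι → ℝ))) ∧ (∀ i, S i ∘L N i = N i ∘L S i) ∧
      ∃ (κ : Type) (_ : Fintype κ) (_ : DecidableEq κ) (ℓ : (ι → ℂ) ≃L[ℂ] (κ → ℂ))
        (w : κ → τ → ℂ), (∀ i j v, ℓ (ofRealPi ι (S i v)) j = w j i * ℓ (ofRealPi ι v) j) ∧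
        ∀ i j, ∃ k : ℕ, ∀ x, ℓ (((A' i - w j i • 1) ^ k) x) j = 0 := by
  have hcA : ∀ i j, Commute (A i : Module.End ℝ (ι → ℝ)) (A j) := fun i j =>
    LinearMap.ext fun v => hA i j v
  choose N hN S hS hnil hss hsum using fun i =>
    Module.End.exists_isNilpotent_isSemisimple (f := (A i : Module.End ℝ (ι → ℝ)))
  have hc1 : ∀ i j, Commute (A i : Module.End ℝ (ι → ℝ)) (S j) := fun i j =>
    Algebra.commute_of_mem_adjoin_singleton_of_commute (hS j) (hcA i j)
  have hc2 : ∀ i j, Commute (S i) (S j) := fun i j =>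
    Algebra.commute_of_mem_adjoin_singleton_of_commute (hS j) (hc1 j i).symm
  have hc3 : ∀ i, Commute (S i) (N i) := fun i =>
    Algebra.commute_of_mem_adjoin_singleton_of_commute (hN i) (hc1 i i).symm
  obtain ⟨κ, i1, i2, ℓ, w, hw⟩ := exists_diagonal_coordinates
    (S := fun i => complexifyEnd ι (S i)) (fun i => isSemisimple_complexifyEnd (hss i))
    fun i j => (hc2 i j).map (complexifyEnd ι)
  refine ⟨fun i => LinearMap.toContinuousLinearMap (S i), fun i => LinearMap.toContinuousLinearMap (N i), fun i => ?_,
    hss, hnil, fun i => ?_, κ, i1, i2, ℓ, w, fun i j v => ?_, fun i j => ?_⟩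
  · ext1 v
    exact (LinearMap.congr_fun (hsum i) v).trans (add_comm _ _)
  · ext1 v
    exact LinearMap.congr_fun (hc3 i).eq v
  · have := hw i j (ofRealPi ι v)
    rwa [complexifyEnd_ofRealPi] at this
  · obtain ⟨k, hk⟩ := hnil i
    refine ⟨k, fun x => ?_⟩
    rw [pow_sub_smul_one_coord ℓ (S := LinearMap.toContinuousLinearMap (complexifyEnd ι (S i)))
      (N := LinearMap.toContinuousLinearMap (complexifyEnd ι (N i))) ?_ ?_ (hw i j)]
    · have h1 : ∀ k : ℕ, ∀ x, (LinearMap.toContinuousLinearMap (complexifyEnd ι (N i)) ^ k) x =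
          (complexifyEnd ι (N i) ^ k) x := by
        intro k
        induction k with
        | zero => exact fun _ => rfl
        | succ k ih =>
          intro x
          rw [pow_succ, pow_succ]
          exact ih _
      rw [h1, ← map_pow, hk, map_zero]
      simp
    · refine ContinuousLinearMap.coe_injective (LinearMap.ext_ofRealPi fun v => ?_)
      change A' i _ = complexifyEnd ι (S i) _ + complexifyEnd ι (N i) _
      rw [hA', complexifyEnd_ofRealPi, complexifyEnd_ofRealPi, ← map_add, add_comm]
      exact congrArg _ (LinearMap.congr_fun (hsum i) v)
    · ext1 v
      exact LinearMap.congr_fun ((hc3 i).map (complexifyEnd ι)).eq v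

end SimultaneousJordan

section LieIterates

variable {E : Type*} [NormedAddCommGroup E] [NormedSpace ℂ E] [CompleteSpace E]

/-- The operator `u ↦ V(u) - c u`. -/
noncomputable def lieSub (V : E → E) (c : ℂ) (u : E → ℂ) (x : E) : ℂ := lieD V u x - c * u x

theorem AnalyticAt.lieSub_iterate {V : E → E} (hV : AnalyticAt ℂ V 0) (c : ℂ) {u : E → ℂ}
    (hu : AnalyticAt ℂ u 0) (k : ℕ) : AnalyticAt ℂ ((lieSub V c)^[k] u) 0 := by
  induction k with
  | zero => exact hu
  | succ k ih =>
    rw [Function.iterate_succ_apply']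
    exact (hV.lieD ih).sub (analyticAt_const.mul ih)

theorem jetDer_sub_pow_jet {V : E → E} (hV : AnalyticAt ℂ V 0) (h0 : V 0 = 0) (c : ℂ) {u : E → ℂ}
    (hu : AnalyticAt ℂ u 0) (N k : ℕ) :
    ((jetDer N V - c • 1) ^ k) (jet N u) = jet N ((lieSub V c)^[k] u) := by
  induction k with
  | zero => rfl
  | succ k ih =>
    have h1 := hV.lieSub_iterate c hu k
    rw [pow_succ', Module.End.mul_apply, ih, Function.iterate_succ_apply']
    set g := (lieSub V c)^[k] u
    have h2 : lieSub V c g + c • g = lieD V g := by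
      ext x
      simp [lieSub]
    have h3 : AnalyticAt ℂ (lieSub V c g) 0 := (hV.lieD h1).sub (analyticAt_const.mul h1)
    rw [LinearMap.sub_apply, LinearMap.smul_apply, Module.End.one_apply, jetDer_jet hV h0 h1, ← h2,
      jet_add h3 (show AnalyticAt ℂ (c • g) 0 from
        (analyticAt_const (v := c)).smul h1), jet_smul h1, add_sub_cancel_right]

theorem jet_mem_weightSpace_iff {τ : Type*} {X : τ → E → E} (hX : ∀ i, AnalyticAt ℂ (X i) 0)
    (hX0 : ∀ i, X i 0 = 0) {u : E → ℂ} (hu : AnalyticAt ℂ u 0) (N : ℕ) (μ : τ → ℂ) :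
    jet N u ∈ weightSpace (fun i => jetDer N (X i)) μ ↔
      ∀ i, ∃ k, VO (N + 1) ((lieSub (X i) (μ i))^[k] u) := by
  rw [mem_weightSpace]
  refine forall_congr' fun i => exists_congr fun k => ?_
  rw [jetDer_sub_pow_jet (hX i) (hX0 i) _ hu, jet_eq_zero_iff ((hX i).lieSub_iterate _ hu k)]

end LieIterates

section ConjugateWeights

variable {E : Type*} [NormedAddCommGroup E] [StarAddMonoid E] [NormedStarGroup E]

/-- Conjugation of a map by the star operation. -/
def starConj {F : Type*} [Star F] (u : E → F) (z : E) : F := star (u (star z))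

theorem tendsto_star_zero : Tendsto (star : E → E) (𝓝 0) (𝓝 0) := by
  simpa using (continuous_star.tendsto (0 : E))

theorem AnalyticAt.starConj [NormedSpace ℂ E] [StarModule ℂ E] {F : Type*} [NormedAddCommGroup F] [NormedSpace ℂ F] [StarAddMonoid F]
    [NormedStarGroup F] [StarModule ℂ F] {u : E → F} (hu : AnalyticAt ℂ u 0) :
    AnalyticAt ℂ (starConj u) 0 := hu.star_star

theorem VO.starConj {F : Type*} [NormedAddCommGroup F] [StarAddMonoid F] [NormedStarGroup F] {k : ℕ}
    {u : E → F} (hu : VO k u) : VO k (starConj u) := by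
  have h1 : VO 1 (fun z : E => star z) := by
    refine IsBigO.of_bound 1 (Eventually.of_forall fun z => ?_)
    simp
  refine ((VO.comp hu h1).norm_left.congr_left fun z => ?_).of_norm_left
  exact (norm_star _).symm

theorem fderiv_starConj [NormedSpace ℂ E] [StarModule ℂ E] {F : Type*} [NormedAddCommGroup F] [NormedSpace ℂ F] [StarAddMonoid F]
    [NormedStarGroup F] [StarModule ℂ F] {u : E → F} {z : E}
    (hu : DifferentiableAt ℂ u (star z)) (v : E) :
    fderiv ℂ (starConj u) z v = star (fderiv ℂ u (star z) (star v)) := by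
  have h1 := hu.hasFDerivAt.star_star
  rw [_root_.star_star] at h1
  exact congrArg (fun T : E →L[ℂ] F => T v) h1.fderiv

variable [NormedSpace ℂ E] [StarModule ℂ E] [CompleteSpace E]

theorem lieSub_iterate_starConj {V : E → E} (hV : AnalyticAt ℂ V 0)
    (hVs : starConj V =ᶠ[𝓝 0] V) (c : ℂ) {u : E → ℂ}
    (hu : AnalyticAt ℂ u 0) (k : ℕ) :
    (lieSub V (star c))^[k] (starConj u) =ᶠ[𝓝 0] starConj ((lieSub V c)^[k] u) := by
  induction k with
  | zero => rfl
  | succ k ih =>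
    have h1 := hV.lieSub_iterate c hu k
    rw [Function.iterate_succ_apply', Function.iterate_succ_apply']
    filter_upwards [ih, ih.lieD (V := V), hVs,
      tendsto_star_zero.eventually h1.eventually_analyticAt] with z h2 h3 h4 h5
    have h6 : star (V z) = V (star z) := by
      rw [← h4]
      exact _root_.star_star _
    rw [lieSub, h2, h3, lieD, fderiv_starConj h5.differentiableAt, h6]
    simp [starConj, lieSub, lieD]

/-- Conjugation exchanges the weight spaces of real vector fields. -/
theorem jet_starConj_mem_weightSpace {τ : Type*} {X : τ → E → E} (hX : ∀ i, AnalyticAt ℂ (X i) 0)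
    (hX0 : ∀ i, X i 0 = 0) (hXs : ∀ i, starConj (X i) =ᶠ[𝓝 0] X i) {u : E → ℂ}
    (hu : AnalyticAt ℂ u 0) {N : ℕ} {μ : τ → ℂ}
    (h : jet N u ∈ weightSpace (fun i => jetDer N (X i)) μ) :
    jet N (starConj u) ∈ weightSpace (fun i => jetDer N (X i)) fun i => star (μ i) := by
  rw [jet_mem_weightSpace_iff hX hX0 hu] at h
  rw [jet_mem_weightSpace_iff hX hX0 hu.starConj]
  intro i
  obtain ⟨k, hk⟩ := h i
  exact ⟨k, hk.starConj.congr (lieSub_iterate_starConj (hX i) (hXs i) (μ i) hu k).symm⟩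

end ConjugateWeights

section RealWeightFunctions

variable {ι κ τ : Type*} [Fintype ι] [Fintype κ] [DecidableEq κ]

theorem star_coord_eq_sum (ℓ : (ι → ℂ) ≃L[ℂ] (κ → ℂ)) (x : ι → ℂ) (j : κ) :
    ℓ (star x) j = ∑ i, ℓ (star (ℓ.symm (Pi.single i 1))) j * star (ℓ x i) := by
  have h1 : x = ∑ i, ℓ x i • ℓ.symm (Pi.single i 1) := by
    apply ℓ.injective
    ext k
    simp [map_sum, Finset.sum_apply, Pi.single_apply]
  conv_lhs => rw [h1]
  simp only [star_sum, star_smul, map_sum, map_smul, Finset.sum_apply, Pi.smul_apply, smul_eq_mul]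
  exact Finset.sum_congr rfl fun i _ => mul_comm _ _

theorem star_weight_eq {ℓ : (ι → ℂ) ≃L[ℂ] (κ → ℂ)} {c : κ → ℂ} {S : (ι → ℝ) → (ι → ℝ)}
    (hS : ∀ j v, ℓ (ofRealPi ι (S v)) j = c j * ℓ (ofRealPi ι v) j) {i j : κ}
    (h : ℓ (star (ℓ.symm (Pi.single i 1))) j ≠ 0) : star (c i) = c j := by
  have h0 : ∀ v, star (ofRealPi ι v) = ofRealPi ι v := fun v => by
    ext i
    simp
  have h1 : ∀ v, diagOp ℓ c (ofRealPi ι v) = ofRealPi ι (S v) := fun v => by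
    apply ℓ.injective
    ext j
    rw [coord_diagOp, hS]
  have h2 : ∀ z, diagOp ℓ c (star z) = star (diagOp ℓ c z) := fun z => by
    rw [← ofRealPi_re_add_im z]
    simp only [star_add, star_smul, map_add, map_smul, h0, h1]
  have h3 := congrArg (fun x => ℓ x j) (h2 (ℓ.symm (Pi.single i 1)))
  have h4 : diagOp ℓ c (ℓ.symm (Pi.single i 1)) = c i • ℓ.symm (Pi.single i 1) := by
    apply ℓ.injective
    ext k
    rw [coord_diagOp, map_smul]
    by_cases hk : k = i
    · subst hk; simp
    · simp [hk]
  beta_reduce at h3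
  rw [coord_diagOp, h4, star_smul, map_smul, Pi.smul_apply, smul_eq_mul] at h3
  exact (mul_right_cancel₀ h h3).symm

/-- Weight coordinates for real vector fields can be chosen real. -/
theorem exists_real_weight_coordinates {X : τ → (ι → ℂ) → ι → ℂ} (hX : ∀ i, AnalyticAt ℂ (X i) 0)
    (hX0 : ∀ i, X i 0 = 0) (hXs : ∀ i, starConj (X i) =ᶠ[𝓝 0] X i)
    (ℓ : (ι → ℂ) ≃L[ℂ] (κ → ℂ)) {w : κ → τ → ℂ} {S : τ → (ι → ℝ) → (ι → ℝ)}
    (hS : ∀ i j v, ℓ (ofRealPi ι (S i v)) j = w j i * ℓ (ofRealPi ι v) j)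
    {ξ : κ → (ι → ℂ) → ℂ} (hξ : ∀ j, AnalyticAt ℂ (ξ j) 0)
    (hξ2 : ∀ j, VO 2 fun x => ξ j x - ℓ x j)
    (hξw : ∀ j N, jet N (ξ j) ∈ weightSpace (fun i => jetDer N (X i)) (w j)) :
    ∃ η : (ι → ℂ) → ι → ℂ, AnalyticAt ℂ η 0 ∧ VO 2 (fun x => η x - x) ∧
      (∀ z, star (η (star z)) = η z) ∧
      ∀ j N, jet N (fun x => ℓ (η x) j) ∈ weightSpace (fun i => jetDer N (X i)) (w j) := by
  set Ξ : (ι → ℂ) → ι → ℂ := fun z => ℓ.symm fun j => ξ j z with hΞdef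
  have hΞ : AnalyticAt ℂ Ξ 0 :=
    (ℓ.symm : (κ → ℂ) →L[ℂ] (ι → ℂ)).analyticAt _ |>.fun_comp (AnalyticAt.pi hξ)
  have hΞ2 : VO 2 fun z => Ξ z - z := by
    have h1 : VO 2 fun z => (fun j => ξ j z - ℓ z j) := vo_pi.mpr hξ2
    refine (h1.continuousLinearMap (ℓ.symm : (κ → ℂ) →L[ℂ] (ι → ℂ))).congr
      (Eventually.of_forall fun z => ?_)
    change ℓ.symm ((fun j => ξ j z) - ℓ z) = _
    rw [map_sub, ℓ.symm_apply_apply]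
  have hℓΞ : ∀ z j, ℓ (Ξ z) j = ξ j z := fun z j => by simp [hΞdef]
  set c : κ → κ → ℂ := fun j i => ℓ (star (ℓ.symm (Pi.single i 1))) j
  have hη : AnalyticAt ℂ (fun z => (1 / 2 : ℂ) • (Ξ z + starConj Ξ z)) 0 :=
    (analyticAt_const (v := (1 / 2 : ℂ))).smul (hΞ.add hΞ.starConj)
  refine ⟨fun z => (1 / 2 : ℂ) • (Ξ z + starConj Ξ z), hη, ?_, fun z => ?_, fun j N => ?_⟩
  · have h1 := (hΞ2.add hΞ2.starConj).continuousLinearMap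
      ((1 / 2 : ℂ) • ContinuousLinearMap.id ℂ (ι → ℂ))
    refine h1.congr (Eventually.of_forall fun z => ?_)
    ext i
    simp [starConj]
    ring
  · simp [starConj, add_comm]
  · have e : (fun z => ℓ ((1 / 2 : ℂ) • (Ξ z + starConj Ξ z)) j) =
        (1 / 2 : ℂ) • (ξ j + ∑ i, c j i • starConj (ξ i)) := by
      ext z
      simp only [map_smul, map_add, Pi.smul_apply, Pi.add_apply, Finset.sum_apply, hℓΞ]
      rw [starConj, star_coord_eq_sum]
      simp only [hℓΞ, smul_eq_mul]
      rfl
    have h1 : ∀ i, AnalyticAt ℂ (c j i • starConj (ξ i)) 0 := fun i =>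
      analyticAt_const.smul (hξ i).starConj
    have h2 : AnalyticAt ℂ (∑ i, c j i • starConj (ξ i)) 0 :=
      Finset.analyticAt_sum _ fun i _ => h1 i
    rw [e, jet_smul ((hξ j).add h2), jet_add (hξ j) h2, jet_sum fun i _ => h1 i]
    refine Submodule.smul_mem _ _ (Submodule.add_mem _ (hξw j N)
      (Submodule.sum_mem _ fun i _ => ?_))
    rw [jet_smul (hξ i).starConj]
    by_cases hc : c j i = 0
    · rw [hc, zero_smul]
      exact Submodule.zero_mem _
    · refine Submodule.smul_mem _ _ ?_
      have h3 : (fun k => star (w i k)) = w j := funext fun k =>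
        star_weight_eq (c := fun j => w j k) (hS k) hc
      rw [← h3]
      exact jet_starConj_mem_weightSpace hX hX0 hXs (hξ i) (hξw i N)

end RealWeightFunctions

section RealPoints

variable {ι κ : Type*}

/-- The componentwise real part. -/
noncomputable def rePi (κ : Type*) : (κ → ℂ) →L[ℝ] (κ → ℝ) :=
  ContinuousLinearMap.pi fun i => Complex.reCLM.comp (ContinuousLinearMap.proj i)

@[simp]
theorem rePi_apply (z : κ → ℂ) (i : κ) : rePi κ z i = (z i).re := rfl

@[simp]
theorem rePi_ofRealPi (x : κ → ℝ) : rePi κ (ofRealPi κ x) = x := by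
  ext i
  simp

theorem re_apply_of_ofRealPi {T : (ι → ℂ) →ₗ[ℂ] ℂ} {T' : (ι → ℝ) → ℝ}
    (h : ∀ v, T (ofRealPi ι v) = T' v) (z : ι → ℂ) : (T z).re = T' (rePi ι z) := by
  conv_lhs => rw [← ofRealPi_re_add_im z]
  rw [map_add, map_smul, h, h]
  simp
  rfl

theorem rePi_apply_of_ofRealPi {T : (ι → ℂ) →ₗ[ℂ] (κ → ℂ)} {T' : (ι → ℝ) → (κ → ℝ)}
    (h : ∀ v, T (ofRealPi ι v) = ofRealPi κ (T' v)) (z : ι → ℂ) :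
    rePi κ (T z) = T' (rePi ι z) := by
  ext i
  exact re_apply_of_ofRealPi (T := (LinearMap.proj i).comp T) (T' := fun v => T' v i)
    (fun v => congrFun (h v) i) z

theorem trace_eq_of_ofRealPi [Fintype ι] [DecidableEq ι] {T : (ι → ℂ) →ₗ[ℂ] (ι → ℂ)}
    {T' : (ι → ℝ) →ₗ[ℝ] (ι → ℝ)} (h : ∀ v, T (ofRealPi ι v) = ofRealPi ι (T' v)) :
    LinearMap.trace ℂ _ T = (LinearMap.trace ℝ _ T' : ℝ) := by
  have h1 : ∀ i, ofRealPi ι (Pi.single i 1) = Pi.single i 1 := fun i => by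
    ext j
    by_cases hj : j = i
    · subst hj; simp
    · simp [hj]
  rw [LinearMap.trace_eq_matrix_trace ℂ (Pi.basisFun ℂ ι),
    LinearMap.trace_eq_matrix_trace ℝ (Pi.basisFun ℝ ι), Matrix.trace, Matrix.trace]
  push_cast
  refine Finset.sum_congr rfl fun i _ => ?_
  simp [← h1, h]

variable [Fintype ι] [Fintype κ]

theorem AnalyticAt.eventually_eq_of_ofRealPi {g h : (ι → ℂ) → κ → ℂ} (hg : AnalyticAt ℂ g 0)
    (hh : AnalyticAt ℂ h 0) (e : ∀ᶠ x in 𝓝 0, g (ofRealPi ι x) = h (ofRealPi ι x)) :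
    ∀ᶠ z in 𝓝 0, g z = h z := by
  have h1 : ∀ i, ∀ᶠ z in 𝓝 0, g z i - h z i = 0 := fun i => by
    refine AnalyticAt.eventually_eq_zero_of_ofRealPi (g := fun z => g z i - h z i)
      ((((ContinuousLinearMap.proj (R := ℂ) (φ := fun _ : κ => ℂ) i).analyticAt _).fun_comp hg).sub
        (((ContinuousLinearMap.proj (R := ℂ) (φ := fun _ : κ => ℂ) i).analyticAt _).fun_comp hh)) ?_
    filter_upwards [e] with x hx
    rw [hx, sub_self]
  filter_upwards [eventually_all.mpr h1] with z hz
  ext i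
  exact sub_eq_zero.mp (hz i)

theorem analyticAt_rePi_comp {g : (ι → ℂ) → κ → ℂ} (hg : AnalyticAt ℂ g 0) :
    AnalyticAt ℝ (fun x => rePi κ (g (ofRealPi ι x))) 0 := by
  have h1 : AnalyticAt ℝ g (ofRealPi ι 0) := by
    rw [map_zero]
    exact hg.restrictScalars
  exact ((rePi κ).analyticAt _).fun_comp (h1.fun_comp ((ofRealPi ι).analyticAt 0))

theorem hasFDerivAt_rePi_comp {g : (ι → ℂ) → κ → ℂ} {x : ι → ℝ}
    (hg : DifferentiableAt ℂ g (ofRealPi ι x)) :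
    HasFDerivAt (fun x => rePi κ (g (ofRealPi ι x)))
      (rePi κ ∘L (fderiv ℂ g (ofRealPi ι x)).restrictScalars ℝ ∘L ofRealPi ι) x :=
  (rePi κ).hasFDerivAt.comp x
    ((hg.hasFDerivAt.restrictScalars ℝ).comp x (ofRealPi ι).hasFDerivAt)

/-- At real points, the derivative of a complexification is the complexified derivative. -/
theorem eventually_fderiv_ofRealPi {g : (ι → ℂ) → κ → ℂ} (hg : AnalyticAt ℂ g 0)
    {g' : (ι → ℝ) → κ → ℝ} (hg' : AnalyticAt ℝ g' 0)
    (h : ∀ᶠ x in 𝓝 0, g (ofRealPi ι x) = ofRealPi κ (g' x)) :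
    ∀ᶠ x in 𝓝 0, ∀ v, fderiv ℂ g (ofRealPi ι x) (ofRealPi ι v) =
      ofRealPi κ (fderiv ℝ g' x v) := by
  filter_upwards [h.eventually_nhds, tendsto_ofRealPi.eventually hg.eventually_analyticAt,
    hg'.eventually_analyticAt] with x h1 h2 h3 v
  have h4 := ((h2.differentiableAt.hasFDerivAt.restrictScalars ℝ).comp x
    (ofRealPi ι).hasFDerivAt)
  have h5 := ((ofRealPi κ).hasFDerivAt.comp x h3.differentiableAt.hasFDerivAt)
  have h6 : g ∘ ofRealPi ι =ᶠ[𝓝 x] ofRealPi κ ∘ g' := h1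
  exact congrArg (fun T : (ι → ℝ) →L[ℝ] (κ → ℂ) => T v) ((h5.congr_of_eventuallyEq h6).unique h4).symm

theorem fluxForm_ofRealPi {m : ℕ} {X : Fin m → (Fin (m + 1) → ℂ) → Fin (m + 1) → ℂ}
    {X' : Fin m → (Fin (m + 1) → ℝ) → Fin (m + 1) → ℝ} {x : Fin (m + 1) → ℝ}
    (h : ∀ i, X i (ofRealPi _ x) = ofRealPi _ (X' i x)) (v : Fin (m + 1) → ℝ) :
    fluxForm X (ofRealPi _ x) (ofRealPi _ v) = (fluxForm X' x v : ℝ) := by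
  rw [fluxForm_apply, fluxForm_apply, volForm_apply, volForm_apply]
  refine Eq.trans ?_ (RingHom.map_det Complex.ofRealHom _).symm
  congr 1
  ext i j
  cases i using Fin.cases with
  | zero => rfl
  | succ i => exact congrFun (h i) j

end RealPoints

section

variable {𝕜 E : Type*} [RCLike 𝕜] [NormedAddCommGroup E] [NormedSpace 𝕜 E] [CompleteSpace E]

theorem fderiv_fderiv_apply_zero {V W : E → E} (hV : AnalyticAt 𝕜 V 0) (hW : AnalyticAt 𝕜 W 0)
    (hV0 : V 0 = 0) (v : E) :
    fderiv 𝕜 (fun x => fderiv 𝕜 W x (V x)) 0 v = fderiv 𝕜 W 0 (fderiv 𝕜 V 0 v) := by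
  rw [(hW.fderiv.differentiableAt.hasFDerivAt.clm_apply hV.differentiableAt.hasFDerivAt).fderiv]
  simp [hV0]

/-- The linear parts of commuting vector fields commute. -/
theorem fderiv_zero_comm {V W : E → E} (hV : AnalyticAt 𝕜 V 0) (hW : AnalyticAt 𝕜 W 0)
    (hV0 : V 0 = 0) (hW0 : W 0 = 0)
    (h : ∀ᶠ x in 𝓝 0, fderiv 𝕜 W x (V x) = fderiv 𝕜 V x (W x)) (v : E) :
    fderiv 𝕜 W 0 (fderiv 𝕜 V 0 v) = fderiv 𝕜 V 0 (fderiv 𝕜 W 0 v) := by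
  rw [← fderiv_fderiv_apply_zero hV hW hV0, ← fderiv_fderiv_apply_zero hW hV hW0,
    Filter.EventuallyEq.fderiv_eq h]

end

section RealNormalForm

/-- Simultaneous convergent normal form of commuting real divergence-free vector fields: the
semisimple parts are linearized in the coordinate `η` and commute with the vector fields. -/
theorem exists_real_normalForm {m : ℕ} {X : Fin m → (Fin (m + 1) → ℝ) → Fin (m + 1) → ℝ}
    (hX : ∀ i, AnalyticAt ℝ (X i) 0) (hX0 : ∀ i, X i 0 = 0)
    (hcomm : ∀ a b, ∀ᶠ x in 𝓝 0, fderiv ℝ (X b) x (X a x) = fderiv ℝ (X a) x (X b x))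
    (hdiv : ∀ i, ∀ᶠ x in 𝓝 0,
      LinearMap.trace ℝ _ (fderiv ℝ (X i) x : (Fin (m + 1) → ℝ) →ₗ[ℝ] _) = 0)
    (hind : ¬ ∀ᶠ x in 𝓝 0, fluxForm X x = 0) :
    ∃ S N : Fin m → (Fin (m + 1) → ℝ) →L[ℝ] (Fin (m + 1) → ℝ),
      (∀ i, fderiv ℝ (X i) 0 = S i + N i) ∧
      (∀ i, Module.End.IsSemisimple (S i : Module.End ℝ (Fin (m + 1) → ℝ))) ∧
      (∀ i, IsNilpotent (N i : Module.End ℝ (Fin (m + 1) → ℝ))) ∧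
      (∀ i, S i ∘L N i = N i ∘L S i) ∧
      ∃ (η : (Fin (m + 1) → ℝ) → Fin (m + 1) → ℝ) (f : (Fin (m + 1) → ℝ) → ℝ),
        AnalyticAt ℝ η 0 ∧ η 0 = 0 ∧ fderiv ℝ η 0 = ContinuousLinearMap.id ℝ _ ∧
        AnalyticAt ℝ f 0 ∧ (∀ᶠ x in 𝓝 0, HasFDerivAt f (fluxForm X x) x) ∧
        ∀ k, ∃ z : (Fin (m + 1) → ℝ) → Fin (m + 1) → ℝ, AnalyticAt ℝ z 0 ∧ z 0 = 0 ∧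
          (∀ᶠ x in 𝓝 0, fderiv ℝ η x (z x) = S k (η x)) ∧
          (∀ i, ∀ᶠ x in 𝓝 0, fderiv ℝ (X i) x (z x) = fderiv ℝ z x (X i x)) ∧
          ∀ᶠ x in 𝓝 0, fluxForm X x (z x) = 0 := by
  choose Y hY hYX using fun i => (hX i).exists_complexification_pi
  have hYX' := eventually_all.mpr hYX
  have hDY := fun i => eventually_fderiv_ofRealPi (hY i) (hX i) (hYX i)
  have hY0 : ∀ i, Y i 0 = 0 := fun i => by
    have := (hYX i).self_of_nhds
    rwa [map_zero, hX0, map_zero] at this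
  have hYcomm : ∀ a b, ∀ᶠ x in 𝓝 0, fderiv ℂ (Y b) x (Y a x) = fderiv ℂ (Y a) x (Y b x) := by
    intro a b
    refine AnalyticAt.eventually_eq_of_ofRealPi ((hY b).fderiv.clm_apply_of (hY a))
      ((hY a).fderiv.clm_apply_of (hY b)) ?_
    filter_upwards [hYX', hDY a, hDY b, hcomm a b] with x h1 h2 h3 h4
    rw [h1, h1, h2, h3, h4]
  have hYs : ∀ i, starConj (Y i) =ᶠ[𝓝 0] Y i := by
    intro i
    refine AnalyticAt.eventually_eq_of_ofRealPi (hY i).starConj (hY i) ?_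
    filter_upwards [hYX i] with x h1
    have h0 : ∀ v, star (ofRealPi (Fin (m + 1)) v) = ofRealPi _ v := fun v => by
      ext i
      simp
    rw [starConj, h0, h1, h0]
  have hYdiv : ∀ i, ∀ᶠ x in 𝓝 0,
      LinearMap.trace ℂ _ (fderiv ℂ (Y i) x : (Fin (m + 1) → ℂ) →ₗ[ℂ] _) = 0 := by
    intro i
    refine AnalyticAt.eventually_eq_zero_of_ofRealPi ?_ ?_
    · exact ((LinearMap.trace ℂ (Fin (m + 1) → ℂ) ∘ₗ
        ContinuousLinearMap.coeLM ℂ).toContinuousLinearMap.analyticAt _).fun_comp (hY i).fderiv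
    · filter_upwards [hDY i, hdiv i] with x h1 h2
      rw [trace_eq_of_ofRealPi h1, h2, Complex.ofReal_zero]
  have hYind : ¬ ∀ᶠ x in 𝓝 0, fluxForm Y x = 0 := by
    intro h
    refine hind ?_
    filter_upwards [tendsto_ofRealPi.eventually h, hYX'] with x h1 h2
    ext v
    have h3 := fluxForm_ofRealPi h2 v
    rw [h1, zero_apply] at h3
    exact_mod_cast h3.symm
  obtain ⟨f, K, hF, hf⟩ := exists_isFrame hY hYcomm hYdiv hYind
  have hA : ∀ i j v, fderiv ℝ (X i) 0 (fderiv ℝ (X j) 0 v) =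
      fderiv ℝ (X j) 0 (fderiv ℝ (X i) 0 v) := by
    intro i j v
    exact fderiv_zero_comm (hX j) (hX i) (hX0 j) (hX0 i) (hcomm j i) v
  obtain ⟨S, N, hSN, hS, hN, hSNc, κ, _, _, ℓ, w, hℓ, hw⟩ :=
    exists_simultaneous_jordan hA (A' := fun i => fderiv ℂ (Y i) 0) (fun i v => by
      have := (hDY i).self_of_nhds v
      rwa [map_zero] at this)
  obtain ⟨ξ, hξ, hξ2, hξw⟩ := hF.exists_weight_functions hY0 ℓ hw
  obtain ⟨η, hη, hη2, hηs, hηw⟩ := exists_real_weight_coordinates hY hY0 hYs ℓ hℓ hξ hξ2 hξw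
  have hη0 : η 0 = 0 := by simpa using hη2.apply_zero
  have hη1 : fderiv ℂ η 0 = ContinuousLinearMap.id ℂ _ :=
    (fderiv_eq_of_vo_two_sub hη.differentiableAt differentiableAt_id hη2).trans fderiv_id
  set η' : (Fin (m + 1) → ℝ) → Fin (m + 1) → ℝ := fun x => rePi _ (η (ofRealPi _ x)) with hη'def
  have hη' : AnalyticAt ℝ η' 0 := analyticAt_rePi_comp hη
  have hηη' : ∀ x, η (ofRealPi _ x) = ofRealPi _ (η' x) := by
    intro x
    have h0 : star (ofRealPi (Fin (m + 1)) x) = ofRealPi _ x := by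
      ext i
      simp
    have h1 := hηs (ofRealPi _ x)
    rw [h0] at h1
    ext i
    exact (Complex.conj_eq_iff_re.mp (congrFun h1 i)).symm
  have hDη := eventually_fderiv_ofRealPi hη hη' (Eventually.of_forall hηη')
  refine ⟨S, N, hSN, hS, hN, hSNc, η', fun x => (f (ofRealPi _ x)).re, hη', ?_, ?_, ?_, ?_,
    fun k => ?_⟩
  · simp [hη'def, hη0]
  · have h1 := (hasFDerivAt_rePi_comp (g := η) (x := 0) (by
      rw [map_zero]; exact hη.differentiableAt)).fderiv
    rw [map_zero, hη1] at h1
    refine h1.trans ?_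
    ext1 v
    simp
  · have h1 : AnalyticAt ℝ f (ofRealPi (Fin (m + 1)) 0) := by
      rw [map_zero]
      exact hF.f_an.restrictScalars
    exact (Complex.reCLM.analyticAt _).fun_comp (h1.fun_comp ((ofRealPi (Fin (m + 1))).analyticAt 0))
  · filter_upwards [tendsto_ofRealPi.eventually hf,
      tendsto_ofRealPi.eventually hF.f_an.eventually_analyticAt, hYX'] with x h1 h2 h3
    refine (Complex.reCLM.hasFDerivAt.comp x ((h2.differentiableAt.hasFDerivAt.restrictScalars
      ℝ).comp x (ofRealPi _).hasFDerivAt)).congr_fderiv ?_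
    ext1 v
    change (fderiv ℂ f (ofRealPi _ x) (ofRealPi _ v)).re = _
    rw [h1, fluxForm_ofRealPi h3, Complex.ofReal_re]
  · obtain ⟨z, hz, hz0, hzη, hzX, hzu⟩ :=
      exists_normalForm_of_weight_functions hY hY0 hYcomm ℓ hη hη2 hηw k
    refine ⟨fun x => rePi _ (z (ofRealPi _ x)), analyticAt_rePi_comp hz, by simp [hz0], ?_,
      fun i => ?_, ?_⟩
    · filter_upwards [hDη, tendsto_ofRealPi.eventually hzη] with x h1 h2
      rw [← rePi_apply_of_ofRealPi (T := (fderiv ℂ η (ofRealPi _ x)).toLinearMap) h1]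
      refine (congrArg _ h2).trans ?_
      have h3 : diagOp ℓ (fun j => w j k) (η (ofRealPi _ x)) = ofRealPi _ (S k (η' x)) := by
        apply ℓ.injective
        ext j
        rw [coord_diagOp, hηη', hℓ]
      rw [h3, rePi_ofRealPi]
    · filter_upwards [hDY i, hYX i, tendsto_ofRealPi.eventually (hzX i),
        tendsto_ofRealPi.eventually hz.eventually_analyticAt] with x h1 h2 h3 h4
      rw [(hasFDerivAt_rePi_comp h4.differentiableAt).fderiv,
        ← rePi_apply_of_ofRealPi (T := (fderiv ℂ (Y i) (ofRealPi _ x)).toLinearMap) h1]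
      change rePi _ (fderiv ℂ (Y i) (ofRealPi _ x) (z (ofRealPi _ x))) =
        rePi _ (fderiv ℂ z (ofRealPi _ x) (ofRealPi _ (X i x)))
      rw [h3, h2]
    · filter_upwards [hYX', tendsto_ofRealPi.eventually hf,
        tendsto_ofRealPi.eventually (hzu f hF.f_an hF.f_X)] with x h1 h2 h3
      rw [← re_apply_of_ofRealPi (T := (fluxForm Y (ofRealPi _ x)).toLinearMap)
        (fluxForm_ofRealPi h1)]
      change (fluxForm Y (ofRealPi _ x) (z (ofRealPi _ x))).re = 0
      rw [← h2, h3, Complex.zero_re]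

end RealNormalForm

section RelatedFields

variable {𝕜 E F : Type*} [RCLike 𝕜] [NormedAddCommGroup E] [NormedSpace 𝕜 E] [CompleteSpace E]
  [NormedAddCommGroup F] [NormedSpace 𝕜 F] [CompleteSpace F]

theorem AnalyticAt.fderiv_fderiv_symm {φ : E → F} {x : E} (hφ : AnalyticAt 𝕜 φ x) (v w : E) :
    fderiv 𝕜 (fderiv 𝕜 φ) x v w = fderiv 𝕜 (fderiv 𝕜 φ) x w v :=
  (hφ.contDiffAt (n := 2)).isSymmSndFDerivAt (by simp [minSmoothness_of_isRCLikeNormedField]) v w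

/-- If `Y` is `φ`-related to `X`, the derivatives of both sides agree. -/
theorem eventually_fderiv_related {φ : E → F} {Y : E → E} {X : F → F} (hφ : AnalyticAt 𝕜 φ 0)
    (hφ0 : φ 0 = 0) (hY : AnalyticAt 𝕜 Y 0) (hX : AnalyticAt 𝕜 X 0)
    (h : ∀ᶠ y in 𝓝 0, fderiv 𝕜 φ y (Y y) = X (φ y)) :
    ∀ᶠ y in 𝓝 0, ∀ w, fderiv 𝕜 (fderiv 𝕜 φ) y w (Y y) + fderiv 𝕜 φ y (fderiv 𝕜 Y y w) =
      fderiv 𝕜 X (φ y) (fderiv 𝕜 φ y w) := by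
  have ht : Tendsto φ (𝓝 0) (𝓝 0) := by simpa [hφ0] using hφ.continuousAt.tendsto
  filter_upwards [h.eventually_nhds, hφ.eventually_analyticAt, hY.eventually_analyticAt,
    ht.eventually hX.eventually_analyticAt] with y h1 h2 h3 h4 w
  have h5 := (h2.fderiv.differentiableAt.hasFDerivAt.clm_apply h3.differentiableAt.hasFDerivAt)
  have h6 := h4.differentiableAt.hasFDerivAt.comp y h2.differentiableAt.hasFDerivAt
  have h7 := DFunLike.congr_fun ((h5.congr_of_eventuallyEq
    (Filter.EventuallyEq.symm h1)).unique h6) w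
  simpa [add_comm] using h7

/-- Brackets of related vector fields are related. -/
theorem eventually_commute_of_related {φ : E → F} {Y Z : E → E} {X W : F → F}
    (hφ : AnalyticAt 𝕜 φ 0) (hφ0 : φ 0 = 0)
    (hinj : ∀ᶠ y in 𝓝 0, Function.Injective (fderiv 𝕜 φ y))
    (hY : AnalyticAt 𝕜 Y 0) (hX : AnalyticAt 𝕜 X 0)
    (hZ : AnalyticAt 𝕜 Z 0) (hW : AnalyticAt 𝕜 W 0)
    (h : ∀ᶠ y in 𝓝 0, fderiv 𝕜 φ y (Y y) = X (φ y))
    (h' : ∀ᶠ y in 𝓝 0, fderiv 𝕜 φ y (Z y) = W (φ y))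
    (hXW : ∀ᶠ x in 𝓝 0, fderiv 𝕜 X x (W x) = fderiv 𝕜 W x (X x)) :
    ∀ᶠ y in 𝓝 0, fderiv 𝕜 Y y (Z y) = fderiv 𝕜 Z y (Y y) := by
  have ht : Tendsto φ (𝓝 0) (𝓝 0) := by simpa [hφ0] using hφ.continuousAt.tendsto
  filter_upwards [hinj, h, h', ht.eventually hXW, hφ.eventually_analyticAt,
    eventually_fderiv_related hφ hφ0 hY hX h, eventually_fderiv_related hφ hφ0 hZ hW h']
    with y h1 h2 h3 h4 h5 h6 h7
  have h8 := h6 (Z y)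
  have h9 := h7 (Y y)
  rw [h3, h4, ← h2, ← h9, h5.fderiv_fderiv_symm] at h8
  exact h1 (add_left_cancel h8)

theorem eventually_injective_fderiv_of_leftInverse {φ : E → F} {ψ : F → E}
    (hφ : AnalyticAt 𝕜 φ 0) (hφ0 : φ 0 = 0) (hψ : AnalyticAt 𝕜 ψ 0)
    (h : ∀ᶠ y in 𝓝 0, ψ (φ y) = y) :
    ∀ᶠ y in 𝓝 0, ∀ v, fderiv 𝕜 ψ (φ y) (fderiv 𝕜 φ y v) = v := by
  have ht : Tendsto φ (𝓝 0) (𝓝 0) := by simpa [hφ0] using hφ.continuousAt.tendsto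
  filter_upwards [h.eventually_nhds, hφ.eventually_analyticAt,
    ht.eventually hψ.eventually_analyticAt] with y h1 h2 h3 v
  have h4 := h3.differentiableAt.hasFDerivAt.comp y h2.differentiableAt.hasFDerivAt
  have h5 := (hasFDerivAt_id (𝕜 := 𝕜) y).congr_of_eventuallyEq h1
  exact DFunLike.congr_fun (h4.unique h5) v

end RelatedFields

section JacobianInvariance

variable {𝕜 : Type*} [RCLike 𝕜] {m : ℕ}

theorem fluxForm_related {X Y : Fin m → (Fin (m + 1) → 𝕜) → Fin (m + 1) → 𝕜}
    {T : (Fin (m + 1) → 𝕜) →L[𝕜] (Fin (m + 1) → 𝕜)} {x y : Fin (m + 1) → 𝕜}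
    (h : ∀ i, T (Y i y) = X i x) (W : Fin (m + 1) → 𝕜) :
    fluxForm X x (T W) =
      LinearMap.det (T : (Fin (m + 1) → 𝕜) →ₗ[𝕜] (Fin (m + 1) → 𝕜)) * fluxForm Y y W := by
  rw [fluxForm_apply, fluxForm_apply, ← volForm_comp]
  congr 1
  ext i j
  cases i using Fin.cases with
  | zero => rfl
  | succ i => simp [h]

/-- If `v • fluxForm Y` is exact and annihilates a trace-free linear vector field `S` commuting with
`Y`, then `v` is invariant under `S`. -/
theorem eventually_fderiv_eq_zero_of_exact
    {Y : Fin m → (Fin (m + 1) → 𝕜) → Fin (m + 1) → 𝕜} (hY : ∀ i, AnalyticAt 𝕜 (Y i) 0)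
    (hind : ¬ ∀ᶠ x in 𝓝 0, fluxForm Y x = 0)
    {S : (Fin (m + 1) → 𝕜) →L[𝕜] (Fin (m + 1) → 𝕜)}
    (hS : LinearMap.trace 𝕜 _ (S : (Fin (m + 1) → 𝕜) →ₗ[𝕜] (Fin (m + 1) → 𝕜)) = 0)
    (hSY : ∀ i, ∀ᶠ y in 𝓝 0, fderiv 𝕜 (Y i) y (S y) = S (Y i y))
    {f v : (Fin (m + 1) → 𝕜) → 𝕜} (hf : AnalyticAt 𝕜 f 0) (hv : AnalyticAt 𝕜 v 0)
    (hfv : ∀ᶠ y in 𝓝 0, fderiv 𝕜 f y = v y • fluxForm Y y)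
    (hfS : ∀ᶠ y in 𝓝 0, fderiv 𝕜 f y (S y) = 0) :
    ∀ᶠ y in 𝓝 0, fderiv 𝕜 v y (S y) = 0 := by
  have key : ∀ᶠ y in 𝓝 0, ∀ W, fderiv 𝕜 v y (S y) * fluxForm Y y W = 0 := by
    filter_upwards [hfv.eventually_nhds, hfS.eventually_nhds, hf.eventually_analyticAt,
      hv.eventually_analyticAt, eventually_all.2 hSY,
      eventually_all.2 fun i => (hY i).eventually_analyticAt] with y h1 h2 h3 h4 h5 h6 W
    have h7 : fderiv 𝕜 (fderiv 𝕜 f) y W (S y) + fderiv 𝕜 f y (S W) = 0 := by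
      have h8 := h3.fderiv.differentiableAt.hasFDerivAt.clm_apply (S.hasFDerivAt (x := y))
      have h9 := (hasFDerivAt_const (𝕜 := 𝕜) (0 : 𝕜) y).congr_of_eventuallyEq h2
      have h10 := DFunLike.congr_fun (h8.unique h9) W
      simpa [add_comm] using h10
    have h8 : fderiv 𝕜 (fderiv 𝕜 f) y (S y) W =
        v y * fderiv 𝕜 (fluxForm Y) y (S y) W + fderiv 𝕜 v y (S y) * fluxForm Y y W := by
      rw [Filter.EventuallyEq.fderiv_eq h1,
        (h4.differentiableAt.hasFDerivAt.fun_smul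
          (fluxForm_analyticAt h6).differentiableAt.hasFDerivAt).fderiv]
      simp
    have h9 : fderiv 𝕜 (fluxForm Y) y (S y) W = - fluxForm Y y (S W) := by
      rw [fderiv_fluxForm_apply h6]
      simp only [h5]
      rw [sum_volForm_cons_update, hS, zero_mul, zero_sub, fluxForm_apply]
    rw [h3.fderiv_fderiv_symm, h8, h9, h1.self_of_nhds] at h7
    simp only [smul_apply, smul_eq_mul] at h7
    linear_combination h7
  have hq : AnalyticAt 𝕜 (fun y => fderiv 𝕜 v y (S y)) 0 := hv.fderiv.clm_apply_of (S.analyticAt 0)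
  by_contra hne
  refine hind ?_
  have h1 : ∀ j, ∀ᶠ y in 𝓝 0, fluxForm Y y (Pi.single j 1) = 0 := fun j => by
    refine (AnalyticAt.eventually_eq_zero_or_of_mul hq
      ((fluxForm_analyticAt hY).clm_apply_of analyticAt_const)
      (key.mono fun y h => h (Pi.single j 1))).resolve_left hne
  filter_upwards [eventually_all.2 h1] with y h
  ext W
  rw [pi_eq_sum_univ' W, map_sum]
  simp [h]

end JacobianInvariance

section RadialEquation

variable {E : Type*} [NormedAddCommGroup E] [NormedSpace ℝ E]

/-- The first-order singular equation `n g + Dg(x) x = n v` has an analytic solution. -/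
theorem AnalyticAt.exists_radial_solution [CompleteSpace E] {v : E → ℝ} (hv : AnalyticAt ℝ v 0)
    (m : ℕ) : ∃ g : E → ℝ, AnalyticAt ℝ g 0 ∧ g 0 = v 0 ∧
      ∀ᶠ x in 𝓝 0, (m + 1) * g x + fderiv ℝ g x x = (m + 1) * v x := by
  set G : E → ℝ := fun x => ∫ t in (0 : ℝ)..1, t ^ m • v (t • x) with hGdef
  have hG : AnalyticAt ℝ G 0 := hv.radial_integral (𝕜 := ℝ) ⟨fun t => t ^ m, continuous_pow m⟩
  have hm : (m + 1 : ℝ) ≠ 0 := by positivity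
  have hg : AnalyticAt ℝ (fun x => (m + 1 : ℝ) * G x) 0 := analyticAt_const.mul hG
  refine ⟨fun x => (m + 1) * G x, hg, ?_, ?_⟩
  · simp only [hGdef, smul_zero, smul_eq_mul, intervalIntegral.integral_mul_const, integral_pow]
    field_simp
    simp
  obtain ⟨r, hr, hr'⟩ := Metric.eventually_nhds_iff_ball.1 hv.eventually_analyticAt
  filter_upwards [Metric.ball_mem_nhds 0 hr, hG.eventually_analyticAt] with x hx hGx
  have hx' : ∀ t ∈ Set.Icc (0 : ℝ) 1, t • x ∈ Metric.ball (0 : E) r := fun t ht => by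
    rw [mem_ball_zero_iff] at hx ⊢
    rw [norm_smul, Real.norm_of_nonneg ht.1]
    nlinarith [norm_nonneg x, ht.2]
  have hscale : ∀ s : ℝ, s ^ (m + 1) * G (s • x) = ∫ u in (0 : ℝ)..s, u ^ m * v (u • x) := by
    intro s
    have h1 := intervalIntegral.smul_integral_comp_mul_left (a := 0) (b := 1)
      (fun u => u ^ m * v (u • x)) s
    rw [mul_zero, mul_one] at h1
    rw [← h1, hGdef, pow_succ', mul_assoc, smul_eq_mul, ← intervalIntegral.integral_const_mul]
    congr 1
    refine intervalIntegral.integral_congr fun t _ => ?_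
    simp only [smul_eq_mul, mul_pow, smul_smul, mul_comm t s]
    ring
  have hl : ∀ s : ℝ, HasDerivAt (fun s : ℝ => s • x) x s := fun s => by
    simpa using (hasDerivAt_id s).smul_const x
  have hcont : ∀ t ∈ Set.Icc (0 : ℝ) 1, ContinuousAt (fun u : ℝ => u ^ m * v (u • x)) t :=
    fun t ht => ((continuous_pow m).continuousAt).mul
      (ContinuousAt.comp (f := fun u : ℝ => u • x) (hr' _ (hx' t ht)).continuousAt
        (hl t).continuousAt)
  have hopen : IsOpen {u : ℝ | u • x ∈ Metric.ball (0 : E) r} :=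
    Metric.isOpen_ball.preimage (continuous_id.smul continuous_const)
  have hFTC : HasDerivAt (fun s => ∫ u in (0 : ℝ)..s, u ^ m * v (u • x)) (v x) 1 := by
    have h1 := intervalIntegral.integral_hasDerivAt_right (a := 0) (b := 1)
      (f := fun u : ℝ => u ^ m * v (u • x))
      (ContinuousOn.intervalIntegrable (fun t ht => (hcont t (by simpa using ht)).continuousWithinAt))
      (ContinuousOn.stronglyMeasurableAtFilter hopen (fun t ht =>
        (((continuous_pow m).continuousAt).mul
          (ContinuousAt.comp (f := fun u : ℝ => u • x) (hr' _ ht).continuousAt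
            (hl t).continuousAt)).continuousWithinAt) 1 (hx' 1 (by simp)))
      (hcont 1 (by simp))
    simpa using h1
  have hL : HasDerivAt (fun s : ℝ => s ^ (m + 1) * G (s • x))
      ((m + 1) * G x + fderiv ℝ G x x) 1 := by
    have h1 : HasFDerivAt G (fderiv ℝ G x) ((1 : ℝ) • x) := by
      rw [one_smul]
      exact hGx.differentiableAt.hasFDerivAt
    simpa using (hasDerivAt_pow (m + 1) (1 : ℝ)).fun_mul (h1.comp_hasDerivAt (1 : ℝ) (hl 1))
  simp only [hscale] at hL
  have h1 := hL.unique hFTC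
  rw [fderiv_const_mul hGx.differentiableAt, smul_apply, smul_eq_mul, ← h1]
  ring

theorem AnalyticAt.eventually_eq_zero_of_radial {q : E → ℝ} (hq : AnalyticAt ℝ q 0)
    (m : ℕ) (h : ∀ᶠ x in 𝓝 0, (m + 1) * q x + fderiv ℝ q x x = 0) : ∀ᶠ x in 𝓝 0, q x = 0 := by
  obtain ⟨r, hr, hr'⟩ := Metric.eventually_nhds_iff_ball.1 (h.and hq.eventually_analyticAt)
  filter_upwards [Metric.ball_mem_nhds 0 hr] with x hx
  have hx' : ∀ t ∈ Set.Icc (0 : ℝ) 1, t • x ∈ Metric.ball (0 : E) r := fun t ht => by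
    rw [mem_ball_zero_iff] at hx ⊢
    rw [norm_smul, Real.norm_of_nonneg ht.1]
    nlinarith [norm_nonneg x, ht.2]
  have hd : ∀ s ∈ Set.Icc (0 : ℝ) 1, HasDerivAt (fun s : ℝ => s ^ (m + 1) * q (s • x)) 0 s := by
    intro s hs
    obtain ⟨h1, h2⟩ := hr' _ (hx' s hs)
    have hl : HasDerivAt (fun s : ℝ => s • x) x s := by simpa using (hasDerivAt_id s).smul_const x
    have h3 := (hasDerivAt_pow (m + 1) s).fun_mul
      (h2.differentiableAt.hasFDerivAt.comp_hasDerivAt s hl)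
    refine h3.congr_deriv ?_
    rw [map_smul, smul_eq_mul] at h1
    change ((m + 1 : ℕ) : ℝ) * s ^ m * q (s • x) + s ^ (m + 1) * fderiv ℝ q (s • x) x = 0
    push_cast
    linear_combination (s ^ m) * h1
  have h1 := constant_of_has_deriv_right_zero
    (fun s hs => (hd s hs).continuousAt.continuousWithinAt)
    (fun s hs => (hd s ⟨hs.1, hs.2.le⟩).hasDerivWithinAt) 1 (by simp)
  simpa using h1

end RadialEquation

section Moser

variable {m : ℕ}

theorem det_smul_id_add_smulRight {a : ℝ} (ha : a ≠ 0)
    (L : (Fin (m + 1) → ℝ) →L[ℝ] ℝ) (x : Fin (m + 1) → ℝ) :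
    LinearMap.det ((a • ContinuousLinearMap.id ℝ (Fin (m + 1) → ℝ) + L.smulRight x :
      (Fin (m + 1) → ℝ) →L[ℝ] (Fin (m + 1) → ℝ)) : (Fin (m + 1) → ℝ) →ₗ[ℝ] (Fin (m + 1) → ℝ)) =
      a ^ (m + 1) + a ^ m * L x := by
  have h : ((a • ContinuousLinearMap.id ℝ (Fin (m + 1) → ℝ) + L.smulRight x :
      (Fin (m + 1) → ℝ) →L[ℝ] (Fin (m + 1) → ℝ)) : (Fin (m + 1) → ℝ) →ₗ[ℝ] (Fin (m + 1) → ℝ)) =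
      a • LinearMap.transvection (a⁻¹ • L : (Fin (m + 1) → ℝ) →L[ℝ] ℝ).toLinearMap x := by
    refine LinearMap.ext fun v => ?_
    simp [LinearMap.transvection.apply, smul_smul, ha]
  rw [h, LinearMap.det_smul, LinearMap.transvection.det]
  simp only [Module.finrank_fin_fun, ContinuousLinearMap.coe_coe, smul_apply, smul_eq_mul]
  rw [mul_add, mul_one, pow_succ, mul_assoc, mul_inv_cancel_left₀ ha]

/-- A positive analytic density normalised at the origin is the Jacobian determinant of a radial
map, which preserves every linear vector field under which the density is invariant. -/
theorem AnalyticAt.exists_radial_moser {v : (Fin (m + 1) → ℝ) → ℝ} (hv : AnalyticAt ℝ v 0)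
    (hv0 : v 0 = 1) : ∃ κ : (Fin (m + 1) → ℝ) → Fin (m + 1) → ℝ, AnalyticAt ℝ κ 0 ∧ κ 0 = 0 ∧
      fderiv ℝ κ 0 = ContinuousLinearMap.id ℝ _ ∧
      (∀ᶠ x in 𝓝 0, LinearMap.det
        (fderiv ℝ κ x : (Fin (m + 1) → ℝ) →ₗ[ℝ] (Fin (m + 1) → ℝ)) = v x) ∧
      ∀ S : (Fin (m + 1) → ℝ) →L[ℝ] (Fin (m + 1) → ℝ), (∀ᶠ x in 𝓝 0, fderiv ℝ v x (S x) = 0) →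
        ∀ᶠ x in 𝓝 0, fderiv ℝ κ x (S x) = S (κ x) := by
  obtain ⟨g, hg, hg0, hgv⟩ := hv.exists_radial_solution m
  rw [hv0] at hg0
  have hm : (m + 1 : ℝ) ≠ 0 := by positivity
  have hpos : ∀ᶠ x in 𝓝 0, 0 < g x := hg.continuousAt.eventually (lt_mem_nhds (by simp [hg0]))
  set h : (Fin (m + 1) → ℝ) → ℝ := fun x => Real.exp ((m + 1 : ℝ)⁻¹ * Real.log (g x)) with hhdef
  have hh : AnalyticAt ℝ h 0 :=
    AnalyticAt.rexp' (f := fun x => (m + 1 : ℝ)⁻¹ * Real.log (g x))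
      (analyticAt_const.fun_mul ((analyticAt_log (by rw [hg0]; exact one_pos)).fun_comp hg))
  have hhpos : ∀ x, 0 < h x := fun x => Real.exp_pos _
  have hh0 : h 0 = 1 := by simp [hhdef, hg0]
  have hhg : ∀ᶠ x in 𝓝 0, h x ^ (m + 1) = g x := by
    filter_upwards [hpos] with x hx
    rw [hhdef, ← Real.exp_nat_mul]
    push_cast
    rw [mul_inv_cancel_left₀ hm, Real.exp_log hx]
  have hDh : ∀ᶠ x in 𝓝 0, ∀ w, (m + 1) * h x ^ m * fderiv ℝ h x w = fderiv ℝ g x w := by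
    filter_upwards [hhg.eventually_nhds, hh.eventually_analyticAt] with x h1 h2 w
    rw [← Filter.EventuallyEq.fderiv_eq h1, fderiv_fun_pow _ h2.differentiableAt]
    simp
  have hκ : AnalyticAt ℝ (fun x => h x • x) 0 := hh.smul analyticAt_id
  have hDκ : ∀ᶠ x in 𝓝 0, fderiv ℝ (fun x => h x • x) x =
      h x • ContinuousLinearMap.id ℝ _ + (fderiv ℝ h x).smulRight x := by
    filter_upwards [hh.eventually_analyticAt] with x h2
    exact (h2.differentiableAt.hasFDerivAt.fun_smul (hasFDerivAt_id x)).fderiv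
  refine ⟨fun x => h x • x, hκ, by simp, ?_, ?_, fun S hS => ?_⟩
  · rw [hDκ.self_of_nhds, hh0, one_smul]
    ext1 v
    simp
  · filter_upwards [hDκ, hhg, hDh, hgv] with x h1 h2 h3 h4
    rw [h1, det_smul_id_add_smulRight (hhpos x).ne', h2]
    apply mul_left_cancel₀ hm
    rw [← h4, ← h3]
    ring
  · have hq : AnalyticAt ℝ (fun x => fderiv ℝ g x (S x)) 0 := hg.fderiv.clm_apply_of (S.analyticAt 0)
    have h0 : ∀ᶠ x in 𝓝 0, fderiv ℝ g x (S x) = 0 := by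
      refine hq.eventually_eq_zero_of_radial m ?_
      filter_upwards [hgv.eventually_nhds, hS, hg.eventually_analyticAt,
        hv.eventually_analyticAt] with x h1 h2 h3 h4
      have h5 := (h3.differentiableAt.hasFDerivAt.const_mul (m + 1 : ℝ)).add
        (h3.fderiv.differentiableAt.hasFDerivAt.clm_apply (hasFDerivAt_id x))
      have h6 := (h4.differentiableAt.hasFDerivAt.const_mul (m + 1 : ℝ)).congr_of_eventuallyEq h1
      have h7 := DFunLike.congr_fun (h5.unique h6) (S x)
      rw [(h3.fderiv.differentiableAt.hasFDerivAt.clm_apply (S.hasFDerivAt (x := x))).fderiv]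
      simp only [add_apply, smul_apply, smul_eq_mul, h2, ContinuousLinearMap.comp_apply,
        ContinuousLinearMap.flip_apply, ContinuousLinearMap.id_apply, id] at h7 ⊢
      rw [h3.fderiv_fderiv_symm]
      linear_combination h7
    filter_upwards [h0, hDκ, hDh] with x h1 h2 h3
    have h4 : fderiv ℝ h x (S x) = 0 := by
      have h5 := h3 (S x)
      rw [h1] at h5
      exact (mul_eq_zero.1 h5).resolve_left (mul_ne_zero hm (pow_pos (hhpos x) m).ne')
    rw [h2]
    simp [h4]

end Moser

section VolumeNormalization

theorem AnalyticAt.tendsto_of_zero {E F : Type*} [NormedAddCommGroup E] [NormedSpace ℝ E]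
    [NormedAddCommGroup F] [NormedSpace ℝ F] {φ : E → F} (hφ : AnalyticAt ℝ φ 0)
    (hφ0 : φ 0 = 0) : Tendsto φ (𝓝 0) (𝓝 0) := by
  simpa [hφ0] using hφ.continuousAt.tendsto

/-- Relatedness of vector fields passes to inverse maps. -/
theorem eventually_related_inverse {E F : Type*} [NormedAddCommGroup E] [NormedSpace ℝ E]
    [CompleteSpace E] [NormedAddCommGroup F] [NormedSpace ℝ F] [CompleteSpace F]
    {η : E → F} {φ : F → E} {z : E → E} {w : F → F}
    (hη : AnalyticAt ℝ η 0) (hη0 : η 0 = 0) (hφ : AnalyticAt ℝ φ 0) (hφ0 : φ 0 = 0)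
    (hφη : ∀ᶠ x in 𝓝 0, φ (η x) = x) (hηφ : ∀ᶠ y in 𝓝 0, η (φ y) = y)
    (h : ∀ᶠ x in 𝓝 0, fderiv ℝ η x (z x) = w (η x)) :
    ∀ᶠ y in 𝓝 0, fderiv ℝ φ y (w y) = z (φ y) := by
  have ht := hφ.tendsto_of_zero hφ0
  filter_upwards [ht.eventually (eventually_injective_fderiv_of_leftInverse hη hη0 hφ hφη), hηφ,
    ht.eventually h] with y h1 h2 h3
  have h4 := h1 (z (φ y))
  rwa [h3, h2] at h4

theorem exists_related {E : Type*} [NormedAddCommGroup E] [NormedSpace ℝ E] [CompleteSpace E]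
    {φ X : E → E} (hφ : AnalyticAt ℝ φ 0) (hφ0 : φ 0 = 0)
    (hφ1 : fderiv ℝ φ 0 = ContinuousLinearMap.id ℝ E) (hX : AnalyticAt ℝ X 0) (hX0 : X 0 = 0) :
    ∃ Y : E → E, AnalyticAt ℝ Y 0 ∧ Y 0 = 0 ∧ fderiv ℝ Y 0 = fderiv ℝ X 0 ∧
      ∀ᶠ y in 𝓝 0, fderiv ℝ φ y (Y y) = X (φ y) := by
  obtain ⟨ψ, hψ, hψ0, hψ1, hψφ, hφψ⟩ := hφ.exists_localInverse hφ0 hφ1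
  have hψ' : AnalyticAt ℝ ψ (φ 0) := by rwa [hφ0]
  have hX' : AnalyticAt ℝ X (φ 0) := by rwa [hφ0]
  have hY : AnalyticAt ℝ (fun y => fderiv ℝ ψ (φ y) (X (φ y))) 0 :=
    (hψ'.fderiv.fun_comp hφ).clm_apply_of (hX'.fun_comp hφ)
  have hYφ : ∀ᶠ y in 𝓝 0, fderiv ℝ φ y (fderiv ℝ ψ (φ y) (X (φ y))) = X (φ y) := by
    filter_upwards [(hφ.tendsto_of_zero hφ0).eventually
      (eventually_injective_fderiv_of_leftInverse hψ hψ0 hφ hφψ), hψφ] with y h1 h2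
    rw [h2] at h1
    exact h1 _
  refine ⟨_, hY, by simp [hφ0, hX0], ?_, hYφ⟩
  ext1 w
  have h1 := (eventually_fderiv_related hφ hφ0 hY hX hYφ).self_of_nhds w
  simpa [hφ0, hX0, hφ1] using h1

variable {m : ℕ}

theorem analyticAt_det_fderiv {φ : (Fin (m + 1) → ℝ) → Fin (m + 1) → ℝ}
    (hφ : AnalyticAt ℝ φ 0) : AnalyticAt ℝ (fun x => LinearMap.det
      (fderiv ℝ φ x : (Fin (m + 1) → ℝ) →ₗ[ℝ] (Fin (m + 1) → ℝ))) 0 := by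
  have h : (fun x => LinearMap.det
      (fderiv ℝ φ x : (Fin (m + 1) → ℝ) →ₗ[ℝ] (Fin (m + 1) → ℝ))) =
      fun x => volForm ℝ (m + 1) fun i => fderiv ℝ φ x (Pi.single i 1) := by
    funext x
    have h1 : volForm ℝ (m + 1) (fun i => Pi.single i 1) = 1 := by
      have h2 : (Matrix.of fun i : Fin (m + 1) => Pi.single i (1 : ℝ)) = 1 := by
        ext i j
        simp [Matrix.one_apply, Pi.single_apply, eq_comm]
      rw [volForm_apply, h2, Matrix.det_one]
    rw [volForm_comp, h1, mul_one]
  rw [h]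
  exact volForm_analyticAt fun i => hφ.fderiv.clm_apply_of analyticAt_const

/-- Commuting, generically independent isochore vector fields on `ℝᵐ⁺¹` have a simultaneous
volume-preserving analytic normal form. -/
theorem exists_volumePreserving_normalForm {X : Fin m → (Fin (m + 1) → ℝ) → Fin (m + 1) → ℝ}
    (hX : ∀ i, AnalyticAt ℝ (X i) 0) (hX0 : ∀ i, X i 0 = 0)
    (hcomm : ∀ a b, ∀ᶠ x in 𝓝 0, fderiv ℝ (X b) x (X a x) = fderiv ℝ (X a) x (X b x))
    (hdiv : ∀ i, ∀ᶠ x in 𝓝 0, LinearMap.trace ℝ _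
      (fderiv ℝ (X i) x : (Fin (m + 1) → ℝ) →ₗ[ℝ] (Fin (m + 1) → ℝ)) = 0)
    (hind : ¬ ∀ᶠ x in 𝓝 0, fluxForm X x = 0) :
    ∃ S N : Fin m → (Fin (m + 1) → ℝ) →L[ℝ] (Fin (m + 1) → ℝ),
      (∀ i, Module.End.IsSemisimple (S i : Module.End ℝ (Fin (m + 1) → ℝ))) ∧
      (∀ i, IsNilpotent (N i : Module.End ℝ (Fin (m + 1) → ℝ))) ∧
      (∀ i, S i ∘L N i = N i ∘L S i) ∧
      ∃ (φ : (Fin (m + 1) → ℝ) → Fin (m + 1) → ℝ)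
        (Y : Fin m → (Fin (m + 1) → ℝ) → Fin (m + 1) → ℝ),
        AnalyticAt ℝ φ 0 ∧ φ 0 = 0 ∧
        (∀ᶠ y in 𝓝 0, LinearMap.det
          (fderiv ℝ φ y : (Fin (m + 1) → ℝ) →ₗ[ℝ] (Fin (m + 1) → ℝ)) = 1) ∧
        (∀ i, AnalyticAt ℝ (Y i) 0) ∧ (∀ i, Y i 0 = 0) ∧
        (∀ i, fderiv ℝ (Y i) 0 = S i + N i) ∧
        (∀ i, ∀ᶠ y in 𝓝 0, fderiv ℝ (Y i) y (S i y) = S i (Y i y)) ∧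
        ∀ i, ∀ᶠ y in 𝓝 0, fderiv ℝ φ y (Y i y) = X i (φ y) := by
  obtain ⟨S, N, hSN, hS, hN, hSNc, η, f, hη, hη0, hη1, hf, hfX, hz⟩ :=
    exists_real_normalForm hX hX0 hcomm hdiv hind
  refine ⟨S, N, hS, hN, hSNc, ?_⟩
  choose z hz hz0 hzη hzX hzf using hz
  have htr : ∀ i, LinearMap.trace ℝ _
      (S i : (Fin (m + 1) → ℝ) →ₗ[ℝ] (Fin (m + 1) → ℝ)) = 0 := by
    intro i
    have h1 := (hdiv i).self_of_nhds
    rw [hSN i, ContinuousLinearMap.toLinearMap_add, map_add,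
      (LinearMap.isNilpotent_trace_of_isNilpotent (hN i)).eq_zero, add_zero] at h1
    exact h1
  obtain ⟨ψ, hψ, hψ0, hψ1, hψη, hηψ⟩ := hη.exists_localInverse hη0 hη1
  have htψ := hψ.tendsto_of_zero hψ0
  have hψS : ∀ k, ∀ᶠ y in 𝓝 0, fderiv ℝ ψ y (S k y) = z k (ψ y) := fun k =>
    eventually_related_inverse (w := fun y => S k y) hη hη0 hψ hψ0 hψη hηψ (hzη k)
  have hinj : ∀ {θ : (Fin (m + 1) → ℝ) → Fin (m + 1) → ℝ}, AnalyticAt ℝ θ 0 → θ 0 = 0 →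
      fderiv ℝ θ 0 = ContinuousLinearMap.id ℝ _ →
      ∀ᶠ y in 𝓝 0, Function.Injective (fderiv ℝ θ y) := by
    intro θ h0 h1 h2
    obtain ⟨k, hk, -, -, hkθ, -⟩ := h0.exists_localInverse h1 h2
    filter_upwards [eventually_injective_fderiv_of_leftInverse h0 h1 hk hkθ] with y h
    exact Function.LeftInverse.injective h
  choose Z hZ hZ0 hZ1 hZψ using fun i => exists_related hψ hψ0 hψ1 (hX i) (hX0 i)
  set v : (Fin (m + 1) → ℝ) → ℝ := fun y => LinearMap.det
    (fderiv ℝ ψ y : (Fin (m + 1) → ℝ) →ₗ[ℝ] (Fin (m + 1) → ℝ)) with hvdef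
  have hv : AnalyticAt ℝ v 0 := analyticAt_det_fderiv hψ
  have hv0 : v 0 = 1 := by simp [hvdef, hψ1]
  have hflux : ∀ᶠ y in 𝓝 0, ∀ W, fluxForm X (ψ y) (fderiv ℝ ψ y W) = v y * fluxForm Z y W := by
    filter_upwards [eventually_all.2 hZψ] with y h W
    exact fluxForm_related h W
  have hZind : ¬ ∀ᶠ y in 𝓝 0, fluxForm Z y = 0 := by
    intro h
    refine hind ?_
    filter_upwards [(hη.tendsto_of_zero hη0).eventually (h.and hflux), hψη,
      eventually_injective_fderiv_of_leftInverse hη hη0 hψ hψη] with x h1 h2 h3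
    ext W
    have h4 := h1.2 (fderiv ℝ η x W)
    rwa [h3, h2, h1.1, zero_apply, mul_zero] at h4
  have hf' : AnalyticAt ℝ f (ψ 0) := by rwa [hψ0]
  have hfψ : ∀ᶠ y in 𝓝 0, ∀ W, fderiv ℝ (fun y => f (ψ y)) y W =
      fluxForm X (ψ y) (fderiv ℝ ψ y W) := by
    filter_upwards [htψ.eventually hfX, hψ.eventually_analyticAt] with y h1 h2 W
    have h3 := h1.comp y h2.differentiableAt.hasFDerivAt
    exact DFunLike.congr_fun h3.fderiv W
  have hvS : ∀ k, ∀ᶠ y in 𝓝 0, fderiv ℝ v y (S k y) = 0 := by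
    intro k
    refine eventually_fderiv_eq_zero_of_exact hZ hZind (htr k) (fun i => ?_)
      (hf'.fun_comp hψ) hv ?_ ?_
    · have h1 := eventually_commute_of_related hψ hψ0 (hinj hψ hψ0 hψ1) (hZ i) (hX i)
        ((S k).analyticAt 0) (hz k) (hZψ i) (hψS k) (hzX k i)
      simpa using h1
    · filter_upwards [hflux, hfψ] with y h1 h2
      ext1 W
      rw [h2, h1]
      rfl
    · filter_upwards [hfψ, hψS k, htψ.eventually (hzf k)] with y h1 h2 h3
      rw [h1, h2, h3]
  obtain ⟨κ, hκ, hκ0, hκ1, hκv, hκS⟩ := hv.exists_radial_moser hv0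
  obtain ⟨θ, hθ, hθ0, hθ1, hθκ, hκθ⟩ := hκ.exists_localInverse hκ0 hκ1
  have htθ := hθ.tendsto_of_zero hθ0
  have hθS : ∀ k, ∀ᶠ y in 𝓝 0, fderiv ℝ θ y (S k y) = S k (θ y) := fun k =>
    eventually_related_inverse (z := fun y => S k y) (w := fun y => S k y) hκ hκ0 hθ hθ0 hθκ hκθ
      (hκS _ (hvS k))
  have hψ' : AnalyticAt ℝ ψ (θ 0) := by rwa [hθ0]
  have hφ : AnalyticAt ℝ (fun y => ψ (θ y)) 0 := hψ'.fun_comp hθ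
  have hφ0 : ψ (θ 0) = 0 := by rw [hθ0, hψ0]
  have hDφ : ∀ᶠ y in 𝓝 0, fderiv ℝ (fun y => ψ (θ y)) y = fderiv ℝ ψ (θ y) ∘L fderiv ℝ θ y := by
    filter_upwards [htθ.eventually hψ.eventually_analyticAt, hθ.eventually_analyticAt] with y h1 h2
    exact (h1.differentiableAt.hasFDerivAt.comp y h2.differentiableAt.hasFDerivAt).fderiv
  have hφ1 : fderiv ℝ (fun y => ψ (θ y)) 0 = ContinuousLinearMap.id ℝ _ := by
    rw [hDφ.self_of_nhds, hθ0, hψ1, hθ1, ContinuousLinearMap.id_comp]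
  choose Y hY hY0 hY1 hYφ using fun i => exists_related hφ hφ0 hφ1 (hX i) (hX0 i)
  refine ⟨fun y => ψ (θ y), Y, hφ, hφ0, ?_, hY, hY0, fun i => (hY1 i).trans (hSN i),
    fun i => ?_, hYφ⟩
  · filter_upwards [hDφ, htθ.eventually hκv, hκθ,
      eventually_injective_fderiv_of_leftInverse hθ hθ0 hκ hκθ] with y h1 h2 h3 h4
    rw [h1]
    have h5 : (fderiv ℝ κ (θ y) : (Fin (m + 1) → ℝ) →ₗ[ℝ] (Fin (m + 1) → ℝ)) ∘ₗ
        (fderiv ℝ θ y : (Fin (m + 1) → ℝ) →ₗ[ℝ] (Fin (m + 1) → ℝ)) = LinearMap.id :=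
      LinearMap.ext h4
    have h6 := congrArg LinearMap.det h5
    rw [LinearMap.det_comp, LinearMap.det_id, h2] at h6
    exact (LinearMap.det_comp _ _).trans h6
  · have h1 := eventually_commute_of_related hφ hφ0 (hinj hφ hφ0 hφ1) (hY i) (hX i)
      ((S i).analyticAt 0) (hz i) (hYφ i) (by
        filter_upwards [hDφ, hθS i, htθ.eventually (hψS i)] with y h1 h2 h3
        rw [h1, ContinuousLinearMap.comp_apply, h2, h3]) (hzX i i)
    simpa using h1

end VolumeNormalization

section FluxIndependent

variable {m : ℕ}

theorem fluxForm_ne_zero_of_linearIndependent {X : Fin m → (Fin (m + 1) → ℝ) → Fin (m + 1) → ℝ}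
    {x : Fin (m + 1) → ℝ} (h : LinearIndependent ℝ fun i => X i x) : fluxForm X x ≠ 0 := by
  intro h0
  have h1 : Submodule.span ℝ (Set.range fun i => X i x) < ⊤ := by
    refine lt_top_iff_ne_top.2 fun h2 => ?_
    have h3 := finrank_span_eq_card h
    rw [h2, finrank_top, Module.finrank_fin_fun, Fintype.card_fin] at h3
    omega
  obtain ⟨V, -, hV⟩ := SetLike.exists_of_lt h1
  have h2 : LinearIndependent ℝ (Fin.cons V fun i => X i x : Fin (m + 1) → Fin (m + 1) → ℝ) :=
    linearIndependent_finCons.2 ⟨h, hV⟩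
  have h3 := (Matrix.isUnit_iff_isUnit_det _).1
    ((Matrix.linearIndependent_rows_iff_isUnit (A := Matrix.of
      (Fin.cons V fun i => X i x : Fin (m + 1) → Fin (m + 1) → ℝ))).1 h2)
  rw [← volForm_apply, ← fluxForm_apply, h0, zero_apply] at h3
  exact h3.ne_zero rfl

end FluxIndependent

end NormalFormTheory

/-- **Simultaneous volume-preserving normalization of commuting isochore
vector fields** (Zung, improving Vey). Any `(n-1)`-tuple of pairwise
commuting real analytic isochore vector fields near `0 ∈ ℝⁿ`, vanishing at `0`
and linearly independent almost everywhere, admits a simultaneous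
volume-preserving convergent Poincaré–Dulac normalization. -/
theorem isochore_simultaneous_volPDNormalization_real
    (n : ℕ) (hn : 1 ≤ n)
    (U : Set (Fin n → ℝ)) (hUopen : IsOpen U) (hUconn : IsConnected U)
    (h0U : (0 : Fin n → ℝ) ∈ U)
    (X : Fin (n - 1) → (Fin n → ℝ) → (Fin n → ℝ))
    (hXan : ∀ i, AnalyticOnNhd ℝ (X i) U)
    (hX0 : ∀ i, X i 0 = 0)
    (hcomm : ∀ i j, ∀ x ∈ U, VectorField.lieBracket ℝ (X i) (X j) x = 0)
    (hiso : ∀ i, ∀ x ∈ U,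
      LinearMap.trace ℝ (Fin n → ℝ)
        (fderiv ℝ (X i) x : (Fin n → ℝ) →ₗ[ℝ] (Fin n → ℝ)) = 0)
    (hXind : ∃ x ∈ U, LinearIndependent ℝ (fun i => X i x)) :
    ∃ (V : Set (Fin n → ℝ)) (φ : (Fin n → ℝ) → (Fin n → ℝ))
      (Y : Fin (n - 1) → (Fin n → ℝ) → (Fin n → ℝ)),
      IsOpen V ∧ (0 : Fin n → ℝ) ∈ V ∧
      AnalyticOnNhd ℝ φ V ∧ φ 0 = 0 ∧
      (∀ x ∈ V,
        LinearMap.det (fderiv ℝ φ x : (Fin n → ℝ) →ₗ[ℝ] (Fin n → ℝ)) = 1) ∧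
      (∀ i, AnalyticOnNhd ℝ (Y i) V) ∧ (∀ i, Y i 0 = 0) ∧
      (∀ i, InPDNormalForm ℝ (Y i) V) ∧
      ∀ i, ∀ x ∈ V, fderiv ℝ φ x (Y i x) = X i (φ x) := by
  obtain ⟨m, rfl⟩ : ∃ m, n = m + 1 := ⟨n - 1, by omega⟩
  change Fin m → (Fin (m + 1) → ℝ) → Fin (m + 1) → ℝ at X
  have hU : U ∈ nhds 0 := hUopen.mem_nhds h0U
  have hind : ¬ ∀ᶠ x in nhds 0, fluxForm X x = 0 := by
    intro h
    obtain ⟨x, hxU, hx⟩ := hXind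
    exact fluxForm_ne_zero_of_linearIndependent hx
      (AnalyticOnNhd.eqOn_zero_of_preconnected_of_eventuallyEq_zero
        (fun y hy => fluxForm_analyticAt fun i => hXan i y hy) hUconn.isPreconnected h0U h hxU)
  obtain ⟨S, N, hS, hN, hSN, φ, Y, hφ, hφ0, hdet, hY, hY0, hY1, hYS, hYφ⟩ :=
    exists_volumePreserving_normalForm (fun i => hXan i 0 h0U) hX0
      (fun a b => by
        filter_upwards [hU] with x hx
        have h := hcomm a b x hx
        rw [VectorField.lieBracket_eq] at h
        exact sub_eq_zero.1 h)
      (fun i => by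
        filter_upwards [hU] with x hx
        exact hiso i x hx)
      hind
  obtain ⟨V, hV, hVopen, h0V⟩ := eventually_nhds_iff.1 (hφ.eventually_analyticAt.and
    (hdet.and ((Filter.eventually_all.2 fun i => (hY i).eventually_analyticAt).and
      ((Filter.eventually_all.2 hYS).and (Filter.eventually_all.2 hYφ)))))
  refine ⟨V, φ, Y, hVopen, h0V, fun x hx => (hV x hx).1, hφ0, fun x hx => (hV x hx).2.1,
    fun i x hx => (hV x hx).2.2.1 i, hY0,
    fun i => ⟨S i, N i, hY1 i, hS i, hN i, hSN i, fun x hx => ?_⟩,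
    fun i x hx => (hV x hx).2.2.2.2 i⟩
  rw [VectorField.lieBracket_eq]
  simp [(hV x hx).2.2.2.1 i]
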